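/- Let k ≥ 1, α₁,…,α_k : Fˣ → ℂˣ characters, and let y₁ ∈ GL_{a₁}(F),…,y_s ∈ GL_{a_s}(F) be regular elliptic elements whose characteristic polynomials are pairwise coprime. Let μ₁,…,μ_s be partitions with μ_j ⊢ b_j and n = Σ_j a_j·b_j. For each j, let E_j be a degree-a_j extension of F, η_j ∈ E_j a root of the characteristic polynomial of y_j, and suppose ω_{j,1},…,ω_{j,k} ∈ ℂ satisfy Σ_{i=1}^k ω_{j,i}^m = (-1)^{k-1} K_{E_{j,m}}(α,ψ,η_{j,m}) for every m ≥ 1. Let y = diag(J_{μ₁}(y₁),…,J_{μ_s}(y_s)) ∈ GL_n(F). Then K(α,ψ,y) = (-1)^{(k-1)n} · q^{(k-1)·n(n-1)/2} · ∏_{j=1}^s [ Σ over d : {1,…,k} → ℕ with Σd_i = b_j of N_d(J_{μ_j}(η_j)) · ω_{j,1}^{d₁}⋯ω_{j,k}^{d_k} ]. -/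

import Mathlib

open scoped BigOperators

/-- The twisted matrix Kloosterman sum
`K(α,ψ,x) = Σ_{g₁⋯g_k = x} (∏ αᵢ(det gᵢ)) ψ(tr(g₁+⋯+g_k))`. -/
noncomputable def matrixKloosterman {F : Type} [Field F] [Fintype F] [DecidableEq F]
    {ι : Type} [Fintype ι] [DecidableEq ι] {k : ℕ}
    (α : Fin k → Fˣ →* ℂˣ) (ψ : AddChar F ℂ) (x : Matrix ι ι F) : ℂ :=
  ∑ g : Fin k → (Matrix ι ι F)ˣ,
    if ((List.ofFn g).prod : Matrix ι ι F) = x then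
      (∏ i, (α i (Units.map (Matrix.detMonoidHom) (g i)) : ℂ)) *
        ψ (Matrix.trace (∑ i, ((g i : Matrix ι ι F))))
    else 0

/-- The twisted Kloosterman sum over a finite extension `E` of `F`:
`K_E(α,ψ,ξ) = Σ_{t₁⋯t_k = ξ} (∏ αᵢ(N_{E/F}(tᵢ))) ψ(Tr_{E/F}(t₁+⋯+t_k))`. -/
noncomputable def fieldKloosterman {F : Type} [Field F] [Fintype F] {k : ℕ}
    (α : Fin k → Fˣ →* ℂˣ) (ψ : AddChar F ℂ)
    (E : Type) [Field E] [Fintype E] [DecidableEq E] [Algebra F E] (ξ : E) : ℂ :=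
  ∑ t : Fin k → Eˣ,
    if ((∏ i, t i : Eˣ) : E) = ξ then
      (∏ i, (α i (Units.map (Algebra.norm F : E →* F) (t i)) : ℂ)) *
        ψ (Algebra.trace F E (∑ i, (t i : E)))
    else 0

/-- `J_{(m)}(y)`: block matrix with `m` copies of the `a×a` matrix `y` on the block diagonal
and identity blocks on the block superdiagonal. -/
def jordanBlock {F : Type} [Zero F] [One F] {a : ℕ}
    (y : Matrix (Fin a) (Fin a) F) (m : ℕ) :
    Matrix (Fin m × Fin a) (Fin m × Fin a) F :=
  fun p q =>
    if p.1 = q.1 then y p.2 q.2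
    else if (p.1 : ℕ) + 1 = (q.1 : ℕ) then (if p.2 = q.2 then 1 else 0) else 0

/-- `J_μ(y)`: block diagonal of `J_{(m₁)}(y), …, J_{(m_r)}(y)` for `μ = (m₁,…,m_r)`. -/
def jordanPartition {F : Type} [Zero F] [One F] {a r : ℕ}
    (y : Matrix (Fin a) (Fin a) F) (μ : Fin r → ℕ) :
    Matrix (Σ j : Fin r, Fin (μ j) × Fin a) (Σ j : Fin r, Fin (μ j) × Fin a) F :=
  Matrix.blockDiagonal' (fun j => jordanBlock y (μ j))

/-- The scalar Jordan block of size `m` with eigenvalue `ξ`. -/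
def jordanBlockScalar {E : Type} [Zero E] [One E] (ξ : E) (m : ℕ) :
    Matrix (Fin m) (Fin m) E :=
  fun p q => if p = q then ξ else if (p : ℕ) + 1 = (q : ℕ) then 1 else 0

/-- `J_μ(ξ)`: block diagonal of scalar Jordan blocks of sizes `μ` with eigenvalue `ξ`. -/
def jordanPartitionScalar {E : Type} [Zero E] [One E] {r : ℕ} (ξ : E) (μ : Fin r → ℕ) :
    Matrix (Σ j : Fin r, Fin (μ j)) (Σ j : Fin r, Fin (μ j)) E :=
  Matrix.blockDiagonal' (fun j => jordanBlockScalar ξ (μ j))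

/-- `N_d(T)`: the number of chains of subspaces `0 ⊆ W₁ ⊆ ⋯ ⊆ W_k = V` with
`dim W_j = d₁ + ⋯ + d_j` and `T(W_j) ⊆ W_j` for all `j`. -/
noncomputable def flagCount {E : Type} [Field E] {V : Type} [AddCommGroup V] [Module E V]
    (T : V →ₗ[E] V) {k : ℕ} (d : Fin k → ℕ) : ℕ :=
  Nat.card {W : Fin k → Submodule E V //
    Monotone W ∧ (∀ j, Module.finrank E (W j) = ∑ i ∈ Finset.Iic j, d i) ∧
    (∀ j, Submodule.map T (W j) ≤ W j) ∧ (∀ j : Fin k, (j : ℕ) + 1 = k → W j = ⊤)}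

set_option linter.all false
namespace MK
open Classical

section

noncomputable instance instFintypeLin {F V W : Type} [Field F] [AddCommGroup V] [Module F V]
    [AddCommGroup W] [Module F W] [Finite V] [Finite W] : Fintype (V →ₗ[F] W) :=
  have : Finite (V →ₗ[F] W) := DFunLike.finite _
  Fintype.ofFinite _

noncomputable instance instFintypeSub {F V : Type} [Field F] [AddCommGroup V] [Module F V]
    [Finite V] : Fintype (Submodule F V) := Fintype.ofFinite _

instance instFiniteQuo {F V : Type} [Field F] [AddCommGroup V] [Module F V] [Finite V]
    (W : Submodule F V) : Finite (V ⧸ W) := Finite.of_surjective _ (Submodule.mkQ_surjective W)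

variable {F : Type} [Field F]

/-- block upper triangular endomorphism -/
def blk {V₁ V₂ : Type} [AddCommGroup V₁] [Module F V₁] [AddCommGroup V₂] [Module F V₂]
    (A : V₁ →ₗ[F] V₁) (u : V₂ →ₗ[F] V₁) (D : V₂ →ₗ[F] V₂) : V₁ × V₂ →ₗ[F] V₁ × V₂ :=
  (A.coprod u).prod (D ∘ₗ LinearMap.snd F V₁ V₂)

@[simp] lemma blk_apply {V₁ V₂ : Type} [AddCommGroup V₁] [Module F V₁] [AddCommGroup V₂]
    [Module F V₂] (A : V₁ →ₗ[F] V₁) (u : V₂ →ₗ[F] V₁) (D : V₂ →ₗ[F] V₂) (x : V₁ × V₂) :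
    blk A u D x = (A x.1 + u x.2, D x.2) := rfl

/-- families of functions on endomorphisms -/
abbrev Fam (F : Type) [Field F] : Type 1 :=
  ∀ (V : Type) [AddCommGroup V] [Module F V] [Finite V], (V →ₗ[F] V) → ℂ

structure IsGL (f : Fam F) : Prop where
  conj : ∀ {V W : Type} [AddCommGroup V] [Module F V] [Finite V] [AddCommGroup W] [Module F W]
    [Finite W] (e : V ≃ₗ[F] W) (g : V →ₗ[F] V), f W (e.conj g) = f V g
  one : ∀ (V : Type) [AddCommGroup V] [Module F V] [Finite V] [Subsingleton V] (g : V →ₗ[F] V),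
    f V g = 1
  ext : ∀ {V₁ V₂ : Type} [AddCommGroup V₁] [Module F V₁] [Finite V₁] [AddCommGroup V₂]
    [Module F V₂] [Finite V₂] (A : V₁ →ₗ[F] V₁) (D : V₂ →ₗ[F] V₂),
    ∑ u : V₂ →ₗ[F] V₁, f (V₁ × V₂) (blk A u D) =
      (Nat.card F : ℂ) ^ (Module.finrank F V₁ * Module.finrank F V₂) * (f V₁ A * f V₂ D)

section basic
variable {V V₁ V₂ W : Type} [AddCommGroup V] [Module F V] [Finite V]
  [AddCommGroup V₁] [Module F V₁] [Finite V₁] [AddCommGroup V₂] [Module F V₂] [Finite V₂]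
  [AddCommGroup W] [Module F W] [Finite W]

lemma IsGL.conj' {f : Fam F} (hf : IsGL f) (e : V ≃ₗ[F] W) (g : V →ₗ[F] V) (g' : W →ₗ[F] W)
    (h : ∀ x, e (g x) = g' (e x)) : f W g' = f V g := by
  rw [← hf.conj e g]
  congr 1
  ext x
  simp [LinearEquiv.conj_apply, h]

/-- unipotent automorphism -/
def shear (S : V₂ →ₗ[F] V₁) : (V₁ × V₂) ≃ₗ[F] (V₁ × V₂) where
  toFun x := (x.1 + S x.2, x.2)
  invFun x := (x.1 - S x.2, x.2)
  map_add' x y := by ext <;> simp; abel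
  map_smul' c x := by ext <;> simp
  left_inv x := by simp
  right_inv x := by simp

@[simp] lemma shear_apply (S : V₂ →ₗ[F] V₁) (x : V₁ × V₂) :
    shear S x = (x.1 + S x.2, x.2) := rfl

lemma blk_shear (A : V₁ →ₗ[F] V₁) (u : V₂ →ₗ[F] V₁) (D : V₂ →ₗ[F] V₂) (S : V₂ →ₗ[F] V₁)
    (x : V₁ × V₂) : shear S (blk A (u + A ∘ₗ S - S ∘ₗ D) D x) = blk A u D (shear S x) := by
  ext <;> simp; abel

lemma natCard_lin [Finite F] :
    Fintype.card (V₂ →ₗ[F] V₁) =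
      Nat.card F ^ (Module.finrank F V₁ * Module.finrank F V₂) := by
  rw [← Nat.card_eq_fintype_card, Module.natCard_eq_pow_finrank (K := F),
    Module.finrank_linearMap, mul_comm]

/-- intertwining by polynomials -/
lemma aeval_comp_of_comm {V V' : Type} [AddCommGroup V] [Module F V] [AddCommGroup V']
    [Module F V'] {A : V →ₗ[F] V} {D : V' →ₗ[F] V'} {s : V' →ₗ[F] V} (h : A ∘ₗ s = s ∘ₗ D)
    (P : Polynomial F) : (Polynomial.aeval A P : V →ₗ[F] V) ∘ₗ s
      = s ∘ₗ (Polynomial.aeval D P : V' →ₗ[F] V') := by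
  induction P using Polynomial.induction_on' with
  | add p q hp hq => simp [LinearMap.add_comp, LinearMap.comp_add, hp, hq]
  | monomial n a =>
    have : ∀ n : ℕ, (A ^ n) ∘ₗ s = s ∘ₗ (D ^ n) := by
      intro n
      induction n with
      | zero => rfl
      | succ n ih =>
        rw [pow_succ, pow_succ', Module.End.mul_eq_comp, Module.End.mul_eq_comp,
          LinearMap.comp_assoc, h, ← LinearMap.comp_assoc, ih, LinearMap.comp_assoc,
          ← Module.End.mul_eq_comp, ← Module.End.mul_eq_comp, ← pow_succ, ← pow_succ']
    ext x
    have := congrArg (fun l => a • l x) (this n)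
    simpa [Polynomial.aeval_monomial, Algebra.algebraMap_eq_smul_one] using this

lemma aeval_apply_of_comm {V V' : Type} [AddCommGroup V] [Module F V] [AddCommGroup V']
    [Module F V'] {A : V →ₗ[F] V} {D : V' →ₗ[F] V'} {s : V' →ₗ[F] V}
    (h : ∀ x, A (s x) = s (D x))
    (P : Polynomial F) (x : V') : (Polynomial.aeval A P : V →ₗ[F] V) (s x)
      = s ((Polynomial.aeval D P : V' →ₗ[F] V') x) := by
  have := aeval_comp_of_comm (A := A) (D := D) (s := s) (LinearMap.ext h) P
  exact congrArg (fun l => l x) this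

/-- `g` is `P`-primary -/
def Nilp {V : Type} [AddCommGroup V] [Module F V] (P : Polynomial F) (g : V →ₗ[F] V) : Prop :=
  IsNilpotent (Polynomial.aeval g P : Module.End F V)

lemma intertwine_zero {V V' : Type} [AddCommGroup V] [Module F V] [AddCommGroup V']
    [Module F V'] {A : V →ₗ[F] V} {D : V' →ₗ[F] V'} {s : V' →ₗ[F] V} (h : A ∘ₗ s = s ∘ₗ D)
    {P₁ P₂ : Polynomial F} (hc : IsCoprime P₁ P₂) (hA : Nilp P₁ A) (hD : Nilp P₂ D) : s = 0 := by
  obtain ⟨N₁, h₁⟩ := hA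
  obtain ⟨N₂, h₂⟩ := hD
  obtain ⟨a, b, hab⟩ := hc.pow (m := N₁) (n := N₂)
  have e := aeval_comp_of_comm h (a * P₁ ^ N₁)
  have e2 : (Polynomial.aeval D (a * P₁ ^ N₁) : Module.End F V') = 1 := by
    have := congrArg (Polynomial.aeval D) hab
    simpa [h₂] using this
  have e1 : (Polynomial.aeval A (a * P₁ ^ N₁) : Module.End F V) = 0 := by
    simp [h₁]
  rw [e1, e2] at e
  ext x
  have := congrArg (fun l => l x) e
  simpa using this.symm

lemma IsGL.prod_of_coprime [Finite F] {f : Fam F} (hf : IsGL f) (A : V₁ →ₗ[F] V₁)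
    (D : V₂ →ₗ[F] V₂) (u : V₂ →ₗ[F] V₁)
    {P₁ P₂ : Polynomial F} (hc : IsCoprime P₁ P₂) (hA : Nilp P₁ A) (hD : Nilp P₂ D) :
    f (V₁ × V₂) (blk A u D) = f V₁ A * f V₂ D := by
  let L : (V₂ →ₗ[F] V₁) →ₗ[F] (V₂ →ₗ[F] V₁) :=
    { toFun := fun s => A ∘ₗ s - s ∘ₗ D
      map_add' := by intro x y; ext z; simp; abel
      map_smul' := by intro c x; ext z; simp [smul_sub] }
  have hinj : Function.Injective L := by
    rw [injective_iff_map_eq_zero]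
    intro s hs
    exact intertwine_zero (sub_eq_zero.mp hs) hc hA hD
  have hsurj : Function.Surjective L := Finite.injective_iff_surjective.mp hinj
  have key : ∀ u, f (V₁ × V₂) (blk A u D) = f (V₁ × V₂) (blk A 0 D) := by
    intro u
    obtain ⟨S, hS⟩ := hsurj (-u)
    refine hf.conj' (shear S) _ _ ?_
    intro x
    rw [← blk_shear]
    congr 2
    have : u + (A ∘ₗ S - S ∘ₗ D) = 0 := by
      have : A ∘ₗ S - S ∘ₗ D = -u := hS
      rw [this]; simp
    rw [← this]; abel_nf
  have e := hf.ext A D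
  rw [Finset.sum_congr rfl (fun u _ => key u), Finset.sum_const, Finset.card_univ, natCard_lin,
    nsmul_eq_mul] at e
  rw [key u]
  have hq : ((Nat.card F : ℂ)) ≠ 0 := by
    exact_mod_cast Nat.card_pos.ne'
  push_cast at e
  exact mul_left_cancel₀ (pow_ne_zero _ hq) e

/-- restriction and quotient of a stable map -/
def quo {V : Type} [AddCommGroup V] [Module F V] (g : V →ₗ[F] V) (W : Submodule F V)
    (h : ∀ x ∈ W, g x ∈ W) : (V ⧸ W) →ₗ[F] (V ⧸ W) := W.mapQ W g h

/-- adapted decomposition -/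
lemma exists_blk {V : Type} [AddCommGroup V] [Module F V] (g : V →ₗ[F] V) (W : Submodule F V)
    (h : ∀ x ∈ W, g x ∈ W) : ∃ (e : V ≃ₗ[F] W × (V ⧸ W)) (u : (V ⧸ W) →ₗ[F] W),
      (∀ x, e (g x) = blk (g.restrict h) u (quo g W h) (e x)) ∧ (∀ w : W, e w = (w, 0)) ∧
      (∀ x, (e x).2 = W.mkQ x) := by
  obtain ⟨s, hs⟩ := W.mkQ.exists_rightInverse_of_surjective (LinearMap.range_eq_top.mpr (Submodule.mkQ_surjective W))
  have hs' : ∀ y, W.mkQ (s y) = y := fun y => congrArg (fun l => l y) hs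
  have hm : ∀ x, x - s (W.mkQ x) ∈ W := by
    intro x
    have h0 : W.mkQ (x - s (W.mkQ x)) = 0 := by rw [map_sub, hs', sub_self]
    exact (Submodule.Quotient.mk_eq_zero W).mp h0
  let p : V →ₗ[F] W := LinearMap.codRestrict W (LinearMap.id - s ∘ₗ W.mkQ) hm
  have hmk : ∀ w : W, W.mkQ (w : V) = 0 := fun w => by simp
  let e : V ≃ₗ[F] W × (V ⧸ W) :=
    { toFun := fun x => (p x, W.mkQ x)
      map_add' := by intro x y; simp
      map_smul' := by intro c x; simp
      invFun := fun z => (z.1 : V) + s z.2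
      left_inv := by intro x; simp [p]
      right_inv := by
        rintro ⟨w, y⟩
        have h1 : W.mkQ ((w : V) + s y) = y := by rw [map_add, hmk, hs', zero_add]
        ext
        · show ((w : V) + s y) - s (W.mkQ ((w : V) + s y)) = w
          rw [h1]; abel
        · exact h1 }
  refine ⟨e, p ∘ₗ g ∘ₗ s, ?_, ?_, ?_⟩
  · intro x
    have hx : g x = g (x - s (W.mkQ x)) + g (s (W.mkQ x)) := by rw [← map_add]; simp
    have hw : ∀ w : V, ∀ hw : w ∈ W, p w = ⟨w, hw⟩ := by
      intro w hw
      ext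
      show w - s (W.mkQ w) = w
      have := hmk ⟨w, hw⟩
      simp only at this
      rw [this]; simp
    ext
    · show ((p (g x) : W) : V) = _
      rw [hx, map_add, hw _ (h _ (hm x))]
      rfl
    · rfl
  · intro w
    have : W.mkQ (w : V) = 0 := hmk w
    ext
    · show (w : V) - s (W.mkQ (w : V)) = w
      rw [this]; simp
    · exact this
  · intro x; rfl

lemma IsGL.split [Finite F] {f : Fam F} (hf : IsGL f) (g : V →ₗ[F] V) (W : Submodule F V)
    (h : ∀ x ∈ W, g x ∈ W)
    {P₁ P₂ : Polynomial F} (hc : IsCoprime P₁ P₂) (hA : Nilp P₁ (g.restrict h))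
    (hD : Nilp P₂ (quo g W h)) : f V g = f W (g.restrict h) * f (V ⧸ W) (quo g W h) := by
  obtain ⟨e, u, he, -, -⟩ := exists_blk g W h
  rw [← hf.prod_of_coprime _ _ u hc hA hD]
  exact (hf.conj' e _ _ he).symm

lemma Nilp.conj {V V' : Type} [AddCommGroup V] [Module F V] [AddCommGroup V']
    [Module F V'] {g : V →ₗ[F] V} {g' : V' →ₗ[F] V'} (e : V ≃ₗ[F] V')
    (he : ∀ x, e (g x) = g' (e x)) {P : Polynomial F} (h : Nilp P g) : Nilp P g' := by
  obtain ⟨N, hN⟩ := h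
  refine ⟨N, ?_⟩
  rw [← map_pow] at hN ⊢
  ext x
  have := aeval_apply_of_comm (A := g') (D := g) (s := (e : V →ₗ[F] V')) (fun x => (he x).symm)
    (P ^ N) (e.symm x)
  rw [hN] at this
  simpa using this

end basic
end

section
variable {F : Type} [Field F]
section stable
variable {V : Type} [AddCommGroup V] [Module F V]

lemma aeval_restrict (g : V →ₗ[F] V) (W : Submodule F V) (h : ∀ x ∈ W, g x ∈ W)
    (P : Polynomial F) (w : W) :
    (((Polynomial.aeval (g.restrict h) P : W →ₗ[F] W) w : W) : V)
      = (Polynomial.aeval g P : V →ₗ[F] V) w :=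
  (aeval_apply_of_comm (A := g) (D := g.restrict h) (s := W.subtype) (fun _ => rfl) P w).symm

lemma aeval_quo (g : V →ₗ[F] V) (W : Submodule F V) (h : ∀ x ∈ W, g x ∈ W)
    (P : Polynomial F) (x : V) :
    (Polynomial.aeval (quo g W h) P : (V ⧸ W) →ₗ[F] (V ⧸ W)) (W.mkQ x)
      = W.mkQ ((Polynomial.aeval g P : V →ₗ[F] V) x) :=
  aeval_apply_of_comm (A := quo g W h) (D := g) (s := W.mkQ) (fun _ => rfl) P x

lemma nilp_iff_exists (P : Polynomial F) (g : V →ₗ[F] V) :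
    Nilp P g ↔ ∃ N, ∀ x, (Polynomial.aeval g (P ^ N) : V →ₗ[F] V) x = 0 := by
  constructor
  · rintro ⟨N, hN⟩
    refine ⟨N, fun x => ?_⟩
    rw [map_pow, hN]; rfl
  · rintro ⟨N, hN⟩
    refine ⟨N, ?_⟩
    rw [← map_pow]
    exact LinearMap.ext hN

lemma Nilp.restrict {g : V →ₗ[F] V} {P : Polynomial F} (hg : Nilp P g) (W : Submodule F V)
    (h : ∀ x ∈ W, g x ∈ W) : Nilp P (g.restrict h) := by
  rw [nilp_iff_exists] at hg ⊢
  obtain ⟨N, hN⟩ := hg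
  refine ⟨N, fun x => ?_⟩
  ext
  rw [aeval_restrict, hN]; rfl

lemma Nilp.quo {g : V →ₗ[F] V} {P : Polynomial F} (hg : Nilp P g) (W : Submodule F V)
    (h : ∀ x ∈ W, g x ∈ W) : Nilp P (quo g W h) := by
  rw [nilp_iff_exists] at hg ⊢
  obtain ⟨N, hN⟩ := hg
  refine ⟨N, fun x => ?_⟩
  obtain ⟨x, rfl⟩ := Submodule.mkQ_surjective W x
  rw [aeval_quo, hN, map_zero]

lemma nilp_iff_restrict_quo (g : V →ₗ[F] V) (P : Polynomial F) (W : Submodule F V)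
    (h : ∀ x ∈ W, g x ∈ W) : Nilp P g ↔ Nilp P (g.restrict h) ∧ Nilp P (quo g W h) := by
  refine ⟨fun hg => ⟨hg.restrict W h, hg.quo W h⟩, ?_⟩
  rw [nilp_iff_exists, nilp_iff_exists, nilp_iff_exists]
  rintro ⟨⟨N, hN⟩, M, hM⟩
  refine ⟨N + M, fun x => ?_⟩
  have h1 := hM (W.mkQ x)
  rw [aeval_quo] at h1
  have h1 := (Submodule.Quotient.mk_eq_zero W).mp h1
  have h2 := hN ⟨_, h1⟩
  have h3 := aeval_restrict g W h (P ^ N) ⟨_, h1⟩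
  rw [h2] at h3
  rw [pow_add, map_mul]
  exact h3.symm

lemma nilp_pow_iff (g : V →ₗ[F] V) (P : Polynomial F) {k : ℕ} (hk : k ≠ 0) :
    Nilp (P ^ k) g ↔ Nilp P g := by
  unfold Nilp
  rw [map_pow, IsNilpotent.pow_iff_pos hk]

lemma Nilp.of_dvd {g : V →ₗ[F] V} {P Q : Polynomial F} (hg : Nilp P g) (h : P ∣ Q) :
    Nilp Q g := by
  obtain ⟨R, rfl⟩ := h
  unfold Nilp
  rw [map_mul]
  have : Commute (Polynomial.aeval g P : Module.End F V) (Polynomial.aeval g R) := by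
    unfold Commute SemiconjBy
    rw [← map_mul, ← map_mul, mul_comm]
  exact this.isNilpotent_mul_right hg

lemma stable_add {g u : V →ₗ[F] V} {W : Submodule F V} (h : ∀ x ∈ W, g x ∈ W)
    (hu : ∀ x, u x ∈ W) : ∀ x ∈ W, (g + u) x ∈ W :=
  fun x hx => W.add_mem (h x hx) (hu x)

lemma restrict_add {g u : V →ₗ[F] V} {W : Submodule F V} (h : ∀ x ∈ W, g x ∈ W)
    (h' : ∀ x ∈ W, (g + u) x ∈ W) (hk : ∀ x ∈ W, u x = 0) :
    (g + u).restrict h' = g.restrict h := by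
  ext x
  simp [hk x x.2]

lemma quo_add {g u : V →ₗ[F] V} {W : Submodule F V} (h : ∀ x ∈ W, g x ∈ W)
    (h' : ∀ x ∈ W, (g + u) x ∈ W) (hu : ∀ x, u x ∈ W) :
    quo (g + u) W h' = quo g W h := by
  ext x
  simp only [quo, LinearMap.comp_apply, Submodule.mapQ_apply, Submodule.mkQ_apply]
  rw [Submodule.Quotient.eq]
  simpa using hu x

end stable

section shift
variable {V : Type} [AddCommGroup V] [Module F V] [Finite V] [Finite F]

def Irr {V : Type} [AddCommGroup V] [Module F V] (y : V →ₗ[F] V) : Prop :=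
  ∀ W : Submodule F V, (∀ x ∈ W, y x ∈ W) → W = ⊥ ∨ W = ⊤

lemma trace_smulRight (ℓ : V →ₗ[F] F) (w : V) : LinearMap.trace F V (ℓ.smulRight w) = ℓ w := by
  simp

lemma shift_sum {ψ : AddChar F ℂ} (hψ : ∃ a, ψ a ≠ 1) {y : V →ₗ[F] V} (hy : Irr y)
    (W : Submodule F V) (h0 : W ≠ ⊥) (h1 : W ≠ ⊤) (G : (V →ₗ[F] V) → ℂ)
    (hG : ∀ g u, (∀ x, u x ∈ W) → (∀ x ∈ W, u x = 0) → G (g + u) = G g) :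
    ∑ g, G g * ψ (LinearMap.trace F V (g ∘ₗ y)) = 0 := by
  have hns : ¬ ∀ x ∈ W, y x ∈ W := fun h => by
    rcases hy W h with h | h <;> contradiction
  push Not at hns
  obtain ⟨w, hw, hyw⟩ := hns
  obtain ⟨ℓ, hℓ, hℓW⟩ := 
    Submodule.exists_dual_map_eq_bot_of_notMem hyw inferInstance
  have hℓW' : ∀ x ∈ W, ℓ x = 0 := by
    intro x hx
    have : ℓ x ∈ W.map ℓ := ⟨x, hx, rfl⟩
    rw [hℓW] at this
    exact (Submodule.mem_bot F).mp this
  obtain ⟨a, ha⟩ := hψ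
  let c : F := a / ℓ (y w)
  let u : V →ₗ[F] V := ℓ.smulRight (c • w)
  have hu1 : ∀ x, u x ∈ W := fun x => W.smul_mem _ (W.smul_mem _ hw)
  have hu2 : ∀ x ∈ W, u x = 0 := fun x hx => by simp [u, hℓW' x hx]
  have htr : LinearMap.trace F V (u ∘ₗ y) = a := by
    have : u ∘ₗ y = (ℓ ∘ₗ y).smulRight (c • w) := by ext; simp [u]
    rw [this, trace_smulRight]
    simp [c, hℓ]
  have key : ∑ g, G g * ψ (LinearMap.trace F V (g ∘ₗ y))
      = ψ a * ∑ g, G g * ψ (LinearMap.trace F V (g ∘ₗ y)) := by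
    conv_lhs => rw [← Equiv.sum_comp (Equiv.addRight u)]
    rw [Finset.mul_sum]
    refine Finset.sum_congr rfl fun g _ => ?_
    rw [Equiv.coe_addRight, hG g u hu1 hu2, LinearMap.add_comp, map_add, htr, AddChar.map_add_eq_mul]
    ring
  have : (1 - ψ a) * ∑ g, G g * ψ (LinearMap.trace F V (g ∘ₗ y)) = 0 := by
    rw [sub_mul, one_mul, sub_eq_zero]; exact key
  rcases mul_eq_zero.mp this with h | h
  · exact absurd (sub_eq_zero.mp h).symm ha
  · exact h

/-- sum over primary endomorphisms -/
noncomputable def SS (f : Fam F) (ψ : AddChar F ℂ) {V : Type} [AddCommGroup V] [Module F V]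
    [Finite V] (y : V →ₗ[F] V) (P : Polynomial F) : ℂ :=
  ∑ g : V →ₗ[F] V, (if Nilp P g then f V g else 0) * ψ (LinearMap.trace F V (g ∘ₗ y))

def QQ {V : Type} [AddCommGroup V] [Module F V] (P₁ P₂ : Polynomial F) (W : Submodule F V)
    (g : V →ₗ[F] V) : Prop :=
  ∃ h : ∀ x ∈ W, g x ∈ W, Nilp P₁ (g.restrict h) ∧ Nilp P₂ (quo g W h)

lemma QQ_add {P₁ P₂ : Polynomial F} {W : Submodule F V} {g u : V →ₗ[F] V}
    (hu : ∀ x, u x ∈ W) (hk : ∀ x ∈ W, u x = 0) (h : QQ P₁ P₂ W g) : QQ P₁ P₂ W (g + u) := by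
  obtain ⟨h, h1, h2⟩ := h
  refine ⟨stable_add h hu, ?_, ?_⟩
  · rw [restrict_add h _ hk]; exact h1
  · rw [quo_add h _ hu]; exact h2

lemma QQ_unique {P₁ P₂ : Polynomial F} (hc : IsCoprime P₁ P₂) {W W' : Submodule F V}
    {g : V →ₗ[F] V} (h : QQ P₁ P₂ W g) (h' : QQ P₁ P₂ W' g) : W ≤ W' := by
  obtain ⟨h, h1, -⟩ := h
  obtain ⟨h', -, h2⟩ := h'
  have : W'.mkQ ∘ₗ W.subtype = 0 :=
    intertwine_zero (A := quo g W' h') (D := g.restrict h) (LinearMap.ext fun x => rfl) hc.symm h2 h1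
  intro x hx
  have := congrArg (fun l => l ⟨x, hx⟩) this
  exact (Submodule.Quotient.mk_eq_zero W').mp this

lemma QQ_exists {P₁ P₂ : Polynomial F} {g : V →ₗ[F] V} (h : Nilp (P₁ * P₂) g) :
    ∃ W, QQ P₁ P₂ W g := by
  rw [nilp_iff_exists] at h
  obtain ⟨N, hN⟩ := h
  have hst : ∀ x ∈ LinearMap.ker (Polynomial.aeval g (P₁ ^ N) : V →ₗ[F] V),
      g x ∈ LinearMap.ker (Polynomial.aeval g (P₁ ^ N) : V →ₗ[F] V) := by
    intro x hx
    rw [LinearMap.mem_ker] at hx ⊢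
    rw [aeval_apply_of_comm (A := g) (D := g) (s := g) (fun _ => rfl), hx, map_zero]
  refine ⟨_, hst, ?_, ?_⟩
  · rw [nilp_iff_exists]
    refine ⟨N, fun x => ?_⟩
    ext
    rw [aeval_restrict]
    exact x.2
  · rw [nilp_iff_exists]
    refine ⟨N, fun x => ?_⟩
    obtain ⟨x, rfl⟩ := Submodule.mkQ_surjective _ x
    rw [aeval_quo]
    refine (Submodule.Quotient.mk_eq_zero _).mpr ?_
    rw [LinearMap.mem_ker, ← Module.End.mul_apply, ← map_mul, ← mul_pow]
    exact hN x

lemma QQ_nilp {P₁ P₂ : Polynomial F} {g : V →ₗ[F] V} {W : Submodule F V}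
    (h : QQ P₁ P₂ W g) : Nilp (P₁ * P₂) g := by
  obtain ⟨h, h1, h2⟩ := h
  rw [nilp_iff_restrict_quo g _ W h]
  exact ⟨h1.of_dvd (dvd_mul_right _ _), h2.of_dvd (dvd_mul_left _ _)⟩

lemma nilp_of_subsingleton {V : Type} [AddCommGroup V] [Module F V] [Subsingleton V]
    (P : Polynomial F) (g : V →ₗ[F] V) : Nilp P g :=
  (nilp_iff_exists _ _).mpr ⟨0, fun _ => Subsingleton.elim _ _⟩

lemma QQ_top {P₁ P₂ : Polynomial F} {g : V →ₗ[F] V} :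
    QQ P₁ P₂ (⊤ : Submodule F V) g ↔ Nilp P₁ g := by
  constructor
  · rintro ⟨h, h1, -⟩
    rw [nilp_iff_restrict_quo g _ ⊤ h]
    haveI : Subsingleton (V ⧸ (⊤ : Submodule F V)) := Submodule.Quotient.subsingleton_iff.mpr rfl
    exact ⟨h1, nilp_of_subsingleton _ _⟩
  · intro h
    haveI : Subsingleton (V ⧸ (⊤ : Submodule F V)) := Submodule.Quotient.subsingleton_iff.mpr rfl
    exact ⟨fun _ _ => trivial, h.restrict _ _, nilp_of_subsingleton _ _⟩

lemma QQ_bot {P₁ P₂ : Polynomial F} {g : V →ₗ[F] V} :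
    QQ P₁ P₂ (⊥ : Submodule F V) g ↔ Nilp P₂ g := by
  constructor
  · rintro ⟨h, -, h2⟩
    rw [nilp_iff_restrict_quo g _ ⊥ h]
    exact ⟨nilp_of_subsingleton _ _, h2⟩
  · intro h
    have hs : ∀ x ∈ (⊥ : Submodule F V), g x ∈ (⊥ : Submodule F V) := by
      intro x hx
      rw [Submodule.mem_bot] at hx ⊢
      rw [hx, map_zero]
    exact ⟨hs, nilp_of_subsingleton _ _, h.quo _ _⟩

lemma sum_sub_bot_top [Nontrivial V] (X : Submodule F V → ℂ)
    (h : ∀ W, W ≠ ⊥ → W ≠ ⊤ → X W = 0) : ∑ W, X W = X ⊤ + X ⊥ := by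
  have : ({⊤, ⊥} : Finset (Submodule F V)) ⊆ Finset.univ := Finset.subset_univ _
  rw [← Finset.sum_subset this]
  · rw [Finset.sum_pair top_ne_bot]
  · intro W _ hW
    simp only [Finset.mem_insert, Finset.mem_singleton, not_or] at hW
    exact h W hW.2 hW.1

lemma SS_mul {f : Fam F} (hf : IsGL f) {ψ : AddChar F ℂ} (hψ : ∃ a, ψ a ≠ 1) [Nontrivial V]
    {y : V →ₗ[F] V} (hy : Irr y) {P₁ P₂ : Polynomial F} (hc : IsCoprime P₁ P₂) :
    SS f ψ y (P₁ * P₂) = SS f ψ y P₁ + SS f ψ y P₂ := by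
  have h1 : ∀ g : V →ₗ[F] V, (if Nilp (P₁ * P₂) g then f V g else 0)
      = ∑ W : Submodule F V, if QQ P₁ P₂ W g then f V g else 0 := by
    intro g
    split_ifs with h
    · obtain ⟨W, hW⟩ := QQ_exists h
      rw [Finset.sum_eq_single W]
      · rw [if_pos hW]
      · intro W' _ hne
        rw [if_neg]
        intro hW'
        exact hne (le_antisymm (QQ_unique hc hW' hW) (QQ_unique hc hW hW'))
      · simp
    · symm
      refine Finset.sum_eq_zero fun W _ => if_neg fun hW => h (QQ_nilp hW)
  unfold SS
  simp_rw [h1, Finset.sum_mul]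
  rw [Finset.sum_comm, sum_sub_bot_top]
  · simp only [QQ_top, QQ_bot]
  · intro W hb ht
    refine shift_sum hψ hy W hb ht (fun g => if QQ P₁ P₂ W g then f V g else 0) ?_
    intro g u hu hk
    by_cases hq : QQ P₁ P₂ W g
    · have hq' := QQ_add hu hk hq
      simp only [if_pos hq, if_pos hq']
      obtain ⟨hs, h1, h2⟩ := hq
      obtain ⟨hs', h1', h2'⟩ := hq'
      rw [hf.split g W hs hc h1 h2, hf.split (g + u) W hs' hc h1' h2']
      rw [restrict_add hs hs' hk, quo_add hs hs' hu]
    · rw [if_neg hq, if_neg]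
      intro hq'
      refine hq ?_
      have := QQ_add (u := -u) (fun x => W.neg_mem (hu x)) (fun x hx => by simp [hk x hx]) hq'
      simpa using this

lemma SS_pow {f : Fam F} {ψ : AddChar F ℂ} {y : V →ₗ[F] V} (P : Polynomial F) {k : ℕ}
    (hk : k ≠ 0) : SS f ψ y (P ^ k) = SS f ψ y P := by
  unfold SS
  simp_rw [nilp_pow_iff _ _ hk]

end shift

/-- convolution with a rank one family -/
noncomputable def conv (f : Fam F) (ρ : ℂ) : Fam F := fun V _ _ _ g =>
  ∑ W : Submodule F V, if h : ∀ x ∈ W, g x ∈ W then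
    f W (g.restrict h) * ρ ^ Module.finrank F (V ⧸ W) else 0

noncomputable def RR (F : Type) [Field F] : List ℂ → Fam F
  | [] => fun V _ _ _ _ => if Subsingleton V then 1 else 0
  | ρ :: l => conv (RR F l) ρ

noncomputable def oneFam (F : Type) [Field F] : Fam F := fun _ _ _ _ _ => 1

section conv
variable {V : Type} [AddCommGroup V] [Module F V] [Finite V] [Finite F]

lemma SS_conv {f : Fam F} (hf : IsGL f) (ρ : ℂ) {ψ : AddChar F ℂ} (hψ : ∃ a, ψ a ≠ 1)
    [Nontrivial V] {y : V →ₗ[F] V} (hy : Irr y) (P : Polynomial F) :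
    SS (conv f ρ) ψ y P = SS f ψ y P + ρ ^ Module.finrank F V * SS (oneFam F) ψ y P := by
  let T : Submodule F V → (V →ₗ[F] V) → ℂ := fun W g => if Nilp P g then
    (if h : ∀ x ∈ W, g x ∈ W then f W (g.restrict h) * ρ ^ Module.finrank F (V ⧸ W) else 0) else 0
  have h1 : ∀ g : V →ₗ[F] V, (if Nilp P g then conv f ρ V g else 0) = ∑ W, T W g := by
    intro g
    simp only [T]
    split_ifs with h
    · rfl
    · simp
  unfold SS
  simp_rw [h1, Finset.sum_mul]
  rw [Finset.sum_comm, sum_sub_bot_top]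
  · congr 1
    · refine Finset.sum_congr rfl fun g _ => ?_
      congr 1
      simp only [T]
      split_ifs with h h2
      · have : Module.finrank F (V ⧸ (⊤ : Submodule F V)) = 0 := by
          haveI : Subsingleton (V ⧸ (⊤ : Submodule F V)) := Submodule.Quotient.subsingleton_iff.mpr rfl
          exact Module.finrank_zero_of_subsingleton
        rw [this, pow_zero, mul_one]
        exact (hf.conj' (Submodule.topEquiv) _ _ (fun x => rfl)).symm
      · exact absurd (fun _ _ => trivial) h2
      · rfl
    · rw [Finset.mul_sum]
      refine Finset.sum_congr rfl fun g _ => ?_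
      rw [← mul_assoc]
      congr 1
      simp only [T, oneFam]
      split_ifs with h h2
      · have h3 := Submodule.finrank_quotient_add_finrank (⊥ : Submodule F V)
        rw [finrank_bot, add_zero] at h3
        rw [h3, hf.one]; ring
      · exact absurd (fun x hx => by rw [Submodule.mem_bot] at hx ⊢; rw [hx, map_zero]) h2
      · simp
  · intro W hb ht
    refine shift_sum hψ hy W hb ht (T W) ?_
    have main : ∀ g u : V →ₗ[F] V, (∀ x, u x ∈ W) → (∀ x ∈ W, u x = 0) →
        (∀ x ∈ W, g x ∈ W) → T W (g + u) = T W g := by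
      intro g u hu hk hs
      have hs' := stable_add hs hu
      simp only [T]
      rw [dif_pos hs, dif_pos hs', restrict_add hs hs' hk]
      simp only [nilp_iff_restrict_quo g P W hs, nilp_iff_restrict_quo (g + u) P W hs',
        restrict_add hs hs' hk, quo_add hs hs' hu]
    intro g u hu hk
    by_cases hs : ∀ x ∈ W, g x ∈ W
    · exact main g u hu hk hs
    · have hs' : ¬ ∀ x ∈ W, (g + u) x ∈ W := by
        intro h
        apply hs
        intro x hx
        have := h x hx
        rwa [LinearMap.add_apply, hk x hx, add_zero] at this
      simp only [T]
      rw [dif_neg hs, dif_neg hs']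
      simp
end conv
end

section
variable {F : Type} [Field F]

lemma sum_hom_surj {G H : Type} [AddCommGroup G] [AddCommGroup H] [Fintype G] [Fintype H]
    (π : G → H) (hadd : ∀ a b, π (a + b) = π a + π b) (hs : Function.Surjective π) (φ : H → ℂ) :
    (Fintype.card H : ℂ) * ∑ g, φ (π g) = Fintype.card G * ∑ h, φ h := by
  have h1 : ∑ g : G, ∑ h : H, φ (π g + h) = Fintype.card G * ∑ h, φ h := by
    have : ∀ g : G, ∑ h : H, φ (π g + h) = ∑ h, φ h := fun g =>
      Equiv.sum_comp (Equiv.addLeft (π g)) φ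
    simp [this]
  have h2 : ∑ h : H, ∑ g : G, φ (π g + h) = Fintype.card H * ∑ g, φ (π g) := by
    have : ∀ h : H, ∑ g : G, φ (π g + h) = ∑ g, φ (π g) := by
      intro h
      obtain ⟨g₀, rfl⟩ := hs h
      simp_rw [← hadd]
      exact Equiv.sum_comp (Equiv.addRight g₀) (fun g => φ (π g))
    simp [this]
  rw [← h1, ← h2, Finset.sum_comm]

noncomputable def cterm (f : Fam F) (ρ : ℂ) {V : Type} [AddCommGroup V] [Module F V] [Finite V]
    (g : V →ₗ[F] V) (W : Submodule F V) : ℂ :=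
  if h : ∀ x ∈ W, g x ∈ W then f W (g.restrict h) * ρ ^ Module.finrank F (V ⧸ W) else 0

section
variable {V V' : Type} [AddCommGroup V] [Module F V] [Finite V]
  [AddCommGroup V'] [Module F V'] [Finite V']

lemma finrank_quo_map (e : V ≃ₗ[F] V') (W : Submodule F V) :
    Module.finrank F (V' ⧸ W.map (e : V →ₗ[F] V')) = Module.finrank F (V ⧸ W) :=
  (LinearEquiv.finrank_eq (Submodule.Quotient.equiv W _ e rfl)).symm

lemma cterm_conj {f : Fam F} (hf : IsGL f) (ρ : ℂ) (e : V ≃ₗ[F] V') (g : V →ₗ[F] V)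
    (g' : V' →ₗ[F] V') (he : ∀ x, e (g x) = g' (e x)) (W : Submodule F V) :
    cterm f ρ g' (W.map (e : V →ₗ[F] V')) = cterm f ρ g W := by
  unfold cterm
  have hiff : (∀ x ∈ W.map (e : V →ₗ[F] V'), g' x ∈ W.map (e : V →ₗ[F] V')) ↔
      ∀ x ∈ W, g x ∈ W := by
    constructor
    · intro h x hx
      obtain ⟨z, hz, hzx⟩ := h (e x) ⟨x, hx, rfl⟩
      rw [← he] at hzx
      have := e.injective hzx
      rwa [← this]
    · rintro h _ ⟨x, hx, rfl⟩
      exact ⟨g x, h x hx, he x⟩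
  by_cases h : ∀ x ∈ W, g x ∈ W
  · rw [dif_pos h, dif_pos (hiff.mpr h), finrank_quo_map]
    congr 1
    refine hf.conj' (e.submoduleMap W) _ _ ?_
    intro x
    ext
    exact he x
  · rw [dif_neg h, dif_neg (fun h' => h (hiff.mp h'))]

lemma conv_eq (f : Fam F) (ρ : ℂ) (g : V →ₗ[F] V) : conv f ρ V g = ∑ W, cterm f ρ g W := rfl

lemma conv_conj {f : Fam F} (hf : IsGL f) (ρ : ℂ) (e : V ≃ₗ[F] V') (g : V →ₗ[F] V)
    (g' : V' →ₗ[F] V') (he : ∀ x, e (g x) = g' (e x)) : conv f ρ V' g' = conv f ρ V g := by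
  rw [conv_eq, conv_eq, ← Equiv.sum_comp (Submodule.orderIsoMapComap e).toEquiv]
  exact Finset.sum_congr rfl fun W _ => cterm_conj hf ρ e g g' he W

end

section
variable {V₁ V₂ : Type} [AddCommGroup V₁] [Module F V₁] [Finite V₁]
  [AddCommGroup V₂] [Module F V₂] [Finite V₂]

lemma map_shear_mem (S : V₂ →ₗ[F] V₁) (W : Submodule F (V₁ × V₂)) (x : V₁ × V₂) :
    x ∈ W.map (shear S : V₁ × V₂ →ₗ[F] V₁ × V₂) ↔ (x.1 - S x.2, x.2) ∈ W := by
  constructor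
  · rintro ⟨z, hz, rfl⟩
    simpa using hz
  · intro h
    exact ⟨_, h, by simp⟩

lemma shear_prod_eq_iff (S S' : V₂ →ₗ[F] V₁) (W₁ : Submodule F V₁) (W₂ : Submodule F V₂) :
    (W₁.prod W₂).map (shear S : V₁ × V₂ →ₗ[F] V₁ × V₂)
      = (W₁.prod W₂).map (shear S' : V₁ × V₂ →ₗ[F] V₁ × V₂) ↔ ∀ x ∈ W₂, (S - S') x ∈ W₁ := by
  constructor
  · intro h x hx
    have : (S x, x) ∈ (W₁.prod W₂).map (shear S : V₁ × V₂ →ₗ[F] V₁ × V₂) := by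
      rw [map_shear_mem]; simp [hx]
    rw [h, map_shear_mem] at this
    exact this.1
  · intro h
    ext ⟨a, b⟩
    rw [map_shear_mem, map_shear_mem]
    simp only [Submodule.mem_prod]
    constructor
    · rintro ⟨h1, h2⟩
      refine ⟨?_, h2⟩
      have := W₁.add_mem h1 (h b h2)
      simpa using this
    · rintro ⟨h1, h2⟩
      refine ⟨?_, h2⟩
      have := W₁.sub_mem h1 (h b h2)
      simpa using this

lemma exists_shear (W : Submodule F (V₁ × V₂)) : ∃ S : V₂ →ₗ[F] V₁,
    W = ((W.comap (LinearMap.inl F V₁ V₂)).prod (W.map (LinearMap.snd F V₁ V₂))).map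
      (shear S : V₁ × V₂ →ₗ[F] V₁ × V₂) := by
  let p : W →ₗ[F] W.map (LinearMap.snd F V₁ V₂) :=
    LinearMap.restrict (LinearMap.snd F V₁ V₂) (fun x hx => ⟨x, hx, rfl⟩)
  have hp : Function.Surjective p := by
    rintro ⟨_, x, hx, rfl⟩
    exact ⟨⟨x, hx⟩, rfl⟩
  obtain ⟨s, hs⟩ := p.exists_rightInverse_of_surjective (LinearMap.range_eq_top.mpr hp)
  have hs' : ∀ y, p (s y) = y := fun y => congrArg (fun l => l y) hs
  obtain ⟨S, hS⟩ := LinearMap.exists_extend ((LinearMap.fst F V₁ V₂) ∘ₗ W.subtype ∘ₗ s)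
  have hmem : ∀ y ∈ W.map (LinearMap.snd F V₁ V₂), (S y, y) ∈ W := by
    intro y hy
    have h1 : S y = ((s ⟨y, hy⟩ : W) : V₁ × V₂).1 := congrArg (fun l => l ⟨y, hy⟩) hS
    have h2 : ((s ⟨y, hy⟩ : W) : V₁ × V₂).2 = y := congrArg Subtype.val (hs' ⟨y, hy⟩)
    have : (S y, y) = ((s ⟨y, hy⟩ : W) : V₁ × V₂) := Prod.ext h1 h2.symm
    rw [this]
    exact (s ⟨y, hy⟩).2
  refine ⟨S, ?_⟩
  ext ⟨a, b⟩
  rw [map_shear_mem]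
  simp only [Submodule.mem_prod, Submodule.mem_comap, LinearMap.inl_apply]
  constructor
  · intro h
    have hb : b ∈ W.map (LinearMap.snd F V₁ V₂) := ⟨_, h, rfl⟩
    refine ⟨?_, hb⟩
    have := W.sub_mem h (hmem b hb)
    simpa using this
  · rintro ⟨h1, h2⟩
    have := W.add_mem h1 (hmem b h2)
    simpa using this

lemma shear_comap_map (S : V₂ →ₗ[F] V₁) (W₁ : Submodule F V₁) (W₂ : Submodule F V₂) :
    ((W₁.prod W₂).map (shear S : V₁ × V₂ →ₗ[F] V₁ × V₂)).comap (LinearMap.inl F V₁ V₂) = W₁ ∧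
    ((W₁.prod W₂).map (shear S : V₁ × V₂ →ₗ[F] V₁ × V₂)).map (LinearMap.snd F V₁ V₂) = W₂ := by
  constructor
  · ext x
    rw [Submodule.mem_comap, map_shear_mem]
    simp
  · ext x
    constructor
    · rintro ⟨z, hz, rfl⟩
      have hz := (map_shear_mem S _ z).mp hz
      exact hz.2
    · intro hx
      exact ⟨(S x, x), (map_shear_mem S _ _).mpr (by simp [hx]), rfl⟩

def pr (W : Submodule F (V₁ × V₂)) : Submodule F V₁ × Submodule F V₂ :=
  (W.comap (LinearMap.inl F V₁ V₂), W.map (LinearMap.snd F V₁ V₂))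

/-- maps carrying W₂ into W₁ -/
def Ks (W₁ : Submodule F V₁) (W₂ : Submodule F V₂) : AddSubgroup (V₂ →ₗ[F] V₁) where
  carrier := {S | ∀ x ∈ W₂, S x ∈ W₁}
  add_mem' ha hb x hx := W₁.add_mem (ha x hx) (hb x hx)
  zero_mem' x hx := W₁.zero_mem
  neg_mem' ha x hx := W₁.neg_mem (ha x hx)

lemma card_fiber (W₁ : Submodule F V₁) (W₂ : Submodule F V₂) :
    Fintype.card (V₂ →ₗ[F] V₁) = (Finset.univ.filter fun W : Submodule F (V₁ × V₂) =>
      pr W = (W₁, W₂)).card * Fintype.card (Ks W₁ W₂) := by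
  rw [← Finset.card_univ, Finset.card_eq_sum_card_fiberwise
    (f := fun S : V₂ →ₗ[F] V₁ => (W₁.prod W₂).map (shear S : V₁ × V₂ →ₗ[F] V₁ × V₂))
    (t := Finset.univ.filter fun W : Submodule F (V₁ × V₂) => pr W = (W₁, W₂))]
  · rw [Finset.sum_const_nat (m := Fintype.card (Ks W₁ W₂))]
    intro W hW
    simp only [Finset.mem_filter, Finset.mem_univ, true_and] at hW
    obtain ⟨S₀, hS₀⟩ := exists_shear W
    have h1 : W.comap (LinearMap.inl F V₁ V₂) = W₁ := congrArg Prod.fst hW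
    have h2 : W.map (LinearMap.snd F V₁ V₂) = W₂ := congrArg Prod.snd hW
    rw [h1, h2] at hS₀
    rw [← Fintype.card_coe]
    refine Fintype.card_congr
      { toFun := fun S => ⟨S.1 - S₀, ?_⟩
        invFun := fun S => ⟨S.1 + S₀, ?_⟩
        left_inv := fun S => by simp
        right_inv := fun S => by simp }
    · have := S.2
      simp only [Finset.mem_filter, Finset.mem_univ, true_and] at this
      exact (shear_prod_eq_iff _ _ _ _).mp (this.trans hS₀)
    · simp only [Finset.mem_filter, Finset.mem_univ, true_and]
      conv_rhs => rw [hS₀]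
      rw [shear_prod_eq_iff]
      intro x hx
      have := S.2 x hx
      simpa using this
  · intro S _
    have := shear_comap_map S W₁ W₂
    simp only [Finset.coe_filter, Set.mem_setOf_eq, Finset.mem_univ, true_and]
    exact Prod.ext this.1 this.2

def prodEquiv' (W₁ : Submodule F V₁) (W₂ : Submodule F V₂) :
    ↥(W₁.prod W₂) ≃ₗ[F] W₁ × W₂ where
  toFun x := (⟨x.1.1, x.2.1⟩, ⟨x.1.2, x.2.2⟩)
  invFun x := ⟨(x.1.1, x.2.1), ⟨x.1.2, x.2.2⟩⟩
  map_add' _ _ := rfl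
  map_smul' _ _ := rfl
  left_inv _ := rfl
  right_inv _ := rfl

lemma finrank_quo_prod (W₁ : Submodule F V₁) (W₂ : Submodule F V₂) :
    Module.finrank F ((V₁ × V₂) ⧸ W₁.prod W₂) =
      Module.finrank F (V₁ ⧸ W₁) + Module.finrank F (V₂ ⧸ W₂) := by
  have h := Submodule.finrank_quotient_add_finrank (W₁.prod W₂)
  have h1 := Submodule.finrank_quotient_add_finrank W₁
  have h2 := Submodule.finrank_quotient_add_finrank W₂
  rw [LinearEquiv.finrank_eq (prodEquiv' W₁ W₂), Module.finrank_prod, Module.finrank_prod] at h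
  omega

variable [Finite F]

lemma sum_cterm_prod {f : Fam F} (hf : IsGL f) (ρ : ℂ) (A : V₁ →ₗ[F] V₁) (D : V₂ →ₗ[F] V₂)
    (W₁ : Submodule F V₁) (W₂ : Submodule F V₂) :
    ∑ u : V₂ →ₗ[F] V₁, cterm f ρ (blk A u D) (W₁.prod W₂) =
      Fintype.card (Ks W₁ W₂) * (cterm f ρ A W₁ * cterm f ρ D W₂) := by
  have hst : ∀ u, (∀ x ∈ W₁.prod W₂, blk A u D x ∈ W₁.prod W₂) ↔
      ((∀ x ∈ W₁, A x ∈ W₁) ∧ (∀ x ∈ W₂, D x ∈ W₂)) ∧ u ∈ Ks W₁ W₂ := by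
    intro u
    constructor
    · intro h
      refine ⟨⟨fun x hx => ?_, fun x hx => ?_⟩, fun x hx => ?_⟩
      · simpa using (h (x, 0) ⟨hx, W₂.zero_mem⟩).1
      · simpa using (h (0, x) ⟨W₁.zero_mem, hx⟩).2
      · simpa using (h (0, x) ⟨W₁.zero_mem, hx⟩).1
    · rintro ⟨⟨h1, h2⟩, h3⟩ x hx
      exact ⟨W₁.add_mem (h1 _ hx.1) (h3 _ hx.2), h2 _ hx.2⟩
  by_cases h : (∀ x ∈ W₁, A x ∈ W₁) ∧ (∀ x ∈ W₂, D x ∈ W₂)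
  swap
  · have h0 : cterm f ρ A W₁ * cterm f ρ D W₂ = 0 := by
      unfold cterm
      rcases not_and_or.mp h with h | h <;> rw [dif_neg h] <;> simp
    rw [h0, mul_zero]
    refine Finset.sum_eq_zero fun u _ => ?_
    unfold cterm
    rw [dif_neg]
    rw [hst]
    exact fun h' => h h'.1
  obtain ⟨hA, hD⟩ := h
  let res : Ks W₁ W₂ → (W₂ →ₗ[F] W₁) := fun u => u.1.restrict u.2
  have hres : Function.Surjective res := by
    intro v
    obtain ⟨u, hu⟩ := LinearMap.exists_extend (W₁.subtype ∘ₗ v)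
    have hu' : ∀ x : W₂, u x = v x := fun x => congrArg (fun l => l x) hu
    refine ⟨⟨u, fun x hx => ?_⟩, ?_⟩
    · rw [hu' ⟨x, hx⟩]; exact (v ⟨x, hx⟩).2
    · ext x; exact hu' x
  have hterm : ∀ u : Ks W₁ W₂, cterm f ρ (blk A u.1 D) (W₁.prod W₂) =
      f (W₁ × W₂) (blk (A.restrict hA) (res u) (D.restrict hD)) *
        ρ ^ (Module.finrank F (V₁ ⧸ W₁) + Module.finrank F (V₂ ⧸ W₂)) := by
    intro u
    unfold cterm
    rw [dif_pos ((hst u.1).mpr ⟨⟨hA, hD⟩, u.2⟩), finrank_quo_prod]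
    congr 1
    refine (hf.conj' (prodEquiv' W₁ W₂) _ _ ?_).symm
    intro x
    rfl
  have hsum : ∑ u : V₂ →ₗ[F] V₁, cterm f ρ (blk A u D) (W₁.prod W₂) =
      ∑ u : Ks W₁ W₂, cterm f ρ (blk A u.1 D) (W₁.prod W₂) := by
    symm
    refine Finset.sum_bij_ne_zero (fun u _ _ => u.1) (fun _ _ _ => Finset.mem_univ _)
      (fun a _ _ b _ _ h => Subtype.ext h) ?_ (fun _ _ _ => rfl)
    intro u _ hu
    have : u ∈ Ks W₁ W₂ := by
      by_contra hn
      apply hu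
      unfold cterm
      rw [dif_neg]
      rw [hst]
      exact fun h' => hn h'.2
    exact ⟨⟨u, this⟩, Finset.mem_univ _, hu, rfl⟩
  rw [hsum, Finset.sum_congr rfl (fun u _ => hterm u), ← Finset.sum_mul]
  have e1 := sum_hom_surj (G := Ks W₁ W₂) res (fun a b => by ext x; rfl) hres
    (fun v => f (W₁ × W₂) (blk (A.restrict hA) v (D.restrict hD)))
  rw [hf.ext, natCard_lin] at e1
  have hq : ((Nat.card F : ℂ)) ≠ 0 := by exact_mod_cast Nat.card_pos.ne'
  have e2 : ∑ u : Ks W₁ W₂, f (W₁ × W₂) (blk (A.restrict hA) (res u) (D.restrict hD)) =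
      Fintype.card (Ks W₁ W₂) * (f W₁ (A.restrict hA) * f W₂ (D.restrict hD)) := by
    push_cast at e1
    refine mul_left_cancel₀ (pow_ne_zero (Module.finrank F W₁ * Module.finrank F W₂) hq) ?_
    rw [e1]; ring
  rw [e2]
  unfold cterm
  rw [dif_pos hA, dif_pos hD]
  ring

lemma conv_isGL {f : Fam F} (hf : IsGL f) (ρ : ℂ) : IsGL (conv f ρ) where
  conj := by
    intro V W _ _ _ _ _ _ e g
    exact conv_conj hf ρ e g _ (fun x => by simp [LinearEquiv.conj_apply])
  one := by
    intro V _ _ _ _ g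
    rw [conv_eq]
    have hu : ∀ W : Submodule F V, cterm f ρ g W = 1 := by
      intro W
      unfold cterm
      rw [dif_pos (fun x _ => by rw [Subsingleton.elim (g x) 0]; exact W.zero_mem), hf.one,
        Module.finrank_zero_of_subsingleton]
      simp
    haveI : Unique (Submodule F V) := ⟨⟨⊥⟩, fun W => by ext x; simp [Subsingleton.elim x 0]⟩
    rw [Fintype.sum_unique, hu]
  ext := by
    intro V₁ V₂ _ _ _ _ _ _ A D
    simp_rw [conv_eq]
    rw [Finset.sum_comm]
    set G : Submodule F (V₁ × V₂) → ℂ := fun W => ∑ u, cterm f ρ (blk A u D) W with hG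
    have hinv : ∀ (S : V₂ →ₗ[F] V₁) W, G (W.map (shear S : V₁ × V₂ →ₗ[F] V₁ × V₂)) = G W := by
      intro S W
      simp only [hG]
      conv_rhs => rw [← Equiv.sum_comp (Equiv.addRight (A ∘ₗ S - S ∘ₗ D))]
      refine Finset.sum_congr rfl fun u _ => ?_
      refine cterm_conj hf ρ (shear S) _ _ ?_ W
      intro x
      rw [← blk_shear, Equiv.coe_addRight, add_sub_assoc]
    have hval : ∀ W, G W = G ((pr W).1.prod (pr W).2) := by
      intro W
      obtain ⟨S, hS⟩ := exists_shear W
      conv_lhs => rw [hS]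
      rw [hinv]
      rfl
    calc ∑ W, G W = ∑ p : Submodule F V₁ × Submodule F V₂,
          ∑ W ∈ Finset.univ.filter (fun W => pr W = p), G W :=
        (Finset.sum_fiberwise _ _ _).symm
      _ = ∑ p : Submodule F V₁ × Submodule F V₂,
          (Fintype.card (V₂ →ₗ[F] V₁) : ℂ) * (cterm f ρ A p.1 * cterm f ρ D p.2) := by
        refine Finset.sum_congr rfl fun p _ => ?_
        rw [Finset.sum_congr rfl (g := fun _ => G (p.1.prod p.2))]
        · rw [Finset.sum_const, hG]
          simp only
          rw [sum_cterm_prod hf, card_fiber p.1 p.2, nsmul_eq_mul]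
          push_cast
          ring
        · intro W hW
          simp only [Finset.mem_filter, Finset.mem_univ, true_and] at hW
          rw [hval, hW]
      _ = _ := by
        rw [← Finset.mul_sum, natCard_lin, Fintype.sum_prod_type, Finset.sum_mul_sum]
        push_cast
        rfl

lemma RR_nil_isGL : IsGL (RR F []) where
  conj := by
    intro V W _ _ _ _ _ _ e g
    simp only [RR]
    congr 1
    exact propext e.symm.toEquiv.subsingleton_congr
  one := by
    intro V _ _ _ h g
    simp [RR, h]
  ext := by
    intro V₁ V₂ _ _ _ _ _ _ A D
    simp only [RR]
    by_cases h1 : Subsingleton V₁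
    · by_cases h2 : Subsingleton V₂
      · have hss : Subsingleton (V₁ × V₂) := inferInstance
        haveI : Unique (V₂ →ₗ[F] V₁) := ⟨⟨0⟩, fun u => by ext x; exact Subsingleton.elim _ _⟩
        rw [if_pos hss, if_pos h1, if_pos h2, Module.finrank_zero_of_subsingleton]
        simp
      · rw [if_neg h2, if_neg]
        · simp
        · intro h; exact h2 (Prod.snd_surjective (α := V₁) |>.subsingleton)
    · rw [if_neg h1, if_neg]
      · simp
      · intro h; exact h1 (Prod.fst_surjective (β := V₂) |>.subsingleton)

lemma RR_isGL (l : List ℂ) : IsGL (RR F l) := by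
  induction l with
  | nil => exact RR_nil_isGL
  | cons ρ l ih => exact conv_isGL ih ρ
end
end

section
variable {F : Type} [Field F]

lemma card_le_ker {G H K : Type} [AddCommGroup G] [AddCommGroup H] [Finite G] [Finite H] [Finite K]
    (φ : G →+ H) (j : φ.ker → K) (hj : Function.Injective j) :
    Nat.card G ≤ Nat.card H * Nat.card K ∧
      ((¬ Function.Surjective φ) → Nat.card G < Nat.card H * Nat.card K) := by
  have h1 : Nat.card G = Nat.card φ.range * Nat.card φ.ker := by
    rw [AddSubgroup.card_eq_card_quotient_mul_card_addSubgroup φ.ker,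
      Nat.card_congr (QuotientAddGroup.quotientKerEquivRange φ).toEquiv]
  have h2 : Nat.card φ.ker ≤ Nat.card K := Nat.card_le_card_of_injective j hj
  have h3 : Nat.card φ.range ≤ Nat.card H :=
    Nat.card_le_card_of_injective _ Subtype.val_injective
  refine ⟨h1 ▸ Nat.mul_le_mul h3 h2, fun hs => ?_⟩
  have h4 : Nat.card φ.range < Nat.card H := by
    have : φ.range ≠ ⊤ := fun h => hs (AddMonoidHom.range_eq_top.mp h)
    refine lt_of_le_of_ne h3 fun h => this ?_
    exact AddSubgroup.eq_top_of_card_eq _ h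
  have h5 : 0 < Nat.card φ.ker := Nat.card_pos
  rw [h1]
  exact lt_of_lt_of_le (Nat.mul_lt_mul_of_pos_right h4 h5) (Nat.mul_le_mul_left _ h2)

/-- intertwiners -/
def HH {V W : Type} [AddCommGroup V] [Module F V] [AddCommGroup W] [Module F W]
    (A : V →ₗ[F] V) (D : W →ₗ[F] W) : AddSubgroup (V →ₗ[F] W) where
  carrier := {s | ∀ x, D (s x) = s (A x)}
  add_mem' ha hb x := by simp [ha x, hb x]
  zero_mem' x := by simp
  neg_mem' ha x := by simp [ha x]

section
variable {V₁ V₂ W : Type} [AddCommGroup V₁] [Module F V₁] [Finite V₁]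
  [AddCommGroup V₂] [Module F V₂] [Finite V₂] [AddCommGroup W] [Module F W] [Finite W]

/-- restriction of intertwiners to the first block -/
def resHH (A : V₁ →ₗ[F] V₁) (u : V₂ →ₗ[F] V₁) (D : V₂ →ₗ[F] V₂) (B : W →ₗ[F] W) :
    HH (blk A u D) B →+ HH A B where
  toFun s := ⟨s.1 ∘ₗ LinearMap.inl F V₁ V₂, fun x => by
    have := s.2 (x, 0)
    simpa using this⟩
  map_zero' := rfl
  map_add' _ _ := rfl

lemma card_HH_blk (A : V₁ →ₗ[F] V₁) (u : V₂ →ₗ[F] V₁) (D : V₂ →ₗ[F] V₂) (B : W →ₗ[F] W) :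
    Nat.card (HH (blk A u D) B) ≤ Nat.card (HH A B) * Nat.card (HH D B) ∧
      ((¬ Function.Surjective (resHH A u D B)) →
        Nat.card (HH (blk A u D) B) < Nat.card (HH A B) * Nat.card (HH D B)) := by
  have h0 : ∀ s : (resHH A u D B).ker, ∀ x, s.1.1 (x, 0) = 0 := by
    intro s x
    have h1 : resHH A u D B s.1 = 0 := s.2
    have := congrArg (fun l => (l.1 : V₁ →ₗ[F] W) x) h1
    simpa [resHH] using this
  refine card_le_ker (resHH A u D B)
    (fun s => ⟨s.1.1 ∘ₗ LinearMap.inr F V₁ V₂, fun x => ?_⟩) ?_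
  · have := s.1.2 (0, x)
    simp only [blk_apply, map_zero, zero_add] at this
    have e : ((u x, D x) : V₁ × V₂) = (u x, 0) + (0, D x) := by simp
    rw [e, map_add, h0, zero_add] at this
    simpa using this
  · intro s t hst
    apply Subtype.ext
    apply Subtype.ext
    refine LinearMap.ext fun x => ?_
    have e : x = (x.1, 0) + (0, x.2) := by simp
    rw [e, map_add, map_add, h0, h0]
    exact congrArg (fun l => 0 + (l.1 : V₂ →ₗ[F] W) x.2) hst

lemma card_end_lt (A : V₁ →ₗ[F] V₁) (u : V₂ →ₗ[F] V₁) (D : V₂ →ₗ[F] V₂)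
    (hu : ¬ ∃ S : V₂ →ₗ[F] V₁, u + A ∘ₗ S - S ∘ₗ D = 0) :
    Nat.card (HH (blk A u D) (blk A u D)) < Nat.card (HH (blk A 0 D) (blk A 0 D)) := by
  let φ : HH (blk A u D) (blk A u D) →+ HH (blk A u D) D :=
    { toFun := fun s => ⟨LinearMap.snd F V₁ V₂ ∘ₗ s.1, fun x => congrArg Prod.snd (s.2 x)⟩
      map_zero' := rfl
      map_add' := fun _ _ => rfl }
  have h0 : ∀ s : φ.ker, ∀ x, (s.1.1 x).2 = 0 := by
    intro s x
    have h1 : φ s.1 = 0 := s.2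
    exact congrArg (fun l => (l.1 : V₁ × V₂ →ₗ[F] V₂) x) h1
  have e1 := (card_le_ker φ (K := HH (blk A u D) A)
    (fun s => ⟨LinearMap.fst F V₁ V₂ ∘ₗ s.1.1, fun x => by
      have := congrArg Prod.fst (s.1.2 x)
      simpa [h0] using this⟩) (by
      intro s t hst
      apply Subtype.ext
      apply Subtype.ext
      refine LinearMap.ext fun x => ?_
      exact Prod.ext (congrArg (fun l => l.1 x) hst) (by rw [h0, h0]))).1
  have e2 := (card_HH_blk A u D D).1
  have e3 := (card_HH_blk A u D A).2 (by
    intro hs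
    obtain ⟨s, hs⟩ := hs ⟨LinearMap.id, fun x => rfl⟩
    apply hu
    refine ⟨-(s.1 ∘ₗ LinearMap.inr F V₁ V₂), ?_⟩
    have h1 : ∀ x, s.1 (x, 0) = x := fun x => congrArg (fun l => (l.1 : V₁ →ₗ[F] V₁) x) hs
    ext x
    have h2 := s.2 (0, x)
    simp only [blk_apply, map_zero, zero_add] at h2
    have e : ((u x, D x) : V₁ × V₂) = (u x, 0) + (0, D x) := by simp
    rw [e, map_add, h1] at h2
    simp [h2])
  have e4 : Nat.card ((HH A A × HH D A) × (HH A D × HH D D)) ≤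
      Nat.card (HH (blk A 0 D) (blk A 0 D)) := by
    refine Nat.card_le_card_of_injective
      (fun p => ⟨(p.1.1.1.coprod p.1.2.1).prod (p.2.1.1.coprod p.2.2.1), ?_⟩) ?_
    · intro x
      have h1 := p.1.1.2 x.1
      have h2 := p.1.2.2 x.2
      have h3 := p.2.1.2 x.1
      have h4 := p.2.2.2 x.2
      simp [h1, h2, h3, h4]
    · rintro ⟨⟨a, b⟩, c, d⟩ ⟨⟨a', b'⟩, c', d'⟩ h
      have h : ∀ x : V₁ × V₂, (a.1 x.1 + b.1 x.2, c.1 x.1 + d.1 x.2) =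
          (a'.1 x.1 + b'.1 x.2, c'.1 x.1 + d'.1 x.2) :=
        fun x => congrArg (fun l => (l.1 : V₁ × V₂ →ₗ[F] V₁ × V₂) x) h
      have ha : a = a' := by ext x; simpa using congrArg Prod.fst (h (x, 0))
      have hb : b = b' := by ext x; simpa using congrArg Prod.fst (h (0, x))
      have hc : c = c' := by ext x; simpa using congrArg Prod.snd (h (x, 0))
      have hd : d = d' := by ext x; simpa using congrArg Prod.snd (h (0, x))
      rw [ha, hb, hc, hd]
  rw [Nat.card_prod, Nat.card_prod, Nat.card_prod] at e4
  refine lt_of_lt_of_le ?_ e4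
  have hp : 0 < Nat.card (HH A D) * Nat.card (HH D D) :=
    Nat.mul_pos Nat.card_pos Nat.card_pos
  calc _ ≤ _ := e1
    _ ≤ (Nat.card (HH A D) * Nat.card (HH D D)) * Nat.card (HH (blk A u D) A) :=
      Nat.mul_le_mul_right _ e2
    _ < (Nat.card (HH A D) * Nat.card (HH D D)) * (Nat.card (HH A A) * Nat.card (HH D A)) :=
      Nat.mul_lt_mul_of_pos_left e3 hp
    _ = _ := by ring

lemma card_HH_conj {V V' : Type} [AddCommGroup V] [Module F V] [AddCommGroup V']
    [Module F V'] (g : V →ₗ[F] V) (g' : V' →ₗ[F] V') (e : V ≃ₗ[F] V')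
    (he : ∀ x, e (g x) = g' (e x)) : Nat.card (HH g g) = Nat.card (HH g' g') := by
  have he' : ∀ x, e.symm (g' x) = g (e.symm x) := fun x => by
    apply e.injective; simp [he]
  refine Nat.card_congr
    { toFun := fun s => ⟨e.toLinearMap ∘ₗ s.1 ∘ₗ e.symm.toLinearMap, fun x => ?_⟩
      invFun := fun s => ⟨e.symm.toLinearMap ∘ₗ s.1 ∘ₗ e.toLinearMap, fun x => ?_⟩
      left_inv := fun s => by ext x; simp
      right_inv := fun s => by ext x; simp }
  · have := s.2 (e.symm x)
    simp [← he, this, he']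
  · have := s.2 (e x)
    simp [← he', this, he]
end

/-- the cyclic module -/
noncomputable def cyc (P : Polynomial F) : AdjoinRoot P →ₗ[F] AdjoinRoot P :=
  LinearMap.mulLeft F (AdjoinRoot.root P)

instance finite_adjoinRoot [Finite F] (P : Polynomial F) [h : Fact (P ≠ 0)] :
    Finite (AdjoinRoot P) :=
  have : Module.Finite F (AdjoinRoot P) := (AdjoinRoot.powerBasis h.out).finite
  Module.finite_of_finite F

noncomputable def phi (f : Fam F) (P : Polynomial F) : ℂ :=
  if h : Finite (AdjoinRoot P) then f (AdjoinRoot P) (cyc P) else 0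

lemma phi_eq (f : Fam F) (P : Polynomial F) [Finite (AdjoinRoot P)] :
    phi f P = f (AdjoinRoot P) (cyc P) := dif_pos _

def IsCyc {V : Type} [AddCommGroup V] [Module F V] (P : Polynomial F) (g : V →ₗ[F] V) : Prop :=
  ∃ v, (∀ x, ∃ Q : Polynomial F, (Polynomial.aeval g Q : V →ₗ[F] V) v = x) ∧
    ∀ Q : Polynomial F, (Polynomial.aeval g Q : V →ₗ[F] V) v = 0 ↔ P ∣ Q

lemma aeval_cyc (P Q : Polynomial F) (x : AdjoinRoot P) :
    (Polynomial.aeval (cyc P) Q : AdjoinRoot P →ₗ[F] AdjoinRoot P) x = AdjoinRoot.mk P Q * x := by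
  have h : cyc P = Algebra.lmul F (AdjoinRoot P) (AdjoinRoot.root P) := rfl
  rw [h, Polynomial.aeval_algHom_apply, AdjoinRoot.aeval_eq]
  rfl

lemma isCyc_iff {V : Type} [AddCommGroup V] [Module F V] (P : Polynomial F) (g : V →ₗ[F] V) :
    IsCyc P g → ∃ e : AdjoinRoot P ≃ₗ[F] V, ∀ x, e (cyc P x) = g (e x) := by
  rintro ⟨v, hs, hk⟩
  let ev : Polynomial F →ₗ[F] V :=
    { toFun := fun Q => (Polynomial.aeval g Q : V →ₗ[F] V) v
      map_add' := by simp
      map_smul' := by simp }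
  let π : Polynomial F →ₗ[F] AdjoinRoot P := (AdjoinRoot.mkₐ P).toLinearMap
  have hker : LinearMap.ker π = LinearMap.ker ev := by
    ext Q
    rw [LinearMap.mem_ker, LinearMap.mem_ker]
    show AdjoinRoot.mk P Q = 0 ↔ _
    rw [AdjoinRoot.mk_eq_zero]
    exact (hk Q).symm
  let e1 := (Submodule.quotEquivOfEq _ _ hker)
  let e2 := π.quotKerEquivOfSurjective AdjoinRoot.mk_surjective
  let e3 := ev.quotKerEquivOfSurjective hs
  refine ⟨e2.symm.trans (e1.trans e3), ?_⟩
  have key : ∀ Q, (e2.symm.trans (e1.trans e3)) (π Q) = ev Q := by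
    intro Q
    have : e2.symm (π Q) = Submodule.Quotient.mk Q := by
      rw [LinearEquiv.symm_apply_eq]; rfl
    rw [LinearEquiv.trans_apply, this]
    rfl
  intro x
  obtain ⟨Q, rfl⟩ := AdjoinRoot.mk_surjective x
  have h1 : cyc P (AdjoinRoot.mk P Q) = π (Polynomial.X * Q) := by
    show AdjoinRoot.root P * _ = AdjoinRoot.mk P (Polynomial.X * Q)
    rw [map_mul]; rfl
  have h2 : AdjoinRoot.mk P Q = π Q := rfl
  rw [h1, h2, key, key]
  simp [ev]

lemma IsGL.phi_of_isCyc {f : Fam F} (hf : IsGL f) {V : Type} [AddCommGroup V] [Module F V]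
    [Finite V] {P : Polynomial F} {g : V →ₗ[F] V} (h : IsCyc P g) : f V g = phi f P := by
  obtain ⟨e, he⟩ := isCyc_iff P g h
  haveI : Finite (AdjoinRoot P) := Finite.of_injective e e.injective
  rw [phi_eq]
  exact hf.conj' e _ _ he

lemma isCyc_cyc (P : Polynomial F) : IsCyc P (cyc P) := by
  refine ⟨1, ?_, ?_⟩
  · intro x
    obtain ⟨Q, rfl⟩ := AdjoinRoot.mk_surjective x
    refine ⟨Q, ?_⟩
    rw [aeval_cyc, mul_one]
  · intro Q
    rw [aeval_cyc, mul_one, AdjoinRoot.mk_eq_zero]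

lemma trichotomy_aux (P : Polynomial F) : ∀ (d : ℕ) (k : Fin d → ℕ) {V : Type} [AddCommGroup V]
    [Module F V] [Finite V] (g : V →ₗ[F] V)
    (e : V ≃ₗ[F] (∀ i : Fin d, AdjoinRoot (P ^ k i)))
    (he : ∀ x i, e (g x) i = cyc (P ^ k i) (e x i)),
    (∃ m, IsCyc (P ^ m) g) ∨ (∃ (V₁ V₂ : Type) (_ : AddCommGroup V₁) (_ : Module F V₁)
      (_ : AddCommGroup V₂) (_ : Module F V₂) (A : V₁ →ₗ[F] V₁) (D : V₂ →ₗ[F] V₂)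
      (e : V ≃ₗ[F] V₁ × V₂), Nontrivial V₁ ∧ Nontrivial V₂ ∧
      ∀ x, e (g x) = blk A 0 D (e x)) := by
  intro d
  induction d with
  | zero =>
    intro k V _ _ _ g e he
    left
    refine ⟨0, 0, ?_, ?_⟩
    · intro x
      exact ⟨0, e.injective (Subsingleton.elim _ _)⟩
    · intro Q
      simp
  | succ d ih =>
    intro k V _ _ _ g e he
    let N₁ := AdjoinRoot (P ^ k 0)
    let N₂ := ∀ i : Fin d, AdjoinRoot (P ^ k i.succ)
    let A : N₁ →ₗ[F] N₁ := cyc (P ^ k 0)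
    let D : N₂ →ₗ[F] N₂ := LinearMap.pi fun i => cyc (P ^ k i.succ) ∘ₗ LinearMap.proj i
    let c : V ≃ₗ[F] N₁ × N₂ :=
      { toFun := fun x => (e x 0, fun i => e x i.succ)
        map_add' := fun x y => by simp; rfl
        map_smul' := fun a x => by simp; rfl
        invFun := fun p => e.symm (Fin.cons p.1 p.2)
        left_inv := fun x => by
          rw [LinearEquiv.symm_apply_eq]
          exact Fin.cons_self_tail (e x)
        right_inv := fun p => by simp }
    have hc : ∀ x, c (g x) = blk A 0 D (c x) := by
      intro x
      refine Prod.ext ?_ ?_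
      · show e (g x) 0 = cyc (P ^ k 0) (e x 0) + 0
        rw [he, add_zero]
      · funext i
        exact he x i.succ
    by_cases h1 : Nontrivial N₁
    · by_cases h2 : Nontrivial N₂
      · right
        exact ⟨N₁, N₂, inferInstance, inferInstance, inferInstance, inferInstance, A, D, c,
          h1, h2, hc⟩
      · left
        rw [not_nontrivial_iff_subsingleton] at h2
        refine ⟨k 0, ?_⟩
        let c' : V ≃ₗ[F] N₁ := c.trans (haveI : Unique N₂ := ⟨⟨0⟩, fun _ => Subsingleton.elim _ _⟩; LinearEquiv.prodUnique)
        have hc' : ∀ x, c' (g x) = A (c' x) := by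
          intro x
          show (c (g x)).1 = A (c x).1
          rw [hc]; simp
        obtain ⟨v, hv1, hv2⟩ := isCyc_cyc (P ^ k 0)
        have ha : ∀ Q : Polynomial F, ∀ w, c' ((Polynomial.aeval g Q : V →ₗ[F] V) w) =
            (Polynomial.aeval A Q : N₁ →ₗ[F] N₁) (c' w) := by
          intro Q w
          exact (aeval_apply_of_comm (A := A) (D := g) (s := c'.toLinearMap) (fun x => (hc' x).symm) Q w).symm
        refine ⟨c'.symm v, fun x => ?_, fun Q => ?_⟩
        · obtain ⟨Q, hQ⟩ := hv1 (c' x)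
          refine ⟨Q, c'.injective ?_⟩
          rw [ha, LinearEquiv.apply_symm_apply, hQ]
        · rw [← hv2, ← map_eq_zero_iff c' c'.injective, ha, LinearEquiv.apply_symm_apply]
    · rw [not_nontrivial_iff_subsingleton] at h1
      let c' : V ≃ₗ[F] N₂ := c.trans (haveI : Unique N₁ := ⟨⟨0⟩, fun _ => Subsingleton.elim _ _⟩; LinearEquiv.uniqueProd)
      refine ih (fun i => k i.succ) g c' ?_
      intro x i
      show (c (g x)).2 i = _
      rw [hc]
      rfl

lemma trichotomy [Finite F] {P : Polynomial F} (hP : Irreducible P) {V : Type} [AddCommGroup V]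
    [Module F V] [Finite V] (g : V →ₗ[F] V) (hg : Nilp P g) :
    (∃ m, IsCyc (P ^ m) g) ∨ (∃ (V₁ V₂ : Type) (_ : AddCommGroup V₁) (_ : Module F V₁)
      (_ : AddCommGroup V₂) (_ : Module F V₂) (A : V₁ →ₗ[F] V₁) (D : V₂ →ₗ[F] V₂)
      (e : V ≃ₗ[F] V₁ × V₂), Nontrivial V₁ ∧ Nontrivial V₂ ∧
      ∀ x, e (g x) = blk A 0 D (e x)) := by
  haveI : Module.Finite F V := Module.Finite.of_finite
  have ht : Module.IsTorsion' (Module.AEval' g) (Submonoid.powers P) := by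
    rw [nilp_iff_exists] at hg
    obtain ⟨N, hN⟩ := hg
    intro x
    refine ⟨⟨P ^ N, N, rfl⟩, ?_⟩
    have h2 : (Polynomial.aeval g (P ^ N) : V →ₗ[F] V) ((Module.AEval'.of g).symm x) = 0 := hN _
    have h3 := Module.AEval.of_aeval_smul g (P ^ N) ((Module.AEval'.of g).symm x)
    show (P ^ N) • x = 0
    have : x = Module.AEval'.of g ((Module.AEval'.of g).symm x) := by simp
    rw [this]
    refine h3.symm.trans ?_
    refine (congrArg (Module.AEval'.of g) h2).trans ?_
    exact map_zero _
  obtain ⟨d, k, ⟨e⟩⟩ := Module.torsion_by_prime_power_decomposition hP ht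
  let e' := e.trans (DirectSum.linearEquivFunOnFintype (Polynomial F) (Fin d) _)
  let e'' : V ≃ₗ[F] (∀ i : Fin d, AdjoinRoot (P ^ k i)) :=
    (Module.AEval'.of g).trans (e'.restrictScalars F)
  refine trichotomy_aux P d k g e'' ?_
  intro x i
  have h1 : Module.AEval'.of g (g x) = (Polynomial.X : Polynomial F) • Module.AEval'.of g x :=
    (Module.AEval'.X_smul_of g x).symm
  show e' (Module.AEval'.of g (g x)) i = _
  rw [h1, map_smul]
  rfl

theorem uniq [Finite F] {f f' : Fam F} (hf : IsGL f) (hf' : IsGL f') {P : Polynomial F}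
    (hP : Irreducible P) (n : ℕ)
    (h : ∀ m, m * P.natDegree ≤ n → phi f (P ^ m) = phi f' (P ^ m)) :
    ∀ (N c : ℕ) (V : Type) [AddCommGroup V] [Module F V] [Finite V] (g : V →ₗ[F] V), Nilp P g →
      Module.finrank F V = N → N ≤ n → Nat.card (HH g g) = c → f V g = f' V g := by
  intro N
  induction N using Nat.strong_induction_on with
  | _ N ihN =>
  intro c
  induction c using Nat.strong_induction_on with
  | _ c ihc =>
  intro V _ _ _ g hg hN hn hc
  rcases trichotomy hP g hg with ⟨m, hm⟩ | ⟨V₁, V₂, _, _, _, _, A, D, e, hn1, hn2, he⟩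
  · rw [hf.phi_of_isCyc hm, hf'.phi_of_isCyc hm]
    apply h
    obtain ⟨e, -⟩ := isCyc_iff _ g hm
    have h1 := e.finrank_eq
    have h0 : P ^ m ≠ 0 := pow_ne_zero _ hP.ne_zero
    rw [(AdjoinRoot.powerBasis h0).finrank, AdjoinRoot.powerBasis_dim,
      Polynomial.natDegree_pow] at h1
    omega
  · haveI : Finite (V₁ × V₂) := Finite.of_injective e.symm e.symm.injective
    haveI : Finite V₁ := Finite.of_surjective _ (Prod.fst_surjective (β := V₂))
    haveI : Finite V₂ := Finite.of_surjective _ (Prod.snd_surjective (α := V₁))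
    have hd : Module.finrank F V₁ + Module.finrank F V₂ = N := by
      rw [← Module.finrank_prod, ← e.finrank_eq, hN]
    have hp1 : 0 < Module.finrank F V₁ := Module.finrank_pos
    have hp2 : 0 < Module.finrank F V₂ := Module.finrank_pos
    have hg0 : Nilp P (blk A 0 D) := hg.conj e he
    have hgen : ∀ u, Nilp P (blk A u D) ↔ Nilp P A ∧ Nilp P D := by
      intro u
      have hsA : ∀ x, blk A u D (LinearMap.inl F V₁ V₂ x) = LinearMap.inl F V₁ V₂ (A x) := by
        intro x; simp
      have hsD : ∀ x, D (LinearMap.snd F V₁ V₂ x) = LinearMap.snd F V₁ V₂ (blk A u D x) := by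
        intro x; rfl
      simp only [nilp_iff_exists]
      constructor
      · rintro ⟨M, hM⟩
        refine ⟨⟨M, fun x => ?_⟩, ⟨M, fun x => ?_⟩⟩
        · have := aeval_apply_of_comm hsA (P ^ M) x
          rw [hM] at this
          simpa using (congrArg Prod.fst this).symm
        · have := aeval_apply_of_comm hsD (P ^ M) (0, x)
          rw [hM, map_zero] at this
          exact this
      · rintro ⟨⟨M, hM⟩, ⟨M', hM'⟩⟩
        refine ⟨M + M', fun x => ?_⟩
        have h2 := aeval_apply_of_comm hsD (P ^ M') x
        rw [hM'] at h2
        have h3 : (Polynomial.aeval (blk A u D) (P ^ M') : V₁ × V₂ →ₗ[F] V₁ × V₂) x =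
            LinearMap.inl F V₁ V₂ ((Polynomial.aeval (blk A u D) (P ^ M') :
              V₁ × V₂ →ₗ[F] V₁ × V₂) x).1 := Prod.ext rfl h2.symm
        rw [pow_add, map_mul, Module.End.mul_apply, h3, aeval_apply_of_comm hsA, hM, map_zero]
    obtain ⟨hA, hD⟩ := (hgen 0).mp hg0
    have eA := ihN _ (by omega) _ V₁ A hA rfl (by omega) rfl
    have eD := ihN _ (by omega) _ V₂ D hD rfl (by omega) rfl
    have key := (hf.ext A D).trans ((by rw [eA, eD] :
      (Nat.card F : ℂ) ^ (Module.finrank F V₁ * Module.finrank F V₂) * (f V₁ A * f V₂ D) =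
      (Nat.card F : ℂ) ^ (Module.finrank F V₁ * Module.finrank F V₂) * (f' V₁ A * f' V₂ D)).trans
      (hf'.ext A D).symm)
    rw [← sub_eq_zero, ← Finset.sum_sub_distrib] at key
    have hval : ∀ u : V₂ →ₗ[F] V₁, f (V₁ × V₂) (blk A u D) - f' (V₁ × V₂) (blk A u D) =
        if (∃ S : V₂ →ₗ[F] V₁, u + A ∘ₗ S - S ∘ₗ D = 0) then f V g - f' V g else 0 := by
      intro u
      split_ifs with hu
      · obtain ⟨S, hS⟩ := hu
        have e1 : ∀ x, (e.trans (shear S)) (g x) = blk A u D ((e.trans (shear S)) x) := by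
          intro x
          rw [LinearEquiv.trans_apply, LinearEquiv.trans_apply, ← blk_shear, hS, he]
        rw [hf.conj' (e.trans (shear S)) g _ e1, hf'.conj' (e.trans (shear S)) g _ e1]
      · rw [sub_eq_zero]
        refine ihc _ ?_ (V₁ × V₂) (blk A u D) ((hgen u).mpr ⟨hA, hD⟩) ?_ hn rfl
        · rw [← hc, card_HH_conj g _ e he]
          exact card_end_lt A u D hu
        · rw [Module.finrank_prod, hd]
    rw [Finset.sum_congr rfl (fun u _ => hval u), ← Finset.sum_filter, Finset.sum_const,
      nsmul_eq_mul, mul_eq_zero] at key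
    rcases key with key | key
    · exfalso
      rw [Nat.cast_eq_zero, Finset.card_eq_zero] at key
      have : (0 : V₂ →ₗ[F] V₁) ∈ Finset.univ.filter
          (fun u : V₂ →ₗ[F] V₁ => ∃ S : V₂ →ₗ[F] V₁, u + A ∘ₗ S - S ∘ₗ D = 0) := by
        simp only [Finset.mem_filter, Finset.mem_univ, true_and]
        exact ⟨0, by simp⟩
      rw [key] at this
      simp at this
    · exact sub_eq_zero.mp key
end

section

/-- power sums attached to complete symmetric sequence -/
noncomputable def pp (h : ℕ → ℂ) (m : ℕ) : ℂ :=
  PowerSeries.coeff m (PowerSeries.X * PowerSeries.derivative ℂ (PowerSeries.mk h) *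
    (PowerSeries.mk h)⁻¹)

lemma newton (h : ℕ → ℂ) (h0 : h 0 = 1) (m : ℕ) :
    (m : ℂ) * h m = ∑ p ∈ Finset.HasAntidiagonal.antidiagonal m, pp h p.1 * h p.2 := by
  have hc : PowerSeries.constantCoeff (PowerSeries.mk h) ≠ 0 := by
    rw [← PowerSeries.coeff_zero_eq_constantCoeff_apply, PowerSeries.coeff_mk, h0]; exact one_ne_zero
  have e : PowerSeries.X * PowerSeries.derivative ℂ (PowerSeries.mk h) *
    (PowerSeries.mk h)⁻¹ * PowerSeries.mk h = PowerSeries.X * PowerSeries.derivative ℂ (PowerSeries.mk h) := by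
    rw [mul_assoc, PowerSeries.inv_mul_cancel _ hc, mul_one]
  have e2 := congrArg (PowerSeries.coeff m) e
  rw [PowerSeries.coeff_mul] at e2
  simp only [PowerSeries.coeff_mk] at e2
  rw [show (∑ p ∈ Finset.HasAntidiagonal.antidiagonal m, pp h p.1 * h p.2) = _ from e2]
  cases m with
  | zero => simp
  | succ m =>
    rw [PowerSeries.coeff_succ_X_mul, PowerSeries.coeff_derivative, PowerSeries.coeff_mk]
    push_cast; ring

lemma pp_zero (h : ℕ → ℂ) : pp h 0 = 0 := by
  simp [pp]

lemma newton' (h : ℕ → ℂ) (h0 : h 0 = 1) (m : ℕ) :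
    (m + 1 : ℂ) * h (m + 1) = pp h (m + 1) +
      ∑ i ∈ Finset.range m, pp h (i + 1) * h (m - i) := by
  have := newton h h0 (m + 1)
  rw [Finset.Nat.sum_antidiagonal_eq_sum_range_succ_mk, Finset.sum_range_succ,
    Finset.sum_range_succ'] at this
  simp only [pp_zero, zero_mul, add_zero, Nat.sub_self, h0, mul_one] at this
  push_cast at this
  rw [this, add_comm]

lemma pp_congr {h h' : ℕ → ℂ} (h0 : h 0 = 1) (h0' : h' 0 = 1) (n : ℕ)
    (hh : ∀ m ≤ n, h m = h' m) : ∀ m ≤ n, pp h m = pp h' m := by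
  intro m
  induction m using Nat.strong_induction_on with
  | _ m ih =>
  intro hm
  cases m with
  | zero => rw [pp_zero, pp_zero]
  | succ m =>
    have e1 := newton' h h0 m
    have e2 := newton' h' h0' m
    rw [hh _ hm, e2] at e1
    have : ∑ i ∈ Finset.range m, pp h (i + 1) * h (m - i) =
        ∑ i ∈ Finset.range m, pp h' (i + 1) * h' (m - i) := by
      refine Finset.sum_congr rfl fun i hi => ?_
      have := Finset.mem_range.mp hi
      rw [ih (i + 1) (by omega) (by omega), hh (m - i) (by omega)]
    rw [this] at e1
    exact (add_right_cancel e1).symm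

lemma h_congr {h h' : ℕ → ℂ} (h0 : h 0 = 1) (h0' : h' 0 = 1) (n : ℕ)
    (hh : ∀ m, 1 ≤ m → m ≤ n → pp h m = pp h' m) : ∀ m ≤ n, h m = h' m := by
  intro m
  induction m using Nat.strong_induction_on with
  | _ m ih =>
  intro hm
  cases m with
  | zero => rw [h0, h0']
  | succ m =>
    have e1 := newton' h h0 m
    have e2 := newton' h' h0' m
    have : ∑ i ∈ Finset.range m, pp h (i + 1) * h (m - i) =
        ∑ i ∈ Finset.range m, pp h' (i + 1) * h' (m - i) := by
      refine Finset.sum_congr rfl fun i hi => ?_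
      have := Finset.mem_range.mp hi
      rw [hh (i + 1) (by omega) (by omega), ih (m - i) (by omega) (by omega)]
    rw [this, hh (m + 1) (by omega) hm, ← e2] at e1
    exact mul_left_cancel₀ (by exact_mod_cast Nat.succ_ne_zero m) e1

lemma pp_step {h h' : ℕ → ℂ} (h0' : h' 0 = 1) (x : ℂ)
    (hh : PowerSeries.mk h' * (1 - PowerSeries.C x * PowerSeries.X) = PowerSeries.mk h)
    (m : ℕ) (hm : 1 ≤ m) : pp h' m = pp h m + x ^ m := by
  set L : PowerSeries ℂ := 1 - PowerSeries.C x * PowerSeries.X with hL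
  have hLi : L * PowerSeries.mk (fun m => x ^ m) = 1 := by
    ext m
    rw [hL, sub_mul, one_mul, mul_assoc, map_sub, PowerSeries.coeff_C_mul]
    cases m with
    | zero => simp
    | succ m => simp [PowerSeries.coeff_succ_X_mul, PowerSeries.coeff_one, pow_succ']
  have hcL : PowerSeries.constantCoeff L ≠ 0 := by simp [hL]
  have hLinv : L⁻¹ = PowerSeries.mk (fun m => x ^ m) := by
    rw [PowerSeries.inv_eq_iff_mul_eq_one hcL, mul_comm]; exact hLi
  have hc : PowerSeries.constantCoeff (PowerSeries.mk h') ≠ 0 := by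
    rw [← PowerSeries.coeff_zero_eq_constantCoeff_apply, PowerSeries.coeff_mk, h0']; exact one_ne_zero
  have hdL : PowerSeries.derivative ℂ L = - PowerSeries.C x := by
    ext k
    rw [PowerSeries.coeff_derivative, hL]
    cases k with
    | zero => simp [PowerSeries.coeff_one]
    | succ k => simp [PowerSeries.coeff_one, PowerSeries.coeff_X, PowerSeries.coeff_C]
  have key : PowerSeries.X * PowerSeries.derivative ℂ (PowerSeries.mk h) * (PowerSeries.mk h)⁻¹ =
      PowerSeries.X * PowerSeries.derivative ℂ (PowerSeries.mk h') * (PowerSeries.mk h')⁻¹ -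
        PowerSeries.C x * (PowerSeries.X * PowerSeries.mk (fun m => x ^ m)) := by
    rw [← hh, Derivation.leibniz, PowerSeries.mul_inv_rev, hdL, ← hLinv]
    have a1 := PowerSeries.mul_inv_cancel _ hc
    have a2 := PowerSeries.mul_inv_cancel _ hcL
    simp only [smul_eq_mul]
    linear_combination (PowerSeries.X * PowerSeries.derivative ℂ (PowerSeries.mk h') * (PowerSeries.mk h')⁻¹) * a2 - PowerSeries.X * PowerSeries.C x * L⁻¹ * a1
  have := congrArg (PowerSeries.coeff m) key
  rw [map_sub, PowerSeries.coeff_C_mul] at this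
  obtain ⟨k, rfl⟩ : ∃ k, m = k + 1 := ⟨m - 1, by omega⟩
  rw [PowerSeries.coeff_succ_X_mul, PowerSeries.coeff_mk, ← pow_succ'] at this
  unfold pp
  rw [this]; ring

lemma pp_const (m : ℕ) : pp (fun k => if k = 0 then 1 else 0) m = 0 := by
  have : PowerSeries.mk (fun k => if k = 0 then (1 : ℂ) else 0) = 1 := by
    ext k; simp [PowerSeries.coeff_one]
  unfold pp
  rw [this]
  simp

variable {F : Type} [Field F]

section
variable {V : Type} [AddCommGroup V] [Module F V] [Finite V]

lemma IsCyc.finrank {P : Polynomial F} (hP : P ≠ 0) {g : V →ₗ[F] V} (h : IsCyc P g) :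
    Module.finrank F V = P.natDegree := by
  obtain ⟨e, -⟩ := isCyc_iff _ g h
  rw [← e.finrank_eq, (AdjoinRoot.powerBasis hP).finrank, AdjoinRoot.powerBasis_dim]

lemma aeval_comm_apply (g : V →ₗ[F] V) (P : Polynomial F) (x : V) :
    (Polynomial.aeval g P : V →ₗ[F] V) (g x) = g ((Polynomial.aeval g P : V →ₗ[F] V) x) :=
  aeval_apply_of_comm (A := g) (D := g) (s := (Polynomial.aeval g P : V →ₗ[F] V)) (by
    intro x
    have : Commute g (Polynomial.aeval g P : Module.End F V) := by
      have := (Commute.all (Polynomial.X : Polynomial F) P).map (Polynomial.aeval g)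
      simpa using this
    exact congrArg (fun l => l x) this) Polynomial.X x |> fun h => by
      have : Commute g (Polynomial.aeval g P : Module.End F V) := by
        have := (Commute.all (Polynomial.X : Polynomial F) P).map (Polynomial.aeval g)
        simpa using this
      exact (congrArg (fun l => l x) this).symm

/-- the standard submodules of a cyclic module -/
noncomputable def cW (g : V →ₗ[F] V) (P : Polynomial F) (i : ℕ) : Submodule F V :=
  LinearMap.range (Polynomial.aeval g (P ^ i) : V →ₗ[F] V)

lemma cW_stable (g : V →ₗ[F] V) (P : Polynomial F) (i : ℕ) : ∀ x ∈ cW g P i, g x ∈ cW g P i := by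
  rintro _ ⟨x, rfl⟩
  exact ⟨g x, aeval_comm_apply g _ x⟩

lemma cW_isCyc {g : V →ₗ[F] V} {P : Polynomial F} (hP : Irreducible P) {i j : ℕ}
    (h : IsCyc (P ^ (j + i)) g) : IsCyc (P ^ j) (g.restrict (cW_stable g P i)) := by
  obtain ⟨v, h1, h2⟩ := h
  refine ⟨⟨(Polynomial.aeval g (P ^ i) : V →ₗ[F] V) v, v, rfl⟩, ?_, ?_⟩
  · rintro ⟨_, x, rfl⟩
    obtain ⟨Q, rfl⟩ := h1 x
    refine ⟨Q, ?_⟩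
    ext
    rw [aeval_restrict]
    show _ = (Polynomial.aeval g (P ^ i) : V →ₗ[F] V) ((Polynomial.aeval g Q : V →ₗ[F] V) v)
    rw [← Module.End.mul_apply, ← Module.End.mul_apply, ← map_mul, ← map_mul, mul_comm]
  · intro Q
    rw [← Subtype.coe_inj, aeval_restrict, ← Module.End.mul_apply, ← map_mul]
    show _ = 0 ↔ _
    rw [h2, pow_add]
    exact mul_dvd_mul_iff_right (pow_ne_zero _ hP.ne_zero)

lemma stable_aeval {g : V →ₗ[F] V} {W : Submodule F V} (h : ∀ x ∈ W, g x ∈ W) (Q : Polynomial F) :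
    ∀ x ∈ W, (Polynomial.aeval g Q : V →ₗ[F] V) x ∈ W := by
  intro x hx
  have := aeval_restrict g W h Q ⟨x, hx⟩
  rw [← this]
  exact Subtype.mem _

lemma stable_eq_cW {g : V →ₗ[F] V} {P : Polynomial F} (hP : Irreducible P) {m : ℕ}
    (h : IsCyc (P ^ m) g) {W : Submodule F V} (hW : ∀ x ∈ W, g x ∈ W) :
    ∃ i ≤ m, W = cW g P i := by
  obtain ⟨v, h1, h2⟩ := h
  let I : Ideal (Polynomial F) :=
    { carrier := {Q | (Polynomial.aeval g Q : V →ₗ[F] V) v ∈ W}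
      add_mem' := fun ha hb => by
        simp only [Set.mem_setOf_eq, map_add] at *
        exact W.add_mem ha hb
      zero_mem' := by simp
      smul_mem' := fun c Q hQ => by
        simp only [Set.mem_setOf_eq, smul_eq_mul, map_mul] at *
        exact stable_aeval hW c _ hQ }
  obtain ⟨p, hp⟩ := (IsPrincipalIdealRing.principal I).principal
  have hm : P ^ m ∈ I := by
    show (Polynomial.aeval g (P ^ m) : V →ₗ[F] V) v ∈ W
    rw [(h2 _).mpr dvd_rfl]; exact W.zero_mem
  rw [hp, Submodule.mem_span_singleton] at hm
  obtain ⟨c, hc⟩ := hm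
  obtain ⟨i, hi, hass⟩ := (dvd_prime_pow hP.prime m).mp (Dvd.intro_left c hc)
  refine ⟨i, hi, ?_⟩
  have hI : ∀ Q, Q ∈ I ↔ P ^ i ∣ Q := by
    intro Q
    rw [hp, ← hass.dvd_iff_dvd_left]
    exact Ideal.mem_span_singleton
  ext x
  constructor
  · intro hx
    obtain ⟨Q, rfl⟩ := h1 x
    obtain ⟨R, rfl⟩ := (hI Q).mp hx
    refine ⟨(Polynomial.aeval g R : V →ₗ[F] V) v, ?_⟩
    rw [map_mul]; rfl
  · rintro ⟨z, rfl⟩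
    obtain ⟨Q, rfl⟩ := h1 z
    have : P ^ i * Q ∈ I := (hI _).mpr (Dvd.intro _ rfl)
    have : (Polynomial.aeval g (P ^ i * Q) : V →ₗ[F] V) v ∈ W := this
    rw [map_mul] at this
    exact this

lemma conv_isCyc [Finite F] {f : Fam F} (hf : IsGL f) (ρ : ℂ) {P : Polynomial F} (hP : Irreducible P) {m : ℕ}
    {g : V →ₗ[F] V} (h : IsCyc (P ^ m) g) :
    conv f ρ V g = ∑ j ∈ Finset.range (m + 1), phi f (P ^ j) * (ρ ^ P.natDegree) ^ (m - j) := by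
  rw [conv_eq]
  have hd : ∀ j ≤ m, Module.finrank F (cW g P (m - j)) = j * P.natDegree := by
    intro j hj
    have : IsCyc (P ^ (j + (m - j))) g := by rwa [Nat.add_sub_cancel' hj]
    rw [(cW_isCyc hP this).finrank (pow_ne_zero _ hP.ne_zero), Polynomial.natDegree_pow]
  have hVd : Module.finrank F V = m * P.natDegree := by
    rw [h.finrank (pow_ne_zero _ hP.ne_zero), Polynomial.natDegree_pow]
  have hpos : 0 < P.natDegree := hP.natDegree_pos
  symm
  refine Finset.sum_bij_ne_zero (fun j _ _ => cW g P (m - j)) (fun _ _ _ => Finset.mem_univ _)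
    ?_ ?_ ?_
  · intro j hj _ j' hj' _ he
    have hj := Finset.mem_range.mp hj
    have hj' := Finset.mem_range.mp hj'
    have e1 := hd j (by omega)
    rw [he, hd j' (by omega)] at e1
    exact (Nat.eq_of_mul_eq_mul_right hpos e1).symm
  · intro W _ hW
    have hst : ∀ x ∈ W, g x ∈ W := by
      by_contra hn
      apply hW
      unfold cterm
      rw [dif_neg hn]
    obtain ⟨i, hi, rfl⟩ := stable_eq_cW hP h hst
    refine ⟨m - i, Finset.mem_range.mpr (by omega), ?_, ?_⟩
    · have hii : cW g P i = cW g P (m - (m - i)) := by congr 1; omega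
      have e : IsCyc (P ^ ((m - i) + i)) g := by rwa [Nat.sub_add_cancel hi]
      unfold cterm at hW
      rw [dif_pos (cW_stable g P i), hf.phi_of_isCyc (cW_isCyc hP e)] at hW
      intro h0
      apply hW
      have hfr := Submodule.finrank_quotient_add_finrank (cW g P i)
      rw [hii, hd _ (by omega), hVd, ← hii] at hfr
      have : Module.finrank F (V ⧸ cW g P i) = P.natDegree * (m - (m - i)) := by
        have : m = (m - i) + (m - (m - i)) := by omega
        have h3 : m * P.natDegree = (m - (m - i)) * P.natDegree + (m - i) * P.natDegree := by
          rw [← Nat.add_mul]; congr 1; omega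
        rw [mul_comm]; omega
      rw [this, pow_mul]
      exact h0
    · congr 1; omega
  · intro j hj _
    have hj := Finset.mem_range.mp hj
    have e : IsCyc (P ^ (j + (m - j))) g := by rwa [Nat.add_sub_cancel' (by omega)]
    unfold cterm
    rw [dif_pos (cW_stable g P _), hf.phi_of_isCyc (cW_isCyc hP e), ← pow_mul]
    congr 2
    have hfr := Submodule.finrank_quotient_add_finrank (cW g P (m - j))
    rw [hd _ (by omega), hVd] at hfr
    have h3 : m * P.natDegree = (m - j) * P.natDegree + j * P.natDegree := by
      rw [← Nat.add_mul]; congr 1; omega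
    rw [mul_comm]; omega
end

section
variable [Finite F]

/-- complete symmetric sequence of f at P -/
noncomputable def hh (f : Fam F) (P : Polynomial F) : ℕ → ℂ := fun m => phi f (P ^ m)

/-- power sums of f at P -/
noncomputable def kap (f : Fam F) (P : Polynomial F) : ℕ → ℂ := pp (hh f P)

lemma hh_zero {f : Fam F} (hf : IsGL f) (P : Polynomial F) : hh f P 0 = 1 := by
  have : IsCyc (P ^ 0) (0 : PUnit →ₗ[F] PUnit) := by
    refine ⟨0, fun x => ⟨0, rfl⟩, fun Q => ?_⟩
    simp
  show phi f (P ^ 0) = 1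
  rw [← hf.phi_of_isCyc this]
  exact hf.one _ _

lemma hh_conv {f : Fam F} (hf : IsGL f) (ρ : ℂ) {P : Polynomial F} (hP : Irreducible P) :
    PowerSeries.mk (hh (conv f ρ) P) * (1 - PowerSeries.C (ρ ^ P.natDegree) * PowerSeries.X)
      = PowerSeries.mk (hh f P) := by
  have hval : ∀ m, hh (conv f ρ) P m =
      ∑ j ∈ Finset.range (m + 1), hh f P j * (ρ ^ P.natDegree) ^ (m - j) := by
    intro m
    show phi _ _ = _
    haveI : Fact (P ^ m ≠ 0) := ⟨pow_ne_zero _ hP.ne_zero⟩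
    rw [phi_eq]
    exact conv_isCyc hf ρ hP (isCyc_cyc _)
  ext m
  rw [mul_sub, mul_one, ← mul_assoc, mul_comm _ (PowerSeries.C _), mul_assoc, map_sub,
    PowerSeries.coeff_C_mul, PowerSeries.coeff_mk, PowerSeries.coeff_mk]
  cases m with
  | zero => simp [hval]
  | succ m =>
    rw [PowerSeries.coeff_succ_mul_X, PowerSeries.coeff_mk, hval, hval, Finset.sum_range_succ,
      Finset.mul_sum, Nat.sub_self, pow_zero, mul_one, add_comm, add_sub_assoc, sub_eq_zero.mpr, add_zero]
    refine Finset.sum_congr rfl fun j hj => ?_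
    have := Finset.mem_range.mp hj
    rw [show m + 1 - j = (m - j) + 1 by omega, pow_succ]
    ring

lemma hh_RR_nil {P : Polynomial F} (hP : Irreducible P) (m : ℕ) :
    hh (RR F []) P m = if m = 0 then 1 else 0 := by
  split_ifs with h
  · rw [h, hh_zero (RR_isGL [])]
  · show phi _ _ = 0
    haveI : Fact (P ^ m ≠ 0) := ⟨pow_ne_zero _ hP.ne_zero⟩
    rw [phi_eq]
    show (if _ then _ else _) = _
    rw [if_neg]
    intro hs
    have h1 := (isCyc_cyc (P ^ m)).finrank (pow_ne_zero _ hP.ne_zero)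
    rw [Module.finrank_zero_of_subsingleton, Polynomial.natDegree_pow] at h1
    have := hP.natDegree_pos
    rcases Nat.mul_eq_zero.mp h1.symm with h | h <;> omega

lemma kap_RR (l : List ℂ) {P : Polynomial F} (hP : Irreducible P) (m : ℕ) (hm : 1 ≤ m) :
    kap (RR F l) P m = (l.map (fun ρ => (ρ ^ P.natDegree) ^ m)).sum := by
  induction l with
  | nil =>
    have : hh (RR F []) P = fun k => if k = 0 then 1 else 0 := funext (hh_RR_nil hP)
    unfold kap
    rw [this, pp_const]; rfl
  | cons ρ l ih =>
    rw [List.map_cons, List.sum_cons, ← ih]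
    have := pp_step (hh_zero (RR_isGL (F := F) (ρ :: l)) P) (ρ ^ P.natDegree)
      (hh_conv (RR_isGL l) ρ hP) m hm
    rw [add_comm]
    exact this

lemma hh_RR_mul (l : List ℂ) {P : Polynomial F} (hP : Irreducible P) :
    PowerSeries.mk (hh (RR F l) P) *
      (l.map (fun ρ => 1 - PowerSeries.C (ρ ^ P.natDegree) * PowerSeries.X)).prod = 1 := by
  induction l with
  | nil =>
    have : hh (RR F []) P = fun k => if k = 0 then 1 else 0 := funext (hh_RR_nil hP)
    rw [this]
    ext k; simp [PowerSeries.coeff_one]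
  | cons ρ l ih =>
    rw [List.map_cons, List.prod_cons, ← mul_assoc]
    have := hh_conv (RR_isGL (F := F) l) ρ hP
    rw [show RR F (ρ :: l) = conv (RR F l) ρ from rfl, this, ih]

lemma poly_factor (D : Polynomial ℂ) (h0 : D.coeff 0 = 1) :
    ∃ l : List ℂ, (l.map (fun x => 1 - Polynomial.C x * Polynomial.X)).prod = D := by
  have hs := IsAlgClosed.splits D
  have hD : D ≠ 0 := by rintro rfl; simp at h0
  have e := hs.eq_prod_roots
  have hr : ∀ r ∈ D.roots, r ≠ 0 := by
    rintro r hr rfl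
    rw [Polynomial.mem_roots hD, Polynomial.IsRoot, ← Polynomial.coeff_zero_eq_eval_zero, h0] at hr
    exact one_ne_zero hr
  refine ⟨D.roots.toList.map (fun r => r⁻¹), ?_⟩
  have hprod : ∀ s : List ℂ, (∀ r ∈ s, r ≠ 0) →
      (s.map (fun r => Polynomial.X - Polynomial.C r)).prod =
      Polynomial.C ((s.map (fun r => -r)).prod) *
        ((s.map (fun r => r⁻¹)).map (fun x => 1 - Polynomial.C x * Polynomial.X)).prod := by
    intro s
    induction s with
    | nil => intro _; simp
    | cons r s ih =>
      intro hs
      have hr : r ≠ 0 := hs r (by simp)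
      simp only [List.map_cons, List.prod_cons]
      rw [ih (fun r h => hs r (by simp [h])), Polynomial.C_mul]
      have : (Polynomial.X - Polynomial.C r) = Polynomial.C (-r) * (1 - Polynomial.C r⁻¹ * Polynomial.X) := by
        rw [mul_sub, mul_one, ← mul_assoc, ← Polynomial.C_mul]
        simp [hr]
        ring
      rw [this]; ring
  have e1 : D = Polynomial.C (D.leadingCoeff * ((D.roots.toList.map (fun r => -r)).prod)) *
      ((D.roots.toList.map (fun r => r⁻¹)).map (fun x => 1 - Polynomial.C x * Polynomial.X)).prod := by
    rw [Polynomial.C_mul, mul_assoc, ← hprod _ (fun r h => hr r (by simpa using h))]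
    conv_lhs => rw [e]
    congr 1
    rw [← Multiset.prod_coe, ← Multiset.map_coe, Multiset.coe_toList]
  set c := D.leadingCoeff * ((D.roots.toList.map (fun r => -r)).prod)
  have hc : c = 1 := by
    have := congrArg (fun p => Polynomial.eval 0 p) e1
    rw [Polynomial.eval_mul, Polynomial.eval_list_prod, List.map_map, List.map_map,
      ← Polynomial.coeff_zero_eq_eval_zero, h0] at this
    simpa [Function.comp_def] using this.symm
  rw [hc] at e1
  conv_rhs => rw [e1]
  simp

theorem exists_RR {f : Fam F} (hf : IsGL f) {P : Polynomial F} (hP : Irreducible P) (n : ℕ) :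
    ∃ l : List ℂ, ∀ m ≤ n, phi f (P ^ m) = phi (RR F l) (P ^ m) := by
  set H := PowerSeries.mk (hh f P)
  have hc : PowerSeries.constantCoeff H ≠ 0 := by
    rw [← PowerSeries.coeff_zero_eq_constantCoeff_apply, PowerSeries.coeff_mk, hh_zero hf]
    exact one_ne_zero
  have hHi := PowerSeries.mul_inv_cancel H hc
  have hDi0 : PowerSeries.coeff 0 H⁻¹ = 1 := by
    have := congrArg (PowerSeries.coeff 0) hHi
    rw [PowerSeries.coeff_mul] at this
    simpa [H, hh_zero hf] using this
  obtain ⟨lx, hlx⟩ := poly_factor (PowerSeries.trunc (n + 1) H⁻¹) (by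
    rw [PowerSeries.coeff_trunc, if_pos (by omega), hDi0])
  have hroot : ∀ x : ℂ, ∃ ρ : ℂ, ρ ^ P.natDegree = x := fun x =>
    IsAlgClosed.exists_pow_nat_eq x hP.natDegree_pos
  choose rt hrt using hroot
  refine ⟨lx.map rt, ?_⟩
  have hR := hh_RR_mul (F := F) (lx.map rt) hP
  have e1 : ((lx.map rt).map (fun ρ => 1 - PowerSeries.C (ρ ^ P.natDegree) * PowerSeries.X)).prod
      = ((PowerSeries.trunc (n + 1) H⁻¹ : Polynomial ℂ) : PowerSeries ℂ) := by
    rw [← hlx, ← Polynomial.coeToPowerSeries.ringHom_apply, map_list_prod, List.map_map,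
      List.map_map]
    congr 1
    refine List.map_congr_left fun x _ => ?_
    simp [hrt, Polynomial.coeToPowerSeries.ringHom_apply]
    rw [← map_pow, hrt]
  rw [e1] at hR
  set R := PowerSeries.mk (hh (RR F (lx.map rt)) P)
  -- H - R has zero coefficients up to n
  have hlow : ∀ m ≤ n, PowerSeries.coeff m (H⁻¹ - ((PowerSeries.trunc (n + 1) H⁻¹ : Polynomial ℂ) : PowerSeries ℂ)) = 0 := by
    intro m hm
    rw [map_sub, Polynomial.coeff_coe, PowerSeries.coeff_trunc, if_pos (by omega), sub_self]
  have hdiff : R - H = (R * H) * (H⁻¹ - ((PowerSeries.trunc (n + 1) H⁻¹ : Polynomial ℂ) : PowerSeries ℂ)) := by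
    linear_combination - R * hHi + H * hR
  intro m hm
  have : PowerSeries.coeff m (R - H) = 0 := by
    rw [hdiff, PowerSeries.coeff_mul]
    refine Finset.sum_eq_zero fun p hp => ?_
    rw [hlow p.2 (by have := Finset.HasAntidiagonal.mem_antidiagonal.mp hp; omega), mul_zero]
  rw [map_sub, PowerSeries.coeff_mk, PowerSeries.coeff_mk, sub_eq_zero] at this
  exact this.symm

lemma nilp_dvd {P : Polynomial F} (hP : Irreducible P) : ∀ (N : ℕ) (V : Type) [AddCommGroup V]
    [Module F V] [Finite V] (g : V →ₗ[F] V), Nilp P g → Module.finrank F V = N →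
    P.natDegree ∣ N := by
  intro N
  induction N using Nat.strong_induction_on with
  | _ N ih =>
  intro V _ _ _ g hg hN
  rcases trichotomy hP g hg with ⟨m, hm⟩ | ⟨V₁, V₂, _, _, _, _, A, D, e, hn1, hn2, he⟩
  · rw [hm.finrank (pow_ne_zero _ hP.ne_zero), Polynomial.natDegree_pow] at hN
    exact Dvd.intro_left _ hN
  · haveI : Finite (V₁ × V₂) := Finite.of_injective e.symm e.symm.injective
    haveI : Finite V₁ := Finite.of_surjective _ (Prod.fst_surjective (β := V₂))
    haveI : Finite V₂ := Finite.of_surjective _ (Prod.snd_surjective (α := V₁))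
    have hd : Module.finrank F V₁ + Module.finrank F V₂ = N := by
      rw [← Module.finrank_prod, ← e.finrank_eq, hN]
    have hp1 : 0 < Module.finrank F V₁ := Module.finrank_pos
    have hp2 : 0 < Module.finrank F V₂ := Module.finrank_pos
    have hg0 : Nilp P (blk A 0 D) := hg.conj e he
    rw [nilp_iff_exists] at hg0
    obtain ⟨M, hM⟩ := hg0
    have hsA : ∀ x, blk A 0 D (LinearMap.inl F V₁ V₂ x) = LinearMap.inl F V₁ V₂ (A x) := by
      intro x; simp
    have hsD : ∀ x, D (LinearMap.snd F V₁ V₂ x) = LinearMap.snd F V₁ V₂ (blk A 0 D x) := by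
      intro x; rfl
    have hA : Nilp P A := by
      rw [nilp_iff_exists]
      refine ⟨M, fun x => ?_⟩
      have := aeval_apply_of_comm hsA (P ^ M) x
      rw [hM] at this
      simpa using (congrArg Prod.fst this).symm
    have hD : Nilp P D := by
      rw [nilp_iff_exists]
      refine ⟨M, fun x => ?_⟩
      have := aeval_apply_of_comm hsD (P ^ M) (0, x)
      rw [hM, map_zero] at this
      exact this
    rw [← hd]
    exact dvd_add (ih _ (by omega) V₁ A hA rfl) (ih _ (by omega) V₂ D hD rfl)

lemma SS_RR {V : Type} [AddCommGroup V] [Module F V] [Finite V] {ψ : AddChar F ℂ}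
    (hψ : ∃ a, ψ a ≠ 1) [Nontrivial V] {y : V →ₗ[F] V} (hy : Irr y) (P : Polynomial F)
    (l : List ℂ) : SS (RR F l) ψ y P =
      (l.map (fun ρ => ρ ^ Module.finrank F V)).sum * SS (oneFam F) ψ y P := by
  induction l with
  | nil =>
    unfold SS
    simp [RR, not_subsingleton V]
  | cons ρ l ih =>
    rw [show RR F (ρ :: l) = conv (RR F l) ρ from rfl, SS_conv (RR_isGL l) ρ hψ hy, ih,
      List.map_cons, List.sum_cons]
    ring

/-- the L-lemma -/
theorem SS_eq_kap {V : Type} [AddCommGroup V] [Module F V] [Finite V] {ψ : AddChar F ℂ}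
    (hψ : ∃ a, ψ a ≠ 1) [Nontrivial V] {y : V →ₗ[F] V} (hy : Irr y) {P : Polynomial F}
    (hP : Irreducible P) {f : Fam F} (hf : IsGL f) :
    SS f ψ y P = kap f P (Module.finrank F V / P.natDegree) * SS (oneFam F) ψ y P := by
  by_cases hd : P.natDegree ∣ Module.finrank F V
  · obtain ⟨m, hm⟩ := hd
    have hpos := hP.natDegree_pos
    obtain ⟨l, hl⟩ := exists_RR hf hP (Module.finrank F V)
    have h1 : SS f ψ y P = SS (RR F l) ψ y P := by
      unfold SS
      refine Finset.sum_congr rfl fun g _ => ?_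
      congr 1
      by_cases hg : Nilp P g
      · rw [if_pos hg, if_pos hg]
        exact uniq hf (RR_isGL l) hP (Module.finrank F V)
          (fun m hm => hl m (le_trans (Nat.le_mul_of_pos_right m hpos) hm)) _ _ V g hg rfl le_rfl rfl
      · rw [if_neg hg, if_neg hg]
    have hm1 : 1 ≤ m := by
      have : 0 < Module.finrank F V := Module.finrank_pos
      rw [hm] at this
      exact Nat.pos_of_mul_pos_left this
    have h2 : Module.finrank F V / P.natDegree = m := by
      rw [hm, Nat.mul_div_cancel_left _ hpos]
    have h3 : kap f P m = kap (RR F l) P m :=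
      pp_congr (hh_zero hf P) (hh_zero (RR_isGL l) P) (Module.finrank F V) hl m
        (by rw [hm]; exact Nat.le_mul_of_pos_left _ hpos)
    rw [h1, SS_RR hψ hy, h2, h3, kap_RR l hP m hm1, hm]
    simp_rw [pow_mul]
  · have h0 : ∀ f : Fam F, SS f ψ y P = 0 := by
      intro f
      unfold SS
      refine Finset.sum_eq_zero fun g _ => ?_
      rw [if_neg (fun hg => hd (nilp_dvd hP _ V g hg rfl)), zero_mul]
    rw [h0, h0, mul_zero]
end
end

section
variable {F : Type} [Field F]

lemma choose_two_add (a b : ℕ) : (a + b).choose 2 = a.choose 2 + b.choose 2 + a * b := by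
  induction b with
  | zero => simp
  | succ b ih =>
    rw [← add_assoc, Nat.choose_succ_succ, ih, Nat.choose_succ_succ b 1, Nat.choose_one_right,
      Nat.choose_one_right]
    ring

section
variable {V : Type} [AddCommGroup V] [Module F V]

noncomputable def rootHom (P : Polynomial F) (g : V →ₗ[F] V) (h : Polynomial.aeval g P = 0) :
    AdjoinRoot P →+* Module.End F V :=
  Ideal.Quotient.lift _ (Polynomial.aeval (R := F) (A := Module.End F V) g).toRingHom (by
    intro a ha
    obtain ⟨c, rfl⟩ := Ideal.mem_span_singleton.mp ha
    change Polynomial.aeval g (P * c) = 0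
    rw [map_mul, h, zero_mul])

lemma exists_mod (P : Polynomial F) (g : V →ₗ[F] V) (h : Polynomial.aeval g P = 0) :
    ∃ inst : Module (AdjoinRoot P) V, (∀ (Q : Polynomial F) (v : V),
      AdjoinRoot.mk P Q • v = Polynomial.aeval g Q v) ∧ IsScalarTower F (AdjoinRoot P) V := by
  letI : Module (AdjoinRoot P) V := Module.compHom V (rootHom P g h)
  have e : ∀ (Q : Polynomial F) (v : V),
      AdjoinRoot.mk P Q • v = Polynomial.aeval g Q v := fun Q v => rfl
  refine ⟨inferInstance, e, ?_⟩
  refine IsScalarTower.of_algebraMap_smul fun c v => ?_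
  have := e (Polynomial.C c) v
  rw [Polynomial.aeval_C] at this
  exact this

/-- the linear maps intertwining `A`, `D` both killed by an irreducible `P`. -/
lemma card_intertwine [Finite F] {V₁ V₂ : Type} [AddCommGroup V₁] [Module F V₁] [Finite V₁]
    [AddCommGroup V₂] [Module F V₂] [Finite V₂]
    {P : Polynomial F} (hP : Irreducible P) {A : V₁ →ₗ[F] V₁} {D : V₂ →ₗ[F] V₂}
    (hA : Polynomial.aeval A P = 0) (hD : Polynomial.aeval D P = 0) :
    ∃ b₁ b₂, Module.finrank F V₁ = P.natDegree * b₁ ∧ Module.finrank F V₂ = P.natDegree * b₂ ∧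
      Nat.card {S : V₂ →ₗ[F] V₁ // A ∘ₗ S = S ∘ₗ D} = Nat.card F ^ (P.natDegree * (b₁ * b₂)) := by
  obtain ⟨i1, h1, t1⟩ := exists_mod P A hA
  obtain ⟨i2, h2, t2⟩ := exists_mod P D hD
  haveI : Fact (Irreducible P) := ⟨hP⟩
  haveI : Fact (P ≠ 0) := ⟨hP.ne_zero⟩
  haveI : Finite (AdjoinRoot P) := inferInstance
  have hd : Module.finrank F (AdjoinRoot P) = P.natDegree :=
    (AdjoinRoot.powerBasis hP.ne_zero).finrank
  haveI : Module.Finite F (AdjoinRoot P) := Module.Finite.of_finite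
  refine ⟨Module.finrank (AdjoinRoot P) V₁, Module.finrank (AdjoinRoot P) V₂, ?_, ?_, ?_⟩
  · rw [← hd, Module.finrank_mul_finrank]
  · rw [← hd, Module.finrank_mul_finrank]
  · have e : {S : V₂ →ₗ[F] V₁ // A ∘ₗ S = S ∘ₗ D} ≃ (V₂ →ₗ[AdjoinRoot P] V₁) :=
      { toFun := fun S =>
          { toFun := S.1
            map_add' := S.1.map_add
            map_smul' := by
              intro c v
              obtain ⟨Q, rfl⟩ := AdjoinRoot.mk_surjective c
              rw [h2, RingHom.id_apply, h1]
              exact (aeval_apply_of_comm (fun x => LinearMap.congr_fun S.2 x) Q v).symm }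
        invFun := fun T => ⟨T.restrictScalars F, by
          ext v
          have := T.map_smul (AdjoinRoot.mk P Polynomial.X) v
          rw [h1, h2, Polynomial.aeval_X, Polynomial.aeval_X] at this
          exact this.symm⟩
        left_inv := fun S => rfl
        right_inv := fun S => rfl }
    rw [Nat.card_congr e, Nat.card_eq_fintype_card, natCard_lin,
      Module.natCard_eq_pow_finrank (K := F) (V := AdjoinRoot P), hd, ← pow_mul]

/-- splitting -/
lemma split_of_aeval [Finite F] {V₁ V₂ : Type} [AddCommGroup V₁] [Module F V₁] [Finite V₁]
    [AddCommGroup V₂] [Module F V₂] [Finite V₂]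
    {P : Polynomial F} (hP : Irreducible P) {A : V₁ →ₗ[F] V₁} {D : V₂ →ₗ[F] V₂}
    {u : V₂ →ₗ[F] V₁}
    (hg : Polynomial.aeval (blk A u D) P = 0) :
    Polynomial.aeval A P = 0 ∧ Polynomial.aeval D P = 0 ∧ ∃ S : V₂ →ₗ[F] V₁,
      A ∘ₗ S - S ∘ₗ D = u := by
  have hsA : ∀ x, blk A u D (LinearMap.inl F V₁ V₂ x) = LinearMap.inl F V₁ V₂ (A x) := by
    intro x; simp
  have hsD : ∀ x, D (LinearMap.snd F V₁ V₂ x) = LinearMap.snd F V₁ V₂ (blk A u D x) := by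
    intro x; rfl
  have hA : Polynomial.aeval A P = 0 := by
    ext x
    have := aeval_apply_of_comm hsA P x
    rw [hg] at this
    simpa using (congrArg Prod.fst this).symm
  have hD : Polynomial.aeval D P = 0 := by
    ext x
    have := aeval_apply_of_comm hsD P (0, x)
    rw [hg] at this
    simpa using this
  refine ⟨hA, hD, ?_⟩
  obtain ⟨i0, h0, t0⟩ := exists_mod P _ hg
  obtain ⟨i2, h2, t2⟩ := exists_mod P D hD
  haveI : Fact (Irreducible P) := ⟨hP⟩
  let π : (V₁ × V₂) →ₗ[AdjoinRoot P] V₂ :=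
    LinearMap.mk (AddHom.mk Prod.snd (fun a b => rfl)) (by
      intro c v
      obtain ⟨Q, rfl⟩ := AdjoinRoot.mk_surjective c
      have e1 := h0 Q v
      rw [RingHom.id_apply, h2]
      have e2 := (aeval_apply_of_comm hsD Q v)
      change Prod.snd _ = _
      refine Eq.trans (congrArg Prod.snd e1) ?_
      exact e2.symm)
  obtain ⟨s, hs⟩ := LinearMap.exists_rightInverse_of_surjective π (LinearMap.range_eq_top.mpr Prod.snd_surjective)
  have hs1 : ∀ v, (s v).2 = v := fun v => LinearMap.congr_fun hs v
  have hs2 : ∀ v, s (D v) = blk A u D (s v) := by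
    intro v
    have := s.map_smul (AdjoinRoot.mk P Polynomial.X) v
    rw [h2, Polynomial.aeval_X] at this
    refine this.trans ?_
    refine (h0 _ _).trans ?_
    rw [Polynomial.aeval_X]
  have hsc : ∀ (c : F) v, s (c • v) = c • s v := by
    intro c v
    have := s.map_smul (AdjoinRoot.mk P (Polynomial.C c)) v
    rw [h2, Polynomial.aeval_C] at this
    refine this.trans ?_
    refine (h0 _ _).trans ?_
    rw [Polynomial.aeval_C]
    rfl
  let S : V₂ →ₗ[F] V₁ :=
    { toFun := fun v => (s v).1
      map_add' := fun a b => by rw [map_add]; rfl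
      map_smul' := fun c v => by rw [hsc]; rfl }
  refine ⟨-S, ?_⟩
  ext v
  have := congrArg Prod.fst (hs2 v)
  rw [blk_apply] at this
  simp only [hs1] at this
  change A (-(s v).1) - -(s (D v)).1 = u v
  rw [this, map_neg]
  abel
end

noncomputable def ssFam (P : Polynomial F) : Fam F := fun V _ _ _ g =>
  if Polynomial.aeval g P = 0 then
    (Nat.card F : ℂ) ^ (P.natDegree * (Module.finrank F V / P.natDegree).choose 2) else 0

lemma aeval_conj {V W : Type} [AddCommGroup V] [Module F V] [AddCommGroup W] [Module F W]
    (e : V ≃ₗ[F] W) (g : V →ₗ[F] V) (P : Polynomial F) :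
    Polynomial.aeval (e.conj g) P = 0 ↔ Polynomial.aeval g P = 0 := by
  have h : ∀ x, e.conj g ((e : V →ₗ[F] W) x) = (e : V →ₗ[F] W) (g x) := by
    intro x; simp [LinearEquiv.conj_apply]
  have := aeval_apply_of_comm h P
  constructor
  · intro h0
    ext x
    have := this x
    rw [h0] at this
    simpa using this.symm
  · intro h0
    ext x
    have := this (e.symm x)
    rw [h0] at this
    simpa using this

lemma ssFam_isGL [Finite F] {P : Polynomial F} (hP : Irreducible P) : IsGL (ssFam P) where
  conj := by
    intro V W _ _ _ _ _ _ e g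
    unfold ssFam
    rw [aeval_conj, e.finrank_eq]
  one := by
    intro V _ _ _ _ g
    unfold ssFam
    rw [if_pos (Subsingleton.elim _ _), Module.finrank_zero_of_subsingleton]
    simp
  ext := by
    intro V₁ V₂ _ _ _ _ _ _ A D
    by_cases h : Polynomial.aeval A P = 0 ∧ Polynomial.aeval D P = 0
    · obtain ⟨hA, hD⟩ := h
      obtain ⟨b₁, b₂, e1, e2, hc⟩ := card_intertwine hP hA hD
      have hpos := hP.natDegree_pos
      let Λ : (V₂ →ₗ[F] V₁) →ₗ[F] (V₂ →ₗ[F] V₁) :=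
        { toFun := fun S => A ∘ₗ S - S ∘ₗ D
          map_add' := fun S T => by ext x; simp; abel
          map_smul' := fun c S => by ext x; simp [smul_sub] }
      have hr : ∀ u, Polynomial.aeval (blk A u D) P = 0 ↔ u ∈ LinearMap.range Λ := by
        intro u
        constructor
        · intro h
          obtain ⟨_, _, S, hS⟩ := split_of_aeval hP h
          exact ⟨S, hS⟩
        · rintro ⟨S, rfl⟩
          have h0 : Polynomial.aeval (blk A 0 D) P = 0 := by
            have hsA : ∀ x, blk A 0 D (LinearMap.inl F V₁ V₂ x) = LinearMap.inl F V₁ V₂ (A x) := by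
              intro x; simp
            have hsD : ∀ x, blk A 0 D (LinearMap.inr F V₁ V₂ x) = LinearMap.inr F V₁ V₂ (D x) := by
              intro x; simp
            apply LinearMap.prod_ext
            · ext x : 1
              have := aeval_apply_of_comm hsA P x
              rw [hA, LinearMap.zero_apply, map_zero] at this
              simpa using this
            · ext x : 1
              have := aeval_apply_of_comm hsD P x
              rw [hD, LinearMap.zero_apply, map_zero] at this
              simpa using this
          rw [← aeval_conj (shear S)]
          rw [show (shear S).conj (blk A (Λ S) D) = blk A 0 D from ?_]
          · exact h0
          refine LinearMap.ext fun x => ?_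
          have := blk_shear A 0 D S ((shear S).symm x)
          rw [LinearEquiv.apply_symm_apply, zero_add] at this
          exact this
      have hcard : Nat.card (LinearMap.range Λ) * Nat.card (LinearMap.ker Λ) =
          Nat.card F ^ (Module.finrank F V₁ * Module.finrank F V₂) := by
        rw [← natCard_lin, ← Nat.card_eq_fintype_card, Module.natCard_eq_pow_finrank (K := F) (V := V₂ →ₗ[F] V₁),
          Module.natCard_eq_pow_finrank (K := F) (V := LinearMap.range Λ), Module.natCard_eq_pow_finrank (K := F) (V := LinearMap.ker Λ), ← pow_add,
          LinearMap.finrank_range_add_finrank_ker]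
      have hker : Nat.card (LinearMap.ker Λ) = Nat.card F ^ (P.natDegree * (b₁ * b₂)) := by
        rw [← hc]
        exact Nat.card_congr (Equiv.subtypeEquivRight fun S => sub_eq_zero)
      have hsum : ∀ u, ssFam P (V₁ × V₂) (blk A u D) = if u ∈ LinearMap.range Λ then
          (Nat.card F : ℂ) ^ (P.natDegree * (b₁ + b₂).choose 2) else 0 := by
        intro u
        unfold ssFam
        simp only [hr u]
        rw [Module.finrank_prod, e1, e2, ← Nat.mul_add, Nat.mul_div_cancel_left _ hpos]
      rw [Finset.sum_congr rfl fun u _ => hsum u, Finset.sum_ite, Finset.sum_const_zero, add_zero,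
        Finset.sum_const, nsmul_eq_mul]
      have hc2 : ((Finset.univ.filter fun u => u ∈ LinearMap.range Λ).card) =
          Nat.card (LinearMap.range Λ) := by
        rw [Nat.card_eq_fintype_card, Fintype.card_subtype]
      rw [hc2]
      unfold ssFam
      rw [if_pos hA, if_pos hD, e1, e2, Nat.mul_div_cancel_left _ hpos, Nat.mul_div_cancel_left _ hpos,
        choose_two_add, ← e1, ← e2]
      have hcC := congrArg (Nat.cast : ℕ → ℂ) hcard
      rw [hker] at hcC
      push_cast at hcC
      rw [← hcC, Nat.mul_add, Nat.mul_add, pow_add, pow_add]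
      ring
    · rw [Finset.sum_eq_zero]
      · unfold ssFam
        by_cases hA : Polynomial.aeval A P = 0
        · rw [if_neg (fun hD => h ⟨hA, hD⟩)]; simp
        · rw [if_neg hA]; simp
      · intro u _
        unfold ssFam
        rw [if_neg]
        intro h0
        obtain ⟨hA, hD, _⟩ := split_of_aeval hP h0
        exact h ⟨hA, hD⟩

lemma hh_ssFam [Finite F] {P : Polynomial F} (hP : Irreducible P) (m : ℕ) :
    hh (ssFam P) P m = if m ≤ 1 then 1 else 0 := by
  haveI : Fact (P ^ m ≠ 0) := ⟨pow_ne_zero _ hP.ne_zero⟩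
  unfold hh
  rw [phi_eq]
  unfold ssFam
  have : Polynomial.aeval (cyc (P ^ m)) P = 0 ↔ m ≤ 1 := by
    constructor
    · intro h
      have h1 := LinearMap.congr_fun h 1
      rw [aeval_cyc] at h1
      simp only [mul_one, LinearMap.zero_apply] at h1
      rw [AdjoinRoot.mk_eq_zero] at h1
      by_contra hm
      push Not at hm
      have h2 := (pow_dvd_pow P hm).trans h1
      rw [Nat.succ_eq_add_one, pow_two] at h2
      exact hP.not_isUnit (isUnit_of_dvd_one ((mul_dvd_mul_iff_left hP.ne_zero).mp (by simpa using h2)))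
    · intro h
      have : AdjoinRoot.mk (P ^ m) P = 0 := by
        rw [AdjoinRoot.mk_eq_zero]
        exact (pow_dvd_pow P h).trans (by simp)
      refine LinearMap.ext fun x => ?_
      rw [aeval_cyc, this, zero_mul]; rfl
  simp only [this]
  split_ifs with h
  · have : Module.finrank F (AdjoinRoot (P ^ m)) = m * P.natDegree := by
      rw [(isCyc_cyc (P ^ m)).finrank (pow_ne_zero _ hP.ne_zero), Polynomial.natDegree_pow]
    rw [this, Nat.mul_div_cancel _ hP.natDegree_pos, Nat.choose_eq_zero_of_lt (by omega)]
    simp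
  · rfl

lemma kap_ssFam [Finite F] {P : Polynomial F} (hP : Irreducible P) (m : ℕ) :
    kap (ssFam P) P (m + 1) = (-1) ^ m := by
  have h0 := hh_zero (ssFam_isGL hP) P
  induction m with
  | zero =>
    have := newton' _ h0 0
    rw [hh_ssFam hP] at this
    simp at this
    unfold kap
    simpa using this.symm
  | succ m ih =>
    have := newton' _ h0 (m + 1)
    rw [hh_ssFam hP, if_neg (by omega), Finset.sum_range_succ, Finset.sum_eq_zero, hh_ssFam hP,
      if_pos (by omega)] at this
    · unfold kap at ih ⊢
      rw [ih] at this
      simp at this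
      rw [pow_succ]
      linear_combination -this
    · intro i hi
      rw [hh_ssFam hP, if_neg (by have := Finset.mem_range.mp hi; omega), mul_zero]

/-- nilpotent sum in terms of semisimple orbit -/
lemma SS_one_eq [Finite F] {V : Type} [AddCommGroup V] [Module F V] [Finite V] {ψ : AddChar F ℂ}
    (hψ : ∃ a, ψ a ≠ 1) [Nontrivial V] {y : V →ₗ[F] V} (hy : Irr y) {P : Polynomial F}
    (hP : Irreducible P) (b : ℕ) (hb : Module.finrank F V = P.natDegree * (b + 1)) :
    SS (oneFam F) ψ y P = (-1) ^ b * (Nat.card F : ℂ) ^ (P.natDegree * (b + 1).choose 2) *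
      ∑ g : V →ₗ[F] V, (if Polynomial.aeval g P = 0 then 1 else 0) *
        ψ (LinearMap.trace F V (g ∘ₗ y)) := by
  have h := SS_eq_kap hψ hy hP (ssFam_isGL hP)
  have hdv : Module.finrank F V / P.natDegree = b + 1 := by
    rw [hb, Nat.mul_div_cancel_left _ hP.natDegree_pos]
  rw [hdv, kap_ssFam hP] at h
  have h2 : SS (ssFam P) ψ y P = (Nat.card F : ℂ) ^ (P.natDegree * (b + 1).choose 2) *
      ∑ g : V →ₗ[F] V, (if Polynomial.aeval g P = 0 then 1 else 0) *
        ψ (LinearMap.trace F V (g ∘ₗ y)) := by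
    unfold SS
    rw [Finset.mul_sum]
    refine Finset.sum_congr rfl fun g _ => ?_
    rw [← mul_assoc]
    congr 1
    unfold ssFam
    rw [hdv]
    by_cases hg : Polynomial.aeval g P = 0
    · have : Nilp P g := by unfold Nilp; rw [hg]; exact IsNilpotent.zero
      simp [hg, this]
    · simp [hg]
  rw [mul_assoc, ← h2, h, ← mul_assoc, ← pow_add, ← two_mul, pow_mul]
  simp
end

section
variable {F : Type} [Field F]

lemma sum_add_char {G : Type} [AddCommGroup G] [Fintype G] (θ : G → ℂ)
    (hadd : ∀ a b, θ (a + b) = θ a * θ b) (x : G) (hx : θ x ≠ 1) : ∑ a, θ a = 0 := by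
  have h : (∑ a, θ a) * θ x = ∑ a, θ a := by
    rw [Finset.sum_mul]
    simp_rw [← hadd]
    exact Fintype.sum_equiv (Equiv.addRight x) _ _ (fun _ => rfl)
  have : (∑ a, θ a) * (θ x - 1) = 0 := by rw [mul_sub, h, mul_one, sub_self]
  rcases mul_eq_zero.mp this with h | h
  · exact h
  · exact absurd (sub_eq_zero.mp h) hx

lemma exists_char_lin {V : Type} [AddCommGroup V] [Module F V] {ψ : AddChar F ℂ}
    (hψ : ∃ a, ψ a ≠ 1) (ℓ : V →ₗ[F] F) (hℓ : ℓ ≠ 0) : ∃ v, ψ (ℓ v) ≠ 1 := by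
  obtain ⟨a, ha⟩ := hψ
  obtain ⟨v, hv⟩ : ∃ v, ℓ v ≠ 0 := by
    by_contra h; push Not at h; exact hℓ (LinearMap.ext h)
  refine ⟨(a * (ℓ v)⁻¹) • v, ?_⟩
  rw [map_smul, smul_eq_mul, mul_assoc, inv_mul_cancel₀ hv, mul_one]
  exact ha

lemma sum_char_lin {V : Type} [AddCommGroup V] [Module F V] [Fintype V] {ψ : AddChar F ℂ}
    (hψ : ∃ a, ψ a ≠ 1) (ℓ : V →ₗ[F] F) (hℓ : ℓ ≠ 0) : ∑ v, ψ (ℓ v) = 0 := by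
  obtain ⟨v, hv⟩ := exists_char_lin hψ ℓ hℓ
  exact sum_add_char (fun v => ψ (ℓ v)) (fun a b => by rw [map_add, AddChar.map_add_eq_mul]) v hv

section eig
variable {H M : Type} [AddCommGroup H] [Module F H] [AddCommGroup M] [Module ℂ M]

def EigGL (σ : (H ≃ₗ[F] H) →* Module.End ℂ M) (v : M) : Prop :=
  ∃ N : Subgroup (H ≃ₗ[F] H), Nat.card N = Nat.card F ^ (Module.finrank F H).choose 2 ∧
    (∀ a ∈ N, ∀ b ∈ N, ∃ c ∈ N, (∀ x, c x = a x + b x - x) ∧ σ c v = σ a (σ b v)) ∧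
    ∀ a ∈ N, ∃ z : ℂ, σ a v = z • v

def EigAff (ψ : AddChar F ℂ) (σ : (H ≃ₗ[F] H) →* Module.End ℂ M) (τ : H → Module.End ℂ M)
    (v : M) : Prop :=
  EigGL σ v ∧ ∃ a : H →ₗ[F] F, ∀ w, τ w v = ψ (a w) • v

lemma EigGL.map {σ : (H ≃ₗ[F] H) →* Module.End ℂ M} {v : M} (h : EigGL σ v)
    (Z : Module.End ℂ M) (hZ : ∀ g x, σ g (Z x) = Z (σ g x)) : EigGL σ (Z v) := by
  obtain ⟨N, h1, h2, h3⟩ := h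
  refine ⟨N, h1, ?_, ?_⟩
  · intro a ha b hb
    obtain ⟨c, hc, hc1, hc2⟩ := h2 a ha b hb
    refine ⟨c, hc, hc1, ?_⟩
    rw [hZ, hc2, hZ, hZ]
  · intro a ha
    obtain ⟨z, hz⟩ := h3 a ha
    exact ⟨z, by rw [hZ, hz, map_smul]⟩

/-- affine embedding -/
def emb (h : H ≃ₗ[F] H) (w : H) : (H × F) ≃ₗ[F] (H × F) where
  toFun x := (h x.1 + x.2 • w, x.2)
  invFun x := (h.symm (x.1 - x.2 • w), x.2)
  map_add' x y := by ext <;> simp [add_smul]; abel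
  map_smul' c x := by ext <;> simp [mul_smul]
  left_inv x := by simp
  right_inv x := by simp

lemma emb_apply (h : H ≃ₗ[F] H) (w : H) (x : H × F) : emb h w x = (h x.1 + x.2 • w, x.2) := rfl

lemma emb_mul (h k : H ≃ₗ[F] H) (w u : H) : emb h w * emb k u = emb (h * k) (w + h u) := by
  refine LinearEquiv.ext fun x => Prod.ext ?_ ?_
  · simp [emb_apply]; abel
  · simp [emb_apply]

lemma emb_inj {h k : H ≃ₗ[F] H} {w u : H} (e : emb h w = emb k u) : h = k ∧ w = u := by
  constructor
  · ext x
    have := congrArg Prod.fst (LinearEquiv.congr_fun e (x, 0))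
    simpa [emb_apply] using this
  · have := congrArg Prod.fst (LinearEquiv.congr_fun e (0, 1))
    simpa [emb_apply] using this

lemma emb_one : emb (F := F) (1 : H ≃ₗ[F] H) 0 = 1 := by
  ext x <;> simp [emb_apply]

def embHom (H : Type) [AddCommGroup H] [Module F H] : (H ≃ₗ[F] H) →* ((H × F) ≃ₗ[F] (H × F)) where
  toFun h := emb h 0
  map_one' := emb_one
  map_mul' h k := by rw [emb_mul]; simp

lemma lift_eig [Finite F] [Finite H] (ψ : AddChar F ℂ) (σ : ((H × F) ≃ₗ[F] (H × F)) →* Module.End ℂ M) (v : M)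
    (h : EigAff ψ (σ.comp (embHom H)) (fun w => σ (emb 1 w)) v) : EigGL σ v := by
  obtain ⟨⟨N, h1, h2, h3⟩, a, ha⟩ := h
  have hs : ∀ h w x, σ (emb h w) x = σ (emb 1 w) (σ (emb h 0) x) := by
    intro h w x
    rw [← Module.End.mul_apply, ← map_mul, emb_mul]; simp
  refine ⟨{ carrier := {g | ∃ h ∈ N, ∃ w, g = emb h w}
            mul_mem' := ?_
            one_mem' := ⟨1, N.one_mem, 0, emb_one.symm⟩
            inv_mem' := ?_ }, ?_, ?_, ?_⟩
  · rintro _ _ ⟨h, hh, w, rfl⟩ ⟨k, hk, u, rfl⟩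
    exact ⟨h * k, N.mul_mem hh hk, _, emb_mul _ _ _ _⟩
  · rintro _ ⟨h, hh, w, rfl⟩
    refine ⟨h⁻¹, N.inv_mem hh, -(h⁻¹ w), ?_⟩
    rw [inv_eq_iff_mul_eq_one, emb_mul]
    rw [← emb_one]
    congr 1
    · simp
    · rw [map_neg]
      have : h (h⁻¹ w) = w := by
        rw [← LinearEquiv.mul_apply, mul_inv_cancel]; rfl
      rw [this]; simp
  · have e : N × H ≃ {g : ((H × F) ≃ₗ[F] (H × F)) // ∃ h ∈ N, ∃ w, g = emb h w} :=
      Equiv.ofBijective (fun p => ⟨emb p.1.1 p.2, p.1.1, p.1.2, p.2, rfl⟩) (by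
        constructor
        · intro p p' hp
          obtain ⟨e1, e2⟩ := emb_inj (Subtype.ext_iff.mp hp)
          exact Prod.ext (Subtype.ext e1) e2
        · rintro ⟨_, h, hh, w, rfl⟩
          exact ⟨(⟨h, hh⟩, w), rfl⟩)
    refine (Nat.card_congr e).symm.trans ?_
    rw [Nat.card_prod, h1, Module.natCard_eq_pow_finrank (K := F) (V := H), ← pow_add,
      Module.finrank_prod, Module.finrank_self, choose_two_add]
    congr 1
    simp
  · rintro _ ⟨h, hh, w, rfl⟩ _ ⟨k, hk, u, rfl⟩
    obtain ⟨c, hc, hc1, hc2⟩ := h2 h hh k hk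
    refine ⟨emb c (w + u), ⟨c, hc, _, rfl⟩, ?_, ?_⟩
    · intro x
      ext
      · simp [emb_apply, hc1]; abel
      · simp [emb_apply]
    · obtain ⟨z1, hz1⟩ := h3 h hh
      obtain ⟨z2, hz2⟩ := h3 k hk
      change σ (emb c 0) v = σ (emb h 0) (σ (emb k 0) v) at hc2
      change σ (emb h 0) v = _ at hz1
      change σ (emb k 0) v = _ at hz2
      change ∀ w, σ (emb 1 w) v = _ at ha
      rw [hs c (w + u) v, hc2, hs k u v, hs h w _]
      simp only [hz1, hz2, ha, map_smul, map_add, AddChar.map_add_eq_mul, smul_smul]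
      congr 1; ring
  · rintro _ ⟨h, hh, w, rfl⟩
    obtain ⟨z1, hz1⟩ := h3 h hh
    change σ (emb h 0) v = _ at hz1
    change ∀ w, σ (emb 1 w) v = _ at ha
    refine ⟨z1 * ψ (a w), ?_⟩
    rw [hs, hz1, map_smul, ha, smul_smul]

def autC {V W : Type} [AddCommGroup V] [Module F V] [AddCommGroup W] [Module F W]
    (e : V ≃ₗ[F] W) : (V ≃ₗ[F] V) →* (W ≃ₗ[F] W) where
  toFun g := (e.symm.trans g).trans e
  map_one' := by ext; simp
  map_mul' a b := by ext; simp

lemma autC_apply {V W : Type} [AddCommGroup V] [Module F V] [AddCommGroup W] [Module F W]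
    (e : V ≃ₗ[F] W) (g : V ≃ₗ[F] V) (x : W) : autC e g x = e (g (e.symm x)) := rfl

lemma eig_transport {V W : Type} [AddCommGroup V] [Module F V] [AddCommGroup W] [Module F W]
    (e : W ≃ₗ[F] V) (σ : (V ≃ₗ[F] V) →* Module.End ℂ M) (v : M)
    (h : EigGL (σ.comp (autC e)) v) : EigGL σ v := by
  obtain ⟨N, h1, h2, h3⟩ := h
  have hinj : Function.Injective (autC e) := by
    intro a b hab
    ext x
    have := LinearEquiv.congr_fun hab (e x)
    simpa [autC_apply] using this
  refine ⟨N.map (autC e), ?_, ?_, ?_⟩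
  · rw [← e.finrank_eq, ← h1]
    exact Nat.card_congr (N.equivMapOfInjective _ hinj).symm.toEquiv
  · rintro _ ⟨a, ha, rfl⟩ _ ⟨b, hb, rfl⟩
    obtain ⟨c, hc, hc1, hc2⟩ := h2 a ha b hb
    refine ⟨autC e c, ⟨c, hc, rfl⟩, ?_, hc2⟩
    intro x
    simp [autC_apply, hc1]
  · rintro _ ⟨a, ha, rfl⟩
    exact h3 a ha

lemma exists_ker_equiv {V : Type} [AddCommGroup V] [Module F V] (b : V →ₗ[F] F) (hb : b ≠ 0) :
    ∃ e : V ≃ₗ[F] (LinearMap.ker b × F), ∀ x, (e x).2 = b x := by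
  obtain ⟨v, hv⟩ : ∃ v, b v ≠ 0 := by
    by_contra h; push Not at h; exact hb (LinearMap.ext h)
  let v0 := (b v)⁻¹ • v
  have hv0 : b v0 = 1 := by simp [v0, hv]
  refine ⟨{ toFun := fun x => (⟨x - b x • v0, by simp [hv0]⟩, b x)
            invFun := fun p => p.1 + p.2 • v0
            map_add' := fun x y => by
              ext
              · simp [add_smul]; abel
              · simp
            map_smul' := fun c x => by
              ext
              · simp [mul_smul, smul_sub]
              · simp
            left_inv := fun x => by simp
            right_inv := fun p => by
              have : b (p.1 : V) = 0 := p.1.2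
              ext <;> simp [hv0, this] }, fun x => rfl⟩

theorem affSpan [Finite F] {ψ : AddChar F ℂ} (hψ : ∃ a, ψ a ≠ 1) : ∀ (n : ℕ) (H : Type) [AddCommGroup H] [Module F H] [Finite H]
    (σ : (H ≃ₗ[F] H) →* Module.End ℂ M) (τ : H → Module.End ℂ M) (hτ0 : τ 0 = 1)
    (hτ : ∀ w w', τ (w + w') = τ w * τ w') (hc : ∀ h w, σ h * τ w = τ (h w) * σ h)
    (hn : Module.finrank F H = n) (v : M), v ∈ Submodule.span ℂ {v | EigAff ψ σ τ v} := by
  intro n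
  induction n with
  | zero =>
    intro H _ _ _ σ τ hτ0 hτ hc hn v
    haveI : Subsingleton H := Module.finrank_zero_iff.mp hn
    refine Submodule.subset_span ⟨⟨⊥, by simp [hn], ?_, ?_⟩, 0, ?_⟩
    · intro a ha b hb
      refine ⟨1, Subgroup.one_mem _, fun x => Subsingleton.elim _ _, ?_⟩
      rw [Subgroup.mem_bot.mp ha, Subgroup.mem_bot.mp hb]; simp
    · intro a ha
      exact ⟨1, by rw [Subgroup.mem_bot.mp ha]; simp⟩
    · intro w
      rw [Subsingleton.elim w 0, hτ0]; simp
  | succ n ih =>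
    intro H _ _ _ σ τ hτ0 hτ hc hn v
    haveI := Fintype.ofFinite H
    haveI : Nontrivial H := Module.nontrivial_of_finrank_pos (R := F) (by omega)
    let Z : (H →ₗ[F] F) → Module.End ℂ M := fun a => ∑ w, ψ (-(a w)) • τ w
    have hZ1 : ∀ a w x, τ w (Z a x) = ψ (a w) • Z a x := by
      intro a w x
      simp only [Z, LinearMap.sum_apply, map_sum, LinearMap.smul_apply, map_smul, Finset.smul_sum]
      simp_rw [← Module.End.mul_apply, ← hτ, smul_smul]
      refine Fintype.sum_equiv (Equiv.addLeft w) _ _ fun u => ?_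
      rw [Equiv.coe_addLeft, ← AddChar.map_add_eq_mul, a.map_add]
      congr 2; abel
    have hsum : v = (Fintype.card (H →ₗ[F] F) : ℂ)⁻¹ • ∑ a, Z a v := by
      have h1 : ∑ a, Z a v = (Fintype.card (H →ₗ[F] F) : ℂ) • v := by
        simp only [Z, LinearMap.sum_apply, LinearMap.smul_apply]
        rw [Finset.sum_comm]
        simp_rw [← Finset.sum_smul]
        rw [Finset.sum_eq_single (0 : H)]
        · simp [hτ0]
        · intro w _ hw
          have : ∑ a : H →ₗ[F] F, ψ (-(a w)) = 0 := by
            have := sum_char_lin hψ (-(LinearMap.applyₗ (R := F) (M₂ := F) w)) (by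
              intro h0
              have hall : ∀ a : H →ₗ[F] F, a w = 0 := fun a => by
                have := LinearMap.congr_fun h0 a
                simpa using this
              exact hw ((Module.forall_dual_apply_eq_zero_iff F w).mp hall))
            exact this
          rw [this, zero_smul]
        · simp
      rw [h1, smul_smul, inv_mul_cancel₀, one_smul]
      exact_mod_cast Fintype.card_ne_zero
    rw [hsum]
    refine Submodule.smul_mem _ _ (Submodule.sum_mem _ fun a _ => ?_)
    obtain ⟨b, hb, c, hbc⟩ : ∃ b : H →ₗ[F] F, b ≠ 0 ∧ ∃ c : F, a = c • b := by
      by_cases h0 : a = 0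
      · obtain ⟨w, hw⟩ := exists_ne (0 : H)
        have : ¬ ∀ f : Module.Dual F H, f w = 0 := fun h =>
          hw ((Module.forall_dual_apply_eq_zero_iff F w).mp h)
        push Not at this
        obtain ⟨f, hf⟩ := this
        exact ⟨f, fun h => hf (by rw [h]; rfl), 0, by rw [h0]; simp⟩
      · exact ⟨a, h0, 1, by simp⟩
    obtain ⟨e, he⟩ := exists_ker_equiv b hb
    have hfr : Module.finrank F (LinearMap.ker b) = n := by
      have := e.finrank_eq
      rw [Module.finrank_prod, Module.finrank_self, hn] at this
      omega
    let σ' := σ.comp (autC e.symm)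
    have hI := ih (LinearMap.ker b) (σ'.comp (embHom _)) (fun w => σ' (emb 1 w))
      (by
        change σ' (emb 1 0) = 1
        rw [emb_one, map_one])
      (by intro w w'; rw [← map_mul, emb_mul]; simp)
      (by
        intro h w
        change σ' (emb h 0) * σ' (emb 1 w) = σ' (emb 1 (h w)) * σ' (emb h 0)
        rw [← map_mul, ← map_mul, emb_mul, emb_mul]; simp) hfr v
    have hcomm : ∀ h w x, σ' (emb h w) (Z a x) = Z a (σ' (emb h w) x) := by
      intro h w x
      set g : H ≃ₗ[F] H := autC e.symm (emb h w) with hg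
      change σ g (Z a x) = Z a (σ g x)
      have hga : ∀ u, a (g u) = a u := by
        intro u
        rw [hbc]
        simp only [LinearMap.smul_apply]
        rw [← he, ← he, hg, autC_apply]
        simp [emb_apply]
      simp only [Z, LinearMap.sum_apply, map_sum, LinearMap.smul_apply, map_smul]
      refine Fintype.sum_equiv g.toEquiv _ _ fun u => ?_
      rw [← Module.End.mul_apply, hc]
      change _ = ψ (-(a (g u))) • _
      rw [hga]; rfl
    have : Submodule.map (Z a) (Submodule.span ℂ {v | EigAff ψ (σ'.comp (embHom _)) (fun w => σ' (emb 1 w)) v})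
        ≤ Submodule.span ℂ {v | EigAff ψ σ τ v} := by
      rw [Submodule.map_span_le]
      rintro x ⟨hx1, a', ha'⟩
      refine Submodule.subset_span ⟨?_, a, fun w => hZ1 a w x⟩
      apply eig_transport e.symm
      apply lift_eig ψ
      refine ⟨hx1.map (Z a) fun g x => hcomm g 0 x, a', fun w => ?_⟩
      change σ' (emb 1 w) (Z a x) = _
      rw [hcomm, show σ' (emb 1 w) x = _ from ha' w, map_smul]
    exact this (Submodule.mem_map_of_mem hI)

theorem glSpan [Finite F] {ψ : AddChar F ℂ} (hψ : ∃ a, ψ a ≠ 1) [Finite H] [Nontrivial H]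
    (σ : (H ≃ₗ[F] H) →* Module.End ℂ M) (v : M) : v ∈ Submodule.span ℂ {v | EigGL σ v} := by
  obtain ⟨b, hb⟩ : ∃ b : H →ₗ[F] F, b ≠ 0 := by
    obtain ⟨w, hw⟩ := exists_ne (0 : H)
    have : ¬ ∀ f : Module.Dual F H, f w = 0 := fun h =>
      hw ((Module.forall_dual_apply_eq_zero_iff F w).mp h)
    push Not at this
    obtain ⟨f, hf⟩ := this
    exact ⟨f, fun h => hf (by rw [h]; rfl)⟩
  obtain ⟨e, he⟩ := exists_ker_equiv b hb
  let σ' := σ.comp (autC e.symm)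
  have hI := affSpan hψ _ (LinearMap.ker b) (σ'.comp (embHom _)) (fun w => σ' (emb 1 w))
      (by
        change σ' (emb 1 0) = 1
        rw [emb_one, map_one])
      (by intro w w'; rw [← map_mul, emb_mul]; simp)
      (by
        intro h w
        change σ' (emb h 0) * σ' (emb 1 w) = σ' (emb 1 (h w)) * σ' (emb h 0)
        rw [← map_mul, ← map_mul, emb_mul, emb_mul]; simp) rfl v
  refine Submodule.span_mono ?_ hI
  intro x hx
  exact eig_transport e.symm _ _ (lift_eig ψ _ _ hx)
end eig
end

section
variable {F : Type} [Field F]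

lemma isIntegral_char [Finite F] (ψ : AddChar F ℂ) (a : F) : IsIntegral ℤ (ψ a) := by
  have h : (ψ a) ^ (Nat.card F) = 1 := by
    haveI := Fintype.ofFinite F
    rw [← AddChar.map_nsmul_eq_pow, Nat.card_eq_fintype_card, card_nsmul_eq_zero, AddChar.map_zero_eq_one]
  exact IsIntegral.of_pow Nat.card_pos (by rw [h]; exact isIntegral_one)

lemma trace_integral_of_lattice {M : Type} [AddCommGroup M] [Module ℂ M] [Module.Finite ℂ M]
    (S : Set M) (hS : S.Finite) (hs : Submodule.span ℂ S = ⊤) (A : Module.End ℂ M)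
    (hA : ∀ v ∈ S, A v ∈ Submodule.span ℤ S) : IsIntegral ℤ (LinearMap.trace ℂ M A) := by
  let Λ := Submodule.span ℤ S
  haveI : Module.Finite ℤ Λ := Module.Finite.span_of_finite ℤ hS
  have hA' : ∀ v ∈ Λ, (A.restrictScalars ℤ) v ∈ Λ := by
    intro v hv
    have : Submodule.map (A.restrictScalars ℤ) Λ ≤ Λ := by
      rw [Submodule.map_span_le]
      exact hA
    exact this (Submodule.mem_map_of_mem hv)
  let f : Module.End ℤ Λ := (A.restrictScalars ℤ).restrict hA'
  obtain ⟨p, hp, hpf⟩ := LinearMap.exists_monic_and_aeval_eq_zero ℤ f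
  have hpow : ∀ (i : ℕ) (x : Λ), (((f ^ i) x : Λ) : M) = (A ^ i) x := by
    intro i
    induction i with
    | zero => intro x; simp
    | succ i ih =>
      intro x
      rw [pow_succ, pow_succ, Module.End.mul_apply, Module.End.mul_apply, ih]
      rfl
  have hpA : Polynomial.aeval A p = 0 := by
    apply LinearMap.ext_on hs
    intro x hx
    have h1 := LinearMap.congr_fun hpf ⟨x, Submodule.subset_span hx⟩
    have h2 := congrArg (Subtype.val) h1
    rw [Polynomial.aeval_eq_sum_range] at h2 ⊢
    simp only [LinearMap.sum_apply, LinearMap.smul_apply, Submodule.coe_sum, Submodule.coe_smul, hpow,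
      LinearMap.zero_apply, Submodule.coe_zero] at h2 ⊢
    exact h2
  have hsp : (A.charpoly).Splits := IsAlgClosed.splits _
  rw [Module.End.trace_eq_sum_roots_charpoly_of_splits hsp]
  refine IsIntegral.multiset_sum fun z hz => ?_
  have hz' : Module.End.HasEigenvalue A z := by
    rw [Module.End.hasEigenvalue_iff_isRoot_charpoly]
    exact (Polynomial.mem_roots'.mp hz).2
  obtain ⟨v, hv⟩ := hz'.exists_hasEigenvector
  refine ⟨p, hp, ?_⟩
  have h3 : Polynomial.aeval A (p.map (algebraMap ℤ ℂ)) v = (p.map (algebraMap ℤ ℂ)).eval z • v :=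
    Module.End.aeval_apply_of_hasEigenvector hv
  rw [Polynomial.aeval_map_algebraMap, hpA, LinearMap.zero_apply] at h3
  rw [← Polynomial.eval_map]
  exact (smul_eq_zero.mp h3.symm).resolve_right hv.2

instance [Finite F] {V : Type} [AddCommGroup V] [Module F V] [Finite V] : Finite (V ≃ₗ[F] V) :=
  Finite.of_injective (fun e : V ≃ₗ[F] V => (e : V → V)) DFunLike.coe_injective

noncomputable instance fintypeGL [Finite F] {V : Type} [AddCommGroup V] [Module F V] [Finite V] : Fintype (V ≃ₗ[F] V) :=
  Fintype.ofFinite _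

section
variable {V M : Type} [AddCommGroup V] [Module F V] [Finite F] [Finite V] [AddCommGroup M] [Module ℂ M]

/-- trace of an automorphism -/
noncomputable def trE (g : V ≃ₗ[F] V) : F := LinearMap.trace F V (g : V →ₗ[F] V)

noncomputable def TT (ψ : AddChar F ℂ) (σ : (V ≃ₗ[F] V) →* Module.End ℂ M) : Module.End ℂ M :=
  ∑ g, ψ (trE g) • σ g

lemma trE_comm (g h : V ≃ₗ[F] V) : trE (g * h) = trE (h * g) := by
  unfold trE
  exact LinearMap.trace_mul_comm F (g : V →ₗ[F] V) (h : V →ₗ[F] V)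

lemma TT_comm (ψ : AddChar F ℂ) (σ : (V ≃ₗ[F] V) →* Module.End ℂ M) (x : V ≃ₗ[F] V) (v : M) :
    TT ψ σ (σ x v) = σ x (TT ψ σ v) := by
  simp only [TT, LinearMap.sum_apply, map_sum, LinearMap.smul_apply, map_smul]
  simp_rw [← Module.End.mul_apply, ← map_mul]
  refine Fintype.sum_equiv (MulAut.conj x⁻¹).toEquiv _ _ fun g => ?_
  have e : (MulAut.conj x⁻¹).toEquiv g = x⁻¹ * g * x := by simp
  rw [e, ← mul_assoc, ← mul_assoc, mul_inv_cancel, one_mul, mul_assoc, trE_comm, mul_assoc,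
    mul_inv_cancel, mul_one]

lemma TT_eig {ψ : AddChar F ℂ} (σ : (V ≃ₗ[F] V) →* Module.End ℂ M) {v : M} (h : EigGL σ v) :
    ∃ u ∈ Submodule.span ℤ {u | ∃ (c : F) (g : V ≃ₗ[F] V), u = ψ c • σ g v},
      TT ψ σ v = ((Nat.card F : ℂ) ^ (Module.finrank F V).choose 2) • u := by
  by_cases hv : v = 0
  · exact ⟨0, Submodule.zero_mem _, by rw [hv]; simp⟩
  obtain ⟨N, h1, h2, h3⟩ := h
  have h3' : ∀ a : N, ∃ z : ℂ, σ a v = z • v := fun a => h3 a a.2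
  choose χ hχ using h3'
  have key : ∀ g : V ≃ₗ[F] V, ∃ b : Bool, ∑ a : N, ψ (trE (g * (a : V ≃ₗ[F] V))) * χ a =
      (if b then ψ (trE g) else 0) * (Nat.card F : ℂ) ^ (Module.finrank F V).choose 2 := by
    intro g
    have htr : ∀ a b c : N, (∀ x, (c : V ≃ₗ[F] V) x = (a : V ≃ₗ[F] V) x + (b : V ≃ₗ[F] V) x - x) →
        trE (g * (c : V ≃ₗ[F] V)) + trE g = trE (g * (a : V ≃ₗ[F] V)) + trE (g * (b : V ≃ₗ[F] V)) := by
      intro a b c hc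
      unfold trE
      rw [← map_add, ← map_add]
      congr 1
      ext x
      simp [hc]
    have hmul : ∀ b a : N, ∃ c : N, (∀ x, (c : V ≃ₗ[F] V) x = (a : V ≃ₗ[F] V) x + (b : V ≃ₗ[F] V) x - x) ∧ χ c = χ a * χ b := by
      intro b a
      obtain ⟨c, hc, hc1, hc2⟩ := h2 a a.2 b b.2
      refine ⟨⟨c, hc⟩, hc1, ?_⟩
      rw [hχ ⟨c, hc⟩, hχ b, map_smul, hχ a, smul_smul] at hc2
      have := sub_eq_zero.mpr hc2
      rw [← sub_smul] at this
      have := (smul_eq_zero.mp this).resolve_right hv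
      rw [sub_eq_zero.mp this, mul_comm]
    by_cases hall : ∀ a : N, ψ (trE (g * (a : V ≃ₗ[F] V))) * χ a = ψ (trE g)
    · refine ⟨true, ?_⟩
      rw [Finset.sum_congr rfl fun a _ => hall a]
      simp only [Finset.sum_const, Finset.card_univ, nsmul_eq_mul, if_true]
      rw [mul_comm, ← Nat.card_eq_fintype_card, h1]; push_cast; rfl
    · refine ⟨false, ?_⟩
      push Not at hall
      obtain ⟨b, hb⟩ := hall
      choose m hm hm2 using hmul b
      have hbij : Function.Bijective m := by
        rw [← Finite.injective_iff_bijective]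
        intro a a' haa
        apply Subtype.ext
        ext x
        have e1 := hm a x
        rw [haa, hm a' x] at e1
        exact (add_right_cancel (sub_left_injective e1)).symm
      have e := hbij.sum_comp (fun a : N => ψ (trE (g * (a : V ≃ₗ[F] V))) * χ a)
      have e2 : ∀ a, ψ (trE g) * (ψ (trE (g * (m a : V ≃ₗ[F] V))) * χ (m a)) = (ψ (trE (g * (a : V ≃ₗ[F] V))) * χ a) * (ψ (trE (g * (b : V ≃ₗ[F] V))) * χ b) := by
        intro a
        rw [hm2, ← mul_assoc, ← AddChar.map_add_eq_mul, add_comm, htr a b (m a) (hm a), AddChar.map_add_eq_mul]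
        ring
      have e3 : (∑ a : N, ψ (trE (g * (a : V ≃ₗ[F] V))) * χ a) * (ψ (trE (g * (b : V ≃ₗ[F] V))) * χ b - ψ (trE g)) = 0 := by
        rw [mul_sub, Finset.sum_mul]
        simp_rw [← e2]
        rw [← Finset.mul_sum, e]; ring
      have := (mul_eq_zero.mp e3).resolve_right (sub_ne_zero.mpr hb)
      rw [this]; simp
  choose b hb using key
  refine ⟨∑ i : (V ≃ₗ[F] V) ⧸ N, (if b i.out then ψ (trE i.out) • σ i.out v else 0), ?_, ?_⟩
  · refine Submodule.sum_mem _ fun i _ => ?_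
    split_ifs
    · exact Submodule.subset_span ⟨_, _, rfl⟩
    · exact Submodule.zero_mem _
  · simp only [TT, LinearMap.sum_apply, LinearMap.smul_apply]
    have hbij : Function.Bijective (fun p : ((V ≃ₗ[F] V) ⧸ N) × N => (p.1.out * (p.2 : V ≃ₗ[F] V))) := by
      constructor
      · rintro ⟨i, a⟩ ⟨j, c⟩ hij
        simp only at hij
        have h1 : i = j := by
          have := congrArg (QuotientGroup.mk (s := N)) hij
          simpa using this
        subst h1
        simpa using hij
      · intro g
        have : (QuotientGroup.mk (s := N) g).out⁻¹ * g ∈ N := by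
          rw [← QuotientGroup.eq]; simp
        exact ⟨(QuotientGroup.mk g, ⟨_, this⟩), by simp⟩
    rw [← Fintype.sum_bijective _ hbij
      (fun p => ψ (trE (p.1.out * (p.2 : V ≃ₗ[F] V))) • σ (p.1.out * (p.2 : V ≃ₗ[F] V)) v) _ (fun p => rfl)]
    rw [Fintype.sum_prod_type, Finset.smul_sum]
    refine Finset.sum_congr rfl fun i _ => ?_
    have : ∀ a : N, ψ (trE (i.out * (a : V ≃ₗ[F] V))) • σ (i.out * (a : V ≃ₗ[F] V)) v = (ψ (trE (i.out * (a : V ≃ₗ[F] V))) * χ a) • σ i.out v := by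
      intro a
      rw [map_mul, Module.End.mul_apply, hχ, map_smul, smul_smul]
    simp_rw [this]
    rw [← Finset.sum_smul, hb]
    split_ifs
    · rw [smul_smul, mul_comm]
    · simp

/-- left regular representation -/
def LL (G : Type) [Group G] : G →* Module.End ℂ (G → ℂ) where
  toFun g := LinearMap.funLeft ℂ ℂ (fun h => g⁻¹ * h)
  map_one' := by ext; simp
  map_mul' a b := by ext φ h; simp [LinearMap.funLeft_apply, mul_assoc]

def RT {G : Type} [Group G] (y : G) : Module.End ℂ (G → ℂ) := LinearMap.funLeft ℂ ℂ (fun h => h * y)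

lemma trace_funLeft {G : Type} [Fintype G] (π : G → G) :
    LinearMap.trace ℂ (G → ℂ) (LinearMap.funLeft ℂ ℂ π) = ∑ h, if π h = h then 1 else 0 := by
  rw [LinearMap.trace_eq_matrix_trace ℂ (Pi.basisFun ℂ G), Matrix.trace]
  refine Finset.sum_congr rfl fun h _ => ?_
  rw [Matrix.diag_apply, LinearMap.toMatrix_apply]
  simp [LinearMap.funLeft_apply, Pi.single_apply]

theorem integral_orb [Nontrivial V] {ψ : AddChar F ℂ} (hψ : ∃ a, ψ a ≠ 1) (x y : V ≃ₗ[F] V) :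
    IsIntegral ℤ (((Nat.card F : ℂ) ^ (Module.finrank F V).choose 2)⁻¹ *
      ∑ z : V ≃ₗ[F] V, ψ (trE (x * (z * y * z⁻¹)))) := by
  set qC : ℂ := (Nat.card F : ℂ) ^ (Module.finrank F V).choose 2 with hqC
  have hq0 : qC ≠ 0 := pow_ne_zero _ (by exact_mod_cast (Nat.card_pos (α := F)).ne')
  let σ := LL (V ≃ₗ[F] V)
  have hcomm : ∀ g h (φ : (V ≃ₗ[F] V) → ℂ), RT h (σ g φ) = σ g (RT h φ) := by
    intro g h φ; ext k
    simp [RT, σ, LL, LinearMap.funLeft_apply, mul_assoc]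
  have hTR : ∀ h (φ : (V ≃ₗ[F] V) → ℂ), TT ψ σ (RT h φ) = RT h (TT ψ σ φ) := by
    intro h φ
    simp only [TT, LinearMap.sum_apply, map_sum, LinearMap.smul_apply, map_smul, hcomm]
  have hRR : ∀ h k (φ : (V ≃ₗ[F] V) → ℂ), RT h (RT k φ) = RT (h * k) φ := by
    intro h k φ; ext l; simp [RT, LinearMap.funLeft_apply, mul_assoc]
  obtain ⟨B, hBsub, hBspan⟩ : ∃ B : Finset ((V ≃ₗ[F] V) → ℂ), (∀ v ∈ B, EigGL σ v) ∧ Submodule.span ℂ (B : Set ((V ≃ₗ[F] V) → ℂ)) = ⊤ := by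
    have htop : Submodule.span ℂ {v | EigGL σ v} = ⊤ := by
      rw [eq_top_iff]; intro v _; exact glSpan hψ σ v
    have hfg : (Submodule.span ℂ {v | EigGL σ v}).FG := by
      rw [htop]; exact Module.Finite.fg_top
    obtain ⟨B, hB, hB2⟩ := Submodule.fg_span_iff_fg_span_finset_subset _ |>.mp hfg
    exact ⟨B, fun v hv => hB hv, by rw [← hB2, htop]⟩
  let S : Set ((V ≃ₗ[F] V) → ℂ) := Set.range (fun p : F × (V ≃ₗ[F] V) × (V ≃ₗ[F] V) × B => ψ p.1 • σ p.2.1 (RT p.2.2.1 (p.2.2.2 : (V ≃ₗ[F] V) → ℂ)))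
  have hS1 : Submodule.span ℂ S = ⊤ := by
    rw [eq_top_iff, ← hBspan]
    refine Submodule.span_mono fun v hv => ?_
    refine ⟨(0, 1, 1, ⟨v, hv⟩), ?_⟩
    ext k
    simp [RT, LinearMap.funLeft_apply]
  let A : Module.End ℂ ((V ≃ₗ[F] V) → ℂ) := qC⁻¹ • (σ x⁻¹ * RT y * TT ψ σ)
  have hA : ∀ v ∈ S, A v ∈ Submodule.span ℤ S := by
    rintro _ ⟨⟨c, g, h, v, hv⟩, rfl⟩
    obtain ⟨u, hu, hTu⟩ := TT_eig (ψ := ψ) σ (hBsub v hv)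
    have e : A (ψ c • σ g (RT h v)) = ψ c • σ (x⁻¹ * g) (RT (y * h) u) := by
      simp only [A, LinearMap.smul_apply, Module.End.mul_apply, map_smul]
      rw [TT_comm, hTR, hTu, map_smul, map_smul, map_smul, map_smul, hcomm, hRR, map_mul, Module.End.mul_apply, ← hqC, smul_smul, smul_smul]
      congr 1
      field_simp
    change A (ψ c • σ g (RT h v)) ∈ _
    rw [e]
    let Z : ((V ≃ₗ[F] V) → ℂ) →ₗ[ℤ] ((V ≃ₗ[F] V) → ℂ) := (ψ c • (σ (x⁻¹ * g) * RT (y * h))).restrictScalars ℤ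
    have hZ : Submodule.map Z (Submodule.span ℤ {u | ∃ (c : F) (g : V ≃ₗ[F] V), u = ψ c • σ g v}) ≤ Submodule.span ℤ S := by
      rw [Submodule.map_span_le]
      rintro _ ⟨c', g', rfl⟩
      refine Submodule.subset_span ⟨(c + c', x⁻¹ * g * g', y * h, ⟨v, hv⟩), ?_⟩
      change _ = ψ c • σ (x⁻¹ * g) (RT (y * h) (ψ c' • σ g' v))
      simp only
      rw [map_smul, map_smul, hcomm, smul_smul, AddChar.map_add_eq_mul, map_mul σ (x⁻¹ * g), Module.End.mul_apply]
    exact hZ (Submodule.mem_map_of_mem hu)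
  have hinteg := trace_integral_of_lattice S (Set.finite_range _) hS1 A hA
  convert hinteg using 1
  simp only [A, map_smul, smul_eq_mul, TT, Finset.mul_sum, map_sum]
  rw [← Finset.mul_sum, ← Finset.mul_sum]
  congr 1
  have : ∀ g : (V ≃ₗ[F] V), LinearMap.trace ℂ ((V ≃ₗ[F] V) → ℂ) (σ x⁻¹ * RT y * ψ (trE g) • σ g) =
      ψ (trE g) * ∑ k : (V ≃ₗ[F] V), if g = x * (k * y * k⁻¹) then 1 else 0 := by
    intro g
    rw [mul_smul_comm, map_smul, smul_eq_mul]
    congr 1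
    have e : σ x⁻¹ * RT y * σ g = LinearMap.funLeft ℂ ℂ (fun k => g⁻¹ * (x * k * y)) := by
      ext φ k
      simp [RT, σ, LL, LinearMap.funLeft_apply, mul_assoc]
    rw [e, trace_funLeft]
    refine Finset.sum_congr rfl fun k _ => ?_
    congr 1
    rw [inv_mul_eq_iff_eq_mul, eq_iff_iff]
    constructor
    · intro h
      rw [← mul_inv_eq_iff_eq_mul] at h
      rw [← h]; group
    · intro h; rw [h]; group
  rw [Finset.sum_congr rfl fun g _ => this g]
  simp_rw [Finset.mul_sum]
  rw [Finset.sum_comm]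
  refine Finset.sum_congr rfl fun k _ => ?_
  simp
end
end

section
variable {F : Type} [Field F]

lemma conj_zero [Finite F] {ψ : AddChar F ℂ} (hψ : ∃ a, ψ a ≠ 1) {ι : Type} [Fintype ι]
    (r : ι → ℚ) (a : ι → F) (hinteg : IsIntegral ℤ (∑ i, (r i : ℂ) * ψ (a i)))
    (hlt : ∀ ψ' : AddChar F ℂ, (∃ a, ψ' a ≠ 1) → ‖∑ i, (r i : ℂ) * ψ' (a i)‖ < 1) :
    ∑ i, (r i : ℂ) * ψ (a i) = 0 := by
  set z : ℂ := ∑ i, (r i : ℂ) * ψ (a i) with hz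
  let A := algebraicClosure ℚ ℂ
  haveI : Algebra.IsAlgebraic ℚ A := algebraicClosure.isAlgebraic ℚ ℂ
  haveI : Algebra.IsIntegral ℚ A := Algebra.isAlgebraic_iff_isIntegral.mp inferInstance
  have hmem : ∀ x, ψ x ∈ A := fun x => by
    have := (isIntegral_char ψ x).tower_top (A := ℚ)
    exact mem_algebraicClosure_iff.mpr this.isAlgebraic
  let χ : F → A := fun x => ⟨ψ x, hmem x⟩
  let zA : A := ∑ i, (algebraMap ℚ A (r i)) * χ (a i)
  have hzA : (zA : ℂ) = z := by
    simp [zA, hz, χ]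
  have hintA : IsIntegral ℚ zA := Algebra.IsIntegral.isIntegral zA
  have hmin : minpoly ℚ zA = minpoly ℚ z := by
    rw [← hzA]
    exact (minpoly.algebraMap_eq (B' := ℂ) (algebraMap A ℂ).injective zA).symm
  have hroots : ∀ w ∈ ((minpoly ℤ z).map (algebraMap ℤ ℂ)).roots, ‖w‖ < 1 := by
    intro w hw
    have hw1 : w ∈ (minpoly ℚ zA).rootSet ℂ := by
      rw [hmin, Polynomial.mem_rootSet]
      refine ⟨minpoly.ne_zero (hzA ▸ hintA.map (IsScalarTower.toAlgHom ℚ A ℂ)), ?_⟩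
      rw [minpoly.isIntegrallyClosed_eq_field_fractions' ℚ hinteg, Polynomial.aeval_map_algebraMap]
      have := (Polynomial.mem_roots'.mp hw).2
      rwa [Polynomial.IsRoot, Polynomial.eval_map_algebraMap] at this
    rw [← Algebra.IsAlgebraic.range_eval_eq_rootSet_minpoly] at hw1
    obtain ⟨φ, hφ⟩ := hw1
    let ψ' : AddChar F ℂ := 
      { toFun := fun x => φ (χ x)
        map_zero_eq_one' := by
          have : χ 0 = 1 := by ext; simp [χ]
          rw [this, map_one]
        map_add_eq_mul' := fun x y => by
          have : χ (x + y) = χ x * χ y := by ext; simp [χ, AddChar.map_add_eq_mul]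
          rw [this, map_mul] }
    have h1 : w = ∑ i, (r i : ℂ) * ψ' (a i) := by
      rw [← hφ]
      simp only [zA, map_sum, map_mul]
      refine Finset.sum_congr rfl fun i _ => ?_
      congr 1
      rw [AlgHom.commutes]; simp
    rw [h1]
    apply hlt
    obtain ⟨x, hx⟩ := hψ
    refine ⟨x, fun h => hx ?_⟩
    have h2 : φ (χ x) = φ 1 := by rw [map_one]; exact h
    have h3 := φ.injective h2
    exact congrArg Subtype.val h3
  have hmonic : ((minpoly ℤ z).map (algebraMap ℤ ℂ)).Monic := (minpoly.monic hinteg).map _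
  have hsp : ((minpoly ℤ z).map (algebraMap ℤ ℂ)).Splits := IsAlgClosed.splits _
  have hc := hsp.coeff_zero_eq_prod_roots_of_monic hmonic
  have hdeg : 0 < ((minpoly ℤ z).map (algebraMap ℤ ℂ)).natDegree := by
    rw [(minpoly.monic hinteg).natDegree_map]; exact minpoly.natDegree_pos hinteg
  have hlt1 : ∀ s : Multiset ℂ, (∀ w ∈ s, ‖w‖ < 1) → s ≠ 0 → ‖s.prod‖ < 1 := by
    intro s
    induction s using Multiset.induction_on with
    | empty => intro _ h; exact absurd rfl h
    | cons w s ih =>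
      intro h _
      rw [Multiset.prod_cons, norm_mul]
      have hw := h w (Multiset.mem_cons_self _ _)
      by_cases hs : s = 0
      · rw [hs]; simpa using hw
      · have := ih (fun x hx => h x (Multiset.mem_cons_of_mem hx)) hs
        nlinarith [norm_nonneg w, norm_nonneg s.prod]
  have hne : ((minpoly ℤ z).map (algebraMap ℤ ℂ)).roots ≠ 0 := by
    intro h
    have := hsp.natDegree_eq_card_roots
    rw [h, Multiset.card_zero] at this; omega
  have h2 := hlt1 _ hroots hne
  have h3 : ‖(((minpoly ℤ z).coeff 0 : ℤ) : ℂ)‖ < 1 := by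
    rw [Polynomial.coeff_map] at hc
    have : (((minpoly ℤ z).coeff 0 : ℤ) : ℂ) = (algebraMap ℤ ℂ) ((minpoly ℤ z).coeff 0) := by simp
    rw [this, hc, norm_mul, norm_pow, norm_neg, norm_one, one_pow, one_mul]
    exact h2
  rw [Complex.norm_intCast] at h3
  have h4 : (minpoly ℤ z).coeff 0 = 0 := by
    have : |((minpoly ℤ z).coeff 0 : ℤ)| < 1 := by exact_mod_cast h3
    exact Int.abs_lt_one_iff.mp this
  have h5 : (minpoly ℚ z).coeff 0 = 0 := by
    rw [minpoly.isIntegrallyClosed_eq_field_fractions' ℚ hinteg, Polynomial.coeff_map, h4, map_zero]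
  exact (minpoly.coeff_zero_eq_zero (hinteg.tower_top (A := ℚ))).mp h5

/-- trace in towers -/
lemma trace_tower {K V : Type} [Field K] [Algebra F K] [FiniteDimensional F K] [AddCommGroup V] [Module F V] [Module K V]
    [IsScalarTower F K V] [FiniteDimensional K V] (g : V →ₗ[K] V) :
    LinearMap.trace F V (g.restrictScalars F) = Algebra.trace F K (LinearMap.trace K V g) := by
  haveI : FiniteDimensional F V := FiniteDimensional.trans F K V
  let b := Module.finBasis K V
  have hg : g = ∑ i, (b.coord i).smulRight (g (b i)) := by
    apply b.ext
    intro j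
    simp [Finsupp.single_apply]
  have h1 : ∀ (ℓ : V →ₗ[K] K) (w : V), LinearMap.trace F V ((ℓ.smulRight w).restrictScalars F) = Algebra.trace F K (ℓ w) := by
    intro ℓ w
    have e : (ℓ.smulRight w).restrictScalars F = ((LinearMap.toSpanSingleton K V w).restrictScalars F) ∘ₗ (ℓ.restrictScalars F) := by
      ext x; simp
    rw [e, LinearMap.trace_comp_comm', Algebra.trace_apply]
    congr 1
    ext x
    simp [mul_comm]
  have h2 : g.restrictScalars F = ∑ i, ((b.coord i).smulRight (g (b i))).restrictScalars F := by
    ext x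
    conv_lhs => rw [hg]
    simp
  rw [h2, map_sum]
  conv_rhs => rw [hg]
  rw [map_sum, map_sum]
  refine Finset.sum_congr rfl fun i _ => ?_
  rw [h1, LinearMap.trace_smulRight]

lemma burnside_integral {G X : Type} [Group G] [Fintype G] [Fintype X] [MulAction G X] (w : X → ℂ)
    (hw : ∀ (g : G) x, w (g • x) = w x) (hinteg : ∀ x, IsIntegral ℤ (w x)) :
    ∃ z : ℂ, IsIntegral ℤ z ∧ ∑ g : G, ∑ x : X, (if g • x = x then w x else 0) = (Fintype.card G : ℂ) * z := by
  refine ⟨∑ o : MulAction.orbitRel.Quotient G X, w o.out, IsIntegral.sum _ fun o _ => hinteg _, ?_⟩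
  rw [Finset.sum_comm, Finset.mul_sum]
  have h1 : ∀ x : X, ∑ g : G, (if g • x = x then w x else 0) =
      (Fintype.card G : ℂ) * ((Fintype.card (MulAction.orbit G x) : ℂ)⁻¹ * w x) := by
    intro x
    have h := MulAction.card_orbit_mul_card_stabilizer_eq_card_group G x
    rw [← Finset.sum_filter, Finset.sum_const, nsmul_eq_mul, ← h]
    have h2 : (Finset.univ.filter fun g : G => g • x = x).card = Fintype.card (MulAction.stabilizer G x) := by
      rw [Fintype.card_subtype]
      congr 1
    rw [h2]
    have h3 : (Fintype.card (MulAction.orbit G x) : ℂ) ≠ 0 := by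
      haveI : Nonempty (MulAction.orbit G x) := ⟨⟨x, MulAction.mem_orbit_self _⟩⟩
      exact_mod_cast Fintype.card_ne_zero
    push_cast
    field_simp
  rw [Finset.sum_congr rfl fun x _ => h1 x]
  rw [← Finset.sum_fiberwise _ (fun x : X => (Quotient.mk'' x : MulAction.orbitRel.Quotient G X))]
  refine Finset.sum_congr rfl fun o _ => ?_
  have h4 : ∀ x ∈ Finset.univ.filter (fun x : X => (Quotient.mk'' x : MulAction.orbitRel.Quotient G X) = o),
      (Fintype.card G : ℂ) * ((Fintype.card (MulAction.orbit G x) : ℂ)⁻¹ * w x) =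
      (Fintype.card G : ℂ) * ((Fintype.card (MulAction.orbit G o.out) : ℂ)⁻¹ * w o.out) := by
    intro x hx
    have hx' := (Finset.mem_filter.mp hx).2
    have hx2 : x ∈ MulAction.orbit G o.out := by
      have : (Quotient.mk'' x : MulAction.orbitRel.Quotient G X) = Quotient.mk'' o.out := by
        rw [hx']; exact (Quotient.out_eq' o).symm
      exact Quotient.exact' this
    obtain ⟨g, rfl⟩ := hx2
    simp only [hw]
    have : MulAction.orbit G (g • o.out) = MulAction.orbit G o.out := MulAction.orbit_eq_iff.mpr ⟨g, rfl⟩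
    simp only [this]
  rw [Finset.sum_congr rfl h4, Finset.sum_const, nsmul_eq_mul]
  have h5 : (Finset.univ.filter (fun x : X => (Quotient.mk'' x : MulAction.orbitRel.Quotient G X) = o)).card = Fintype.card (MulAction.orbit G o.out) := by
    rw [← Set.toFinset_card]
    congr 1
    ext x
    simp only [Finset.mem_filter, Finset.mem_univ, true_and, Set.mem_toFinset]
    constructor
    · intro hx'
      have : (Quotient.mk'' x : MulAction.orbitRel.Quotient G X) = Quotient.mk'' o.out := by
        rw [hx']; exact (Quotient.out_eq' o).symm
      exact Quotient.exact' this
    · intro hx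
      rw [← Quotient.out_eq' o]
      exact Quotient.sound' hx
  rw [h5]
  have h3 : (Fintype.card (MulAction.orbit G o.out) : ℂ) ≠ 0 := by
    haveI : Nonempty (MulAction.orbit G o.out) := ⟨⟨o.out, MulAction.mem_orbit_self _⟩⟩
    exact_mod_cast Fintype.card_ne_zero
  field_simp
end

section
variable {F : Type} [Field F]

noncomputable def TF {E : Type} [Field E] [Algebra F E] [Fintype E] (ψ : AddChar F ℂ) (ξ : E) (P : Polynomial F) : ℂ :=
  ∑ t : E, if Polynomial.aeval t P = 0 then ψ (Algebra.trace F E (ξ * t)) else 0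

def ClaimA (F E : Type) [Field F] [Finite F] [Field E] [Algebra F E] [Fintype E] : Prop :=
  ∀ (ψ : AddChar F ℂ), (∃ a, ψ a ≠ 1) → ∀ ξ : E, Irr (LinearMap.mulLeft F ξ) → ∀ P : Polynomial F, P ≠ 0 →
    SS (oneFam F) ψ (LinearMap.mulLeft F ξ) P = (-1) ^ (Module.finrank F E - 1) *
      (Nat.card F : ℂ) ^ (Module.finrank F E).choose 2 * TF ψ ξ P

noncomputable def trChar {F : Type} (K : Type) [Field F] [Field K] [Algebra F K] (ψ : AddChar F ℂ) : AddChar K ℂ :=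
  ψ.compAddMonoidHom (Algebra.trace F K).toAddMonoidHom

lemma trChar_apply {K : Type} [Field K] [Algebra F K] (ψ : AddChar F ℂ) (x : K) :
    trChar K ψ x = ψ (Algebra.trace F K x) := rfl

lemma trChar_ne {K : Type} [Finite F] [Field K] [Algebra F K] [Finite K] {ψ : AddChar F ℂ} (hψ : ∃ a, ψ a ≠ 1) :
    ∃ a, trChar K ψ a ≠ 1 := by
  obtain ⟨a, ha⟩ := hψ
  obtain ⟨b, hb⟩ := Algebra.trace_surjective F K a
  exact ⟨b, by rw [trChar_apply, hb]; exact ha⟩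

lemma isIntegral_TF {E : Type} [Finite F] [Field E] [Algebra F E] [Fintype E] (ψ : AddChar F ℂ) (ξ : E) (P : Polynomial F) :
    IsIntegral ℤ (TF ψ ξ P) := by
  refine IsIntegral.sum _ fun t _ => ?_
  split_ifs
  · exact isIntegral_char _ _
  · exact isIntegral_zero

lemma comm_sum {E K : Type} [Finite F] [Field E] [Algebra F E] [Fintype E] [Field K] [Algebra F K] [Algebra K E]
    [IsScalarTower F K E] [Finite K] (ψ : AddChar F ℂ) (ξ : E) (P : Polynomial F) (C : (E →ₗ[F] E) → Prop)
    (hC : ∀ g, C g ↔ ∃ g' : E →ₗ[K] E, g'.restrictScalars F = g) :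
    ∑ g : E →ₗ[F] E, (if C g then (if Nilp P g then 1 else 0) * ψ (LinearMap.trace F E (g ∘ₗ LinearMap.mulLeft F ξ)) else 0)
      = SS (oneFam K) (trChar K ψ) (LinearMap.mulLeft K ξ) (P.map (algebraMap F K)) := by
  unfold SS oneFam
  rw [← Finset.sum_filter]
  symm
  refine Finset.sum_bij (fun g' _ => g'.restrictScalars F) ?_ ?_ ?_ ?_
  · intro g' _
    exact Finset.mem_filter.mpr ⟨Finset.mem_univ _, (hC _).mpr ⟨g', rfl⟩⟩
  · intro a _ b _ h
    exact LinearMap.restrictScalars_injective F h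
  · intro g hg
    obtain ⟨g', h⟩ := (hC g).mp (Finset.mem_filter.mp hg).2
    exact ⟨g', Finset.mem_univ _, h⟩
  · intro g' _
    congr 1
    · congr 1
      rw [eq_iff_iff, nilp_iff_exists, nilp_iff_exists]
      have hpow : ∀ (Q : Polynomial F) x, Polynomial.aeval (g'.restrictScalars F : Module.End F E) Q x
          = Polynomial.aeval (g' : Module.End K E) (Q.map (algebraMap F K)) x := by
        intro Q x
        induction Q using Polynomial.induction_on' with
        | add p q hp hq => simp only [Polynomial.map_add, map_add, LinearMap.add_apply, hp, hq]
        | monomial m c =>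
          have h1 : ∀ (m : ℕ) x, ((g'.restrictScalars F : Module.End F E) ^ m) x = ((g' : Module.End K E) ^ m) x := by
            intro m
            induction m with
            | zero => intro x; rfl
            | succ m ih => intro x; rw [pow_succ, pow_succ, Module.End.mul_apply, Module.End.mul_apply, ih]; rfl
          rw [Polynomial.map_monomial, Polynomial.aeval_monomial, Polynomial.aeval_monomial]
          simp only [Module.End.mul_apply, Module.algebraMap_end_apply, h1]
          rw [algebraMap_smul]
      constructor
      · rintro ⟨m, hm⟩
        refine ⟨m, fun x => ?_⟩
        rw [hpow, Polynomial.map_pow]; exact hm x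
      · rintro ⟨m, hm⟩
        refine ⟨m, fun x => ?_⟩
        rw [← Polynomial.map_pow, ← hpow]; exact hm x
    · rw [trChar_apply, ← trace_tower]
      rfl

lemma Irr.tower {E K : Type} [Field E] [Algebra F E] [Field K] [Algebra F K] [Algebra K E]
    [IsScalarTower F K E] {ξ : E} (h : Irr (LinearMap.mulLeft F ξ)) : Irr (LinearMap.mulLeft K ξ) := by
  intro W hW
  rcases h (W.restrictScalars F) (fun x hx => hW x hx) with h | h
  · left
    refine (Submodule.eq_bot_iff _).mpr fun x hx => ?_
    exact (Submodule.eq_bot_iff _).mp h x hx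
  · right
    refine eq_top_iff.mpr fun x _ => ?_
    have hx : x ∈ W.restrictScalars F := h ▸ Submodule.mem_top
    exact hx

lemma TF_tower {E K : Type} [Finite F] [Field E] [Algebra F E] [Fintype E] [Field K] [Algebra F K] [Algebra K E]
    [IsScalarTower F K E] [Finite K] (ψ : AddChar F ℂ) (ξ : E) (P : Polynomial F) :
    TF (trChar K ψ) ξ (P.map (algebraMap F K)) = TF ψ ξ P := by
  unfold TF
  refine Finset.sum_congr rfl fun t _ => ?_
  rw [Polynomial.aeval_map_algebraMap, trChar_apply, Algebra.trace_trace]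

lemma comm_iff {E : Type} [Field E] [Algebra F E] [FiniteDimensional F E] (u : E) (g : E →ₗ[F] E) :
    (∀ x, g (u * x) = u * g x) ↔ ∃ g' : E →ₗ[IntermediateField.adjoin F {u}] E, g'.restrictScalars F = g := by
  constructor
  · intro h
    refine ⟨{ toFun := g, map_add' := g.map_add, map_smul' := ?_ }, rfl⟩
    have hall : ∀ c ∈ IntermediateField.adjoin F {u}, ∀ x, g (c * x) = c * g x := by
      intro c hc
      have hc' : c ∈ Algebra.adjoin F {u} := by
        have := IntermediateField.adjoin_simple_toSubalgebra_of_isAlgebraic (Algebra.IsAlgebraic.isAlgebraic (R := F) u)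
        rw [← this]; exact hc
      induction hc' using Algebra.adjoin_induction with
      | mem x hx => rw [Set.mem_singleton_iff.mp hx]; exact h
      | algebraMap r => intro x; rw [← Algebra.smul_def, map_smul, Algebra.smul_def]
      | add a b ha hb iha ihb =>
        intro x
        have h1 : ∀ {a}, a ∈ Algebra.adjoin F {u} → a ∈ IntermediateField.adjoin F {u} := fun h => IntermediateField.algebra_adjoin_le_adjoin F _ h
        rw [add_mul, map_add, iha (h1 ha), ihb (h1 hb), add_mul]
      | mul a b ha hb iha ihb =>
        intro x
        have h1 : ∀ {a}, a ∈ Algebra.adjoin F {u} → a ∈ IntermediateField.adjoin F {u} := fun h => IntermediateField.algebra_adjoin_le_adjoin F _ h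
        rw [mul_assoc, iha (h1 ha), ihb (h1 hb), mul_assoc]
    intro c x
    exact hall c.1 c.2 x
  · rintro ⟨g', rfl⟩ x
    exact g'.map_smul (⟨u, IntermediateField.mem_adjoin_simple_self F u⟩ : IntermediateField.adjoin F {u}) x

/-- the sign factor -/
def sfac (q n d : ℕ) : ℤ := (-1) ^ (n / d - 1) * ((q : ℤ) ^ d) ^ (n / d).choose 2

lemma sfac_congr (q c d : ℕ) (hc : 0 < c) (hd : 0 < d) :
    ((q : ℤ) ^ (d * c) - 1) ∣ sfac q (d * c) d - (if Even c then -(q : ℤ) ^ (d * c / 2) else 1) := by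
  unfold sfac
  rw [Nat.mul_div_cancel_left c hd]
  rcases Nat.even_or_odd' c with ⟨k, rfl | rfl⟩
  · obtain ⟨j, rfl⟩ : ∃ j, k = j + 1 := ⟨k - 1, by omega⟩
    rw [if_pos (even_two_mul _)]
    have h1 : (2 * (j + 1)).choose 2 = (j + 1) * (2 * j + 1) := by
      rw [Nat.choose_two_right]
      have : 2 * (j + 1) - 1 = 2 * j + 1 := by omega
      rw [this, mul_assoc, Nat.mul_div_cancel_left _ (by norm_num)]
    have h2 : d * (2 * (j + 1)) / 2 = d * (j + 1) := by
      rw [mul_left_comm, Nat.mul_div_cancel_left _ (by norm_num)]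
    have h3 : Odd (2 * (j + 1) - 1) := ⟨j, by omega⟩
    rw [h1, h2, h3.neg_one_pow, ← pow_mul, show d * (2 * (j + 1)) = 2 * (d * (j + 1)) by ring, pow_mul,
      show d * ((j + 1) * (2 * j + 1)) = 2 * (d * (j + 1)) * j + d * (j + 1) by ring, pow_add, pow_mul _ _ j]
    have h4 := sub_dvd_pow_sub_pow ((q : ℤ) ^ (2 * (d * (j + 1)))) 1 j
    rw [one_pow] at h4
    rw [← pow_mul]
    have : -1 * (((q : ℤ) ^ (2 * (d * (j + 1)))) ^ j * (q : ℤ) ^ (d * (j + 1))) - -(q : ℤ) ^ (d * (j + 1)) =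
      (((q : ℤ) ^ (2 * (d * (j + 1)))) ^ j - 1) * (-(q : ℤ) ^ (d * (j + 1))) := by ring
    rw [this]
    exact Dvd.dvd.mul_right h4 _
  · have hne : ¬ Even (2 * k + 1) := by rw [Nat.not_even_iff_odd]; exact ⟨k, rfl⟩
    rw [if_neg hne]
    have h1 : (2 * k + 1).choose 2 = (2 * k + 1) * k := by
      rw [Nat.choose_two_right]
      have : 2 * k + 1 - 1 = 2 * k := by omega
      rw [this, mul_left_comm, Nat.mul_div_cancel_left _ (by norm_num)]
    rw [h1, show 2 * k + 1 - 1 = 2 * k by omega, pow_mul (-1 : ℤ), neg_one_sq, one_pow, one_mul, ← pow_mul, ← mul_assoc, pow_mul _ _ k]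
    have h4 := sub_dvd_pow_sub_pow ((q : ℤ) ^ (d * (2 * k + 1))) 1 k
    rwa [one_pow] at h4

lemma deg_dvd_iff {E : Type} [Finite F] [Field E] [Algebra F E] [Finite E] (u : E) (m : ℕ) :
    (minpoly F u).natDegree ∣ m ↔ u ^ (Nat.card F) ^ m = u := by
  have hi := Algebra.IsIntegral.isIntegral (R := F) u
  rw [(minpoly.irreducible hi).natDegree_dvd_iff_dvd_X_pow_card_pow_sub_X, minpoly.dvd_iff]
  simp [sub_eq_zero]

lemma sum_sfac (E : Type) [Finite F] [Field E] [Algebra F E] [Fintype E] :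
    ∃ k : ℤ, ∑ u : Eˣ, sfac (Nat.card F) (Module.finrank F E) (minpoly F (u : E)).natDegree =
      ((Nat.card F : ℤ) ^ (Module.finrank F E) - 1) * k := by
  set q := Nat.card F with hq
  set n := Module.finrank F E with hn
  have hnpos : 0 < n := Module.finrank_pos
  have hE : Nat.card E = q ^ n := Module.natCard_eq_pow_finrank (K := F) (V := E)
  have hqn : 1 ≤ q ^ n := Nat.one_le_pow _ _ Nat.card_pos
  have hcard : Fintype.card Eˣ = q ^ n - 1 := by
    rw [Fintype.card_units, ← Nat.card_eq_fintype_card, hE]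
  let s' : Eˣ → ℤ := fun u => if Even n ∧ u ^ (q ^ (n / 2) - 1) = 1 then -(q : ℤ) ^ (n / 2) else 1
  have h1 : ∀ u : Eˣ, ((q : ℤ) ^ n - 1) ∣ sfac q n (minpoly F (u : E)).natDegree - s' u := by
    intro u
    have hi := Algebra.IsIntegral.isIntegral (R := F) (u : E)
    have hd : 0 < (minpoly F (u : E)).natDegree := minpoly.natDegree_pos hi
    obtain ⟨c, hc⟩ := minpoly.degree_dvd hi
    set d := (minpoly F (u : E)).natDegree
    change n = d * c at hc
    have hcpos : 0 < c := by
      rcases Nat.eq_zero_or_pos c with h | h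
      · rw [h] at hc; omega
      · exact h
    have h2 := sfac_congr q c d hcpos hd
    rw [← hc] at h2
    have h3 : (Even n ∧ u ^ (q ^ (n / 2) - 1) = 1) ↔ Even c := by
      have h4 : u ^ (q ^ (n / 2) - 1) = 1 ↔ (u : E) ^ q ^ (n / 2) = u := by
        have : 1 ≤ q ^ (n / 2) := Nat.one_le_pow _ _ Nat.card_pos
        rw [← Units.val_inj]
        push_cast
        conv_rhs => rw [show q ^ (n / 2) = (q ^ (n / 2) - 1) + 1 by omega, pow_succ]
        constructor
        · intro h; rw [h, one_mul]
        · intro h; exact mul_right_cancel₀ u.ne_zero (by rw [h, one_mul])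
      rw [h4, ← deg_dvd_iff]
      change Even n ∧ d ∣ n / 2 ↔ Even c
      constructor
      · rintro ⟨⟨m, hm⟩, k, hk⟩
        have : n / 2 = m := by omega
        rw [this] at hk
        have : d * c = d * (k + k) := by rw [← hc, hm, hk]; ring
        exact ⟨k, Nat.eq_of_mul_eq_mul_left hd this⟩
      · rintro ⟨k, rfl⟩
        have : n = 2 * (d * k) := by rw [hc]; ring
        refine ⟨⟨d * k, by omega⟩, k, by omega⟩
    simp only [s', h3]
    exact h2
  have h2 : ∃ k : ℤ, ∑ u, s' u = ((q : ℤ) ^ n - 1) * k := by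
    by_cases he : Even n
    · refine ⟨0, ?_⟩
      obtain ⟨m, hm⟩ := he
      have hm2 : n / 2 = m := by omega
      set R := q ^ m with hR
      have hR1 : 1 ≤ R := Nat.one_le_pow _ _ Nat.card_pos
      have hRR : q ^ n = R * R := by rw [hm, pow_add]
      have hcount : (Finset.univ.filter fun u : Eˣ => u ^ (R - 1) = 1).card = R - 1 := by
        have h5 := IsCyclic.card_powMonoidHom_ker Eˣ (R - 1)
        rw [Nat.card_eq_fintype_card (α := Eˣ), hcard, hRR] at h5
        have h6 : R * R - 1 = (R - 1) * (R + 1) := by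
          zify [hR1, Nat.mul_le_mul hR1 hR1]; ring
        rw [h6, Nat.gcd_mul_right_left] at h5
        refine Eq.trans ?_ h5
        rw [Nat.card_eq_fintype_card, Fintype.card_subtype]
        congr 1
        ext u
        simp [MonoidHom.mem_ker]
      have h7 : ∀ u, s' u = 1 + (if u ^ (R - 1) = 1 then -(R : ℤ) - 1 else 0) := by
        intro u
        simp only [s', hm2]
        have : Even n := ⟨m, hm⟩
        simp only [this, true_and, hR]
        split_ifs <;> push_cast <;> ring
      simp_rw [h7]
      rw [Finset.sum_add_distrib, ← Finset.sum_filter, Finset.sum_const, Finset.sum_const, hcount, Finset.card_univ, hcard, hRR]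
      have h8 : 1 ≤ R * R := Nat.mul_le_mul hR1 hR1
      simp only [nsmul_eq_mul]
      push_cast [h8, hR1]
      ring
    · refine ⟨1, ?_⟩
      have h7 : ∀ u, s' u = 1 := fun u => by simp [s', he]
      simp_rw [h7]
      rw [Finset.sum_const, Finset.card_univ, hcard]
      simp only [nsmul_eq_mul]
      push_cast [hqn]
      ring
  choose k hk using h1
  obtain ⟨k0, hk0⟩ := h2
  refine ⟨∑ u, k u + k0, ?_⟩
  rw [mul_add, ← hk0, Finset.mul_sum, ← Finset.sum_add_distrib]
  refine Finset.sum_congr rfl fun u _ => ?_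
  rw [← hk]; ring
end

section
variable {F : Type} [Field F]

lemma sum_comm_unit {E : Type} [Finite F] [Field E] [Algebra F E] [Fintype E]
    (ih : ∀ (F' E' : Type) [Field F'] [Finite F'] [Field E'] [Algebra F' E'] [Fintype E'],
      Module.finrank F' E' < Module.finrank F E → ClaimA F' E')
    {ψ : AddChar F ℂ} (hψ : ∃ a, ψ a ≠ 1) {ξ : E} (hξ : Irr (LinearMap.mulLeft F ξ)) {P : Polynomial F} (hP : P ≠ 0)
    (u : E) (hu : (minpoly F u).natDegree ≠ 1) :
    ∑ g : E →ₗ[F] E, (if ∀ x, g (u * x) = u * g x then (if Nilp P g then 1 else 0) *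
        ψ (LinearMap.trace F E (g ∘ₗ LinearMap.mulLeft F ξ)) else 0) =
      (sfac (Nat.card F) (Module.finrank F E) (minpoly F u).natDegree : ℂ) * TF ψ ξ P := by
  have hi := Algebra.IsIntegral.isIntegral (R := F) u
  let K := IntermediateField.adjoin F {u}
  have hK : Module.finrank F K = (minpoly F u).natDegree := IntermediateField.adjoin.finrank hi
  have hmul : Module.finrank F K * Module.finrank K E = Module.finrank F E := Module.finrank_mul_finrank F K E
  have hpos : 0 < Module.finrank K E := Module.finrank_pos
  have hd : 0 < (minpoly F u).natDegree := minpoly.natDegree_pos hi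
  have hcs := comm_sum (K := K) ψ ξ P _ (comm_iff u)
  refine Eq.trans (Finset.sum_congr rfl fun g _ => ?_) (hcs.trans ?_)
  · congr
  have hlt : Module.finrank K E < Module.finrank F E := by
    rw [← hmul, hK]
    have : 2 ≤ (minpoly F u).natDegree := by omega
    nlinarith
  rw [ih K E hlt (trChar K ψ) (trChar_ne hψ) ξ hξ.tower _ ((Polynomial.map_ne_zero_iff (algebraMap F K).injective).mpr hP), TF_tower]
  have hc : Module.finrank F E / (minpoly F u).natDegree = Module.finrank K E := by
    rw [← hmul, hK, Nat.mul_div_cancel_left _ hd]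
  have hq : Nat.card K = Nat.card F ^ (minpoly F u).natDegree := by
    rw [← hK]; exact Module.natCard_eq_pow_finrank (K := F) (V := K)
  unfold sfac
  rw [hc, hq]
  push_cast
  rfl

def EndX (F E : Type) [Field F] [Field E] [Algebra F E] : Type := E →ₗ[F] E

noncomputable instance {E : Type} [Finite F] [Field E] [Algebra F E] [Finite E] : Fintype (EndX F E) :=
  inferInstanceAs (Fintype (E →ₗ[F] E))

lemma congr_A {E : Type} [Finite F] [Field E] [Algebra F E] [Fintype E]
    (ih : ∀ (F' E' : Type) [Field F'] [Finite F'] [Field E'] [Algebra F' E'] [Fintype E'],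
      Module.finrank F' E' < Module.finrank F E → ClaimA F' E')
    {ψ : AddChar F ℂ} (hψ : ∃ a, ψ a ≠ 1) {ξ : E} (hξ : Irr (LinearMap.mulLeft F ξ)) {P : Polynomial F} (hP : P ≠ 0) :
    ∃ z : ℂ, IsIntegral ℤ z ∧ ((Nat.card F : ℂ) - 1) * (SS (oneFam F) ψ (LinearMap.mulLeft F ξ) P -
      (-1) ^ (Module.finrank F E - 1) * (Nat.card F : ℂ) ^ (Module.finrank F E).choose 2 * TF ψ ξ P) =
      ((Nat.card F : ℂ) ^ (Module.finrank F E) - 1) * z := by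
  let mulE : Eˣ → (E ≃ₗ[F] E) := fun u => LinearEquiv.ofLinear (LinearMap.mulLeft F (u : E)) (LinearMap.mulLeft F ((u⁻¹ : Eˣ) : E))
    (by ext x; simp) (by ext x; simp)
  letI act : MulAction Eˣ (EndX F E) :=
    { smul := fun u (g : E →ₗ[F] E) => LinearMap.mulLeft F (u : E) ∘ₗ g ∘ₗ LinearMap.mulLeft F ((u⁻¹ : Eˣ) : E)
      one_smul := fun (g : E →ₗ[F] E) => by
        show LinearMap.mulLeft F ((1 : Eˣ) : E) ∘ₗ g ∘ₗ LinearMap.mulLeft F (((1 : Eˣ)⁻¹ : Eˣ) : E) = g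
        ext x; simp
      mul_smul := fun u v (g : E →ₗ[F] E) => by
        show LinearMap.mulLeft F ((u * v : Eˣ) : E) ∘ₗ g ∘ₗ LinearMap.mulLeft F (((u * v)⁻¹ : Eˣ) : E) =
          LinearMap.mulLeft F (u : E) ∘ₗ (LinearMap.mulLeft F (v : E) ∘ₗ g ∘ₗ LinearMap.mulLeft F ((v⁻¹ : Eˣ) : E)) ∘ₗ LinearMap.mulLeft F ((u⁻¹ : Eˣ) : E)
        ext x
        simp only [LinearMap.comp_apply, LinearMap.mulLeft_apply, mul_inv_rev, Units.val_mul, mul_assoc] }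
  let cj : Eˣ → (E →ₗ[F] E) → (E →ₗ[F] E) := fun u g => act.toSMul.smul u g
  have hsm : ∀ (u : Eˣ) (g : E →ₗ[F] E), (cj u g) = LinearMap.mulLeft F (u : E) ∘ₗ g ∘ₗ LinearMap.mulLeft F ((u⁻¹ : Eˣ) : E) := fun _ _ => rfl
  let w : (E →ₗ[F] E) → ℂ := fun g => (if Nilp P g then 1 else 0) * ψ (LinearMap.trace F E (g ∘ₗ LinearMap.mulLeft F ξ))
  have hsx : ∀ (u : Eˣ) (g : E →ₗ[F] E) x, (cj u g) ((u : E) * x) = u * g x := by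
    intro u g x
    rw [hsm]
    simp
  have hN1 : ∀ (u : Eˣ) (g : E →ₗ[F] E), Nilp P g → Nilp P (cj u g) := by
    intro u g h
    exact Nilp.conj (mulE u) (fun x => (hsx u g x).symm) h
  have hw : ∀ (u : Eˣ) (g : E →ₗ[F] E), w (cj u g) = w g := by
    intro u g
    have h1 : Nilp P (cj u g) ↔ Nilp P g := by
      refine ⟨fun h => ?_, hN1 u g⟩
      have := hN1 u⁻¹ _ h
      have h3 : cj u⁻¹ (cj u g) = g := inv_smul_smul (G := Eˣ) (α := EndX F E) u g
      rwa [h3] at this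
    have h2 : LinearMap.trace F E ((cj u g) ∘ₗ LinearMap.mulLeft F ξ) = LinearMap.trace F E (g ∘ₗ LinearMap.mulLeft F ξ) := by
      rw [hsm, LinearMap.comp_assoc, LinearMap.trace_comp_comm', LinearMap.comp_assoc, LinearMap.comp_assoc]
      congr 2
      ext x
      simp only [LinearMap.comp_apply, LinearMap.mulLeft_apply]
      rw [mul_left_comm ξ, ← mul_assoc, Units.inv_mul, one_mul]
    simp only [w, h1, h2]
  obtain ⟨z, hz, hsum⟩ := burnside_integral (G := Eˣ) (X := EndX F E) w hw (fun g => by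
    simp only [w]
    refine IsIntegral.mul ?_ (isIntegral_char _ _)
    split_ifs
    · exact isIntegral_one
    · exact isIntegral_zero)
  have hfix : ∀ (u : Eˣ) (g : E →ₗ[F] E), cj u g = g ↔ ∀ x, g ((u : E) * x) = u * g x := by
    intro u g
    constructor
    · intro h x
      conv_lhs => rw [← h]
      exact hsx u g x
    · intro h
      refine LinearMap.ext fun x => ?_
      rw [hsm]
      simp only [LinearMap.comp_apply, LinearMap.mulLeft_apply]
      rw [← h]
      simp
  have hsum : ∑ u : Eˣ, (∑ g : E →ₗ[F] E, if ∀ x, g ((u : E) * x) = u * g x then w g else 0) = (Fintype.card Eˣ : ℂ) * z := by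
    rw [← hsum]
    refine Finset.sum_congr rfl fun u _ => ?_
    refine Finset.sum_congr rfl fun g _ => ?_
    exact if_congr (hfix u g).symm rfl rfl
  set s : ℕ → ℤ := sfac (Nat.card F) (Module.finrank F E) with hs
  set L := SS (oneFam F) ψ (LinearMap.mulLeft F ξ) P with hL
  set T := TF ψ ξ P with hT
  have hin : ∀ u : Eˣ, (∑ g : E →ₗ[F] E, if ∀ x, g ((u : E) * x) = u * g x then w g else 0) =
      (s (minpoly F (u : E)).natDegree : ℂ) * T + (if (minpoly F (u : E)).natDegree = 1 then L - (s 1 : ℂ) * T else 0) := by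
    intro u
    by_cases hu : (minpoly F (u : E)).natDegree = 1
    · rw [if_pos hu, hu, add_sub_cancel, hL]
      unfold SS
      refine Finset.sum_congr rfl fun g _ => ?_
      rw [if_pos]
      · rfl
      · intro x
        obtain ⟨c, hc⟩ := minpoly.natDegree_eq_one_iff.mp hu
        rw [← hc, ← Algebra.smul_def, ← Algebra.smul_def, map_smul]
    · rw [if_neg hu, add_zero]
      exact sum_comm_unit ih hψ hξ hP _ hu
  simp_rw [hin] at hsum
  rw [Finset.sum_add_distrib, ← Finset.sum_mul] at hsum
  have hcnt : (∑ u : Eˣ, if (minpoly F (u : E)).natDegree = 1 then L - (s 1 : ℂ) * T else 0) =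
      ((Nat.card F : ℂ) - 1) * (L - (s 1 : ℂ) * T) := by
    haveI := Fintype.ofFinite F
    rw [← Finset.sum_filter, Finset.sum_const, nsmul_eq_mul]
    congr 1
    have : (Finset.univ.filter fun u : Eˣ => (minpoly F (u : E)).natDegree = 1) =
        Finset.univ.image (Units.map (algebraMap F E : F →* E)) := by
      ext u
      simp only [Finset.mem_filter, Finset.mem_univ, true_and, Finset.mem_image, minpoly.natDegree_eq_one_iff]
      constructor
      · rintro ⟨c, hc⟩
        have hc0 : c ≠ 0 := by
          rintro rfl
          rw [map_zero] at hc
          exact u.ne_zero hc.symm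
        exact ⟨Units.mk0 c hc0, Units.ext hc⟩
      · rintro ⟨c, rfl⟩
        exact ⟨c, rfl⟩
    have hinj : Function.Injective (Units.map (algebraMap F E : F →* E)) :=
      Units.map_injective (algebraMap F E).injective
    rw [this, Finset.card_image_of_injective _ hinj,
      Finset.card_univ, Fintype.card_units, Nat.card_eq_fintype_card, Nat.cast_sub Fintype.card_pos, Nat.cast_one]
  rw [hcnt] at hsum
  obtain ⟨k, hk⟩ := sum_sfac (F := F) E
  have hk' : ∑ u : Eˣ, (s (minpoly F (u : E)).natDegree : ℂ) = ((Nat.card F : ℂ) ^ (Module.finrank F E) - 1) * k := by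
    exact_mod_cast congrArg (Int.cast : ℤ → ℂ) hk
  rw [hk'] at hsum
  have hcardU : (Fintype.card Eˣ : ℂ) = (Nat.card F : ℂ) ^ (Module.finrank F E) - 1 := by
    rw [Fintype.card_units, Nat.cast_sub Fintype.card_pos, ← Nat.card_eq_fintype_card,
      Module.natCard_eq_pow_finrank (K := F) (V := E)]
    push_cast
    rfl
  rw [hcardU] at hsum
  have hs1 : (s 1 : ℂ) = (-1) ^ (Module.finrank F E - 1) * (Nat.card F : ℂ) ^ (Module.finrank F E).choose 2 := by
    rw [hs]
    simp [sfac]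
  rw [← hs1]
  refine ⟨z - k * T, hz.sub (IsIntegral.mul (isIntegral_algebraMap (R := ℤ) (A := ℂ) (x := k)) (isIntegral_TF ψ ξ P)), ?_⟩
  linear_combination hsum

end

section
variable {F : Type} [Field F]
variable {V : Type} [AddCommGroup V] [Module F V] [Finite V]

lemma trace_nondeg [Finite F] {g : V →ₗ[F] V} (h : ∀ y : V →ₗ[F] V, LinearMap.trace F V (g ∘ₗ y) = 0) : g = 0 := by
  ext v
  rw [LinearMap.zero_apply]
  refine (Module.forall_dual_apply_eq_zero_iff F (g v)).mp fun ℓ => ?_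
  have := h (ℓ.smulRight v)
  have h2 : g ∘ₗ LinearMap.smulRight ℓ v = LinearMap.smulRight ℓ (g v) := by ext x; simp
  rwa [h2, trace_smulRight] at this

lemma sum_tr [Finite F] {ψ : AddChar F ℂ} (hψ : ∃ a, ψ a ≠ 1) (g : V →ₗ[F] V) :
    ∑ y : V →ₗ[F] V, ψ (LinearMap.trace F V (g ∘ₗ y)) =
      if g = 0 then (Nat.card F : ℂ) ^ (Module.finrank F V * Module.finrank F V) else 0 := by
  split_ifs with hg
  · subst hg
    simp only [LinearMap.zero_comp, map_zero, AddChar.map_zero_eq_one, Finset.sum_const, Finset.card_univ, nsmul_eq_mul, mul_one]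
    rw [natCard_lin]
    push_cast
    rfl
  · let ℓ : (V →ₗ[F] V) →ₗ[F] F :=
      { toFun := fun y => LinearMap.trace F V (g ∘ₗ y)
        map_add' := fun a b => by rw [LinearMap.comp_add, map_add]
        map_smul' := fun c a => by rw [LinearMap.comp_smul, map_smul, RingHom.id_apply] }
    refine sum_char_lin hψ ℓ ?_
    intro h0
    exact hg (trace_nondeg fun y => LinearMap.congr_fun h0 y)

lemma parseval [Finite F] {ψ : AddChar F ℂ} (hψ : ∃ a, ψ a ≠ 1) (c : (V →ₗ[F] V) → ℂ) :
    ∑ y : V →ₗ[F] V, ‖∑ g, c g * ψ (LinearMap.trace F V (g ∘ₗ y))‖ ^ 2 =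
      (Nat.card F : ℝ) ^ (Module.finrank F V * Module.finrank F V) * ∑ g, ‖c g‖ ^ 2 := by
  have key : ∑ y : V →ₗ[F] V, ((∑ g, c g * ψ (LinearMap.trace F V (g ∘ₗ y))) *
      (starRingEnd ℂ) (∑ g, c g * ψ (LinearMap.trace F V (g ∘ₗ y)))) =
      (Nat.card F : ℂ) ^ (Module.finrank F V * Module.finrank F V) * ∑ g, c g * (starRingEnd ℂ) (c g) := by
    have h1 : ∀ y : V →ₗ[F] V, ((∑ g, c g * ψ (LinearMap.trace F V (g ∘ₗ y))) *
      (starRingEnd ℂ) (∑ g, c g * ψ (LinearMap.trace F V (g ∘ₗ y)))) =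
        ∑ g, ∑ g', c g * (starRingEnd ℂ) (c g') * ψ (LinearMap.trace F V ((g - g') ∘ₗ y)) := by
      intro y
      rw [map_sum, Finset.sum_mul_sum]
      refine Finset.sum_congr rfl fun g _ => Finset.sum_congr rfl fun g' _ => ?_
      haveI := Fintype.ofFinite F
      rw [map_mul, ← AddChar.map_neg_eq_conj, LinearMap.sub_comp, map_sub, sub_eq_add_neg, AddChar.map_add_eq_mul]
      ring
    simp_rw [h1]
    rw [Finset.sum_comm, Finset.mul_sum]
    refine Finset.sum_congr rfl fun g _ => ?_
    rw [Finset.sum_comm]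
    simp_rw [← Finset.mul_sum, sum_tr hψ, sub_eq_zero]
    rw [Finset.sum_eq_single g]
    · rw [if_pos rfl]; ring
    · intro b _ hb; rw [if_neg (Ne.symm hb), mul_zero]
    · simp
  simp_rw [Complex.mul_conj'] at key
  exact_mod_cast key

lemma conj_of_aeval [Finite F] {P : Polynomial F} (hP : Irreducible P) {g g' : V →ₗ[F] V}
    (hg : Polynomial.aeval g P = 0) (hg' : Polynomial.aeval g' P = 0) :
    ∃ h : V ≃ₗ[F] V, ∀ v, h (g v) = g' (h v) := by
  haveI : Fact (Irreducible P) := ⟨hP⟩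
  haveI : Fact (P ≠ 0) := ⟨hP.ne_zero⟩
  haveI : Finite (AdjoinRoot P) := inferInstance
  haveI : Module.Finite F (AdjoinRoot P) := Module.Finite.of_finite
  obtain ⟨i1, h1, t1⟩ := exists_mod P g hg
  have key : ∀ (W : Type) [AddCommGroup W] [Module F W] [Finite W] (e : V ≃ₗ[F] W) (g' : W →ₗ[F] W),
      Polynomial.aeval g' P = 0 → ∃ h : V ≃ₗ[F] W, ∀ v, h (g v) = g' (h v) := by
    intro W _ _ _ e g' hg'
    obtain ⟨i2, h2, t2⟩ := exists_mod P g' hg'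
    have hfr : Module.finrank (AdjoinRoot P) V = Module.finrank (AdjoinRoot P) W := by
      have a1 := Module.finrank_mul_finrank F (AdjoinRoot P) V
      have a2 := Module.finrank_mul_finrank F (AdjoinRoot P) W
      rw [← e.finrank_eq, ← a1] at a2
      exact (Nat.eq_of_mul_eq_mul_left Module.finrank_pos a2).symm
    let h := LinearEquiv.ofFinrankEq V W hfr
    refine ⟨h.restrictScalars F, fun v => ?_⟩
    have := h.map_smul (AdjoinRoot.mk P Polynomial.X) v
    rw [h1, h2, Polynomial.aeval_X, Polynomial.aeval_X] at this
    exact this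
  exact key V (LinearEquiv.refl F V) g' hg'

lemma card_Z [Finite F] {P : Polynomial F} (hP : Irreducible P) {g : V →ₗ[F] V}
    (hg : Polynomial.aeval g P = 0) (b : ℕ) (hb : Module.finrank F V = P.natDegree * b) :
    Nat.card {h : V ≃ₗ[F] V // ∀ v, h (g v) = g (h v)} =
      ∏ i : Fin b, ((Nat.card F ^ P.natDegree) ^ b - (Nat.card F ^ P.natDegree) ^ (i : ℕ)) := by
  haveI : Fact (Irreducible P) := ⟨hP⟩
  haveI : Fact (P ≠ 0) := ⟨hP.ne_zero⟩
  haveI : Finite (AdjoinRoot P) := inferInstance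
  haveI : Module.Finite F (AdjoinRoot P) := Module.Finite.of_finite
  haveI := Fintype.ofFinite (AdjoinRoot P)
  have hd : Module.finrank F (AdjoinRoot P) = P.natDegree :=
    (AdjoinRoot.powerBasis hP.ne_zero).finrank
  obtain ⟨i1, h1, t1⟩ := exists_mod P g hg
  have hfr : Module.finrank (AdjoinRoot P) V = b := by
    have a1 := Module.finrank_mul_finrank F (AdjoinRoot P) V
    rw [hd, hb] at a1
    exact Nat.eq_of_mul_eq_mul_left hP.natDegree_pos a1
  have e : {h : V ≃ₗ[F] V // ∀ v, h (g v) = g (h v)} ≃ (V ≃ₗ[AdjoinRoot P] V) :=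
    { toFun := fun S =>
        { S.1 with
          map_smul' := by
            intro c v
            obtain ⟨Q, rfl⟩ := AdjoinRoot.mk_surjective c
            rw [h1, RingHom.id_apply, h1]
            exact (aeval_apply_of_comm (s := S.1.toLinearMap) (fun x => (S.2 x).symm) Q v).symm }
      invFun := fun T => ⟨T.restrictScalars F, by
        intro v
        have := T.map_smul (AdjoinRoot.mk P Polynomial.X) v
        rw [h1, h1, Polynomial.aeval_X] at this
        exact this⟩
      left_inv := fun S => rfl
      right_inv := fun S => rfl }
  rw [Nat.card_congr e]
  let bs := Module.finBasisOfFinrankEq (AdjoinRoot P) V hfr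
  rw [← Nat.card_congr (LinearMap.GeneralLinearGroup.generalLinearEquiv (AdjoinRoot P) V).toEquiv,
    ← Nat.card_congr (Matrix.GeneralLinearGroup.toLin' bs).toEquiv, Matrix.card_GL_field,
    ← Nat.card_eq_fintype_card, Module.natCard_eq_pow_finrank (K := F) (V := AdjoinRoot P), hd]

/-- conjugation by an automorphism -/
noncomputable def cjg (h : V ≃ₗ[F] V) (g : V →ₗ[F] V) : V →ₗ[F] V := (h : V →ₗ[F] V) ∘ₗ g ∘ₗ (h.symm : V →ₗ[F] V)

lemma cjg_eq_iff (h : V ≃ₗ[F] V) (g g' : V →ₗ[F] V) : cjg h g = g' ↔ ∀ v, h (g v) = g' (h v) := by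
  constructor
  · rintro rfl v
    simp [cjg]
  · intro H
    ext v
    simp [cjg, H]

lemma cjg_aeval (h : V ≃ₗ[F] V) (g : V →ₗ[F] V) (P : Polynomial F) :
    Polynomial.aeval (cjg h g) P = 0 ↔ Polynomial.aeval g P = 0 := by
  have key : ∀ (h : V ≃ₗ[F] V) (g g' : V →ₗ[F] V), (∀ v, h (g v) = g' (h v)) → Polynomial.aeval g P = 0 → Polynomial.aeval g' P = 0 := by
    intro h g g' H h0
    ext v
    have := aeval_apply_of_comm (A := g') (D := g) (s := (h : V →ₗ[F] V)) (fun x => (H x).symm) P (h.symm v)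
    rw [h0] at this
    simpa using this
  refine ⟨key h.symm _ _ fun v => ?_, key h _ _ ((cjg_eq_iff h g _).mp rfl)⟩
  simp [cjg]

lemma orb_sum [Finite F] {P : Polynomial F} (hP : Irreducible P) {x : V →ₗ[F] V}
    (hx : Polynomial.aeval x P = 0) (φ : (V →ₗ[F] V) → ℂ) :
    ∑ h : V ≃ₗ[F] V, φ (cjg h x) = (Nat.card {h : V ≃ₗ[F] V // ∀ v, h (x v) = x (h v)} : ℂ) *
      ∑ g, (if Polynomial.aeval g P = 0 then 1 else 0) * φ g := by
  have h1 : ∀ h : V ≃ₗ[F] V, φ (cjg h x) = ∑ g : V →ₗ[F] V, if cjg h x = g then φ g else 0 := by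
    intro h; simp
  simp_rw [h1]
  rw [Finset.sum_comm, Finset.mul_sum]
  refine Finset.sum_congr rfl fun g _ => ?_
  by_cases hg : Polynomial.aeval g P = 0
  · rw [if_pos hg, one_mul, ← Finset.sum_filter, Finset.sum_const, nsmul_eq_mul]
    congr 2
    obtain ⟨k, hk⟩ := conj_of_aeval hP hx hg
    rw [← Fintype.card_subtype, ← Nat.card_eq_fintype_card]
    refine Nat.card_congr ⟨fun h => ⟨h.1.trans k.symm, ?_⟩, fun h => ⟨h.1.trans k, ?_⟩, ?_, ?_⟩
    · intro v
      have h2 := (cjg_eq_iff h.1 x g).mp h.2 v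
      simp only [LinearEquiv.trans_apply]
      rw [h2, LinearEquiv.symm_apply_eq, hk, LinearEquiv.apply_symm_apply]
    · rw [cjg_eq_iff]
      intro v
      simp only [LinearEquiv.trans_apply]
      rw [h.2, hk]
    · intro h; ext v; simp
    · intro h; ext v; simp
  · rw [if_neg hg, zero_mul, mul_zero]
    refine Finset.sum_eq_zero fun h _ => ?_
    rw [if_neg]
    rintro rfl
    exact hg ((cjg_aeval h x P).mpr hx)

lemma card_cjg [Finite F] [Nontrivial V] {y : V →ₗ[F] V} (hy : Irr y) (y' : V →ₗ[F] V) :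
    (Finset.univ.filter fun h : V ≃ₗ[F] V => cjg h y = y').card ≤ Nat.card F ^ (Module.finrank F V) - 1 := by
  obtain ⟨v0, hv0⟩ := exists_ne (0 : V)
  haveI := Fintype.ofFinite V
  have hc : (Finset.univ.erase (0 : V)).card = Nat.card F ^ (Module.finrank F V) - 1 := by
    rw [Finset.card_erase_of_mem (Finset.mem_univ _), Finset.card_univ, ← Nat.card_eq_fintype_card,
      Module.natCard_eq_pow_finrank (K := F) (V := V)]
  rw [← hc]
  refine Finset.card_le_card_of_injOn (fun h => h v0) (fun h _ => ?_) ?_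
  · simp [hv0]
  · intro h hh h' hh' he
    simp only [Finset.coe_filter, Finset.mem_univ, true_and, Set.mem_setOf_eq, cjg_eq_iff] at hh hh'
    simp only at he
    have hW := hy (LinearMap.eqLocus (h : V →ₗ[F] V) (h' : V →ₗ[F] V)) (fun x hx => by
      rw [LinearMap.mem_eqLocus] at hx ⊢
      simp only [LinearEquiv.coe_coe] at hx ⊢
      rw [hh, hh', hx])
    have hm : v0 ∈ LinearMap.eqLocus (h : V →ₗ[F] V) (h' : V →ₗ[F] V) := he
    rcases hW with hW | hW
    · rw [hW] at hm
      exact absurd ((Submodule.mem_bot F).mp hm) hv0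
    · ext v
      have : v ∈ LinearMap.eqLocus (h : V →ₗ[F] V) (h' : V →ₗ[F] V) := by rw [hW]; trivial
      exact this

lemma trace_cjg (h : V ≃ₗ[F] V) (g y : V →ₗ[F] V) :
    LinearMap.trace F V (cjg h g ∘ₗ cjg h y) = LinearMap.trace F V (g ∘ₗ y) := by
  have : cjg h g ∘ₗ cjg h y = h.conj (g ∘ₗ y) := by
    ext v; simp [cjg, LinearEquiv.conj_apply]
  rw [this, LinearMap.trace_conj']

noncomputable def cjgEquiv (h : V ≃ₗ[F] V) : (V →ₗ[F] V) ≃ (V →ₗ[F] V) :=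
  ⟨cjg h, cjg h.symm, fun g => by ext v; simp [cjg], fun g => by ext v; simp [cjg]⟩

lemma orb_bound [Finite F] [Nontrivial V] {ψ : AddChar F ℂ} (hψ : ∃ a, ψ a ≠ 1) {y : V →ₗ[F] V} (hy : Irr y)
    {P : Polynomial F} (hP : Irreducible P) {x : V →ₗ[F] V} (hx : Polynomial.aeval x P = 0) :
    ‖∑ g : V →ₗ[F] V, (if Polynomial.aeval g P = 0 then 1 else 0) * ψ (LinearMap.trace F V (g ∘ₗ y))‖ ^ 2 *
      (Nat.card {h : V ≃ₗ[F] V // ∀ v, h (x v) = x (h v)} : ℝ) ≤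
      ((Nat.card F : ℝ) ^ (Module.finrank F V) - 1) * (Nat.card F : ℝ) ^ (Module.finrank F V * Module.finrank F V) := by
  set O : (V →ₗ[F] V) → ℂ := fun y => ∑ g : V →ₗ[F] V, (if Polynomial.aeval g P = 0 then 1 else 0) * ψ (LinearMap.trace F V (g ∘ₗ y)) with hO
  set G0 : ℝ := ∑ g : V →ₗ[F] V, if Polynomial.aeval g P = 0 then 1 else 0 with hG0
  set Z : ℕ := Nat.card {h : V ≃ₗ[F] V // ∀ v, h (x v) = x (h v)} with hZ
  have hq1 : 1 ≤ Nat.card F ^ (Module.finrank F V) := Nat.one_le_pow _ _ Nat.card_pos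
  have hinv : ∀ h : V ≃ₗ[F] V, O (cjg h y) = O y := by
    intro h
    simp only [hO]
    rw [← Equiv.sum_comp (cjgEquiv h)]
    refine Finset.sum_congr rfl fun g _ => ?_
    show (if Polynomial.aeval (cjg h g) P = 0 then (1 : ℂ) else 0) * ψ (LinearMap.trace F V (cjg h g ∘ₗ cjg h y)) = _
    rw [trace_cjg]
    simp only [cjg_aeval]
  have h1 : ∑ y' : V →ₗ[F] V, ‖O y'‖ ^ 2 = (Nat.card F : ℝ) ^ (Module.finrank F V * Module.finrank F V) * G0 := by
    rw [parseval hψ]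
    congr 1
    refine Finset.sum_congr rfl fun g _ => ?_
    split_ifs <;> simp
  have h2 : (Fintype.card (V ≃ₗ[F] V) : ℝ) * ‖O y‖ ^ 2 ≤ ((Nat.card F : ℝ) ^ (Module.finrank F V) - 1) *
      ∑ y' : V →ₗ[F] V, ‖O y'‖ ^ 2 := by
    have a1 : (Fintype.card (V ≃ₗ[F] V) : ℝ) * ‖O y‖ ^ 2 = ∑ h : V ≃ₗ[F] V, ∑ y' : V →ₗ[F] V, if cjg h y = y' then ‖O y'‖ ^ 2 else 0 := by
      simp_rw [Finset.sum_ite_eq, Finset.mem_univ, if_true, hinv]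
      rw [Finset.sum_const, Finset.card_univ, nsmul_eq_mul]
    rw [a1, Finset.sum_comm, Finset.mul_sum]
    refine Finset.sum_le_sum fun y' _ => ?_
    rw [← Finset.sum_filter, Finset.sum_const, nsmul_eq_mul]
    refine mul_le_mul_of_nonneg_right ?_ (by positivity)
    have := card_cjg hy y'
    have h3 : ((Finset.univ.filter fun h : V ≃ₗ[F] V => cjg h y = y').card : ℝ) ≤ ((Nat.card F ^ (Module.finrank F V) - 1 : ℕ) : ℝ) := by
      exact_mod_cast this
    rw [Nat.cast_sub hq1] at h3
    exact_mod_cast h3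
  have h4 : (Fintype.card (V ≃ₗ[F] V) : ℝ) = Z * G0 := by
    have := orb_sum hP hx (fun _ => 1)
    simp only [Finset.sum_const, Finset.card_univ, nsmul_eq_mul, mul_one] at this
    rw [hG0, hZ]
    exact_mod_cast this
  have hpos : 0 < G0 := by
    have : (0 : ℝ) < Fintype.card (V ≃ₗ[F] V) := by exact_mod_cast Fintype.card_pos
    rw [h4] at this
    by_contra hc
    have hZ0 : (0 : ℝ) ≤ Z := by positivity
    nlinarith
  rw [h1, h4] at h2
  refine le_of_mul_le_mul_right ?_ hpos
  calc ‖O y‖ ^ 2 * (Z : ℝ) * G0 = Z * G0 * ‖O y‖ ^ 2 := by ring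
    _ ≤ _ := h2
    _ = _ := by ring

end

section
variable {F : Type} [Field F]

noncomputable def mfac (Q b : ℕ) : ℕ := ∏ i ∈ Finset.range b, (Q ^ (i + 1) - 1)

lemma prod_GL (Q b : ℕ) (hQ : 0 < Q) : ∏ i : Fin b, (Q ^ b - Q ^ (i : ℕ)) = Q ^ b.choose 2 * mfac Q b := by
  rw [Fin.prod_univ_eq_prod_range (fun i => Q ^ b - Q ^ i) b]
  have h1 : ∀ i ∈ Finset.range b, Q ^ b - Q ^ i = Q ^ i * (Q ^ (b - i) - 1) := by
    intro i hi
    have hi' : i ≤ b := (Finset.mem_range.mp hi).le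
    rw [Nat.mul_sub, mul_one, ← pow_add, Nat.add_sub_cancel' hi']
  rw [Finset.prod_congr rfl h1, Finset.prod_mul_distrib, Finset.prod_pow_eq_pow_sum, Finset.sum_range_id, Nat.choose_two_right]
  congr 1
  rw [mfac, ← Finset.prod_range_reflect]
  refine Finset.prod_congr rfl fun i hi => ?_
  have : i < b := Finset.mem_range.mp hi
  congr 2
  omega

lemma mfac_coprime (Q b k : ℕ) (hQ : 0 < Q) : Nat.Coprime (Q ^ k) (mfac Q b) := by
  refine Nat.Coprime.pow_left _ (Nat.Coprime.prod_right fun i _ => ?_)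
  have h1 : Q ^ (i + 1) = (Q ^ (i + 1) - 1) + 1 := (Nat.sub_add_cancel (Nat.one_le_pow _ _ hQ)).symm
  have h2 : Nat.Coprime (Q ^ (i + 1)) (Q ^ (i + 1) - 1) := by
    conv_lhs => rw [h1]
    simp
  exact Nat.Coprime.coprime_dvd_left (dvd_pow_self Q (Nat.succ_ne_zero i)) h2

lemma mfac_bound (Q b : ℕ) (hQ : 4 ≤ Q) : (2 * (Q : ℝ) ^ b + 1) * (Q : ℝ) ^ (b + 1).choose 2 ≤ 3 * (mfac Q b : ℝ) * (Q : ℝ) ^ b := by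
  have hQ' : (4 : ℝ) ≤ Q := by exact_mod_cast hQ
  induction b with
  | zero => simp [mfac]; norm_num
  | succ b ih =>
    have h1 : 1 ≤ Q ^ (b + 1) := Nat.one_le_pow _ _ (by omega)
    have h2 : (mfac Q (b + 1) : ℝ) = mfac Q b * ((Q : ℝ) ^ (b + 1) - 1) := by
      have : mfac Q (b + 1) = mfac Q b * (Q ^ (b + 1) - 1) := Finset.prod_range_succ _ _
      rw [this, Nat.cast_mul, Nat.cast_sub h1, Nat.cast_pow, Nat.cast_one]
    have h3 : (b + 1 + 1).choose 2 = (b + 1) + (b + 1).choose 2 := by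
      rw [Nat.choose_succ_succ' (b + 1) 1, Nat.choose_one_right]
    rw [h2, h3, pow_add (Q : ℝ) (b + 1)]
    have hx : (1 : ℝ) ≤ (Q : ℝ) ^ b := one_le_pow₀ (by linarith)
    rw [pow_succ (Q : ℝ) b]
    set x := (Q : ℝ) ^ b
    set M := (Q : ℝ) ^ (b + 1).choose 2
    set m := (mfac Q b : ℝ)
    have hM : 0 ≤ M := by positivity
    have hxQ : 1 ≤ x * Q := by nlinarith
    have h4 : (2 * x + 1) * M * ((x * Q - 1) * Q) ≤ 3 * m * x * ((x * Q - 1) * Q) :=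
      mul_le_mul_of_nonneg_right ih (by nlinarith)
    have h5 : (2 * (x * Q) + 1) * (x * Q * M) ≤ (2 * x + 1) * M * ((x * Q - 1) * Q) := by
      have : (2 * (x * Q) + 1) * (x * Q) ≤ (2 * x + 1) * ((x * Q - 1) * Q) := by
        have : (2 * (x * Q) + 1) * x ≤ (2 * x + 1) * (x * Q - 1) := by nlinarith
        nlinarith
      nlinarith
    calc _ ≤ _ := h5
      _ ≤ _ := h4
      _ = _ := by ring

lemma geo_bound (q n : ℕ) (hq : 2 ≤ q) (hn : 3 ≤ n) : q ^ (n - 1) + n ≤ ∑ i ∈ Finset.range n, q ^ i := by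
  induction n, hn using Nat.le_induction with
  | base => simp [Finset.sum_range_succ]; omega
  | succ n hn ih =>
    rw [Finset.sum_range_succ, Nat.add_sub_cancel]
    have : 1 ≤ q ^ (n - 1) := Nat.one_le_pow _ _ (by omega)
    omega

lemma norm_bound (q n : ℕ) (hq : 2 ≤ q) (hn : 3 ≤ n) (s T : ℂ) (hs : 2 * ‖s‖ ^ 2 ≤ 3 * ((q : ℝ) ^ n - 1)) (hT : ‖T‖ ≤ n) :
    ‖s - T‖ < ((∑ i ∈ Finset.range n, q ^ i : ℕ) : ℝ) := by
  have h1 : ((q ^ (n - 1) + n : ℕ) : ℝ) ≤ ((∑ i ∈ Finset.range n, q ^ i : ℕ) : ℝ) := by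
    exact_mod_cast geo_bound q n hq hn
  have hq' : (2 : ℝ) ≤ q := by exact_mod_cast hq
  have h2 : ‖s‖ < (q : ℝ) ^ (n - 1) := by
    refine lt_of_pow_lt_pow_left₀ 2 (by positivity) ?_
    have h3 : (q : ℝ) ^ (n + 1) ≤ ((q : ℝ) ^ (n - 1)) ^ 2 := by
      rw [← pow_mul]
      exact pow_le_pow_right₀ (by linarith) (by omega)
    have h4 : (2 : ℝ) * (q : ℝ) ^ n ≤ (q : ℝ) ^ (n + 1) := by
      rw [pow_succ, mul_comm]
      exact mul_le_mul_of_nonneg_left hq' (by positivity)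
    have h5 : (0 : ℝ) ≤ (q : ℝ) ^ n := by positivity
    linarith
  push_cast at h1
  have := norm_sub_le s T
  push_cast
  linarith

lemma integral_L [Finite F] {V : Type} [AddCommGroup V] [Module F V] [Finite V] [Nontrivial V] {ψ : AddChar F ℂ}
    (hψ : ∃ a, ψ a ≠ 1) (y x : V ≃ₗ[F] V) (hy : Irr (y : V →ₗ[F] V)) {P : Polynomial F} (hP : Irreducible P)
    (hx : Polynomial.aeval (x : V →ₗ[F] V) P = 0) (b : ℕ) (hb : Module.finrank F V = P.natDegree * (b + 1)) :
    IsIntegral ℤ (((Nat.card F : ℂ) ^ (Module.finrank F V).choose 2)⁻¹ * SS (oneFam F) ψ (y : V →ₗ[F] V) P) := by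
  set q := Nat.card F with hq
  have hq0 : 0 < q := Nat.card_pos
  set C := (Module.finrank F V).choose 2 with hC
  have h1 := integral_orb hψ y x
  have h2 : ∀ z : V ≃ₗ[F] V, ψ (trE (y * (z * x * z⁻¹))) = (fun g => ψ (LinearMap.trace F V (g ∘ₗ (y : V →ₗ[F] V)))) (cjg z (x : V →ₗ[F] V)) := by
    intro z
    simp only
    rw [LinearMap.trace_comp_comm']
    rfl
  rw [Finset.sum_congr rfl fun z _ => h2 z] at h1
  rw [orb_sum hP hx (fun g => ψ (LinearMap.trace F V (g ∘ₗ (y : V →ₗ[F] V)))), card_Z hP hx _ hb, prod_GL _ _ (Nat.pow_pos hq0)] at h1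
  set m := mfac (q ^ P.natDegree) (b + 1) with hm
  rw [SS_one_eq hψ hy hP b hb]
  set O : ℂ := ∑ g : V →ₗ[F] V, (if Polynomial.aeval g P = 0 then 1 else 0) * ψ (LinearMap.trace F V (g ∘ₗ (y : V →ₗ[F] V))) with hO
  have hOi : IsIntegral ℤ O := by
    refine IsIntegral.sum _ fun g _ => ?_
    refine IsIntegral.mul ?_ (isIntegral_char _ _)
    split_ifs
    · exact isIntegral_one
    · exact isIntegral_zero
  set D := P.natDegree * (b + 1).choose 2 with hD
  have hcop : Nat.Coprime (q ^ C) m := by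
    have := mfac_coprime (q ^ P.natDegree) (b + 1) C (Nat.pow_pos hq0)
    rw [← pow_mul] at this
    exact Nat.Coprime.coprime_dvd_left (pow_dvd_pow q (by nlinarith [hP.natDegree_pos])) this
  obtain ⟨u, v, huv⟩ := Nat.isCoprime_iff_coprime.mpr hcop
  have huv' : (u : ℂ) * (q : ℂ) ^ C + v * m = 1 := by exact_mod_cast huv
  have hqC : (q : ℂ) ^ C ≠ 0 := pow_ne_zero _ (by exact_mod_cast hq0.ne')
  have hZ : ∀ k : ℤ, IsIntegral ℤ (k : ℂ) := fun k => isIntegral_algebraMap (R := ℤ) (A := ℂ) (x := k)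
  have hN : ∀ k : ℕ, IsIntegral ℤ (k : ℂ) := fun k => by exact_mod_cast hZ k
  have hsgn : IsIntegral ℤ ((-1 : ℂ) ^ b) := (isIntegral_one.neg).pow b
  have e : ((q : ℂ) ^ C)⁻¹ * ((-1) ^ b * (q : ℂ) ^ D * O) =
      (-1) ^ b * ((u : ℂ) * ((q ^ D : ℕ) : ℂ) * O + v * (((q : ℂ) ^ C)⁻¹ * (((q ^ P.natDegree) ^ (b + 1).choose 2 * m : ℕ) * O))) := by
    have : ((q : ℂ) ^ C)⁻¹ = u + v * m * ((q : ℂ) ^ C)⁻¹ := by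
      field_simp
      rw [← huv']; ring
    rw [← pow_mul, ← hD]
    push_cast
    conv_lhs => rw [this]
    ring
  rw [e]
  exact hsgn.mul ((((hZ u).mul (hN _)).mul hOi).add ((hZ v).mul h1))

lemma bound_L [Finite F] {V : Type} [AddCommGroup V] [Module F V] [Finite V] [Nontrivial V] {ψ : AddChar F ℂ}
    (hψ : ∃ a, ψ a ≠ 1) {y x : V →ₗ[F] V} (hy : Irr y) {P : Polynomial F} (hP : Irreducible P) (hd : 2 ≤ P.natDegree)
    (hx : Polynomial.aeval x P = 0) (b : ℕ) (hb : Module.finrank F V = P.natDegree * (b + 1)) :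
    2 * ‖((Nat.card F : ℂ) ^ (Module.finrank F V).choose 2)⁻¹ * SS (oneFam F) ψ y P‖ ^ 2 ≤
      3 * ((Nat.card F : ℝ) ^ (Module.finrank F V) - 1) := by
  have h1 := orb_bound hψ hy hP hx
  set q := Nat.card F with hq
  have hq2 : 2 ≤ q := Finite.one_lt_card
  have hq0 : (0 : ℝ) < q := by exact_mod_cast (by omega : 0 < q)
  rw [card_Z hP hx _ hb, prod_GL _ _ (Nat.pow_pos (by omega))] at h1
  rw [SS_one_eq hψ hy hP b hb]
  set O : ℂ := ∑ g : V →ₗ[F] V, (if Polynomial.aeval g P = 0 then 1 else 0) * ψ (LinearMap.trace F V (g ∘ₗ y)) with hO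
  have hQ4 : 4 ≤ q ^ P.natDegree := by
    calc 4 = 2 ^ 2 := rfl
      _ ≤ q ^ 2 := Nat.pow_le_pow_left hq2 2
      _ ≤ _ := Nat.pow_le_pow_right (by omega) hd
  have h2 := mfac_bound (q ^ P.natDegree) (b + 1) hQ4
  set m := mfac (q ^ P.natDegree) (b + 1) with hm
  set n := Module.finrank F V with hn
  have hQr : ((q ^ P.natDegree : ℕ) : ℝ) ^ (b + 1) = (q : ℝ) ^ n := by
    push_cast; rw [← pow_mul, hb]
  rw [hQr] at h2
  have hn0 : 0 < n := Module.finrank_pos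
  set Q : ℝ := ((q ^ P.natDegree : ℕ) : ℝ) with hQ
  have hQpos : 0 < Q := by rw [hQ]; exact_mod_cast (by omega : 0 < q ^ P.natDegree)
  have hch : (b + 1 + 1).choose 2 = (b + 1) + (b + 1).choose 2 := by
    rw [Nat.choose_succ_succ' (b + 1) 1, Nat.choose_one_right]
  rw [hch, pow_add, hQr] at h2
  set c := Q ^ (b + 1).choose 2 with hc
  have hcpos : 0 < c := by positivity
  have hqn : 0 < (q : ℝ) ^ n := by positivity
  have h3 : 2 * (q : ℝ) ^ n * c ≤ 3 * m := by
    have : 2 * (q : ℝ) ^ n * c * (q : ℝ) ^ n ≤ 3 * m * (q : ℝ) ^ n := by nlinarith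
    exact le_of_mul_le_mul_right this hqn
  have hcc : (q : ℝ) ^ (P.natDegree * (b + 1).choose 2) = c := by
    rw [hc, hQ, pow_mul]; push_cast; rfl
  have hnorm : ‖((q : ℂ) ^ n.choose 2)⁻¹ * ((-1) ^ b * (q : ℂ) ^ (P.natDegree * (b + 1).choose 2) * O)‖ ^ 2 =
      ((q : ℝ) ^ (n.choose 2 + n.choose 2))⁻¹ * (c * c) * ‖O‖ ^ 2 := by
    rw [norm_mul, norm_mul, norm_mul, norm_inv, norm_pow, norm_pow, norm_pow, norm_neg, norm_one, one_pow, one_mul, Complex.norm_natCast, hcc, pow_add]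
    field_simp
  rw [hnorm]
  have hnn : n * n = n.choose 2 + n.choose 2 + n := by
    have := Nat.choose_two_right n
    have h4 : n * (n - 1) = 2 * n.choose 2 := by
      rw [this]
      exact (Nat.mul_div_cancel' (Nat.even_mul_pred_self n).two_dvd).symm
    obtain ⟨k, hk⟩ : ∃ k, n = k + 1 := ⟨n - 1, by omega⟩
    rw [hk] at h4 ⊢
    rw [Nat.add_sub_cancel] at h4
    nlinarith
  push_cast at h1
  have hQ' : ((q : ℝ) ^ P.natDegree) = Q := by rw [hQ]; push_cast; rfl
  rw [hQ', ← hc, hnn, pow_add] at h1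
  set A := (q : ℝ) ^ (n.choose 2 + n.choose 2) with hA
  have hApos : 0 < A := by positivity
  have hO0 : 0 ≤ ‖O‖ ^ 2 := by positivity
  have h5 : 2 * ((c * c) * ‖O‖ ^ 2) * (q : ℝ) ^ n ≤ 3 * ((q : ℝ) ^ n - 1) * A * (q : ℝ) ^ n := by
    calc 2 * ((c * c) * ‖O‖ ^ 2) * (q : ℝ) ^ n = (2 * (q : ℝ) ^ n * c) * (c * ‖O‖ ^ 2) := by ring
      _ ≤ (3 * m) * (c * ‖O‖ ^ 2) := mul_le_mul_of_nonneg_right h3 (by positivity)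
      _ = 3 * (‖O‖ ^ 2 * (c * m)) := by ring
      _ ≤ 3 * (((q : ℝ) ^ n - 1) * (A * (q : ℝ) ^ n)) := by linarith
      _ = _ := by ring
  have h6 := le_of_mul_le_mul_right h5 hqn
  calc 2 * (A⁻¹ * (c * c) * ‖O‖ ^ 2) = A⁻¹ * (2 * ((c * c) * ‖O‖ ^ 2)) := by ring
    _ ≤ A⁻¹ * (3 * ((q : ℝ) ^ n - 1) * A) := mul_le_mul_of_nonneg_left h6 (by positivity)
    _ = _ := by field_simp

end

section
variable {F : Type} [Field F]

lemma norm_TF {E : Type} [Finite F] [Field E] [Algebra F E] [Fintype E] (ψ : AddChar F ℂ) (ξ : E) {P : Polynomial F} (hP : P ≠ 0) :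
    ‖TF ψ ξ P‖ ≤ P.natDegree := by
  haveI := Fintype.ofFinite F
  unfold TF
  rw [← Finset.sum_filter]
  refine (norm_sum_le _ _).trans ?_
  have h1 : ∀ t ∈ Finset.univ.filter (fun t : E => Polynomial.aeval t P = 0), ‖ψ (Algebra.trace F E (ξ * t))‖ = 1 := by
    intro t _
    exact AddChar.norm_apply ψ _
  rw [Finset.sum_congr rfl h1, Finset.sum_const, nsmul_eq_mul, mul_one]
  have h2 : (Finset.univ.filter (fun t : E => Polynomial.aeval t P = 0)) ⊆ (P.aroots E).toFinset := by
    intro t ht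
    rw [Finset.mem_filter] at ht
    rw [Multiset.mem_toFinset, Polynomial.mem_aroots]
    exact ⟨hP, ht.2⟩
  have h3 := (Finset.card_le_card h2).trans ((Multiset.toFinset_card_le _).trans (Polynomial.card_roots' _))
  rw [Polynomial.natDegree_map] at h3
  exact_mod_cast h3

lemma exists_root {E : Type} [Finite F] [Field E] [Algebra F E] [Finite E] {P : Polynomial F} (hP : Irreducible P)
    (hd : P.natDegree ∣ Module.finrank F E) : ∃ t : E, Polynomial.aeval t P = 0 := by
  haveI : Fact (Irreducible P) := ⟨hP⟩
  haveI : Fact (P ≠ 0) := ⟨hP.ne_zero⟩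
  haveI : Finite (AdjoinRoot P) := inferInstance
  have hd' : Module.finrank F (AdjoinRoot P) = P.natDegree :=
    (AdjoinRoot.powerBasis hP.ne_zero).finrank
  rw [← hd'] at hd
  obtain ⟨e⟩ := FiniteField.nonempty_algHom_of_finrank_dvd hd
  refine ⟨e (AdjoinRoot.root P), ?_⟩
  rw [Polynomial.aeval_algHom_apply, AdjoinRoot.aeval_eq, AdjoinRoot.mk_self, map_zero]

lemma aeval_mulLeft {E : Type} [Field E] [Algebra F E] (t : E) (P : Polynomial F) :
    Polynomial.aeval (LinearMap.mulLeft F t) P = LinearMap.mulLeft F (Polynomial.aeval t P) := by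
  have : LinearMap.mulLeft F t = Algebra.lmul F E t := rfl
  rw [this, Polynomial.aeval_algHom_apply]
  rfl

lemma A_big {E : Type} [Finite F] [Field E] [Algebra F E] [Fintype E]
    (ih : ∀ (F' E' : Type) [Field F'] [Finite F'] [Field E'] [Algebra F' E'] [Fintype E'],
      Module.finrank F' E' < Module.finrank F E → ClaimA F' E')
    {ψ : AddChar F ℂ} (hψ : ∃ a, ψ a ≠ 1) {ξ : E} (hξ : Irr (LinearMap.mulLeft F ξ)) {P : Polynomial F}
    (hP : Irreducible P) (hn : 3 ≤ Module.finrank F E) (hd : 2 ≤ P.natDegree) (hdvd : P.natDegree ∣ Module.finrank F E) :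
    SS (oneFam F) ψ (LinearMap.mulLeft F ξ) P = (-1) ^ (Module.finrank F E - 1) *
      (Nat.card F : ℂ) ^ (Module.finrank F E).choose 2 * TF ψ ξ P := by
  obtain ⟨b', hb'⟩ := hdvd
  obtain ⟨b, rfl⟩ : ∃ b, b' = b + 1 := ⟨b' - 1, by
    rcases b' with _ | b'
    · omega
    · rfl⟩
  obtain ⟨t0, ht0⟩ := exists_root hP (E := E) ⟨_, hb'⟩
  have ht00 : t0 ≠ 0 := by
    rintro rfl
    have h1 : minpoly F (0 : E) ∣ P := minpoly.dvd F _ ht0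
    rw [minpoly.zero] at h1
    have h2 := (hP.dvd_iff.mp h1).resolve_left Polynomial.not_isUnit_X
    have := Polynomial.natDegree_eq_of_degree_eq (Polynomial.degree_eq_degree_of_associated h2)
    rw [Polynomial.natDegree_X] at this
    omega
  have hξ0 : ξ ≠ 0 := by
    rintro rfl
    have := hξ (Submodule.span F {1}) (fun x _ => by simp)
    rcases this with h | h
    · rw [Submodule.span_singleton_eq_bot] at h
      exact one_ne_zero h
    · have h2 := finrank_span_singleton (K := F) (one_ne_zero (α := E))
      rw [h, finrank_top] at h2
      omega
  let mulE : ∀ t : E, t ≠ 0 → (E ≃ₗ[F] E) := fun t ht => LinearEquiv.ofLinear (LinearMap.mulLeft F t) (LinearMap.mulLeft F t⁻¹)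
    (by ext x; simp [ht]) (by ext x; simp [ht])
  have hmul : ∀ t ht, (mulE t ht : E →ₗ[F] E) = LinearMap.mulLeft F t := fun t ht => rfl
  have hxa : Polynomial.aeval (LinearMap.mulLeft F t0) P = 0 := by
    rw [aeval_mulLeft, ht0, LinearMap.mulLeft_zero_eq_zero]
  set q := Nat.card F with hq
  set n := Module.finrank F E with hnn
  set C := n.choose 2 with hC
  have hq2 : 2 ≤ q := Finite.one_lt_card
  set Qn : ℕ := ∑ i ∈ Finset.range n, q ^ i with hQn
  have hQgeo : (Qn : ℂ) * ((q : ℂ) - 1) = (q : ℂ) ^ n - 1 := by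
    have := geom_sum_mul (q : ℂ) n
    rw [hQn]; exact_mod_cast this
  have hQpos : 0 < Qn := by
    rw [hQn]
    exact Finset.sum_pos (fun i _ => Nat.pow_pos (by omega)) ⟨0, Finset.mem_range.mpr (by omega)⟩
  have hQC : (Qn : ℂ) ≠ 0 := by exact_mod_cast hQpos.ne'
  have hqC : (q : ℂ) ^ C ≠ 0 := pow_ne_zero _ (by exact_mod_cast (by omega : q ≠ 0))
  -- the quantity
  let r : (E →ₗ[F] E) ⊕ E → ℚ := Sum.elim
    (fun g => (Qn : ℚ)⁻¹ * ((-1) ^ (n - 1) * ((q : ℚ) ^ C)⁻¹ * (if Nilp P g then 1 else 0)))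
    (fun t => (Qn : ℚ)⁻¹ * -(if Polynomial.aeval t P = 0 then 1 else 0))
  let a : (E →ₗ[F] E) ⊕ E → F := Sum.elim (fun g => LinearMap.trace F E (g ∘ₗ LinearMap.mulLeft F ξ))
    (fun t => Algebra.trace F E (ξ * t))
  have hform : ∀ ψ' : AddChar F ℂ, ∑ i, (r i : ℂ) * ψ' (a i) =
      (Qn : ℂ)⁻¹ * ((-1) ^ (n - 1) * (((q : ℂ) ^ C)⁻¹ * SS (oneFam F) ψ' (LinearMap.mulLeft F ξ) P) - TF ψ' ξ P) := by
    intro ψ'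
    rw [Fintype.sum_sum_type, mul_sub, sub_eq_add_neg]
    congr 1
    · unfold SS oneFam
      simp only [Finset.mul_sum]
      refine Finset.sum_congr rfl fun g _ => ?_
      simp only [r, a, Sum.elim_inl]
      split_ifs <;> push_cast <;> ring
    · unfold TF
      rw [← mul_neg, ← Finset.sum_neg_distrib, Finset.mul_sum]
      refine Finset.sum_congr rfl fun t _ => ?_
      simp only [r, a, Sum.elim_inr]
      split_ifs <;> push_cast <;> ring
  have hZ : ∀ k : ℤ, IsIntegral ℤ (k : ℂ) := fun k => isIntegral_algebraMap (R := ℤ) (A := ℂ) (x := k)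
  have hsgn : IsIntegral ℤ ((-1 : ℂ) ^ (n - 1)) := (isIntegral_one.neg).pow _
  have hsq : (-1 : ℂ) ^ (n - 1) * (-1 : ℂ) ^ (n - 1) = 1 := by
    rw [← mul_pow]; norm_num
  have hinteg : IsIntegral ℤ (∑ i, (r i : ℂ) * ψ (a i)) := by
    rw [hform]
    have hi := integral_L hψ (mulE ξ hξ0) (mulE t0 ht00) hξ hP hxa b hb'
    rw [hmul ξ hξ0] at hi
    obtain ⟨z, hz, hzz⟩ := congr_A ih hψ hξ hP.ne_zero
    set L := SS (oneFam F) ψ (LinearMap.mulLeft F ξ) P with hL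
    set T := TF ψ ξ P with hT
    have hsT : IsIntegral ℤ ((-1) ^ (n - 1) * (((q : ℂ) ^ C)⁻¹ * L) - T) := (hsgn.mul hi).sub (isIntegral_TF ψ ξ P)
    have hzz' : L - (-1) ^ (n - 1) * (q : ℂ) ^ C * T = Qn * z := by
      have hq1 : (q : ℂ) - 1 ≠ 0 := by
        rw [sub_ne_zero]; exact_mod_cast (by omega : q ≠ 1)
      refine mul_left_cancel₀ hq1 ?_
      rw [hzz, ← hQgeo]
      ring
    have hcop : Nat.Coprime (q ^ C) Qn := by
      refine Nat.Coprime.pow_left _ ?_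
      obtain ⟨k, hk⟩ : ∃ k, n = k + 1 := ⟨n - 1, by omega⟩
      rw [hQn, hk, Finset.sum_range_succ']
      have : ∀ i ∈ Finset.range k, q ^ (i + 1) = q * q ^ i := fun i _ => pow_succ' q i
      rw [Finset.sum_congr rfl this, ← Finset.mul_sum, pow_zero]
      simp
    obtain ⟨u, v, huv⟩ := Nat.isCoprime_iff_coprime.mpr hcop
    have huv' : (u : ℂ) * (q : ℂ) ^ C + v * Qn = 1 := by exact_mod_cast huv
    have e : (Qn : ℂ)⁻¹ * ((-1) ^ (n - 1) * (((q : ℂ) ^ C)⁻¹ * L) - T) =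
        u * ((-1) ^ (n - 1) * z) + v * ((-1) ^ (n - 1) * (((q : ℂ) ^ C)⁻¹ * L) - T) := by
      have h1 : (q : ℂ) ^ C * ((-1) ^ (n - 1) * (((q : ℂ) ^ C)⁻¹ * L) - T) = (-1) ^ (n - 1) * (Qn * z) := by
        rw [← hzz']
        field_simp
        linear_combination (q : ℂ) ^ C * T * hsq
      set X := (-1) ^ (n - 1) * (((q : ℂ) ^ C)⁻¹ * L) - T with hX
      rw [inv_mul_eq_iff_eq_mul₀ hQC]
      linear_combination (-X) * huv' + u * h1
    rw [e]
    exact ((hZ u).mul (hsgn.mul hz)).add ((hZ v).mul hsT)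
  have hlt : ∀ ψ' : AddChar F ℂ, (∃ a, ψ' a ≠ 1) → ‖∑ i, (r i : ℂ) * ψ' (a i)‖ < 1 := by
    intro ψ' hψ'
    rw [hform, norm_mul, norm_inv, Complex.norm_natCast, inv_mul_lt_iff₀ (by exact_mod_cast hQpos), mul_one]
    refine norm_bound q n hq2 hn _ _ ?_ ?_
    · rw [norm_mul, norm_pow, norm_neg, norm_one, one_pow, one_mul]
      exact bound_L hψ' hξ hP hd hxa b hb'
    · refine (norm_TF ψ' ξ hP.ne_zero).trans ?_
      exact_mod_cast Nat.le_of_dvd (by omega) ⟨_, hb'⟩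
  have hzero := conj_zero hψ r a hinteg hlt
  rw [hform] at hzero
  have h1 := (mul_eq_zero.mp hzero).resolve_left (inv_ne_zero hQC)
  have h2 := sub_eq_zero.mp h1
  rw [← h2]
  field_simp
  rw [pow_two, hsq, mul_one]

end

section
variable {F : Type} [Field F]
variable {E : Type} [Finite F] [Field E] [Algebra F E] [Fintype E]

lemma oneFam_isGL : IsGL (oneFam F) where
  conj := by intros; rfl
  one := by intros; rfl
  ext := by
    intros
    simp only [oneFam, Finset.sum_const, Finset.card_univ, nsmul_eq_mul, mul_one]
    rw [natCard_lin]
    push_cast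
    rfl

noncomputable def frob (F E : Type) [Field F] [Finite F] [Field E] [Algebra F E] : E →ₐ[F] E :=
  letI := Fintype.ofFinite F
  FiniteField.frobeniusAlgHom F E

lemma frob_apply (x : E) : frob F E x = x ^ Nat.card F := by
  letI := Fintype.ofFinite F
  unfold frob
  rw [FiniteField.coe_frobeniusAlgHom, Nat.card_eq_fintype_card]

lemma frob_eq_iff (x : E) : frob F E x = x ↔ x ∈ (algebraMap F E).range := by
  have := deg_dvd_iff (F := F) x 1
  rw [pow_one] at this
  rw [frob_apply, ← this, Nat.dvd_one, minpoly.natDegree_eq_one_iff]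

section two

lemma frob_frob (h2 : Module.finrank F E = 2) (x : E) : frob F E (frob F E x) = x := by
  rw [frob_apply, frob_apply, ← pow_mul, ← pow_two]
  have := Module.natCard_eq_pow_finrank (K := F) (V := E)
  rw [h2, Nat.card_eq_fintype_card (α := E)] at this
  rw [← this, FiniteField.pow_card]

lemma trace_two (h2 : Module.finrank F E = 2) (x : E) : algebraMap F E (Algebra.trace F E x) = x + frob F E x := by
  rw [FiniteField.algebraMap_trace_eq_sum_pow, h2, Finset.sum_range_succ, Finset.sum_range_one, frob_apply]
  simp

lemma norm_two (h2 : Module.finrank F E = 2) (x : E) : algebraMap F E (Algebra.norm F x) = x * frob F E x := by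
  rw [FiniteField.algebraMap_norm_eq_prod_pow, h2, Finset.prod_range_succ, Finset.prod_range_one, frob_apply]
  simp

lemma norm_count (h2 : Module.finrank F E = 2) (r : E) (hr : r ≠ 0) (hr' : frob F E r = r) :
    (Finset.univ.filter fun x : E => x * frob F E x = r).card = Nat.card F + 1 := by
  letI := Fintype.ofFinite F
  obtain ⟨r', rfl⟩ := (frob_eq_iff r).mp hr'
  have hr0 : r' ≠ 0 := by rintro rfl; simp at hr
  set N : Eˣ →* Fˣ := Units.map (Algebra.norm F) with hN
  have hsurj : Function.Surjective N := FiniteField.unitsMap_norm_surjective F E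
  have e1 : (Finset.univ.filter fun x : E => x * frob F E x = algebraMap F E r').card
      = (Finset.univ.filter fun x : Eˣ => N x = Units.mk0 r' hr0).card := by
    symm
    refine Finset.card_bij (fun x _ => (x : E)) ?_ ?_ ?_
    · intro x hx
      have hx := (Finset.mem_filter.mp hx).2
      refine Finset.mem_filter.mpr ⟨Finset.mem_univ _, ?_⟩
      rw [← norm_two h2]
      congr 1
      exact congrArg Units.val hx
    · intro a _ b _ h
      exact Units.ext h
    · intro x hx
      have hx := (Finset.mem_filter.mp hx).2
      have hx0 : x ≠ 0 := by rintro rfl; rw [zero_mul] at hx; exact hr hx.symm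
      refine ⟨Units.mk0 x hx0, Finset.mem_filter.mpr ⟨Finset.mem_univ _, ?_⟩, rfl⟩
      ext
      apply (algebraMap F E).injective
      simp only [hN, Units.coe_map, MonoidHom.coe_coe, Units.val_mk0]
      rw [← hx]
      exact norm_two h2 x
  rw [e1]
  have e2 : Fintype.card Eˣ = ∑ b : Fˣ, (Finset.univ.filter fun x : Eˣ => N x = b).card := by
    rw [← Finset.card_univ]
    exact Finset.card_eq_sum_card_fiberwise (fun _ _ => by simp)
  have e3 : ∀ b : Fˣ, (Finset.univ.filter fun x : Eˣ => N x = b).card =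
      (Finset.univ.filter fun x : Eˣ => N x = Units.mk0 r' hr0).card := fun b =>
    MonoidHom.card_fiber_eq_of_mem_range N (hsurj _) (hsurj _)
  rw [Finset.sum_congr rfl fun b _ => e3 b, Finset.sum_const, Finset.card_univ, smul_eq_mul] at e2
  rw [← Nat.card_eq_fintype_card, ← Nat.card_eq_fintype_card, Nat.card_units, Nat.card_units,
    Module.natCard_eq_pow_finrank (K := F) (V := E), h2] at e2
  have hq : 1 < Nat.card F := Finite.one_lt_card
  obtain ⟨q, hq'⟩ : ∃ q, Nat.card F = q + 1 := ⟨Nat.card F - 1, by omega⟩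
  rw [hq'] at e2 ⊢
  simp only [Nat.add_sub_cancel] at e2
  have : (q + 1) ^ 2 - 1 = q * (q + 1 + 1) := by
    have : (q + 1) ^ 2 = q * (q + 1 + 1) + 1 := by ring
    omega
  rw [this] at e2
  exact (Nat.eq_of_mul_eq_mul_left (by omega) e2).symm

end two

lemma irr_frob_ne {ξ : E} (hn : 2 ≤ Module.finrank F E) (hξ : Irr (LinearMap.mulLeft F ξ)) : frob F E ξ ≠ ξ := by
  intro h
  obtain ⟨a, rfl⟩ := (frob_eq_iff ξ).mp h
  have := hξ (F ∙ (1 : E)) (by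
    intro x hx
    have : LinearMap.mulLeft F (algebraMap F E a) x = a • x := by
      rw [LinearMap.mulLeft_apply, Algebra.smul_def]
    rw [this]
    exact Submodule.smul_mem _ _ hx)
  rcases this with h | h
  · rw [Submodule.span_singleton_eq_bot] at h
    exact one_ne_zero h
  · have h1 := finrank_span_singleton (K := F) (v := (1 : E)) one_ne_zero
    rw [h, finrank_top] at h1
    omega

noncomputable def M2 (t t' : E) : E →ₗ[F] E :=
  LinearMap.mulLeft F t + LinearMap.mulLeft F t' ∘ₗ (frob F E).toLinearMap

@[simp] lemma M2_apply (t t' x : E) : M2 (F := F) t t' x = t * x + t' * frob F E x := rfl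

lemma M2_inj {ξ : E} (hξ : frob F E ξ ≠ ξ) : Function.Injective fun p : E × E => M2 (F := F) p.1 p.2 := by
  rintro ⟨a, b⟩ ⟨c, d⟩ h
  have h1 := LinearMap.congr_fun h 1
  have h2 := LinearMap.congr_fun h ξ
  simp only [M2_apply, map_one, mul_one] at h1 h2
  have h3 : (b - d) * (frob F E ξ - ξ) = 0 := by linear_combination h2 - ξ * h1
  rcases mul_eq_zero.mp h3 with h3 | h3
  · have hb : b = d := sub_eq_zero.mp h3
    subst hb
    have ha : a = c := by linear_combination h1
    rw [ha]
  · exact absurd (sub_eq_zero.mp h3) hξ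

lemma M2_bij (h2 : Module.finrank F E = 2) {ξ : E} (hξ : frob F E ξ ≠ ξ) :
    Function.Bijective fun p : E × E => M2 (F := F) p.1 p.2 := by
  refine (Nat.bijective_iff_injective_and_card _).mpr ⟨M2_inj hξ, ?_⟩
  rw [Nat.card_prod, Nat.card_eq_fintype_card (α := E →ₗ[F] E), natCard_lin, h2,
    Module.natCard_eq_pow_finrank (K := F) (V := E), h2, ← pow_add]

lemma trace_M2 {ξ : E} (hξ : frob F E ξ ≠ ξ) (t t' s : E) :
    LinearMap.trace F E (M2 t t' ∘ₗ LinearMap.mulLeft F s) = Algebra.trace F E (s * t) := by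
  have key : ∀ c : E, LinearMap.trace F E (LinearMap.mulLeft F c ∘ₗ (frob F E).toLinearMap) = 0 := by
    intro c
    have hne : ξ - frob F E ξ ≠ 0 := sub_ne_zero.mpr hξ.symm
    set w := c / (ξ - frob F E ξ) with hw
    have e1 : LinearMap.mulLeft F c ∘ₗ (frob F E).toLinearMap =
        LinearMap.mulLeft F ξ ∘ₗ (LinearMap.mulLeft F w ∘ₗ (frob F E).toLinearMap) -
        (LinearMap.mulLeft F w ∘ₗ (frob F E).toLinearMap) ∘ₗ LinearMap.mulLeft F ξ := by
      ext x
      have : c = w * (ξ - frob F E ξ) := by rw [hw]; field_simp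
      simp only [LinearMap.comp_apply, LinearMap.sub_apply, LinearMap.mulLeft_apply, AlgHom.toLinearMap_apply, map_mul]
      linear_combination (frob F E x) * this
    rw [e1, map_sub, LinearMap.trace_comp_comm', sub_self]
  have e2 : M2 (F := F) t t' ∘ₗ LinearMap.mulLeft F s = LinearMap.mulLeft F (s * t) +
      LinearMap.mulLeft F (t' * frob F E s) ∘ₗ (frob F E).toLinearMap := by
    ext x
    simp only [LinearMap.comp_apply, LinearMap.add_apply, LinearMap.mulLeft_apply, AlgHom.toLinearMap_apply, M2_apply, map_mul]
    ring
  rw [e2, map_add, key, add_zero]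
  rfl

lemma A_two {ψ : AddChar F ℂ} (hψ : ∃ a, ψ a ≠ 1) (h2 : Module.finrank F E = 2) {ξ : E}
    (hξ : Irr (LinearMap.mulLeft F ξ)) {P : Polynomial F} (hP : Irreducible P) (hd : P.natDegree = 2) :
    SS (oneFam F) ψ (LinearMap.mulLeft F ξ) P = - (Nat.card F : ℂ) * TF ψ ξ P := by
  have hf := irr_frob_ne h2.ge hξ
  rw [SS_one_eq hψ hξ hP 0 (by rw [h2, hd])]
  simp only [pow_zero, zero_add, Nat.choose_eq_zero_of_lt (show 1 < 2 by norm_num), mul_zero, one_mul]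
  obtain ⟨a, b, c, hPe, ha⟩ : ∃ a b c : F, P = Polynomial.C a * Polynomial.X ^ 2 + Polynomial.C b * Polynomial.X + Polynomial.C c
      ∧ a ≠ 0 := by
    refine ⟨P.coeff 2, P.coeff 1, P.coeff 0, Polynomial.eq_quadratic_of_degree_le_two ?_, ?_⟩
    · exact Polynomial.natDegree_le_iff_degree_le.mp hd.le
    · rw [← hd]; exact Polynomial.leadingCoeff_ne_zero.mpr hP.ne_zero
  set σ := frob F E with hσ
  set a' := algebraMap F E a with ha'
  set b' := algebraMap F E b with hb'
  set c' := algebraMap F E c with hc'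
  have ha0 : a' ≠ 0 := by simpa [ha'] using ha
  have hσa : σ a' = a' := AlgHom.commutes _ _
  have hσb : σ b' = b' := AlgHom.commutes _ _
  have hσc : σ c' = c' := AlgHom.commutes _ _
  have hPt : ∀ t : E, Polynomial.aeval t P = a' * t ^ 2 + b' * t + c' := by
    intro t
    rw [hPe]
    simp [ha', hb', hc']
  have hσσ : ∀ x, σ (σ x) = x := frob_frob h2
  have hPg : ∀ t t' : E, Polynomial.aeval (M2 (F := F) t t') P =
      M2 (a' * (t ^ 2 + t' * σ t') + b' * t + c') (t' * (a' * (t + σ t) + b')) := by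
    intro t t'
    ext x
    rw [hPe]
    simp only [map_add, map_mul, Polynomial.aeval_C, Polynomial.aeval_X, map_pow, LinearMap.add_apply, Module.End.mul_apply,
      M2_apply, Module.algebraMap_end_apply, Algebra.smul_def, pow_two, ← hσ, hσσ]
    simp only [← ha', ← hb', ← hc']
    ring
  have hM0 : ∀ t t' : E, M2 (F := F) t t' = 0 ↔ t = 0 ∧ t' = 0 := by
    intro t t'
    constructor
    · intro h
      have := @M2_inj F _ E _ _ _ _ ξ hf (t, t') (0, 0) (by
        show M2 (F := F) t t' = M2 0 0
        rw [h]; ext x; simp)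
      exact Prod.mk.inj this
    · rintro ⟨rfl, rfl⟩
      ext x; simp
  have hroot : ∀ t : E, Polynomial.aeval t P = 0 → a' * (t + σ t) + b' = 0 := by
    intro t ht
    have h1 := ht
    rw [hPt] at h1
    have h3 := congrArg σ h1
    simp only [map_add, map_mul, map_pow, hσa, hσb, hσc, map_zero] at h3
    have h4 : (t - σ t) * (a' * (t + σ t) + b') = 0 := by linear_combination h1 - h3
    rcases mul_eq_zero.mp h4 with h4 | h4
    · exfalso
      obtain ⟨s, hs⟩ := (frob_eq_iff t).mp (sub_eq_zero.mp h4).symm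
      have hr : P.IsRoot s := by
        rw [← hs, Polynomial.aeval_algebraMap_apply] at ht
        simpa using ht
      have h5 := Polynomial.natDegree_eq_of_degree_eq_some (Polynomial.degree_eq_one_of_irreducible_of_root hP hr)
      rw [hd] at h5
      norm_num at h5
    · exact h4
  rw [← (Equiv.ofBijective _ (M2_bij h2 hf)).sum_comp, Fintype.sum_prod_type]
  simp only [Equiv.ofBijective_apply, hPg, hM0, trace_M2 hf]
  have hcnt : ∀ t : E, (∑ t' : E, if a' * (t ^ 2 + t' * σ t') + b' * t + c' = 0 ∧ t' * (a' * (t + σ t) + b') = 0 then (1 : ℂ) else 0)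
      = (if a' * (t + σ t) + b' = 0 then ((Nat.card F : ℂ) + 1) else 0) -
        (if Polynomial.aeval t P = 0 then (Nat.card F : ℂ) else 0) := by
    intro t
    by_cases h0 : a' * (t + σ t) + b' = 0
    · simp only [h0, mul_zero, and_true, if_true]
      have hiff : ∀ t' : E, a' * (t ^ 2 + t' * σ t') + b' * t + c' = 0 ↔ t' * σ t' = - Polynomial.aeval t P / a' := by
        intro t'
        rw [hPt, eq_div_iff ha0]
        constructor <;> intro h <;> linear_combination h
      simp only [hiff]
      by_cases h1 : Polynomial.aeval t P = 0
      · simp only [h1, neg_zero, zero_div, if_true, mul_eq_zero]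
        have : ∀ t' : E, (t' = 0 ∨ σ t' = 0) ↔ t' = 0 := fun t' => by simp
        simp only [this]
        simp
      · rw [if_neg h1, sub_zero, Finset.sum_boole, norm_count h2]
        · push_cast; rfl
        · exact div_ne_zero (neg_ne_zero.mpr h1) ha0
        · rw [← hσ, map_div₀, map_neg, hσa, hPt]
          congr 2
          simp only [map_add, map_mul, map_pow, hσa, hσb, hσc]
          linear_combination (σ t - t) * h0
    · have h1 : Polynomial.aeval t P ≠ 0 := fun h => h0 (hroot t h)
      rw [if_neg h0, if_neg h1, sub_zero]
      refine Finset.sum_eq_zero fun t' _ => if_neg ?_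
      rintro ⟨h3, h4⟩
      have ht' : t' = 0 := (mul_eq_zero.mp h4).resolve_right h0
      rw [ht'] at h3
      apply h1
      rw [hPt]
      linear_combination h3
  have hz : ∑ t : E, (if a' * (t + σ t) + b' = 0 then ψ (Algebra.trace F E (ξ * t)) else 0) = 0 := by
    obtain ⟨e, he⟩ := hψ
    set τ := Algebra.trace F E (ξ * (ξ - σ ξ)) with hτ
    have hτ0 : τ ≠ 0 := by
      intro h
      have := trace_two h2 (ξ * (ξ - σ ξ))
      rw [← hτ, h, map_zero, ← hσ, map_mul, map_sub, hσσ] at this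
      have : (ξ - σ ξ) ^ 2 = 0 := by linear_combination -this
      exact hf (sub_eq_zero.mp (pow_eq_zero_iff (two_ne_zero) |>.mp this)).symm
    set v := (e / τ) • (ξ - σ ξ) with hv
    have hσv : σ v = - v := by
      rw [hv, map_smul, map_sub, hσσ, ← smul_neg, neg_sub]
    have hψv : ψ (Algebra.trace F E (ξ * v)) = ψ e := by
      rw [hv, mul_smul_comm, map_smul, ← hτ, smul_eq_mul, div_mul_cancel₀ _ hτ0]
    set S := ∑ t : E, (if a' * (t + σ t) + b' = 0 then ψ (Algebra.trace F E (ξ * t)) else 0) with hS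
    have : S = ψ e * S := by
      refine (Equiv.sum_comp (Equiv.addRight v) _).symm.trans ?_
      rw [hS, Finset.mul_sum]
      refine Finset.sum_congr rfl fun t _ => ?_
      show (if a' * (t + v + σ (t + v)) + b' = 0 then ψ (Algebra.trace F E (ξ * (t + v))) else 0) = _
      rw [map_add σ, hσv, mul_add ξ, map_add (Algebra.trace F E), AddChar.map_add_eq_mul, hψv]
      have : t + v + (σ t + -v) = t + σ t := by ring
      rw [this]
      split_ifs <;> ring
    have h3 : (ψ e - 1) * S = 0 := by linear_combination -this
    exact (mul_eq_zero.mp h3).resolve_left (sub_ne_zero.mpr he)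
  have : ∀ t : E, ∑ t' : E, (if a' * (t ^ 2 + t' * σ t') + b' * t + c' = 0 ∧ t' * (a' * (t + σ t) + b') = 0 then (1 : ℂ) else 0) *
      ψ (Algebra.trace F E (ξ * t)) =
      (Nat.card F + 1) * (if a' * (t + σ t) + b' = 0 then ψ (Algebra.trace F E (ξ * t)) else 0) -
      Nat.card F * (if Polynomial.aeval t P = 0 then ψ (Algebra.trace F E (ξ * t)) else 0) := by
    intro t
    rw [← Finset.sum_mul, hcnt]
    split_ifs <;> ring
  rw [Finset.sum_congr rfl fun t _ => this t, Finset.sum_sub_distrib, ← Finset.mul_sum, hz, ← Finset.mul_sum]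
  unfold TF
  ring

lemma A_one {ψ : AddChar F ℂ} (hψ : ∃ a, ψ a ≠ 1) {ξ : E}
    (hξ : Irr (LinearMap.mulLeft F ξ)) {P : Polynomial F} (hP : Irreducible P) (hd : P.natDegree = 1) :
    SS (oneFam F) ψ (LinearMap.mulLeft F ξ) P = (-1) ^ (Module.finrank F E - 1) *
      (Nat.card F : ℂ) ^ (Module.finrank F E).choose 2 * TF ψ ξ P := by
  have hpos : 0 < Module.finrank F E := Module.finrank_pos
  rw [SS_one_eq hψ hξ hP (Module.finrank F E - 1) (by rw [hd]; omega)]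
  rw [hd, one_mul, Nat.sub_add_cancel hpos]
  congr 1
  obtain ⟨a, b, hab⟩ := Polynomial.exists_eq_X_add_C_of_natDegree_le_one hd.le
  have ha : a ≠ 0 := by
    rintro rfl
    rw [hab] at hd
    simp at hd
  unfold TF
  have hg : ∀ g : E →ₗ[F] E, Polynomial.aeval g P = 0 ↔ g = LinearMap.mulLeft F (algebraMap F E (-b / a)) := by
    intro g
    have e1 : ∀ x, Polynomial.aeval g P x = a • g x + b • x := by
      intro x
      rw [hab]
      simp [Module.algebraMap_end_apply]
    constructor
    · intro h
      ext x
      have := e1 x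
      rw [h, LinearMap.zero_apply] at this
      rw [LinearMap.mulLeft_apply, ← Algebra.smul_def]
      have h3 : a • (g x - (-b / a) • x) = 0 := by
        rw [smul_sub, smul_smul, mul_div_cancel₀ _ ha, neg_smul, sub_neg_eq_add, ← this]
      exact sub_eq_zero.mp ((smul_eq_zero.mp h3).resolve_left ha)
    · intro h
      ext x
      rw [e1, h, LinearMap.mulLeft_apply, ← Algebra.smul_def, smul_smul, mul_div_cancel₀ _ ha]
      simp
  have ht : ∀ t : E, Polynomial.aeval t P = 0 ↔ t = algebraMap F E (-b / a) := by
    intro t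
    have := hg (LinearMap.mulLeft F t)
    rw [aeval_mulLeft] at this
    constructor
    · intro h
      rw [h] at this
      have := this.mp (by ext x; simp)
      simpa using LinearMap.congr_fun this 1
    · intro h
      rw [← h] at this
      simpa using LinearMap.congr_fun (this.mpr rfl) 1
  simp only [hg, ht]
  rw [Finset.sum_ite_eq' Finset.univ]
  simp only [ite_mul, one_mul, zero_mul, Finset.sum_ite_eq', Finset.mem_univ, if_true]
  congr 1
  have : LinearMap.mulLeft F (algebraMap F E (-b / a)) ∘ₗ LinearMap.mulLeft F ξ =
    LinearMap.mulLeft F (ξ * algebraMap F E (-b / a)) := by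
    ext x; simp only [LinearMap.comp_apply, LinearMap.mulLeft_apply]; ring
  rw [this]
  rfl

lemma A_irr (ih : ∀ (F' E' : Type) [Field F'] [Finite F'] [Field E'] [Algebra F' E'] [Fintype E'],
      Module.finrank F' E' < Module.finrank F E → ClaimA F' E') {ψ : AddChar F ℂ} (hψ : ∃ a, ψ a ≠ 1) {ξ : E}
    (hξ : Irr (LinearMap.mulLeft F ξ)) {P : Polynomial F} (hP : Irreducible P) :
    SS (oneFam F) ψ (LinearMap.mulLeft F ξ) P = (-1) ^ (Module.finrank F E - 1) *
      (Nat.card F : ℂ) ^ (Module.finrank F E).choose 2 * TF ψ ξ P := by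
  have hpos : 0 < Module.finrank F E := Module.finrank_pos
  have hdpos := hP.natDegree_pos
  by_cases hdvd : P.natDegree ∣ Module.finrank F E
  · by_cases hd1 : P.natDegree = 1
    · exact A_one hψ hξ hP hd1
    by_cases h3 : 3 ≤ Module.finrank F E
    · exact A_big ih hψ hξ hP h3 (by omega) hdvd
    have hle := Nat.le_of_dvd hpos hdvd
    have h2 : Module.finrank F E = 2 := by omega
    rw [A_two hψ h2 hξ hP (by omega), h2]
    simp
  · have e1 : SS (oneFam F) ψ (LinearMap.mulLeft F ξ) P = 0 := by
      unfold SS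
      refine Finset.sum_eq_zero fun g _ => ?_
      rw [if_neg, zero_mul]
      intro h
      exact hdvd (nilp_dvd hP _ E g h rfl)
    have e2 : TF ψ ξ P = 0 := by
      unfold TF
      refine Finset.sum_eq_zero fun t _ => if_neg ?_
      intro h
      apply hdvd
      have h1 := (minpoly.eq_of_irreducible hP h)
      have h2 : (minpoly F t).natDegree = P.natDegree := by
        rw [← h1, Polynomial.natDegree_mul_C (inv_ne_zero (Polynomial.leadingCoeff_ne_zero.mpr hP.ne_zero))]
      rw [← h2]
      exact minpoly.degree_dvd (IsIntegral.of_finite F t)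
    rw [e1, e2, mul_zero]

lemma TF_mul (ψ : AddChar F ℂ) (ξ : E) {P Q : Polynomial F} (h : IsCoprime P Q) : TF ψ ξ (P * Q) = TF ψ ξ P + TF ψ ξ Q := by
  unfold TF
  rw [← Finset.sum_add_distrib]
  refine Finset.sum_congr rfl fun t _ => ?_
  rw [map_mul]
  by_cases h1 : Polynomial.aeval t P = 0
  · have h2 : Polynomial.aeval t Q ≠ 0 := by
      intro h2
      obtain ⟨u, v, huv⟩ := h
      have := congrArg (Polynomial.aeval t) huv
      simp [h1, h2] at this
    simp [h1, h2]
  · simp [h1]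

lemma A_step (ih : ∀ (F' E' : Type) [Field F'] [Finite F'] [Field E'] [Algebra F' E'] [Fintype E'],
      Module.finrank F' E' < Module.finrank F E → ClaimA F' E') : ClaimA F E := by
  intro ψ hψ ξ hξ P
  have hunit : ∀ P : Polynomial F, IsUnit P → SS (oneFam F) ψ (LinearMap.mulLeft F ξ) P = 0 ∧ TF ψ ξ P = 0 := by
    intro P hP
    constructor
    · unfold SS
      refine Finset.sum_eq_zero fun g _ => ?_
      rw [if_neg, zero_mul]
      intro h
      have h1 : IsUnit (Polynomial.aeval (g : Module.End F E) P) := hP.map _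
      obtain ⟨k, hk⟩ := h
      have h2 := h1.pow k
      have : (Polynomial.aeval (g : Module.End F E) P) ^ k = 0 := hk
      rw [this] at h2
      exact not_isUnit_zero h2
    · unfold TF
      refine Finset.sum_eq_zero fun t _ => if_neg ?_
      exact (hP.map (Polynomial.aeval t)).ne_zero
  refine UniqueFactorizationMonoid.induction_on_coprime P ?_ ?_ ?_ ?_
  · intro h; exact absurd rfl h
  · intro x hx _
    rw [(hunit x hx).1, (hunit x hx).2, mul_zero]
  · intro p i hp _
    by_cases hi : i = 0
    · subst hi
      rw [pow_zero, (hunit 1 isUnit_one).1, (hunit 1 isUnit_one).2, mul_zero]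
    · rw [SS_pow p hi, A_irr ih hψ hξ hp.irreducible]
      congr 1
      unfold TF
      refine Finset.sum_congr rfl fun t _ => ?_
      rw [map_pow]
      simp only [pow_eq_zero_iff hi]
  · intro x y hxy hx hy hne
    have hc : IsCoprime x y := hxy.isCoprime
    rw [SS_mul oneFam_isGL hψ hξ hc, TF_mul _ _ hc, hx (left_ne_zero_of_mul hne), hy (right_ne_zero_of_mul hne), mul_add]

theorem claimA (F E : Type) [Field F] [Finite F] [Field E] [Algebra F E] [Fintype E] : ClaimA F E := by
  have : ∀ n : ℕ, ∀ (F E : Type) [Field F] [Finite F] [Field E] [Algebra F E] [Fintype E], Module.finrank F E = n → ClaimA F E := by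
    intro n
    induction n using Nat.strong_induction_on with
    | _ n ih =>
      intro F E _ _ _ _ _ hn
      refine A_step ?_
      intro F' E' _ _ _ _ _ h
      exact ih _ (hn ▸ h) F' E' rfl
  exact this _ F E rfl

end

section
variable {F : Type} [Field F]

noncomputable def kapE (f : Fam F) {E : Type} [Field E] [Algebra F E] (t : E) : ℂ :=
  kap f (minpoly F t) (Module.finrank F E / (minpoly F t).natDegree)

section ft
variable {E : Type} [Finite F] [Field E] [Algebra F E] [Fintype E]

noncomputable def TK (f : Fam F) (ψ : AddChar F ℂ) (ξ : E) (P : Polynomial F) : ℂ :=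
  ∑ t : E, if Polynomial.aeval t P = 0 then kapE f t * ψ (Algebra.trace F E (ξ * t)) else 0

lemma TK_mul (f : Fam F) (ψ : AddChar F ℂ) (ξ : E) {P Q : Polynomial F} (h : IsCoprime P Q) :
    TK f ψ ξ (P * Q) = TK f ψ ξ P + TK f ψ ξ Q := by
  unfold TK
  rw [← Finset.sum_add_distrib]
  refine Finset.sum_congr rfl fun t _ => ?_
  rw [map_mul]
  by_cases h1 : Polynomial.aeval t P = 0
  · have h2 : Polynomial.aeval t Q ≠ 0 := by
      intro h2
      obtain ⟨u, v, huv⟩ := h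
      have := congrArg (Polynomial.aeval t) huv
      simp [h1, h2] at this
    simp [h1, h2]
  · simp [h1]

lemma SS_assoc {f : Fam F} {ψ : AddChar F ℂ} {V : Type} [AddCommGroup V] [Module F V] [Finite V]
    {y : V →ₗ[F] V} {P Q : Polynomial F} (h : Associated P Q) : SS f ψ y P = SS f ψ y Q := by
  unfold SS
  refine Finset.sum_congr rfl fun g _ => ?_
  congr 1
  exact if_congr ⟨fun hg => hg.of_dvd h.dvd, fun hg => hg.of_dvd h.symm.dvd⟩ rfl rfl

lemma SS_TK {f : Fam F} (hf : IsGL f) {ψ : AddChar F ℂ} (hψ : ∃ a, ψ a ≠ 1) {ξ : E}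
    (hξ : Irr (LinearMap.mulLeft F ξ)) (P : Polynomial F) (hP : P ≠ 0) :
    SS f ψ (LinearMap.mulLeft F ξ) P = (-1) ^ (Module.finrank F E - 1) *
      (Nat.card F : ℂ) ^ (Module.finrank F E).choose 2 * TK f ψ ξ P := by
  have hunit : ∀ P : Polynomial F, IsUnit P → SS f ψ (LinearMap.mulLeft F ξ) P = 0 ∧ TK f ψ ξ P = 0 := by
    intro P hP
    constructor
    · unfold SS
      refine Finset.sum_eq_zero fun g _ => ?_
      rw [if_neg, zero_mul]
      intro h
      have h1 : IsUnit (Polynomial.aeval (g : Module.End F E) P) := hP.map _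
      obtain ⟨k, hk⟩ := h
      have h2 := h1.pow k
      have : (Polynomial.aeval (g : Module.End F E) P) ^ k = 0 := hk
      rw [this] at h2
      exact not_isUnit_zero h2
    · unfold TK
      refine Finset.sum_eq_zero fun t _ => if_neg ?_
      exact (hP.map (Polynomial.aeval t)).ne_zero
  revert hP
  refine UniqueFactorizationMonoid.induction_on_coprime P ?_ ?_ ?_ ?_
  · intro h; exact absurd rfl h
  · intro x hx _
    rw [(hunit x hx).1, (hunit x hx).2, mul_zero]
  · intro p i hp _
    by_cases hi : i = 0
    · subst hi
      rw [pow_zero, (hunit 1 isUnit_one).1, (hunit 1 isUnit_one).2, mul_zero]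
    · rw [SS_pow p hi]
      have hass : Associated p (normalize p) := (normalize_associated p).symm
      have hmon : (normalize p).Monic := Polynomial.monic_normalize hp.ne_zero
      have hirr : Irreducible (normalize p) := hass.irreducible hp.irreducible
      rw [SS_assoc hass, SS_eq_kap hψ hξ hirr hf, claimA F E ψ hψ ξ hξ _ hirr.ne_zero, mul_left_comm]
      congr 1
      unfold TK TF
      rw [Finset.mul_sum]
      refine Finset.sum_congr rfl fun t _ => ?_
      have h1 : Polynomial.aeval t (p ^ i) = 0 ↔ Polynomial.aeval t (normalize p) = 0 := by
        rw [map_pow, pow_eq_zero_iff hi]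
        constructor
        · intro h
          obtain ⟨r, hr⟩ := hass.dvd
          rw [hr, map_mul, h, zero_mul]
        · intro h
          obtain ⟨r, hr⟩ := hass.symm.dvd
          rw [hr, map_mul, h, zero_mul]
      by_cases h2 : Polynomial.aeval t (normalize p) = 0
      · rw [if_pos h2, if_pos (h1.mpr h2)]
        have h3 := minpoly.eq_of_irreducible_of_monic hirr h2 hmon
        unfold kapE
        rw [← h3]
      · rw [if_neg h2, if_neg (h1.not.mpr h2), mul_zero]
  · intro x y hxy hx hy hne
    have hc : IsCoprime x y := hxy.isCoprime
    rw [SS_mul hf hψ hξ hc, TK_mul _ _ _ hc, hx (left_ne_zero_of_mul hne), hy (right_ne_zero_of_mul hne), mul_add]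

theorem FT1 {f : Fam F} (hf : IsGL f) {ψ : AddChar F ℂ} (hψ : ∃ a, ψ a ≠ 1) {ξ : E}
    (hξ : Irr (LinearMap.mulLeft F ξ)) :
    ∑ g : E →ₗ[F] E, f E g * ψ (LinearMap.trace F E (g ∘ₗ LinearMap.mulLeft F ξ)) =
      (-1) ^ (Module.finrank F E - 1) * (Nat.card F : ℂ) ^ (Module.finrank F E).choose 2 *
        ∑ t : E, kapE f t * ψ (Algebra.trace F E (ξ * t)) := by
  set P : Polynomial F := ∏ g : E →ₗ[F] E, g.charpoly with hP
  have hP0 : P ≠ 0 := (Polynomial.monic_prod_of_monic _ _ fun g _ => g.charpoly_monic).ne_zero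
  have hg : ∀ g : E →ₗ[F] E, Polynomial.aeval g P = 0 := by
    intro g
    obtain ⟨r, hr⟩ : g.charpoly ∣ P := Finset.dvd_prod_of_mem _ (Finset.mem_univ g)
    rw [hr, map_mul, g.aeval_self_charpoly, zero_mul]
  have := SS_TK hf hψ hξ P hP0
  unfold SS TK at this
  rw [Finset.sum_congr rfl fun g _ => by
    rw [if_pos (show Nilp P g from ⟨1, by rw [pow_one]; exact hg g⟩)]] at this
  rw [this]
  congr 1
  refine Finset.sum_congr rfl fun t _ => if_pos ?_
  have h1 := hg (LinearMap.mulLeft F t)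
  rw [aeval_mulLeft] at h1
  simpa using LinearMap.congr_fun h1 1

end ft

noncomputable def Phi (ψ : AddChar F ℂ) (f : Fam F) : Fam F := fun V _ _ _ y =>
  ((Nat.card F : ℂ) ^ (Module.finrank F V).choose 2)⁻¹ *
    ∑ g : V →ₗ[F] V, f V g * ψ (LinearMap.trace F V (g ∘ₗ y))

section phi
variable {V₁ V₂ : Type} [AddCommGroup V₁] [Module F V₁] [Finite V₁] [AddCommGroup V₂] [Module F V₂] [Finite V₂]

def full (p : ((V₁ →ₗ[F] V₁) × (V₂ →ₗ[F] V₁)) × ((V₁ →ₗ[F] V₂) × (V₂ →ₗ[F] V₂))) : V₁ × V₂ →ₗ[F] V₁ × V₂ :=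
  (p.1.1.coprod p.1.2).prod (p.2.1.coprod p.2.2)

lemma full_bij : Function.Bijective (full (F := F) (V₁ := V₁) (V₂ := V₂)) := by
  constructor
  · rintro ⟨⟨a, b⟩, c, d⟩ ⟨⟨a', b'⟩, c', d'⟩ h
    have h1 : ∀ x : V₁ × V₂, a x.1 + b x.2 = a' x.1 + b' x.2 ∧ c x.1 + d x.2 = c' x.1 + d' x.2 := by
      intro x
      have := LinearMap.congr_fun h x
      exact Prod.mk.inj this
    have ha : a = a' := by ext x; simpa using (h1 (x, 0)).1
    have hb : b = b' := by ext x; simpa using (h1 (0, x)).1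
    have hc : c = c' := by ext x; simpa using (h1 (x, 0)).2
    have hd : d = d' := by ext x; simpa using (h1 (0, x)).2
    rw [ha, hb, hc, hd]
  · intro g
    refine ⟨((LinearMap.fst F V₁ V₂ ∘ₗ g ∘ₗ LinearMap.inl F V₁ V₂, LinearMap.fst F V₁ V₂ ∘ₗ g ∘ₗ LinearMap.inr F V₁ V₂),
      (LinearMap.snd F V₁ V₂ ∘ₗ g ∘ₗ LinearMap.inl F V₁ V₂, LinearMap.snd F V₁ V₂ ∘ₗ g ∘ₗ LinearMap.inr F V₁ V₂)), ?_⟩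
    have h0 : g (0, 0) = 0 := map_zero g
    ext x <;> simp [full, h0]

lemma trace_full [Finite F] (a : V₁ →ₗ[F] V₁) (b : V₂ →ₗ[F] V₁) (c : V₁ →ₗ[F] V₂) (d : V₂ →ₗ[F] V₂) :
    LinearMap.trace F (V₁ × V₂) (full ((a, b), (c, d))) = LinearMap.trace F V₁ a + LinearMap.trace F V₂ d := by
  have e : full ((a, b), (c, d)) = LinearMap.prodMap a d +
      LinearMap.inl F V₁ V₂ ∘ₗ (b ∘ₗ LinearMap.snd F V₁ V₂) + LinearMap.inr F V₁ V₂ ∘ₗ (c ∘ₗ LinearMap.fst F V₁ V₂) := by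
    ext x <;> simp [full]
  have e1 : (b ∘ₗ LinearMap.snd F V₁ V₂) ∘ₗ LinearMap.inl F V₁ V₂ = 0 := by ext x; simp
  have e2 : (c ∘ₗ LinearMap.fst F V₁ V₂) ∘ₗ LinearMap.inr F V₁ V₂ = 0 := by ext x; simp
  rw [e, map_add, map_add, LinearMap.trace_prodMap', LinearMap.trace_comp_comm' (b ∘ₗ LinearMap.snd F V₁ V₂) (LinearMap.inl F V₁ V₂),
    LinearMap.trace_comp_comm' (c ∘ₗ LinearMap.fst F V₁ V₂) (LinearMap.inr F V₁ V₂), e1, e2]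
  simp

lemma full_comp_blk (a : V₁ →ₗ[F] V₁) (b : V₂ →ₗ[F] V₁) (c : V₁ →ₗ[F] V₂) (d : V₂ →ₗ[F] V₂)
    (A : V₁ →ₗ[F] V₁) (u : V₂ →ₗ[F] V₁) (D : V₂ →ₗ[F] V₂) :
    full ((a, b), (c, d)) ∘ₗ blk A u D = full ((a ∘ₗ A, a ∘ₗ u + b ∘ₗ D), (c ∘ₗ A, c ∘ₗ u + d ∘ₗ D)) := by
  ext x <;> simp [full]

lemma sum_tr' [Finite F] {ψ : AddChar F ℂ} (hψ : ∃ a, ψ a ≠ 1) (c : V₁ →ₗ[F] V₂) :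
    ∑ u : V₂ →ₗ[F] V₁, ψ (LinearMap.trace F V₂ (c ∘ₗ u)) =
      if c = 0 then (Nat.card F : ℂ) ^ (Module.finrank F V₁ * Module.finrank F V₂) else 0 := by
  split_ifs with hc
  · subst hc
    simp only [LinearMap.zero_comp, map_zero, AddChar.map_zero_eq_one, Finset.sum_const, Finset.card_univ, nsmul_eq_mul, mul_one]
    rw [natCard_lin]
    push_cast
    rfl
  · refine sum_char_lin hψ ((LinearMap.trace F V₂) ∘ₗ (LinearMap.compRight F c : (V₂ →ₗ[F] V₁) →ₗ[F] (V₂ →ₗ[F] V₂))) ?_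
    intro h
    apply hc
    ext v
    rw [LinearMap.zero_apply]
    refine (Module.forall_dual_apply_eq_zero_iff F (c v)).mp fun ℓ => ?_
    have h1 := LinearMap.congr_fun h (ℓ.smulRight v)
    have h2 : c ∘ₗ (ℓ.smulRight v) = ℓ.smulRight (c v) := by ext x; simp
    simp only [LinearMap.comp_apply, LinearMap.zero_apply] at h1
    have h3 : LinearMap.compRight F c (ℓ.smulRight v) = c ∘ₗ (ℓ.smulRight v) := rfl
    rw [h3, h2, trace_smulRight] at h1
    exact h1

lemma Phi_isGL [Finite F] {ψ : AddChar F ℂ} (hψ : ∃ a, ψ a ≠ 1) {f : Fam F} (hf : IsGL f) : IsGL (Phi ψ f) where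
  conj := by
    intro V W _ _ _ _ _ _ e g
    unfold Phi
    rw [e.finrank_eq]
    congr 1
    rw [← (e.conj).toEquiv.sum_comp]
    refine Finset.sum_congr rfl fun x _ => ?_
    show f W (e.conj x) * ψ (LinearMap.trace F W (e.conj x ∘ₗ e.conj g)) = _
    rw [hf.conj, ← LinearEquiv.conj_comp, LinearMap.trace_conj']
  one := by
    intro V _ _ _ _ g
    unfold Phi
    have : Subsingleton (V →ₗ[F] V) := ⟨fun a b => by ext x; exact Subsingleton.elim _ _⟩
    rw [Fintype.sum_subsingleton _ 0, hf.one, Module.finrank_zero_of_subsingleton]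
    simp
  ext := by
    intro V₁ V₂ _ _ _ _ _ _ A D
    have hq : (Nat.card F : ℂ) ≠ 0 := by exact_mod_cast Nat.card_pos.ne'
    unfold Phi
    rw [← Finset.mul_sum, Finset.sum_comm, ← (Equiv.ofBijective _ full_bij).sum_comp]
    have e1 : ∀ p : ((V₁ →ₗ[F] V₁) × (V₂ →ₗ[F] V₁)) × ((V₁ →ₗ[F] V₂) × (V₂ →ₗ[F] V₂)),
        ∑ u : V₂ →ₗ[F] V₁, f (V₁ × V₂) (Equiv.ofBijective _ full_bij p) *
          ψ (LinearMap.trace F (V₁ × V₂) (Equiv.ofBijective _ full_bij p ∘ₗ blk A u D)) =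
        (f (V₁ × V₂) (full p) * ψ (LinearMap.trace F V₁ (p.1.1 ∘ₗ A)) * ψ (LinearMap.trace F V₂ (p.2.2 ∘ₗ D))) *
         if p.2.1 = 0 then (Nat.card F : ℂ) ^ (Module.finrank F V₁ * Module.finrank F V₂) else 0 := by
      rintro ⟨⟨a, b⟩, c, d⟩
      rw [← sum_tr' hψ, Finset.mul_sum]
      refine Finset.sum_congr rfl fun u _ => ?_
      rw [Equiv.ofBijective_apply, full_comp_blk, trace_full, map_add (LinearMap.trace F V₂), AddChar.map_add_eq_mul, AddChar.map_add_eq_mul]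
      ring
    rw [Finset.sum_congr rfl fun p _ => e1 p]
    rw [Fintype.sum_prod_type, Fintype.sum_prod_type]
    simp only [Fintype.sum_prod_type, mul_ite, mul_zero]
    have e2 : ∀ (a : V₁ →ₗ[F] V₁) (b : V₂ →ₗ[F] V₁), (∑ c : V₁ →ₗ[F] V₂, ∑ d : V₂ →ₗ[F] V₂, if c = 0 then
        f (V₁ × V₂) (full ((a, b), c, d)) * ψ (LinearMap.trace F V₁ (a ∘ₗ A)) * ψ (LinearMap.trace F V₂ (d ∘ₗ D)) *
          (Nat.card F : ℂ) ^ (Module.finrank F V₁ * Module.finrank F V₂) else 0) =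
        ∑ d : V₂ →ₗ[F] V₂, f (V₁ × V₂) (blk a b d) * ψ (LinearMap.trace F V₁ (a ∘ₗ A)) * ψ (LinearMap.trace F V₂ (d ∘ₗ D)) *
          (Nat.card F : ℂ) ^ (Module.finrank F V₁ * Module.finrank F V₂) := by
      intro a b
      rw [Finset.sum_eq_single 0]
      · refine Finset.sum_congr rfl fun d _ => ?_
        rw [if_pos rfl]
        have : full ((a, b), ((0 : V₁ →ₗ[F] V₂), d)) = blk a b d := by
          ext x <;> simp [full]
        rw [this]
      · intro c _ hc
        exact Finset.sum_eq_zero fun d _ => if_neg hc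
      · intro h; exact absurd (Finset.mem_univ _) h
    rw [Finset.sum_congr rfl fun a _ => Finset.sum_congr rfl fun b _ => e2 a b]
    have e3 : ∀ a : V₁ →ₗ[F] V₁, ∑ b : V₂ →ₗ[F] V₁, ∑ d : V₂ →ₗ[F] V₂, f (V₁ × V₂) (blk a b d) *
        ψ (LinearMap.trace F V₁ (a ∘ₗ A)) * ψ (LinearMap.trace F V₂ (d ∘ₗ D)) *
          (Nat.card F : ℂ) ^ (Module.finrank F V₁ * Module.finrank F V₂) =
        (Nat.card F : ℂ) ^ (Module.finrank F V₁ * Module.finrank F V₂) *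
        (Nat.card F : ℂ) ^ (Module.finrank F V₁ * Module.finrank F V₂) * (f V₁ a * ψ (LinearMap.trace F V₁ (a ∘ₗ A))) *
         ∑ d : V₂ →ₗ[F] V₂, f V₂ d * ψ (LinearMap.trace F V₂ (d ∘ₗ D)) := by
      intro a
      rw [Finset.sum_comm, Finset.mul_sum]
      refine Finset.sum_congr rfl fun d _ => ?_
      rw [← Finset.sum_mul, ← Finset.sum_mul, ← Finset.sum_mul, hf.ext]
      ring
    rw [Finset.sum_congr rfl fun a _ => e3 a, ← Finset.sum_mul, ← Finset.mul_sum, Module.finrank_prod, choose_two_add]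
    field_simp
    try ring

lemma Phi_inv [Finite F] {ψ : AddChar F ℂ} (hψ : ∃ a, ψ a ≠ 1) (f : Fam F) (V : Type) [AddCommGroup V] [Module F V] [Finite V]
    (g : V →ₗ[F] V) : Phi ψ⁻¹ (Phi ψ f) V g = (Nat.card F : ℂ) ^ (Module.finrank F V) * f V g := by
  have hq : (Nat.card F : ℂ) ≠ 0 := by exact_mod_cast Nat.card_pos.ne'
  unfold Phi
  have e1 : ∑ y : V →ₗ[F] V, (((Nat.card F : ℂ) ^ (Module.finrank F V).choose 2)⁻¹ *
      ∑ x : V →ₗ[F] V, f V x * ψ (LinearMap.trace F V (x ∘ₗ y))) * ψ⁻¹ (LinearMap.trace F V (y ∘ₗ g)) =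
      ((Nat.card F : ℂ) ^ (Module.finrank F V).choose 2)⁻¹ * ∑ x : V →ₗ[F] V, f V x *
        ∑ y : V →ₗ[F] V, ψ (LinearMap.trace F V ((x - g) ∘ₗ y)) := by
    simp only [Finset.mul_sum, Finset.sum_mul]
    rw [Finset.sum_comm]
    refine Finset.sum_congr rfl fun x _ => Finset.sum_congr rfl fun y _ => ?_
    rw [LinearMap.sub_comp, map_sub, sub_eq_add_neg, AddChar.map_add_eq_mul, AddChar.inv_apply, LinearMap.trace_comp_comm' y g]
    ring
  rw [e1]
  simp only [sum_tr hψ, sub_eq_zero, mul_ite, mul_zero, Finset.sum_ite_eq', Finset.mem_univ, if_true]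
  have : Module.finrank F V * Module.finrank F V = (Module.finrank F V).choose 2 + (Module.finrank F V).choose 2 + Module.finrank F V := by
    generalize Module.finrank F V = n
    have := Nat.choose_two_right n
    have h2 : 2 ∣ n * (n - 1) := (Nat.even_mul_pred_self n).two_dvd
    have h3 : n * (n - 1) + n = n * n := by
      cases n with
      | zero => rfl
      | succ k => simp; ring
    omega
  rw [this, pow_add, pow_add]
  field_simp

end phi
end

section
variable {E : Type} [Field E] [Fintype E]

lemma sum_chi {χ : AddChar E ℂ} (hχ : ∃ a, χ a ≠ 1) (c : E) :
    ∑ x : E, χ (x * c) = if c = 0 then (Fintype.card E : ℂ) else 0 := by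
  split_ifs with hc
  · subst hc; simp
  · have h1 : ∑ x : E, χ (x * c) = ∑ x : E, χ x :=
      Equiv.sum_comp (Equiv.mulRight₀ c hc) (fun x => χ x)
    rw [h1]
    refine AddChar.sum_eq_zero_of_ne_one ?_
    rintro rfl
    obtain ⟨a, ha⟩ := hχ
    exact ha rfl

lemma fourier_inv {χ : AddChar E ℂ} (hχ : ∃ a, χ a ≠ 1) (g : E → ℂ) (t : E) :
    ∑ x : E, (∑ s : E, g s * χ (x * s)) * χ⁻¹ (t * x) = Fintype.card E * g t := by
  have h1 : ∀ x : E, (∑ s : E, g s * χ (x * s)) * χ⁻¹ (t * x) = ∑ s : E, g s * χ (x * (s - t)) := by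
    intro x
    rw [Finset.sum_mul]
    refine Finset.sum_congr rfl fun s _ => ?_
    rw [AddChar.inv_apply, mul_assoc, ← AddChar.map_add_eq_mul]
    congr 2
    ring
  rw [Finset.sum_congr rfl fun x _ => h1 x, Finset.sum_comm]
  simp only [← Finset.mul_sum, sum_chi hχ, sub_eq_zero, mul_ite, mul_zero]
  rw [Finset.sum_ite_eq' Finset.univ t, if_pos (Finset.mem_univ _), mul_comm]

lemma uncertainty {χ : AddChar E ℂ} (hχ : ∃ a, χ a ≠ 1) (g : E → ℂ) (S T : Finset E)
    (hS : ∀ t, t ∉ S → g t = 0) (hT : ∀ x, x ∉ T → ∑ s : E, g s * χ (x * s) = 0)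
    (hc : S.card * T.card < Fintype.card E) (t : E) : g t = 0 := by
  obtain ⟨t0, -, hM⟩ := Finset.exists_max_image Finset.univ (fun t => ‖g t‖) ⟨t, Finset.mem_univ t⟩
  have h1 : ∀ x, ‖∑ s : E, g s * χ (x * s)‖ ≤ S.card * ‖g t0‖ := by
    intro x
    have : ∑ s : E, g s * χ (x * s) = ∑ s ∈ S, g s * χ (x * s) := by
      symm
      refine Finset.sum_subset (Finset.subset_univ _) fun s _ hs => ?_
      rw [hS s hs, zero_mul]
    rw [this]
    refine (norm_sum_le _ _).trans ?_
    rw [← nsmul_eq_mul]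
    refine Finset.sum_le_card_nsmul _ _ _ fun s _ => ?_
    rw [norm_mul, AddChar.norm_apply, mul_one]
    exact hM s (Finset.mem_univ _)
  have h2 : (Fintype.card E : ℝ) * ‖g t0‖ ≤ T.card * (S.card * ‖g t0‖) := by
    have h3 := fourier_inv hχ g t0
    have h4 : ∑ x : E, (∑ s : E, g s * χ (x * s)) * χ⁻¹ (t0 * x) =
        ∑ x ∈ T, (∑ s : E, g s * χ (x * s)) * χ⁻¹ (t0 * x) := by
      symm
      refine Finset.sum_subset (Finset.subset_univ _) fun s _ hs => ?_
      rw [hT s hs, zero_mul]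
    have h5 : (Fintype.card E : ℝ) * ‖g t0‖ = ‖(Fintype.card E : ℂ) * g t0‖ := by
      rw [norm_mul, Complex.norm_natCast]
    rw [h5, ← h3, h4]
    refine (norm_sum_le _ _).trans ?_
    rw [← nsmul_eq_mul]
    refine Finset.sum_le_card_nsmul _ _ _ fun x _ => ?_
    rw [norm_mul, AddChar.norm_apply, mul_one]
    exact h1 x
  have h6 : ‖g t0‖ = 0 := by
    by_contra hne
    have hpos : 0 < ‖g t0‖ := lt_of_le_of_ne (norm_nonneg _) (Ne.symm hne)
    have hc' : ((S.card : ℝ) * T.card) < Fintype.card E := by exact_mod_cast hc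
    have := mul_lt_mul_of_pos_right hc' hpos
    linarith
  have := hM t (Finset.mem_univ _)
  rw [h6] at this
  exact norm_le_zero_iff.mp this

lemma card_fixed (Q : ℕ) (hQ : 2 ≤ Q) : (Finset.univ.filter fun x : E => x ^ Q = x).card ≤ Q := by
  have h0 : (Polynomial.X ^ Q - Polynomial.X : Polynomial E) ≠ 0 := FiniteField.X_pow_card_sub_X_ne_zero E hQ
  have h1 : (Finset.univ.filter fun x : E => x ^ Q = x) ⊆ (Polynomial.X ^ Q - Polynomial.X : Polynomial E).roots.toFinset := by
    intro x hx
    rw [Multiset.mem_toFinset, Polynomial.mem_roots h0]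
    simp [Polynomial.IsRoot, sub_eq_zero, (Finset.mem_filter.mp hx).2]
  refine (Finset.card_le_card h1).trans ((Multiset.toFinset_card_le _).trans ((Polynomial.card_roots' _).trans ?_))
  rw [FiniteField.X_pow_card_sub_X_natDegree_eq E hQ]

lemma sum_pow_bound (q e : ℕ) (hq : 2 ≤ q) : ∑ d ∈ Finset.Icc 1 e, q ^ d + 2 ≤ 2 * q ^ e := by
  induction e with
  | zero => simp
  | succ e ih =>
    rw [Finset.sum_Icc_succ_top (by omega), pow_succ]
    nlinarith [Nat.pow_pos (n := e) (show 0 < q by omega)]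

lemma odd_bound (q e N : ℕ) (hq : 2 ≤ q) (hN : N ≤ ∑ d ∈ Finset.Icc 1 e, q ^ d) : N * N < q ^ (3 * e) := by
  have h1 := sum_pow_bound q e hq
  have h2 : 1 ≤ q ^ e := Nat.one_le_pow _ _ (by omega)
  have h3 : q ^ (3 * e) = q ^ e * q ^ e * q ^ e := by rw [← pow_add, ← pow_add]; congr 1; ring
  rw [h3]
  generalize q ^ e = x at *
  have h4 : N + 2 ≤ 2 * x := by omega
  obtain ⟨y, rfl⟩ : ∃ y, x = y + 1 := ⟨x - 1, by omega⟩
  have h5 : N ≤ 2 * y := by omega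
  have h6 : N * N ≤ 2 * y * (2 * y) := Nat.mul_le_mul h5 h5
  refine lt_of_le_of_lt h6 ?_
  zify
  nlinarith [mul_nonneg (Int.natCast_nonneg y) (sq_nonneg ((y : ℤ) - 1)), Int.natCast_nonneg y]

lemma even_bound1 (q e : ℕ) (hq : 2 ≤ q) : 3 * ∑ c ∈ Finset.Icc 1 e, (q ^ (2 * c) - q) ≤ q ^ (3 * e) := by
  rcases Nat.lt_or_ge e 2 with he | he
  · interval_cases e
    · simp
    · simp
      have : q ≤ q ^ 2 := by nlinarith
      zify [this]
      nlinarith [sq_nonneg ((q : ℤ) - 2), mul_nonneg (show (0 : ℤ) ≤ q by positivity) (sq_nonneg (2 * (q : ℤ) - 3))]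
  · have h1 : ∀ e, 3 * ∑ c ∈ Finset.Icc 1 e, (q ^ (2 * c) - q) ≤ 4 * q ^ (2 * e) := by
      intro e
      induction e with
      | zero => simp
      | succ e ih =>
        rw [Finset.sum_Icc_succ_top (by omega)]
        have h2 : q ^ (2 * (e + 1)) - q ≤ q ^ (2 * (e + 1)) := Nat.sub_le _ _
        have h3 : 4 * q ^ (2 * e) ≤ q ^ (2 * (e + 1)) := by
          rw [show 2 * (e + 1) = 2 * e + 2 by ring, pow_add]
          have h5 : 4 ≤ q ^ 2 := by nlinarith
          rw [mul_comm]
          exact Nat.mul_le_mul_left _ h5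
        omega
    refine (h1 e).trans ?_
    have h4 : 4 ≤ q ^ e := by
      calc 4 = 2 ^ 2 := by norm_num
        _ ≤ q ^ 2 := Nat.pow_le_pow_left hq 2
        _ ≤ q ^ e := Nat.pow_le_pow_right (by omega) he
    rw [show 3 * e = e + 2 * e by ring, pow_add]
    exact Nat.mul_le_mul_right _ h4

lemma even_bound2 (x D : ℕ) (hx : 1 ≤ x) (h : 3 * D ≤ x) : D * (2 * (x + D)) < x * x := by
  nlinarith

section lemL
variable {F : Type} [Field F] [Finite F] [Algebra F E]

lemma two_le_q (F : Type) [Field F] [Finite F] : 2 ≤ Nat.card F := Finite.one_lt_card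

lemma card_E (F E : Type) [Field F] [Finite F] [Field E] [Fintype E] [Algebra F E] :
    Fintype.card E = Nat.card F ^ Module.finrank F E := by
  rw [← Nat.card_eq_fintype_card, Module.natCard_eq_pow_finrank (K := F) (V := E)]

/-- elements not generating `E` over `F` -/
noncomputable def ZZ (F E : Type) [Field F] [Finite F] [Field E] [Fintype E] [Algebra F E] : Finset E :=
  Finset.univ.filter fun x => (minpoly F x).natDegree ≠ Module.finrank F E

lemma mem_ZZ (x : E) : x ∈ ZZ F E ↔ (minpoly F x).natDegree ≠ Module.finrank F E := by simp [ZZ]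

lemma deg_dvd (x : E) : (minpoly F x).natDegree ∣ Module.finrank F E :=
  minpoly.degree_dvd (Algebra.IsIntegral.isIntegral (R := F) x)

lemma deg_pos (x : E) : 0 < (minpoly F x).natDegree :=
  minpoly.natDegree_pos (Algebra.IsIntegral.isIntegral (R := F) x)

lemma card_ZZ_odd (hn : Odd (Module.finrank F E)) : (ZZ F E).card * (ZZ F E).card < Fintype.card E := by
  have hq := two_le_q F
  rw [card_E F E]
  set n := Module.finrank F E with hnn
  set q := Nat.card F with hqq
  have h1 : (ZZ F E).card ≤ ∑ d ∈ Finset.Icc 1 (n / 3), q ^ d := by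
    have h2 : ZZ F E ⊆ (Finset.Icc 1 (n / 3)).biUnion fun d => Finset.univ.filter fun x : E => x ^ (q ^ d) = x := by
      intro x hx
      rw [mem_ZZ] at hx
      obtain ⟨c, hc⟩ := deg_dvd (F := F) x
      have hp := deg_pos (F := F) x
      rw [← hnn] at hc hx
      rw [Finset.mem_biUnion]
      refine ⟨(minpoly F x).natDegree, ?_, ?_⟩
      · rw [Finset.mem_Icc]
        refine ⟨hp, ?_⟩
        rw [Nat.le_div_iff_mul_le (by norm_num), hc]
        refine Nat.mul_le_mul_left _ ?_
        have hodd : Odd c := by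
          rw [hc] at hn
          exact (Nat.odd_mul.mp hn).2
        have : c ≠ 1 := by
          rintro rfl
          rw [mul_one] at hc
          exact hx hc.symm
        obtain ⟨k, hk⟩ := hodd
        omega
      · rw [Finset.mem_filter]
        exact ⟨Finset.mem_univ _, (deg_dvd_iff x _).mp dvd_rfl⟩
    refine (Finset.card_le_card h2).trans (Finset.card_biUnion_le.trans (Finset.sum_le_sum fun d hd => ?_))
    refine card_fixed _ ?_
    calc 2 ≤ q := hq
      _ = q ^ 1 := (pow_one q).symm
      _ ≤ q ^ d := Nat.pow_le_pow_right (by omega) (Finset.mem_Icc.mp hd).1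
  exact lt_of_lt_of_le (odd_bound q _ _ hq h1) (Nat.pow_le_pow_right (by omega) (Nat.mul_div_le n 3))

lemma card_ZZ_even {m : ℕ} (hm : Module.finrank F E = 2 * m) :
    3 * ((ZZ F E).filter fun x => x ^ (Nat.card F ^ m) ≠ x).card ≤ Nat.card F ^ m := by
  have hq := two_le_q F
  set q := Nat.card F with hqq
  have h1 : ((ZZ F E).filter fun x => x ^ (q ^ m) ≠ x).card ≤ ∑ c ∈ Finset.Icc 1 (m / 3), (q ^ (2 * c) - q) := by
    have h2 : ((ZZ F E).filter fun x => x ^ (q ^ m) ≠ x) ⊆ (Finset.Icc 1 (m / 3)).biUnion fun c =>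
        (Finset.univ.filter fun x : E => x ^ (q ^ (2 * c)) = x) \ (Finset.univ.filter fun x : E => x ^ q = x) := by
      intro x hx
      rw [Finset.mem_filter, mem_ZZ, hm, ne_eq, ne_eq, ← deg_dvd_iff (F := F) x] at hx
      obtain ⟨hx1, hx2⟩ := hx
      obtain ⟨c, hc⟩ := deg_dvd (F := F) x
      have hp := deg_pos (F := F) x
      rw [hm] at hc
      have hodd : Odd c := by
        by_contra h
        rw [Nat.not_odd_iff_even] at h
        obtain ⟨k, rfl⟩ := h
        exact hx2 ⟨k, by nlinarith⟩
      have heven : Even (minpoly F x).natDegree := by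
        by_contra h
        rw [Nat.not_even_iff_odd] at h
        have := h.mul hodd
        rw [← hc] at this
        exact (Nat.not_odd_iff_even.mpr (even_two_mul m)) this
      obtain ⟨k, hk⟩ := heven
      have hc1 : c ≠ 1 := by
        rintro rfl
        omega
      obtain ⟨j, hj⟩ := hodd
      rw [Finset.mem_biUnion]
      refine ⟨k, ?_, ?_⟩
      · rw [Finset.mem_Icc]
        refine ⟨by omega, ?_⟩
        rw [Nat.le_div_iff_mul_le (by norm_num)]
        have : m = k * c := by
          rw [hk] at hc
          nlinarith
        rw [this]
        exact Nat.mul_le_mul_left _ (by omega)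
      · rw [Finset.mem_sdiff, Finset.mem_filter, Finset.mem_filter]
        refine ⟨⟨Finset.mem_univ _, (deg_dvd_iff x _).mp ⟨1, by omega⟩⟩, ?_⟩
        rintro ⟨-, h⟩
        apply hx2
        have := (deg_dvd_iff (F := F) x 1).mpr (by rw [pow_one]; exact h)
        exact this.trans (one_dvd m)
    refine (Finset.card_le_card h2).trans (Finset.card_biUnion_le.trans (Finset.sum_le_sum fun c hc => ?_))
    have hc1 := (Finset.mem_Icc.mp hc).1
    have hsub : (Finset.univ.filter fun x : E => x ^ q = x) ⊆ (Finset.univ.filter fun x : E => x ^ (q ^ (2 * c)) = x) := by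
      intro x hx
      rw [Finset.mem_filter] at hx ⊢
      refine ⟨Finset.mem_univ _, (deg_dvd_iff x _).mp ?_⟩
      have := (deg_dvd_iff (F := F) x 1).mpr (by rw [pow_one]; exact hx.2)
      exact this.trans (one_dvd _)
    rw [Finset.card_sdiff_of_subset hsub]
    have hcard : q ≤ (Finset.univ.filter fun x : E => x ^ q = x).card := by
      letI := Fintype.ofFinite F
      have : (Finset.univ.image (algebraMap F E)) ⊆ (Finset.univ.filter fun x : E => x ^ q = x) := by
        intro x hx
        obtain ⟨a, -, rfl⟩ := Finset.mem_image.mp hx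
        rw [Finset.mem_filter]
        refine ⟨Finset.mem_univ _, ?_⟩
        rw [← frob_apply, AlgHom.commutes]
      refine le_trans ?_ (Finset.card_le_card this)
      rw [Finset.card_image_of_injective _ (algebraMap F E).injective, Finset.card_univ, hqq, Nat.card_eq_fintype_card]
    have := card_fixed (E := E) (q ^ (2 * c)) (by
      calc 2 ≤ q := hq
        _ = q ^ 1 := (pow_one q).symm
        _ ≤ q ^ (2 * c) := Nat.pow_le_pow_right (by omega) (by omega))
    omega
  refine (Nat.mul_le_mul_left 3 h1).trans ((even_bound1 q _ hq).trans ?_)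
  exact Nat.pow_le_pow_right (by omega) (Nat.mul_div_le m 3)

lemma even_supp {m : ℕ} (hm : Module.finrank F E = 2 * m) (hm0 : 0 < m) {χ : AddChar E ℂ} (hχ : ∃ a, χ a ≠ 1)
    (σ : E →ₐ[F] E) (hσ : ∀ x, σ x = x ^ (Nat.card F ^ m)) (hχσ : ∀ x, χ (σ x) = χ x) (g : E → ℂ)
    (hS : ∀ t, t ∉ ZZ F E → g t = 0) (hT : ∀ x, x ∉ ZZ F E → ∑ s : E, g s * χ (x * s) = 0)
    (t : E) (ht : σ t ≠ t) : g t = 0 := by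
  have hq := two_le_q F
  have hσσ : ∀ x, σ (σ x) = x := by
    intro x
    rw [hσ, hσ, ← pow_mul, ← pow_add, ← two_mul, ← hm, ← card_E F E, FiniteField.pow_card]
  obtain ⟨a, ha⟩ := hχ
  have hne : t - σ t ≠ 0 := sub_ne_zero.mpr (Ne.symm ht)
  set θ := a / (t - σ t) with hθ
  have key : ∀ s, χ ((θ - σ θ) * s) = χ (θ * (s - σ s)) := by
    intro s
    have h1 : χ (σ θ * s) = χ (θ * σ s) := by
      rw [← hχσ (σ θ * s), map_mul, hσσ]
    rw [sub_mul, mul_sub, sub_eq_add_neg, sub_eq_add_neg, AddChar.map_add_eq_mul, AddChar.map_add_eq_mul,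
      AddChar.map_neg_eq_inv, AddChar.map_neg_eq_inv, h1]
  set D := (ZZ F E).filter fun x => x ^ (Nat.card F ^ m) ≠ x with hD
  have h2 := uncertainty (χ := χ) ⟨a, ha⟩ (fun s => g s * (χ ((θ - σ θ) * s) - 1)) D
    (ZZ F E ∪ (ZZ F E).image (fun x => x - (θ - σ θ))) ?_ ?_ ?_ t
  · have h3 : θ * (t - σ t) = a := div_mul_cancel₀ a hne
    simp only [key, h3] at h2
    exact (mul_eq_zero.mp h2).resolve_right (sub_ne_zero.mpr ha)
  · intro s hs
    show g s * (χ ((θ - σ θ) * s) - 1) = 0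
    rw [hD, Finset.mem_filter, not_and_or, not_not] at hs
    rcases hs with hs | hs
    · rw [hS s hs, zero_mul]
    · rw [key, hσ, hs, sub_self, mul_zero, AddChar.map_zero_eq_one, sub_self, mul_zero]
  · intro x hx
    rw [Finset.mem_union, not_or] at hx
    have h4 : x + (θ - σ θ) ∉ ZZ F E := by
      intro h
      exact hx.2 (Finset.mem_image.mpr ⟨_, h, by ring⟩)
    have h5 : ∑ s : E, g s * (χ ((θ - σ θ) * s) - 1) * χ (x * s) =
        ∑ s : E, g s * χ ((x + (θ - σ θ)) * s) - ∑ s : E, g s * χ (x * s) := by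
      rw [← Finset.sum_sub_distrib]
      refine Finset.sum_congr rfl fun s _ => ?_
      rw [add_mul, AddChar.map_add_eq_mul]
      ring
    rw [h5, hT _ h4, hT _ hx.1, sub_zero]
  · have h6 : (ZZ F E).card ≤ Nat.card F ^ m + D.card := by
      rw [← Finset.card_filter_add_card_filter_not (s := ZZ F E) (fun x => x ^ (Nat.card F ^ m) = x)]
      refine Nat.add_le_add_right ?_ _
      refine (Finset.card_le_card (Finset.filter_subset_filter _ (Finset.subset_univ _))).trans (card_fixed _ ?_)
      calc 2 ≤ Nat.card F := hq
        _ = Nat.card F ^ 1 := (pow_one _).symm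
        _ ≤ Nat.card F ^ m := Nat.pow_le_pow_right (by omega) hm0
    have h7 := card_ZZ_even (F := F) (E := E) hm
    have h8 : (ZZ F E ∪ (ZZ F E).image (fun x => x - (θ - σ θ))).card ≤ 2 * (Nat.card F ^ m + D.card) := by
      refine (Finset.card_union_le _ _).trans ?_
      have := Finset.card_image_le (s := ZZ F E) (f := fun x => x - (θ - σ θ))
      omega
    have h9 := even_bound2 (Nat.card F ^ m) D.card (Nat.one_le_pow _ _ (by omega)) h7
    rw [card_E F E, hm, two_mul m, pow_add]
    exact lt_of_le_of_lt (Nat.mul_le_mul_left _ h8) h9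

theorem lemL {ψ : AddChar F ℂ} (hψ : ∃ a, ψ a ≠ 1) (g : E → ℂ)
    (hS : ∀ t : E, (minpoly F t).natDegree = Module.finrank F E → g t = 0)
    (hT : ∀ x : E, (minpoly F x).natDegree = Module.finrank F E → ∑ s : E, g s * ψ (Algebra.trace F E (x * s)) = 0)
    (h0 : ∑ s : E, g s = 0) (t : E) : g t = 0 := by
  have hχ : ∃ a, trChar E ψ a ≠ 1 := trChar_ne hψ
  have hS' : ∀ t, t ∉ ZZ F E → g t = 0 := fun t ht => hS t (by rwa [mem_ZZ, not_not] at ht)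
  have hT' : ∀ x, x ∉ ZZ F E → ∑ s : E, g s * trChar E ψ (x * s) = 0 := fun t ht => hT t (by rwa [mem_ZZ, not_not] at ht)
  rcases Nat.even_or_odd (Module.finrank F E) with he | ho
  swap
  · exact uncertainty hχ g _ _ hS' hT' (card_ZZ_odd ho) t
  obtain ⟨m, hm⟩ := he
  rw [← two_mul] at hm
  have hm0 : 0 < m := by
    have : 0 < Module.finrank F E := Module.finrank_pos
    omega
  have hq := two_le_q F
  set χ := trChar E ψ with hχd
  obtain ⟨σ, hσ⟩ : ∃ σ : E →ₐ[F] E, ∀ x, σ x = x ^ (Nat.card F ^ m) := by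
    clear_value χ
    clear hm hm0
    induction m with
    | zero => exact ⟨AlgHom.id F E, fun x => by simp⟩
    | succ k ih =>
      obtain ⟨σ, hσ⟩ := ih
      refine ⟨(frob F E).comp σ, fun x => ?_⟩
      rw [AlgHom.comp_apply, hσ, frob_apply, ← pow_mul, pow_succ]
  have hσσ : ∀ x, σ (σ x) = x := by
    intro x
    rw [hσ, hσ, ← pow_mul, ← pow_add, ← two_mul, ← hm, ← card_E F E, FiniteField.pow_card]
  have hχσ : ∀ x, χ (σ x) = χ x := by
    intro x
    have hb : Function.Bijective σ := Finite.injective_iff_bijective.mp σ.toRingHom.injective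
    rw [hχd, trChar_apply, trChar_apply]
    congr 1
    exact Algebra.trace_eq_of_algEquiv (AlgEquiv.ofBijective σ hb) x
  have hgA := even_supp hm hm0 hχ σ hσ hχσ g hS' hT'
  set gh : E → ℂ := fun x => ∑ s : E, g s * χ (x * s) with hgh
  have hinv := fourier_inv hχ g
  have hχ' : ∃ a, χ⁻¹ a ≠ 1 := by
    obtain ⟨a, ha⟩ := hχ
    exact ⟨-a, by rwa [AddChar.inv_apply, neg_neg]⟩
  have hghA := even_supp hm hm0 hχ' σ hσ (fun x => by
    rw [AddChar.inv_apply, AddChar.inv_apply, ← map_neg, hχσ]) gh hT' (fun x hx => by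
      rw [hinv x, hS' x hx, mul_zero])
  have hper : ∀ x θ, gh (x + (θ - σ θ)) = gh x := by
    intro x θ
    refine Finset.sum_congr rfl fun s _ => ?_
    by_cases hs : σ s = s
    · congr 1
      have h1 : χ (σ θ * s) = χ (θ * s) := by
        rw [← hχσ (θ * s), map_mul σ, hs]
      have h2 : χ (θ * s) ≠ 0 := by
        intro h
        have := AddChar.norm_apply χ (θ * s)
        rw [h] at this
        simp at this
      rw [add_mul, AddChar.map_add_eq_mul, sub_mul, sub_eq_add_neg, AddChar.map_add_eq_mul, AddChar.map_neg_eq_inv, h1,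
        mul_inv_cancel₀ h2, mul_one]
    · rw [hgA s hs, zero_mul, zero_mul]
  have hz : ∀ x, gh x = 0 := by
    intro x
    by_contra hx
    have hxA : σ x = x := by
      by_contra h
      exact hx (hghA x h)
    have hB : ∀ θ, σ (θ - σ θ) = θ - σ θ := by
      intro θ
      have : σ (x + (θ - σ θ)) = x + (θ - σ θ) := by
        by_contra h
        exact hx ((hper x θ).symm.trans (hghA _ h))
      rw [map_add, hxA] at this
      exact add_left_cancel this
    obtain ⟨θ, hθ⟩ : ∃ θ, σ θ ≠ θ := by
      by_contra h
      push Not at h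
      have h1 := card_fixed (E := E) (Nat.card F ^ m) (by
        calc 2 ≤ Nat.card F := hq
          _ = Nat.card F ^ 1 := (pow_one _).symm
          _ ≤ Nat.card F ^ m := Nat.pow_le_pow_right (by omega) hm0)
      rw [Finset.filter_true_of_mem (fun x _ => by rw [← hσ, h]), Finset.card_univ, card_E F E, hm] at h1
      have := Nat.pow_lt_pow_right (show 1 < Nat.card F by omega) (show m < 2 * m by omega)
      omega
    have hne : θ - σ θ ≠ 0 := sub_ne_zero.mpr (Ne.symm hθ)
    set c := -(x / (θ - σ θ)) with hc
    have hσc : σ c = c := by rw [hc, map_neg, map_div₀, hxA, hB]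
    have h2 := hper x (c * θ)
    have h3 : x + (c * θ - σ (c * θ)) = 0 := by
      rw [map_mul, hσc, ← mul_sub, hc]
      field_simp
      ring
    rw [h3] at h2
    apply hx
    rw [← h2, hgh]
    simpa using h0
  have h5 := hinv t
  rw [Finset.sum_eq_zero fun x _ => by rw [show ∑ s : E, g s * χ (x * s) = 0 from hz x, zero_mul]] at h5
  have h6 : (Fintype.card E : ℂ) ≠ 0 := by exact_mod_cast Fintype.card_ne_zero
  exact (mul_eq_zero.mp h5.symm).resolve_left h6

end lemL
end

section
variable {F : Type} [Field F]

lemma aeval_prodMap {V₁ V₂ : Type} [AddCommGroup V₁] [Module F V₁] [AddCommGroup V₂] [Module F V₂]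
    (A : V₁ →ₗ[F] V₁) (D : V₂ →ₗ[F] V₂) (Q : Polynomial F) (x : V₁ × V₂) :
    (Polynomial.aeval (blk A 0 D : Module.End F (V₁ × V₂)) Q) x =
      ((Polynomial.aeval (A : Module.End F V₁) Q) x.1, (Polynomial.aeval (D : Module.End F V₂) Q) x.2) := by
  induction Q using Polynomial.induction_on' generalizing x with
  | add p q hp hq => simp only [map_add, LinearMap.add_apply, hp, hq, Prod.mk_add_mk]
  | monomial m c =>
    simp only [Polynomial.aeval_monomial, Module.End.mul_apply, Module.algebraMap_end_apply]
    rw [← Prod.smul_mk]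
    congr 1
    induction m generalizing x with
    | zero => rfl
    | succ m ih =>
      rw [pow_succ, pow_succ, pow_succ, Module.End.mul_apply, Module.End.mul_apply, Module.End.mul_apply, ih]
      simp

lemma isCyc_mul {P Q : Polynomial F} (hc : IsCoprime P Q) : IsCyc (P * Q) (blk (cyc P) 0 (cyc Q)) := by
  obtain ⟨a, b, hab⟩ := hc
  have h1 := congrArg (AdjoinRoot.mk P) hab
  have h2 := congrArg (AdjoinRoot.mk Q) hab
  simp only [map_add, map_mul, AdjoinRoot.mk_self, mul_zero, zero_add, add_zero, map_one] at h1 h2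
  refine ⟨(1, 1), ?_, ?_⟩
  · rintro ⟨x, y⟩
    obtain ⟨R, rfl⟩ := AdjoinRoot.mk_surjective x
    obtain ⟨S, rfl⟩ := AdjoinRoot.mk_surjective y
    refine ⟨R * (b * Q) + S * (a * P), ?_⟩
    rw [aeval_prodMap, aeval_cyc, aeval_cyc]
    simp [h1, h2]
  · intro R
    rw [aeval_prodMap, aeval_cyc, aeval_cyc]
    simp only [mul_one, Prod.mk_eq_zero, AdjoinRoot.mk_eq_zero]
    exact ⟨fun h => IsCoprime.mul_dvd ⟨a, b, hab⟩ h.1 h.2, fun h => ⟨(dvd_mul_right _ _).trans h, (dvd_mul_left _ _).trans h⟩⟩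

lemma nilp_cyc (P : Polynomial F) : Nilp P (cyc P) := by
  refine ⟨1, ?_⟩
  rw [pow_one]
  ext x
  rw [aeval_cyc, AdjoinRoot.mk_self, zero_mul, LinearMap.zero_apply]

lemma phi_mul [Finite F] {f : Fam F} (hf : IsGL f) {P Q : Polynomial F} (hP : P ≠ 0) (hQ : Q ≠ 0) (hc : IsCoprime P Q) :
    phi f (P * Q) = phi f P * phi f Q := by
  haveI : Fact (P ≠ 0) := ⟨hP⟩
  haveI : Fact (Q ≠ 0) := ⟨hQ⟩
  rw [← hf.phi_of_isCyc (isCyc_mul hc), hf.prod_of_coprime _ _ _ hc (nilp_cyc P) (nilp_cyc Q), phi_eq, phi_eq]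

lemma phi_one [Finite F] {f : Fam F} (hf : IsGL f) : phi f 1 = 1 := by
  have := hh_zero hf (0 : Polynomial F)
  simpa [hh] using this

instance finite_degreeLT [Finite F] (n : ℕ) : Finite (Polynomial.degreeLT F n) :=
  Finite.of_injective _ (Polynomial.degreeLTEquiv F n).injective

noncomputable instance fintype_degreeLT [Finite F] (n : ℕ) : Fintype (Polynomial.degreeLT F n) := Fintype.ofFinite _

/-- monic polynomials of degree n -/
noncomputable def mon (F : Type) [Field F] [Finite F] (n : ℕ) : Finset (Polynomial F) :=
  Finset.univ.image fun R : Polynomial.degreeLT F n => Polynomial.X ^ n + R.1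

lemma mem_mon [Finite F] (n : ℕ) (P : Polynomial F) : P ∈ mon F n ↔ P.Monic ∧ P.natDegree = n := by
  unfold mon
  rw [Finset.mem_image]
  constructor
  · rintro ⟨⟨R, hR⟩, -, rfl⟩
    rw [Polynomial.mem_degreeLT] at hR
    refine ⟨Polynomial.monic_X_pow_add hR, ?_⟩
    have : (Polynomial.X ^ n + R).degree = ((n : ℕ) : WithBot ℕ) := by
      rw [Polynomial.degree_add_eq_left_of_degree_lt, Polynomial.degree_X_pow]
      rwa [Polynomial.degree_X_pow]
    exact Polynomial.natDegree_eq_of_degree_eq_some this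
  · rintro ⟨hm, hn⟩
    refine ⟨⟨P - Polynomial.X ^ n, ?_⟩, Finset.mem_univ _, by simp⟩
    rw [Polynomial.mem_degreeLT]
    have hd : P.degree = n := by rw [Polynomial.degree_eq_natDegree hm.ne_zero, hn]
    rw [← hd]
    refine Polynomial.degree_sub_lt ?_ hm.ne_zero ?_
    · rw [hd, Polynomial.degree_X_pow]
    · rw [hm.leadingCoeff, (Polynomial.monic_X_pow n).leadingCoeff]

lemma sum_mon [Finite F] (n : ℕ) (G : Polynomial F → ℂ) :
    ∑ P ∈ mon F n, G P = ∑ R : Polynomial.degreeLT F n, G (Polynomial.X ^ n + R.1) := by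
  unfold mon
  rw [Finset.sum_image]
  intro a _ b _ h
  exact Subtype.ext (add_left_cancel h)

/-- companion operator on polynomials of degree < n -/
noncomputable def comp0 (F : Type) [Field F] (n : ℕ) : Polynomial.degreeLT F n →ₗ[F] F :=
  (Polynomial.lcoeff F (n - 1)) ∘ₗ (Polynomial.degreeLT F n).subtype

noncomputable def companion (n : ℕ) (P : Polynomial F) (hP : P.Monic ∧ P.natDegree = n) (hn : n ≠ 0) :
    Polynomial.degreeLT F n →ₗ[F] Polynomial.degreeLT F n :=
  LinearMap.codRestrict _
    ((LinearMap.mulLeft F Polynomial.X) ∘ₗ (Polynomial.degreeLT F n).subtype - (comp0 F n).smulRight P) (by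
    intro Q
    rw [Polynomial.mem_degreeLT, Polynomial.degree_lt_iff_coeff_zero]
    obtain ⟨Q, hQ⟩ := Q
    rw [Polynomial.mem_degreeLT, Polynomial.degree_lt_iff_coeff_zero] at hQ
    intro m hm
    obtain ⟨k, rfl⟩ : ∃ k, m = k + 1 := ⟨m - 1, by omega⟩
    simp only [comp0, LinearMap.sub_apply, LinearMap.comp_apply, Submodule.subtype_apply, LinearMap.mulLeft_apply, LinearMap.smulRight_apply,
      Polynomial.lcoeff_apply, Polynomial.coeff_sub, Polynomial.coeff_X_mul, Polynomial.coeff_smul, smul_eq_mul]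
    rcases Nat.lt_or_ge k n with h | h
    · have h1 : k = n - 1 := by omega
      have h2 : k + 1 = P.natDegree := by omega
      rw [h2, hP.1.coeff_natDegree, h1, mul_one, sub_self]
    · rw [hQ k h, Polynomial.coeff_eq_zero_of_natDegree_lt (by omega : P.natDegree < k + 1), mul_zero, sub_zero])

lemma companion_apply (n : ℕ) (P : Polynomial F) (hP : P.Monic ∧ P.natDegree = n) (hn : n ≠ 0) (Q : Polynomial.degreeLT F n) :
    (companion n P hP hn Q : Polynomial F) = Polynomial.X * Q.1 - Q.1.coeff (n - 1) • P := rfl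

lemma companion_mod (n : ℕ) (P : Polynomial F) (hP : P.Monic ∧ P.natDegree = n) (hn : n ≠ 0)
    (Q : Polynomial F) (R : Polynomial.degreeLT F n) :
    P ∣ ((Polynomial.aeval (companion n P hP hn : Module.End F _) Q) R).1 - Q * R.1 := by
  induction Q using Polynomial.induction_on' with
  | add p q hp hq =>
    have := dvd_add hp hq
    simp only [map_add, LinearMap.add_apply, Submodule.coe_add]
    convert this using 1
    ring
  | monomial m c =>
    simp only [Polynomial.aeval_monomial, Module.End.mul_apply, Module.algebraMap_end_apply]
    have h : P ∣ (((companion n P hP hn : Module.End F _) ^ m) R).1 - Polynomial.X ^ m * R.1 := by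
      induction m with
      | zero => simp
      | succ m ih =>
        rw [pow_succ', Module.End.mul_apply, companion_apply]
        obtain ⟨S, hS⟩ := ih
        refine ⟨Polynomial.X * S - Polynomial.C ((((companion n P hP hn : Module.End F _) ^ m) R).1.coeff (n - 1)), ?_⟩
        rw [Polynomial.smul_eq_C_mul]
        linear_combination Polynomial.X * hS
    rw [Submodule.coe_smul, Polynomial.smul_eq_C_mul, ← Polynomial.C_mul_X_pow_eq_monomial, mul_assoc, ← mul_sub]
    exact h.mul_left _

lemma companion_isCyc (n : ℕ) (P : Polynomial F) (hP : P.Monic ∧ P.natDegree = n) (hn : n ≠ 0) :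
    IsCyc P (companion n P hP hn) := by
  have hd : P.degree = n := by rw [Polynomial.degree_eq_natDegree hP.1.ne_zero, hP.2]
  have h1 : (1 : Polynomial F) ∈ Polynomial.degreeLT F n := by
    rw [Polynomial.mem_degreeLT, Polynomial.degree_one]
    exact_mod_cast Nat.pos_of_ne_zero hn
  have hsmall : ∀ R ∈ Polynomial.degreeLT F n, P ∣ R → R = 0 := by
    intro R hR hdvd
    rw [Polynomial.mem_degreeLT, ← hd] at hR
    exact Polynomial.eq_zero_of_dvd_of_degree_lt hdvd hR
  have key : ∀ Q, P ∣ ((Polynomial.aeval (companion n P hP hn : Module.End F _) Q) ⟨1, h1⟩).1 - Q := by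
    intro Q
    have := companion_mod n P hP hn Q ⟨1, h1⟩
    simpa using this
  refine ⟨⟨1, h1⟩, ?_, ?_⟩
  · intro x
    refine ⟨x.1, ?_⟩
    apply Subtype.ext
    have := hsmall _ (Submodule.sub_mem _ ((Polynomial.aeval (companion n P hP hn : Module.End F _) x.1) ⟨1, h1⟩).2 x.2) (key x.1)
    exact sub_eq_zero.mp this
  · intro Q
    have h2 := key Q
    constructor
    · intro h
      have h' : ((Polynomial.aeval (companion n P hP hn : Module.End F _) Q) ⟨1, h1⟩).1 = 0 := congrArg Subtype.val h
      rw [h', zero_sub] at h2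
      exact (dvd_neg).mp h2
    · intro h
      apply Subtype.ext
      refine hsmall _ (Subtype.prop _) ?_
      have := dvd_add h2 h
      simpa using this

lemma tr_comp_sub {V : Type} [AddCommGroup V] [Module F V] [Module.Finite F V] (g y : V →ₗ[F] V) (ℓ : V →ₗ[F] F) (R : V) :
    LinearMap.trace F V (g ∘ₗ (y - ℓ.smulRight R)) = LinearMap.trace F V (g ∘ₗ y) + (-(ℓ ∘ₗ g)) R := by
  have h : g ∘ₗ ℓ.smulRight R = ℓ.smulRight (g R) := by ext1 x; simp
  rw [LinearMap.comp_sub, map_sub, h, LinearMap.trace_smulRight, sub_eq_add_neg]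
  rfl

lemma sum_phi_Phi [Finite F] {ψ : AddChar F ℂ} (hψ : ∃ a, ψ a ≠ 1) {f : Fam F} (hf : IsGL f)
    (hs : ∀ (V : Type) [AddCommGroup V] [Module F V] [Finite V] (g : V →ₗ[F] V), ¬ Function.Surjective g → f V g = 0)
    (n : ℕ) (hn : n ≠ 0) : ∑ P ∈ mon F n, phi (Phi ψ f) P = 0 := by
  rw [sum_mon]
  have hX : ∀ R : Polynomial.degreeLT F n, (Polynomial.X ^ n + R.1).Monic ∧ (Polynomial.X ^ n + R.1).natDegree = n :=
    fun R => (mem_mon n _).mp (Finset.mem_image.mpr ⟨R, Finset.mem_univ _, rfl⟩)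
  have e1 : ∀ R : Polynomial.degreeLT F n, phi (Phi ψ f) (Polynomial.X ^ n + R.1) =
      Phi ψ f (Polynomial.degreeLT F n) (companion n _ (hX 0) hn - (comp0 F n).smulRight R) := by
    intro R
    rw [← (Phi_isGL hψ hf).phi_of_isCyc (companion_isCyc n _ (hX R) hn)]
    congr 1
    ext1 Q
    apply Subtype.ext
    rw [LinearMap.sub_apply, Submodule.coe_sub, companion_apply, companion_apply]
    simp [comp0]
    ring
  rw [Finset.sum_congr rfl fun R _ => e1 R]
  unfold Phi
  rw [← Finset.mul_sum, Finset.sum_comm]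
  refine mul_eq_zero_of_right _ (Finset.sum_eq_zero fun g _ => ?_)
  rw [← Finset.mul_sum]
  by_cases hg : Function.Surjective g
  · refine mul_eq_zero_of_right _ ?_
    have e2 : ∀ R : Polynomial.degreeLT F n, ψ (LinearMap.trace F _ (g ∘ₗ (companion n _ (hX 0) hn - (comp0 F n).smulRight R))) =
        ψ (LinearMap.trace F _ (g ∘ₗ companion n _ (hX 0) hn)) * ψ ((-(comp0 F n ∘ₗ g)) R) := by
      intro R
      rw [← AddChar.map_add_eq_mul, tr_comp_sub]
    rw [Finset.sum_congr rfl fun R _ => e2 R, ← Finset.mul_sum]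
    refine mul_eq_zero_of_right _ (sum_char_lin hψ _ ?_)
    intro h
    have hX1 : Polynomial.X ^ (n - 1) ∈ Polynomial.degreeLT F n := by
      rw [Polynomial.mem_degreeLT, Polynomial.degree_X_pow]
      exact_mod_cast (by omega : n - 1 < n)
    obtain ⟨x, hx⟩ := hg ⟨_, hX1⟩
    have h3 := LinearMap.congr_fun h x
    simp [hx, comp0] at h3
  · rw [hs _ g hg, zero_mul]

end

section
variable {F : Type} [Field F] [Finite F]

noncomputable def irrN (F : Type) [Field F] [Finite F] (N : ℕ) : Finset (Polynomial F) :=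
  ((Finset.range (N + 1)).biUnion (mon F)).filter Irreducible

lemma mem_irrN (N : ℕ) (P : Polynomial F) : P ∈ irrN F N ↔ P.Monic ∧ P.natDegree ≤ N ∧ Irreducible P := by
  unfold irrN
  rw [Finset.mem_filter, Finset.mem_biUnion]
  constructor
  · rintro ⟨⟨n, hn, h⟩, hi⟩
    rw [mem_mon] at h
    exact ⟨h.1, by rw [h.2]; exact Nat.lt_succ_iff.mp (Finset.mem_range.mp hn), hi⟩
  · rintro ⟨h1, h2, h3⟩
    exact ⟨⟨P.natDegree, Finset.mem_range.mpr (by omega), (mem_mon _ _).mpr ⟨h1, rfl⟩⟩, h3⟩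

noncomputable def dq (f : Fam F) (R P : Polynomial F) : ℂ := if R ∣ P then phi f (P / R) else 0

lemma dq_mul (f : Fam F) {R : Polynomial F} (hR : R ≠ 0) (Q : Polynomial F) : dq f R (R * Q) = phi f Q := by
  unfold dq
  rw [if_pos (dvd_mul_right _ _), mul_div_cancel_left₀ _ hR]

noncomputable def Lam (f : Fam F) (N : ℕ) (P : Polynomial F) : ℂ :=
  ∑ P0 ∈ irrN F N, ∑ i ∈ Finset.Icc 1 N, (P0.natDegree : ℂ) * kap f P0 i * dq f (P0 ^ i) P

lemma newton_Icc {h : ℕ → ℂ} (h0 : h 0 = 1) (m N : ℕ) (hm : m ≤ N) :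
    ∑ i ∈ Finset.Icc 1 N, pp h i * (if i ≤ m then h (m - i) else 0) = m * h m := by
  rw [newton h h0 m, Finset.Nat.sum_antidiagonal_eq_sum_range_succ_mk]
  have e1 : ∑ i ∈ Finset.range (m + 1), pp h i * h (m - i) =
      ∑ i ∈ Finset.range (m + 1), pp h i * (if i ≤ m then h (m - i) else 0) := by
    refine Finset.sum_congr rfl fun i hi => ?_
    rw [if_pos (Nat.lt_succ_iff.mp (Finset.mem_range.mp hi))]
  rw [e1]
  have e2 : ∑ i ∈ Finset.range (m + 1), pp h i * (if i ≤ m then h (m - i) else 0) =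
      ∑ i ∈ Finset.range (N + 1), pp h i * (if i ≤ m then h (m - i) else 0) := by
    refine Finset.sum_subset (Finset.range_mono (by omega)) fun i _ hi => ?_
    rw [if_neg (by rw [Finset.mem_range] at hi; omega), mul_zero]
  rw [e2]
  refine Finset.sum_subset (fun i hi => ?_) fun i hi hi' => ?_
  · rw [Finset.mem_Icc] at hi
    exact Finset.mem_range.mpr (by omega)
  · have : i = 0 := by
      rw [Finset.mem_Icc] at hi'
      rw [Finset.mem_range] at hi
      omega
    rw [this, pp_zero, zero_mul]

lemma Lam_eq {f : Fam F} (hf : IsGL f) (N : ℕ) : ∀ (n : ℕ) (P : Polynomial F), P.Monic → P.natDegree = n → n ≤ N →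
    (n : ℂ) * phi f P = Lam f N P := by
  intro n
  induction n using Nat.strong_induction_on with
  | _ n ih =>
  intro P hP hn hN
  by_cases hu : IsUnit P
  · have hP1 : P = 1 := hP.eq_one_of_isUnit hu
    have hn0 : n = 0 := by rw [← hn, hP1, Polynomial.natDegree_one]
    rw [hn0, Nat.cast_zero, zero_mul]
    symm
    refine Finset.sum_eq_zero fun P0 h0 => Finset.sum_eq_zero fun i hi => ?_
    rw [mem_irrN] at h0
    have : ¬ P0 ^ i ∣ P := by
      intro h
      have h1 := isUnit_of_dvd_unit h hu
      rw [isUnit_pow_iff (by have := (Finset.mem_Icc.mp hi).1; omega)] at h1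
      exact h0.2.2.not_isUnit h1
    rw [dq, if_neg this, mul_zero]
  obtain ⟨P0, h0m, h0i, h0d⟩ := Polynomial.exists_monic_irreducible_factor P hu
  obtain ⟨m, Q, hPQ, rfl⟩ := WfDvdMonoid.max_power_factor hP.ne_zero h0i
  have hQm : Q.Monic := (h0m.pow m).of_mul_monic_left hP
  have hm : m ≠ 0 := by
    rintro rfl
    rw [pow_zero, one_mul] at h0d
    exact hPQ h0d
  have hdeg : n = m * P0.natDegree + Q.natDegree := by
    rw [← hn, (h0m.pow m).natDegree_mul hQm, h0m.natDegree_pow]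
  have hd0 : 0 < P0.natDegree := h0i.natDegree_pos
  have hmd : m ≤ m * P0.natDegree := Nat.le_mul_of_pos_right _ hd0
  have hdm : P0.natDegree ≤ m * P0.natDegree := Nat.le_mul_of_pos_left _ (Nat.pos_of_ne_zero hm)
  have hc : IsCoprime P0 Q := (h0i.coprime_iff_not_dvd).mpr hPQ
  have hphi : ∀ j, phi f (P0 ^ j * Q) = hh f P0 j * phi f Q := fun j =>
    phi_mul hf (h0m.pow j).ne_zero hQm.ne_zero (hc.pow_left)
  have hLQ := ih Q.natDegree (by omega) Q hQm rfl (by omega)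
  have hmem : P0 ∈ irrN F N := (mem_irrN N P0).mpr ⟨h0m, by omega, h0i⟩
  have h1 : ∑ i ∈ Finset.Icc 1 N, (P0.natDegree : ℂ) * kap f P0 i * dq f (P0 ^ i) (P0 ^ m * Q) =
      P0.natDegree * (m * hh f P0 m) * phi f Q := by
    rw [← newton_Icc (hh_zero hf P0) m N (by omega), Finset.mul_sum, Finset.sum_mul]
    refine Finset.sum_congr rfl fun i _ => ?_
    have : dq f (P0 ^ i) (P0 ^ m * Q) = (if i ≤ m then hh f P0 (m - i) else 0) * phi f Q := by
      split_ifs with hi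
      · obtain ⟨j, rfl⟩ := Nat.exists_eq_add_of_le hi
        rw [pow_add, mul_assoc, dq_mul f (h0m.pow i).ne_zero, hphi, Nat.add_sub_cancel_left]
      · rw [dq, if_neg, zero_mul]
        intro hd
        obtain ⟨j, rfl⟩ := Nat.exists_eq_add_of_lt (not_le.mp hi)
        rw [add_assoc, pow_add] at hd
        have := (mul_dvd_mul_iff_left (h0m.pow m).ne_zero).mp hd
        exact hPQ ((dvd_pow_self P0 (by omega)).trans this)
    rw [this]
    unfold kap
    ring
  have h2 : ∀ P1 ∈ (irrN F N).erase P0, ∑ i ∈ Finset.Icc 1 N, (P1.natDegree : ℂ) * kap f P1 i * dq f (P1 ^ i) (P0 ^ m * Q) =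
      hh f P0 m * ∑ i ∈ Finset.Icc 1 N, (P1.natDegree : ℂ) * kap f P1 i * dq f (P1 ^ i) Q := by
    intro P1 hP1
    rw [Finset.mem_erase, mem_irrN] at hP1
    rw [Finset.mul_sum]
    refine Finset.sum_congr rfl fun i _ => ?_
    have hcop : IsCoprime P1 P0 := by
      rw [hP1.2.2.2.coprime_iff_not_dvd]
      intro hd
      have := (hP1.2.2.2.associated_of_dvd h0i hd)
      exact hP1.1 (Polynomial.eq_of_monic_of_associated hP1.2.1 h0m this)
    have : dq f (P1 ^ i) (P0 ^ m * Q) = hh f P0 m * dq f (P1 ^ i) Q := by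
      by_cases hd : P1 ^ i ∣ Q
      · obtain ⟨S, rfl⟩ := hd
        have hS : S ≠ 0 := right_ne_zero_of_mul hQm.ne_zero
        rw [mul_left_comm, dq_mul f (hP1.2.1.pow i).ne_zero, dq_mul f (hP1.2.1.pow i).ne_zero]
        exact phi_mul hf (h0m.pow m).ne_zero hS ((hc.of_isCoprime_of_dvd_right (dvd_mul_left _ _)).pow_left)
      · have : ¬ P1 ^ i ∣ P0 ^ m * Q := fun h => hd (((hcop.pow) : IsCoprime (P1 ^ i) (P0 ^ m)).dvd_of_dvd_mul_left h)
        rw [dq, dq, if_neg hd, if_neg this, mul_zero]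
    rw [this]
    ring
  have h3 : ∑ i ∈ Finset.Icc 1 N, (P0.natDegree : ℂ) * kap f P0 i * dq f (P0 ^ i) Q = 0 := by
    refine Finset.sum_eq_zero fun i hi => ?_
    rw [dq, if_neg, mul_zero]
    intro hd
    exact hPQ ((dvd_pow_self P0 (by have := (Finset.mem_Icc.mp hi).1; omega)).trans hd)
  unfold Lam at hLQ ⊢
  rw [← Finset.add_sum_erase _ _ hmem, h1, Finset.sum_congr rfl h2, ← Finset.mul_sum, hphi]
  rw [← Finset.add_sum_erase _ _ hmem, h3, zero_add] at hLQ
  rw [← hLQ, hdeg]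
  push_cast
  ring

/-- sum over monic polynomials divisible by R -/
lemma sum_dq (f : Fam F) {R : Polynomial F} (hR : R.Monic) (n : ℕ) :
    ∑ P ∈ mon F n, dq f R P = if R.natDegree ≤ n then ∑ Q ∈ mon F (n - R.natDegree), phi f Q else 0 := by
  split_ifs with h
  · unfold dq
    rw [← Finset.sum_filter]
    symm
    refine Finset.sum_bij (fun Q _ => R * Q) ?_ ?_ ?_ ?_
    · intro Q hQ
      rw [mem_mon] at hQ
      rw [Finset.mem_filter, mem_mon]
      refine ⟨⟨hR.mul hQ.1, ?_⟩, dvd_mul_right _ _⟩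
      rw [hR.natDegree_mul hQ.1, hQ.2]
      omega
    · intro a _ b _ hab
      exact mul_left_cancel₀ hR.ne_zero hab
    · intro P hP
      rw [Finset.mem_filter, mem_mon] at hP
      obtain ⟨⟨hm, hn⟩, Q, rfl⟩ := hP
      have hQ := hR.of_mul_monic_left hm
      refine ⟨Q, ?_, rfl⟩
      rw [mem_mon]
      rw [hR.natDegree_mul hQ] at hn
      exact ⟨hQ, by omega⟩
    · intro Q _
      rw [mul_div_cancel_left₀ _ hR.ne_zero]
  · refine Finset.sum_eq_zero fun P hP => ?_
    rw [mem_mon] at hP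
    rw [dq, if_neg]
    intro hd
    have := Polynomial.natDegree_le_of_dvd hd hP.1.ne_zero
    omega

lemma card_roots_E {E : Type} [Field E] [Algebra F E] [Fintype E] {P : Polynomial F} (hm : P.Monic) (hP : Irreducible P)
    (hd : P.natDegree ∣ Module.finrank F E) :
    (Finset.univ.filter fun t : E => minpoly F t = P).card = P.natDegree := by
  obtain ⟨t0, ht0⟩ := exists_root (E := E) hP hd
  have hmin : minpoly F t0 = P := (minpoly.eq_of_irreducible_of_monic hP ht0 hm).symm
  haveI : Algebra.IsAlgebraic F E := inferInstance
  have hsp := Normal.splits (inferInstance : Normal F E) t0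
  rw [hmin] at hsp
  have hsep : P.Separable := PerfectField.separable_of_irreducible hP
  have h1 := Polynomial.card_rootSet_eq_natDegree hsep hsp
  rw [← h1, ← Set.toFinset_card]
  congr 1
  ext t
  rw [Finset.mem_filter, Set.mem_toFinset, Polynomial.mem_rootSet]
  constructor
  · rintro ⟨-, rfl⟩
    exact ⟨hm.ne_zero, minpoly.aeval F t⟩
  · rintro ⟨-, h⟩
    exact ⟨Finset.mem_univ _, (minpoly.eq_of_irreducible_of_monic hP h hm).symm⟩

theorem sum_kapE {f : Fam F} (hf : IsGL f) (hs : ∀ n, n ≠ 0 → ∑ P ∈ mon F n, phi f P = 0)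
    (E : Type) [Field E] [Algebra F E] [Fintype E] : ∑ t : E, kapE f t = 0 := by
  set n := Module.finrank F E with hn
  have hn0 : n ≠ 0 := Module.finrank_pos.ne'
  have hs0 : ∑ P ∈ mon F 0, phi f P = 1 := by
    have : mon F 0 = {1} := by
      ext P
      rw [mem_mon, Finset.mem_singleton]
      constructor
      · rintro ⟨h1, h2⟩
        exact h1.natDegree_eq_zero.mp h2
      · rintro rfl
        exact ⟨Polynomial.monic_one, Polynomial.natDegree_one⟩
    rw [this, Finset.sum_singleton, phi_one hf]
  have h1 : ∑ P ∈ mon F n, Lam f n P = 0 := by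
    rw [Finset.sum_congr rfl fun P hP => (Lam_eq hf n n P ((mem_mon _ _).mp hP).1 ((mem_mon _ _).mp hP).2 le_rfl).symm,
      ← Finset.mul_sum, hs n hn0, mul_zero]
  have h2 : ∑ P ∈ mon F n, Lam f n P = ∑ P0 ∈ irrN F n, ∑ i ∈ Finset.Icc 1 n, (P0.natDegree : ℂ) * kap f P0 i *
      (if i * P0.natDegree = n then 1 else 0) := by
    unfold Lam
    rw [Finset.sum_comm]
    refine Finset.sum_congr rfl fun P0 h0 => ?_
    rw [Finset.sum_comm]
    refine Finset.sum_congr rfl fun i _ => ?_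
    rw [mem_irrN] at h0
    rw [← Finset.mul_sum, sum_dq f (h0.1.pow i), h0.1.natDegree_pow]
    congr 1
    split_ifs with h3 h4 h4
    · rw [h4, Nat.sub_self, hs0]
    · exact hs _ (by omega)
    · omega
    · rfl
  have h3 : ∀ P0 ∈ irrN F n, ∑ i ∈ Finset.Icc 1 n, (P0.natDegree : ℂ) * kap f P0 i *
      (if i * P0.natDegree = n then 1 else 0) = ∑ t : E, if minpoly F t = P0 then kapE f t else 0 := by
    intro P0 h0
    rw [mem_irrN] at h0
    have hpos := h0.2.2.natDegree_pos
    by_cases hd : P0.natDegree ∣ n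
    · rw [← Finset.sum_filter]
      have hc0 : ∑ t ∈ Finset.univ.filter (fun t : E => minpoly F t = P0), kapE f t =
          P0.natDegree * kap f P0 (n / P0.natDegree) := by
        rw [Finset.sum_congr rfl (g := fun _ => kap f P0 (n / P0.natDegree)) (fun t ht => by
          rw [kapE, (Finset.mem_filter.mp ht).2]), Finset.sum_const, card_roots_E h0.1 h0.2.2 hd, nsmul_eq_mul]
      rw [hc0]
      obtain ⟨c, hc⟩ := hd
      rw [Finset.sum_eq_single c]
      · rw [if_pos (by rw [hc, mul_comm]), mul_one, hc, Nat.mul_div_cancel_left _ hpos]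
      · intro i _ hi
        rw [if_neg, mul_zero]
        intro h
        apply hi
        rw [hc, mul_comm] at h
        exact Nat.eq_of_mul_eq_mul_left hpos h
      · intro h
        exfalso
        apply h
        rw [Finset.mem_Icc]
        constructor
        · rcases Nat.eq_zero_or_pos c with h' | h'
          · rw [h', mul_zero] at hc
            exact absurd hc hn0
          · exact h'
        · rw [hc]
          exact Nat.le_mul_of_pos_left _ hpos
    · rw [Finset.sum_eq_zero, Finset.sum_eq_zero]
      · intro t _
        rw [if_neg]
        rintro rfl
        exact hd (deg_dvd t)
      · intro i _
        rw [if_neg, mul_zero]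
        intro h
        exact hd ⟨i, by rw [← h, mul_comm]⟩
  rw [h2, Finset.sum_congr rfl h3, Finset.sum_comm] at h1
  rw [← h1]
  refine Finset.sum_congr rfl fun t _ => ?_
  rw [Finset.sum_ite_eq, if_pos]
  rw [mem_irrN]
  have hi := Algebra.IsIntegral.isIntegral (R := F) t
  exact ⟨minpoly.monic hi, Nat.le_of_dvd (Nat.pos_of_ne_zero hn0) (deg_dvd t), minpoly.irreducible hi⟩

end

section
variable {F : Type} [Field F] [Finite F]
variable {E : Type} [Field E] [Algebra F E] [Fintype E]

lemma gen_aeval {ξ : E} (h : (minpoly F ξ).natDegree = Module.finrank F E) (x : E) :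
    ∃ Q : Polynomial F, Polynomial.aeval ξ Q = x := by
  have h1 := (Field.primitive_element_iff_minpoly_natDegree_eq F ξ).mpr h
  have h2 := IntermediateField.adjoin_simple_toSubalgebra_of_isAlgebraic (Algebra.IsAlgebraic.isAlgebraic (R := F) ξ)
  rw [h1, IntermediateField.top_toSubalgebra, Algebra.adjoin_singleton_eq_range_aeval] at h2
  have h3 : x ∈ (Polynomial.aeval (R := F) ξ).range := by rw [← h2]; trivial
  exact h3

lemma gen_isCyc {ξ : E} (h : (minpoly F ξ).natDegree = Module.finrank F E) :
    IsCyc (minpoly F ξ) (LinearMap.mulLeft F ξ) := by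
  refine ⟨1, fun x => ?_, fun Q => ?_⟩
  · obtain ⟨Q, rfl⟩ := gen_aeval h x
    exact ⟨Q, by rw [aeval_mulLeft, LinearMap.mulLeft_apply, mul_one]⟩
  · rw [aeval_mulLeft, LinearMap.mulLeft_apply, mul_one, minpoly.dvd_iff]

lemma gen_irr {ξ : E} (h : (minpoly F ξ).natDegree = Module.finrank F E) :
    Irr (LinearMap.mulLeft F ξ) := by
  intro W hW
  by_cases hb : W = ⊥
  · exact Or.inl hb
  right
  obtain ⟨w, hw, hw0⟩ := Submodule.exists_mem_ne_zero_of_ne_bot hb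
  have h1 : ∀ Q : Polynomial F, ∀ v ∈ W, Polynomial.aeval ξ Q * v ∈ W := by
    intro Q
    induction Q using Polynomial.induction_on' with
    | add P Q hP hQ =>
      intro v hv
      rw [map_add, add_mul]
      exact W.add_mem (hP v hv) (hQ v hv)
    | monomial m a =>
      intro v hv
      rw [Polynomial.aeval_monomial, mul_assoc, ← Algebra.smul_def]
      refine W.smul_mem a ?_
      induction m with
      | zero => rwa [pow_zero, one_mul]
      | succ m ih => rw [pow_succ', mul_assoc]; exact hW _ ih
  rw [eq_top_iff]
  intro x _
  obtain ⟨Q, hQ⟩ := gen_aeval h (x * w⁻¹)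
  have := h1 Q w hw
  rwa [hQ, mul_assoc, inv_mul_cancel₀ hw0, mul_one] at this

lemma gen_kapE {f : Fam F} (hf : IsGL f) {ξ : E} (h : (minpoly F ξ).natDegree = Module.finrank F E) :
    kapE f ξ = f E (LinearMap.mulLeft F ξ) := by
  rw [kapE, h, Nat.div_self Module.finrank_pos, kap, hf.phi_of_isCyc (gen_isCyc h)]
  have := newton' (hh f (minpoly F ξ)) (hh_zero hf _) 0
  simp only [Finset.range_zero, Finset.sum_empty, add_zero, Nat.cast_zero, zero_add, one_mul] at this
  rw [← this, hh, pow_one]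

def SurjSupp (f : Fam F) : Prop :=
  ∀ (V : Type) [AddCommGroup V] [Module F V] [Finite V] (g : V →ₗ[F] V), ¬ Function.Surjective g → f V g = 0

lemma kapE_zero {f : Fam F} (hf : IsGL f) (hs : SurjSupp f) : kapE f (0 : E) = 0 := by
  rw [kapE, minpoly.zero, Polynomial.natDegree_X, Nat.div_one, kap]
  have : hh f (Polynomial.X : Polynomial F) = fun k => if k = 0 then 1 else 0 := by
    funext k
    split_ifs with hk
    · rw [hk, hh_zero hf]
    · unfold hh
      haveI : Fact ((Polynomial.X : Polynomial F) ^ k ≠ 0) := ⟨pow_ne_zero _ Polynomial.X_ne_zero⟩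
      haveI := finite_adjoinRoot ((Polynomial.X : Polynomial F) ^ k)
      rw [phi_eq]
      apply hs
      intro hsurj
      have hnil : (Polynomial.aeval (cyc ((Polynomial.X : Polynomial F) ^ k)) (Polynomial.X ^ k : Polynomial F)) = 0 := by
        ext x
        rw [aeval_cyc, AdjoinRoot.mk_self, zero_mul]
        rfl
      rw [map_pow, Polynomial.aeval_X] at hnil
      have h2 : Function.Surjective ((cyc ((Polynomial.X : Polynomial F) ^ k)) ^ k) := by
        rw [Module.End.coe_pow]
        exact hsurj.iterate k
      rw [hnil] at h2
      have hnt : Nontrivial (AdjoinRoot ((Polynomial.X : Polynomial F) ^ k)) := by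
        apply AdjoinRoot.nontrivial
        rw [Polynomial.degree_X_pow]
        exact_mod_cast hk
      obtain ⟨x, hx⟩ := h2 1
      exact zero_ne_one hx
  rw [this, pp_const]

theorem kapE_Phi {ψ : AddChar F ℂ} (hψ : ∃ a, ψ a ≠ 1) {f : Fam F} (hf : IsGL f) (hs : SurjSupp f) (t : E) :
    kapE (Phi ψ f) t = (-1) ^ (Module.finrank F E - 1) * ∑ s : E, kapE f s * ψ (Algebra.trace F E (t * s)) := by
  have hq : (Nat.card F : ℂ) ≠ 0 := by exact_mod_cast Nat.card_pos.ne'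
  have hψi : ∃ a, ψ⁻¹ a ≠ 1 := by
    obtain ⟨a, ha⟩ := hψ
    refine ⟨-a, ?_⟩
    rwa [AddChar.inv_apply, neg_neg]
  have hPhi := Phi_isGL hψ hf
  set n := Module.finrank F E with hn
  have hinv := fourier_inv (trChar_ne (K := E) hψ) (fun s : E => kapE f s)
  have hti : (trChar E ψ)⁻¹ = trChar E ψ⁻¹ := by
    ext x
    rw [AddChar.inv_apply, trChar_apply, trChar_apply, AddChar.inv_apply, map_neg]
  rw [hti] at hinv
  simp only [trChar_apply] at hinv
  have key := lemL hψi (fun t : E => kapE (Phi ψ f) t -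
    (-1) ^ (n - 1) * ∑ s : E, kapE f s * ψ (Algebra.trace F E (t * s))) ?_ ?_ ?_ t
  · exact sub_eq_zero.mp key
  · intro ξ hξ
    have h1 := FT1 hf hψ (gen_irr hξ)
    show _ - _ = _
    rw [gen_kapE hPhi hξ, Phi, h1, ← hn, sub_eq_zero]
    field_simp
  · intro x hx
    have h1 := FT1 hPhi hψi (gen_irr hx)
    have h2 := Phi_inv hψ f E (LinearMap.mulLeft F x)
    rw [Phi, h1, ← gen_kapE hf hx, ← hn] at h2
    have h3 : ∑ s : E, kapE (Phi ψ f) s * ψ⁻¹ (Algebra.trace F E (x * s)) =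
        (-1) ^ (n - 1) * ((Nat.card F : ℂ) ^ n * kapE f x) := by
      rw [← h2]
      have h4 : ((-1 : ℂ) ^ (n - 1)) * (-1) ^ (n - 1) = 1 := by
        rw [← mul_pow]; norm_num
      field_simp
      rw [pow_two, h4, mul_one]
    simp only [sub_mul]
    rw [Finset.sum_sub_distrib, h3]
    have h5 := hinv x
    simp only [mul_assoc]
    rw [← Finset.mul_sum, h5, card_E F E]
    push_cast
    rw [← hn]
    ring
  · rw [Finset.sum_sub_distrib, sum_kapE hPhi (fun m hm => sum_phi_Phi hψ hf hs m hm), ← Finset.mul_sum]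
    have h5 := hinv 0
    simp only [zero_mul, map_zero, AddChar.map_zero_eq_one, mul_one] at h5
    rw [h5, kapE_zero hf hs]
    simp

end

section
variable {F : Type} [Field F] [Finite F]

lemma ringInv_eq {R : Type} [Ring R] {a b : R} (h1 : a * b = 1) (h2 : b * a = 1) : Ring.inverse a = b := by
  have := Ring.inverse_unit (⟨a, b, h1, h2⟩ : Rˣ)
  exact this

section
variable {V V₁ V₂ : Type} [AddCommGroup V] [Module F V] [Finite V]
  [AddCommGroup V₁] [Module F V₁] [Finite V₁] [AddCommGroup V₂] [Module F V₂] [Finite V₂]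

lemma det_blk (A : V₁ →ₗ[F] V₁) (u : V₂ →ₗ[F] V₁) (D : V₂ →ₗ[F] V₂) :
    LinearMap.det (blk A u D) = LinearMap.det A * LinearMap.det D := by
  let b1 := Module.finBasis F V₁
  let b2 := Module.finBasis F V₂
  rw [← LinearMap.det_toMatrix (b1.prod b2), ← LinearMap.det_toMatrix b1, ← LinearMap.det_toMatrix b2]
  have : LinearMap.toMatrix (b1.prod b2) (b1.prod b2) (blk A u D) =
      Matrix.fromBlocks (LinearMap.toMatrix b1 b1 A) (LinearMap.toMatrix b2 b1 u) 0 (LinearMap.toMatrix b2 b2 D) := by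
    ext i j
    rcases i with i | i <;> rcases j with j | j <;> simp [LinearMap.toMatrix_apply]
  rw [this, Matrix.det_fromBlocks_zero₂₁]

lemma det_conj2 (e : V₁ ≃ₗ[F] V₂) (g : V₁ →ₗ[F] V₁) : LinearMap.det (e.conj g) = LinearMap.det g :=
  LinearMap.det_conj g e

lemma isUnit_iff_det (g : V →ₗ[F] V) : IsUnit g ↔ LinearMap.det g ≠ 0 := by
  rw [LinearMap.isUnit_iff_isUnit_det, isUnit_iff_ne_zero]

end

noncomputable def Mop (χ : MulChar F ℂ) (f : Fam F) : Fam F := fun V _ _ _ g => χ (LinearMap.det g) * f V g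

noncomputable def Top (χ : MulChar F ℂ) (f : Fam F) : Fam F := fun V _ _ _ g =>
  χ (LinearMap.det g) * f V (Ring.inverse g)

lemma Mop_isGL (χ : MulChar F ℂ) {f : Fam F} (hf : IsGL f) : IsGL (Mop χ f) where
  conj := by
    intro V W _ _ _ _ _ _ e g
    unfold Mop
    rw [hf.conj, det_conj2]
  one := by
    intro V _ _ _ _ g
    unfold Mop
    rw [hf.one, LinearMap.det_eq_one_of_subsingleton, map_one, one_mul]
  ext := by
    intro V₁ V₂ _ _ _ _ _ _ A D
    unfold Mop
    simp only [det_blk]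
    rw [← Finset.mul_sum, hf.ext, map_mul]
    ring

lemma Top_isGL (χ : MulChar F ℂ) {f : Fam F} (hf : IsGL f) : IsGL (Top χ f) where
  conj := by
    intro V W _ _ _ _ _ _ e g
    unfold Top
    by_cases hg : IsUnit g
    · obtain ⟨g, rfl⟩ := hg
      have h1 : Ring.inverse (e.conj (g : V →ₗ[F] V)) = e.conj ((g⁻¹ : (V →ₗ[F] V)ˣ) : V →ₗ[F] V) := by
        apply ringInv_eq
        · rw [Module.End.mul_eq_comp, ← LinearEquiv.conj_comp, ← Module.End.mul_eq_comp, Units.mul_inv]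
          exact LinearEquiv.conj_id e
        · rw [Module.End.mul_eq_comp, ← LinearEquiv.conj_comp, ← Module.End.mul_eq_comp, Units.inv_mul]
          exact LinearEquiv.conj_id e
      rw [h1, hf.conj, det_conj2, Ring.inverse_unit]
    · rw [det_conj2]
      rw [isUnit_iff_det, not_not] at hg
      rw [hg, MulChar.map_zero, zero_mul, zero_mul]
  one := by
    intro V _ _ _ _ g
    unfold Top
    rw [hf.one, LinearMap.det_eq_one_of_subsingleton, map_one, one_mul]
  ext := by
    intro V₁ V₂ _ _ _ _ _ _ A D
    unfold Top
    simp only [det_blk]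
    rw [← Finset.mul_sum, map_mul]
    by_cases hA : IsUnit A
    swap
    · rw [isUnit_iff_det, not_not] at hA
      rw [hA, MulChar.map_zero]
      ring
    by_cases hD : IsUnit D
    swap
    · rw [isUnit_iff_det, not_not] at hD
      rw [hD, MulChar.map_zero]
      ring
    obtain ⟨A, rfl⟩ := hA
    obtain ⟨D, rfl⟩ := hD
    rw [Ring.inverse_unit, Ring.inverse_unit]
    have hA1 : ∀ x, (A : V₁ →ₗ[F] V₁) (((A⁻¹ : (V₁ →ₗ[F] V₁)ˣ) : V₁ →ₗ[F] V₁) x) = x := fun x => by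
      rw [← Module.End.mul_apply, Units.mul_inv, Module.End.one_apply]
    have hA2 : ∀ x, ((A⁻¹ : (V₁ →ₗ[F] V₁)ˣ) : V₁ →ₗ[F] V₁) ((A : V₁ →ₗ[F] V₁) x) = x := fun x => by
      rw [← Module.End.mul_apply, Units.inv_mul, Module.End.one_apply]
    have hD1 : ∀ x, (D : V₂ →ₗ[F] V₂) (((D⁻¹ : (V₂ →ₗ[F] V₂)ˣ) : V₂ →ₗ[F] V₂) x) = x := fun x => by
      rw [← Module.End.mul_apply, Units.mul_inv, Module.End.one_apply]
    have hD2 : ∀ x, ((D⁻¹ : (V₂ →ₗ[F] V₂)ˣ) : V₂ →ₗ[F] V₂) ((D : V₂ →ₗ[F] V₂) x) = x := fun x => by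
      rw [← Module.End.mul_apply, Units.inv_mul, Module.End.one_apply]
    set A' := ((A⁻¹ : (V₁ →ₗ[F] V₁)ˣ) : V₁ →ₗ[F] V₁)
    set D' := ((D⁻¹ : (V₂ →ₗ[F] V₂)ˣ) : V₂ →ₗ[F] V₂)
    let σ : (V₂ →ₗ[F] V₁) ≃ (V₂ →ₗ[F] V₁) :=
      { toFun := fun u => -(A' ∘ₗ u ∘ₗ D')
        invFun := fun u => -((A : V₁ →ₗ[F] V₁) ∘ₗ u ∘ₗ (D : V₂ →ₗ[F] V₂))
        left_inv := fun u => by ext x; simp [hA1, hD2]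
        right_inv := fun u => by ext x; simp [hA2, hD1] }
    have hinv : ∀ u, Ring.inverse (blk (A : V₁ →ₗ[F] V₁) u (D : V₂ →ₗ[F] V₂)) = blk A' (σ u) D' := by
      intro u
      apply ringInv_eq
      · ext x <;> simp [σ, hA1, hD1]
      · ext x <;> simp [σ, hA2, hD2]
    have h1 : ∑ u, f (V₁ × V₂) (Ring.inverse (blk (A : V₁ →ₗ[F] V₁) u (D : V₂ →ₗ[F] V₂))) =
        ∑ u, f (V₁ × V₂) (blk A' u D') := by
      rw [← Equiv.sum_comp σ (fun u => f (V₁ × V₂) (blk A' u D'))]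
      exact Finset.sum_congr rfl fun u _ => by rw [hinv]
    rw [h1, hf.ext]
    ring

lemma Top_supp (χ : MulChar F ℂ) (f : Fam F) : SurjSupp (Top χ f) := by
  intro V _ _ _ g hg
  have : ¬ IsUnit g := fun h => hg ((Module.End.isUnit_iff g).mp h).2
  rw [isUnit_iff_det, not_not] at this
  rw [Top, this, MulChar.map_zero, zero_mul]

lemma pp_scale {h h' : ℕ → ℂ} (h0 : h 0 = 1) (c : ℂ) (e : ∀ m, h' m = c ^ m * h m) (m : ℕ) :
    pp h' m = c ^ m * pp h m := by
  have h0' : h' 0 = 1 := by rw [e, h0, pow_zero, one_mul]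
  induction m using Nat.strong_induction_on with
  | _ m ih =>
  rcases m with _ | m
  · rw [pp_zero, pp_zero, mul_zero]
  have n1 := newton' h h0 m
  have n2 := newton' h' h0' m
  have : ∑ i ∈ Finset.range m, pp h' (i + 1) * h' (m - i) = c ^ (m + 1) * ∑ i ∈ Finset.range m, pp h (i + 1) * h (m - i) := by
    rw [Finset.mul_sum]
    refine Finset.sum_congr rfl fun i hi => ?_
    rw [Finset.mem_range] at hi
    rw [ih (i + 1) (by omega), e]
    have : c ^ (m + 1) = c ^ (i + 1) * c ^ (m - i) := by rw [← pow_add]; congr 1; omega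
    rw [this]
    ring
  rw [this, e] at n2
  linear_combination c ^ (m + 1) * n1 - n2

lemma det_cyc {P : Polynomial F} (hP : P.Monic) :
    LinearMap.det (cyc P) = (-1) ^ P.natDegree * P.coeff 0 := by
  have h := Algebra.PowerBasis.norm_gen_eq_coeff_zero_minpoly (AdjoinRoot.powerBasis hP.ne_zero)
  rw [AdjoinRoot.powerBasis_gen, AdjoinRoot.powerBasis_dim, AdjoinRoot.minpoly_root hP.ne_zero, hP.leadingCoeff, inv_one,
    map_one, mul_one] at h
  exact h

lemma det_cyc_pow {P : Polynomial F} (hP : P.Monic) (m : ℕ) :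
    LinearMap.det (cyc (P ^ m)) = LinearMap.det (cyc P) ^ m := by
  rw [det_cyc hP, det_cyc (hP.pow m), hP.natDegree_pow, mul_pow, ← pow_mul, mul_comm m, Polynomial.coeff_zero_eq_eval_zero,
    Polynomial.eval_pow, Polynomial.coeff_zero_eq_eval_zero]

variable {E : Type} [Field E] [Algebra F E] [Fintype E]

lemma norm_eq (t : E) : Algebra.norm F t =
    LinearMap.det (cyc (minpoly F t)) ^ (Module.finrank F E / (minpoly F t).natDegree) := by
  have hi := Algebra.IsIntegral.isIntegral (R := F) t
  rw [Algebra.norm_eq_norm_adjoin, det_cyc (minpoly.monic hi)]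
  have h1 := Algebra.PowerBasis.norm_gen_eq_coeff_zero_minpoly (IntermediateField.adjoin.powerBasis hi)
  rw [IntermediateField.adjoin.powerBasis_gen, IntermediateField.adjoin.powerBasis_dim, IntermediateField.minpoly_gen] at h1
  rw [h1]
  congr 1
  rw [← IntermediateField.adjoin.finrank hi, ← Module.finrank_mul_finrank F (IntermediateField.adjoin F {t}) E,
    Nat.mul_div_cancel_left _ Module.finrank_pos]

lemma fact_pow {P : Polynomial F} (hP : P.Monic) (m : ℕ) : Fact (P ^ m ≠ 0) := ⟨(hP.pow m).ne_zero⟩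

lemma kapE_Mop (χ : MulChar F ℂ) {f : Fam F} (hf : IsGL f) (t : E) :
    kapE (Mop χ f) t = χ (Algebra.norm F t) * kapE f t := by
  have hm := minpoly.monic (Algebra.IsIntegral.isIntegral (R := F) t)
  rw [norm_eq, map_pow]
  refine pp_scale (hh_zero hf _) _ (fun m => ?_) _
  haveI := fact_pow hm m
  rw [hh, hh, phi_eq, phi_eq, Mop, det_cyc_pow hm, map_pow]

lemma deg_inv (t : E) : (minpoly F t⁻¹).natDegree = (minpoly F t).natDegree := by
  apply Nat.dvd_antisymm
  · rw [deg_dvd_iff, inv_pow, (deg_dvd_iff t _).mp dvd_rfl]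
  · rw [deg_dvd_iff, ← inv_inj, ← inv_pow, (deg_dvd_iff t⁻¹ _).mp dvd_rfl]

lemma isCyc_inv {t : E} (ht : t ≠ 0) (m : ℕ) : ∃ g : AdjoinRoot (minpoly F t ^ m) →ₗ[F] AdjoinRoot (minpoly F t ^ m),
    Ring.inverse (cyc (minpoly F t ^ m)) = g ∧ IsCyc (minpoly F t⁻¹ ^ m) g := by
  have hi := Algebra.IsIntegral.isIntegral (R := F) t
  have hi' := Algebra.IsIntegral.isIntegral (R := F) t⁻¹
  set P := minpoly F t with hP
  set P' := minpoly F t⁻¹ with hP'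
  have hm : P.Monic := minpoly.monic hi
  have hm' : P'.Monic := minpoly.monic hi'
  haveI := fact_pow hm m
  haveI := fact_pow hm' m
  haveI : Finite (AdjoinRoot (P ^ m)) := finite_adjoinRoot _
  set A := AdjoinRoot (P ^ m) with hA
  set r : A := AdjoinRoot.root (P ^ m) with hr
  -- the reverse polynomial
  have hrev : ∃ c : F, c ≠ 0 ∧ P.reverse = Polynomial.C c * P' := by
    have hd : P' ∣ P.reverse := by
      apply minpoly.dvd
      letI : Invertible t := invertibleOfNonzero ht
      have := Polynomial.eval₂_reverse_mul_pow (algebraMap F E) t P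
      rw [invOf_eq_inv, ← Polynomial.aeval_def, ← Polynomial.aeval_def, minpoly.aeval] at this
      exact (mul_eq_zero.mp this).resolve_right (pow_ne_zero _ ht)
    obtain ⟨Q, hQ⟩ := hd
    have hr0 : P.reverse ≠ 0 := by rw [Ne, Polynomial.reverse_eq_zero]; exact hm.ne_zero
    have hQ0 : Q ≠ 0 := by rintro rfl; exact hr0 (by rw [hQ, mul_zero])
    have hdeg := Polynomial.reverse_natDegree_le P
    rw [hQ, Polynomial.natDegree_mul hm'.ne_zero hQ0, hP', deg_inv, ← hP] at hdeg
    obtain ⟨c, rfl⟩ := Polynomial.natDegree_eq_zero.mp (show Q.natDegree = 0 by omega)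
    exact ⟨c, fun h => hQ0 (by rw [h, map_zero]), by rw [hQ, mul_comm]⟩
  obtain ⟨c, hc, hrev⟩ := hrev
  -- inverse of r
  obtain ⟨s, hs⟩ : ∃ s : A, r * s = 1 := by
    have hX : IsCoprime (Polynomial.X : Polynomial F) (P ^ m) := by
      apply IsCoprime.pow_right
      rw [Polynomial.irreducible_X.coprime_iff_not_dvd, Polynomial.X_dvd_iff]
      exact minpoly.coeff_zero_ne_zero hi ht
    obtain ⟨a, b, hab⟩ := hX
    refine ⟨AdjoinRoot.mk _ a, ?_⟩
    have := congrArg (AdjoinRoot.mk (P ^ m)) hab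
    rw [map_add, map_mul, map_mul, AdjoinRoot.mk_self, mul_zero, add_zero, AdjoinRoot.mk_X, map_one] at this
    rw [mul_comm]
    exact this
  have hs' : s * r = 1 := by rw [mul_comm, hs]
  refine ⟨LinearMap.mulLeft F s, ?_, ?_⟩
  · apply ringInv_eq
    · ext x
      show r * (s * x) = x
      rw [← mul_assoc, hs, one_mul]
    · ext x
      show s * (r * x) = x
      rw [← mul_assoc, hs', one_mul]
  have hae : ∀ Q : Polynomial F, ∀ x, Polynomial.aeval (LinearMap.mulLeft F s) Q x = Polynomial.aeval s Q * x := by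
    intro Q x
    have : LinearMap.mulLeft F s = Algebra.lmul F A s := rfl
    rw [this, Polynomial.aeval_algHom_apply]
    rfl
  have hann : Polynomial.aeval s (P' ^ m) = 0 := by
    letI : Invertible r := ⟨s, hs', hs⟩
    have h1 := Polynomial.eval₂_reverse_mul_pow (algebraMap F A) r P
    rw [← Polynomial.aeval_def, ← Polynomial.aeval_def, hrev] at h1
    have h2 : Polynomial.aeval s P' = algebraMap F A c⁻¹ * (Polynomial.aeval r P * s ^ P.natDegree) := by
      rw [← h1, map_mul, Polynomial.aeval_C]
      show _ = algebraMap F A c⁻¹ * (algebraMap F A c * Polynomial.aeval s P' * r ^ P.natDegree * s ^ P.natDegree)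
      rw [mul_assoc _ (r ^ _), ← mul_pow, hs, one_pow, mul_one, ← mul_assoc, ← map_mul, inv_mul_cancel₀ hc, map_one, one_mul]
    have h3 : Polynomial.aeval r P ^ m = 0 := by
      rw [← map_pow, AdjoinRoot.aeval_eq, AdjoinRoot.mk_self]
    rw [map_pow, h2, mul_pow, mul_pow, h3, zero_mul, mul_zero]
  have hsur : ∀ x : A, ∃ Q : Polynomial F, Polynomial.aeval s Q = x := by
    intro x
    obtain ⟨Q, rfl⟩ := AdjoinRoot.mk_surjective x
    let u : Aˣ := ⟨r, s, hs, hs'⟩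
    have hN := pow_orderOf_eq_one u
    have hNp := orderOf_pos u
    have hrs : r = s ^ (orderOf u - 1) := by
      have h4 : r ^ orderOf u = 1 := by
        have := congrArg Units.val hN
        exact this
      obtain ⟨N, hN⟩ := Nat.exists_eq_succ_of_ne_zero hNp.ne'
      rw [hN] at h4 ⊢
      calc r = r * (r * s) ^ N := by rw [hs, one_pow, mul_one]
        _ = r ^ (N + 1) * s ^ N := by rw [mul_pow, pow_succ]; ring
        _ = _ := by rw [h4, one_mul]; rfl
    refine ⟨Q.comp (Polynomial.X ^ (orderOf u - 1)), ?_⟩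
    rw [Polynomial.aeval_comp, map_pow, Polynomial.aeval_X, ← hrs, AdjoinRoot.aeval_eq]
  refine ⟨1, fun x => ?_, fun Q => ?_⟩
  · obtain ⟨Q, hQ⟩ := hsur x
    exact ⟨Q, by rw [hae, hQ, mul_one]⟩
  rw [hae, mul_one]
  let ev : AdjoinRoot (P' ^ m) →ₐ[F] A := AdjoinRoot.liftAlgHom (P' ^ m) (Algebra.ofId F A) s (by
    exact hann)
  have hev : ∀ Q, ev (AdjoinRoot.mk _ Q) = Polynomial.aeval s Q := by
    intro Q
    rw [← AdjoinRoot.aeval_eq, ← Polynomial.aeval_algHom_apply]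
    rw [show ev (AdjoinRoot.root (P' ^ m)) = s from AdjoinRoot.liftAlgHom_root (P' ^ m) (Algebra.ofId F A) s hann]
  have hevs : Function.Surjective ev := fun x => by
    obtain ⟨Q, hQ⟩ := hsur x
    exact ⟨AdjoinRoot.mk _ Q, by rw [hev, hQ]⟩
  haveI : Finite (AdjoinRoot (P' ^ m)) := finite_adjoinRoot _
  have hfr : Module.finrank F (AdjoinRoot (P' ^ m)) = Module.finrank F A := by
    rw [(AdjoinRoot.powerBasis (hm.pow m).ne_zero).finrank, (AdjoinRoot.powerBasis (hm'.pow m).ne_zero).finrank,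
      AdjoinRoot.powerBasis_dim, AdjoinRoot.powerBasis_dim, hm.natDegree_pow, hm'.natDegree_pow, hP', deg_inv]
  have hevi : Function.Injective ev.toLinearMap :=
    (LinearMap.injective_iff_surjective_of_finrank_eq_finrank hfr).mpr hevs
  rw [← hev, ← AdjoinRoot.mk_eq_zero]
  exact map_eq_zero_iff ev hevi

lemma kapE_Top (χ : MulChar F ℂ) {f : Fam F} (hf : IsGL f) (t : E) :
    kapE (Top χ f) t = χ (Algebra.norm F t) * kapE f t⁻¹ := by
  by_cases ht : t = 0
  · rw [ht, kapE_zero (Top_isGL χ hf) (Top_supp χ f), Algebra.norm_zero, MulChar.map_zero, zero_mul]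
  have hm := minpoly.monic (Algebra.IsIntegral.isIntegral (R := F) t)
  rw [norm_eq, map_pow, kapE, kapE, deg_inv]
  refine pp_scale (hh_zero hf _) _ (fun m => ?_) _
  haveI := fact_pow hm m
  obtain ⟨g, hg, hc⟩ := isCyc_inv (F := F) ht m
  rw [hh, hh, phi_eq, Top, det_cyc_pow hm, map_pow, hg, hf.phi_of_isCyc hc]

end

section

/-- abstract Kloosterman sum over a finite group -/
noncomputable def Kl {G : Type} [Group G] [Fintype G] (k : ℕ) (w : Fin k → G → ℂ) (x : G) : ℂ :=
  ∑ g : Fin k → G, if (List.ofFn g).prod = x then ∏ i, w i (g i) else 0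

lemma Kl_succ {G : Type} [Group G] [Fintype G] (k : ℕ) (w : Fin (k + 1) → G → ℂ) (x : G) :
    Kl (k + 1) w x = ∑ h : G, w 0 (x * h) * Kl k (fun i => w i.succ) h⁻¹ := by
  unfold Kl
  have hR : ∑ h : G, w 0 (x * h) * ∑ g : Fin k → G, (if (List.ofFn g).prod = h⁻¹ then ∏ i, w i.succ (g i) else 0) =
      ∑ g : Fin k → G, w 0 (x * (List.ofFn g).prod⁻¹) * ∏ i, w i.succ (g i) := by
    simp only [Finset.mul_sum]
    rw [Finset.sum_comm]
    refine Finset.sum_congr rfl fun g _ => ?_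
    rw [Finset.sum_eq_single ((List.ofFn g).prod⁻¹)]
    · rw [inv_inv, if_pos rfl]
    · intro h _ hh
      rw [if_neg, mul_zero]
      intro h'
      exact hh (by rw [h', inv_inv])
    · intro h
      exact absurd (Finset.mem_univ _) h
  rw [hR, ← Equiv.sum_comp (Fin.consEquiv fun _ => G), Fintype.sum_prod_type, Finset.sum_comm]
  refine Finset.sum_congr rfl fun g _ => ?_
  rw [Finset.sum_eq_single (x * (List.ofFn g).prod⁻¹)]
  · rw [if_pos, Fin.prod_univ_succ]
    · simp [Fin.consEquiv]
    · simp [Fin.consEquiv, List.ofFn_succ]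
  · intro h _ hh
    rw [if_neg]
    intro h'
    apply hh
    rw [← h']
    simp [Fin.consEquiv, List.ofFn_succ]
  · intro h
    exact absurd (Finset.mem_univ _) h

lemma Kl_equiv {G H : Type} [Group G] [Fintype G] [Group H] [Fintype H] (e : G ≃* H) (k : ℕ) (w : Fin k → G → ℂ)
    (w' : Fin k → H → ℂ) (hw : ∀ i g, w' i (e g) = w i g) (x : G) : Kl k w' (e x) = Kl k w x := by
  unfold Kl
  rw [← Equiv.sum_comp ((Equiv.refl (Fin k)).arrowCongr e.toEquiv)]
  refine Finset.sum_congr rfl fun g _ => ?_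
  have h1 : ((Equiv.refl (Fin k)).arrowCongr e.toEquiv) g = fun i => e (g i) := rfl
  have h2 : (List.ofFn fun i => e (g i)).prod = e (List.ofFn g).prod := by
    rw [map_list_prod, List.map_ofFn]
    rfl
  rw [h1, h2]
  simp only [hw, EmbeddingLike.apply_eq_iff_eq]

lemma sum_units {R : Type} [Monoid R] [Fintype R] [Fintype Rˣ] (f : R → ℂ) (h : ∀ r, ¬ IsUnit r → f r = 0) :
    ∑ r : R, f r = ∑ u : Rˣ, f u := by
  symm
  refine Finset.sum_of_injOn (fun u : Rˣ => (u : R)) (fun a _ b _ hab => Units.ext hab) (fun _ _ => Finset.mem_univ _)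
    (fun r _ hr => h r fun hu => hr ?_) (fun _ _ => rfl)
  obtain ⟨u, rfl⟩ := hu
  exact ⟨u, by simp, rfl⟩

variable {F : Type} [Field F] [Finite F]

noncomputable def FK (ψ : AddChar F ℂ) : ∀ k : ℕ, (Fin k → MulChar F ℂ) → Fam F
  | 0, _ => ssFam (Polynomial.X - Polynomial.C 1)
  | k + 1, χ => Mop (χ 0) (Phi ψ (Top (χ 0) (FK ψ k (fun i => χ i.succ))))

lemma FK_isGL {ψ : AddChar F ℂ} (hψ : ∃ a, ψ a ≠ 1) : ∀ (k : ℕ) (χ : Fin k → MulChar F ℂ), IsGL (FK ψ k χ) := by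
  intro k
  induction k with
  | zero => intro χ; exact ssFam_isGL (Polynomial.irreducible_X_sub_C 1)
  | succ k ih => intro χ; exact Mop_isGL _ (Phi_isGL hψ (Top_isGL _ (ih _)))

noncomputable instance fintypeUnits {R : Type} [Monoid R] [Finite R] : Fintype Rˣ := Fintype.ofFinite _

noncomputable def wE (E : Type) [Field E] [Algebra F E] (ψ : AddChar F ℂ) (χ : MulChar F ℂ) (u : Eˣ) : ℂ :=
  χ (Algebra.norm F (u : E)) * ψ (Algebra.trace F E u)

lemma kapE_FK_zero {E : Type} [Field E] [Algebra F E] [Fintype E] (ψ : AddChar F ℂ) (χ : Fin 0 → MulChar F ℂ) (t : E) :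
    kapE (FK ψ 0 χ) t = if t = 1 then (-1) ^ (Module.finrank F E - 1) else 0 := by
  have hi : Irreducible (Polynomial.X - Polynomial.C (1 : F)) := Polynomial.irreducible_X_sub_C 1
  have hn : 0 < Module.finrank F E := Module.finrank_pos
  split_ifs with ht
  · rw [ht, kapE, minpoly.one]
    have : (Polynomial.X - 1 : Polynomial F) = Polynomial.X - Polynomial.C 1 := by rw [Polynomial.C_1]
    rw [this, Polynomial.natDegree_X_sub_C, Nat.div_one]
    conv_lhs => rw [← Nat.succ_pred_eq_of_pos hn]
    exact kap_ssFam hi _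
  · rw [kapE, kap]
    have hi2 := Algebra.IsIntegral.isIntegral (R := F) t
    have hm := minpoly.monic hi2
    have : hh (FK ψ 0 χ) (minpoly F t) = fun k => if k = 0 then 1 else 0 := by
      funext m
      split_ifs with hk
      · rw [hk]
        exact hh_zero (ssFam_isGL hi) _
      · haveI := fact_pow hm m
        rw [hh, phi_eq]
        show ssFam _ _ _ = 0
        unfold ssFam
        rw [if_neg]
        intro h
        have h1 := congrArg (fun g => g (1 : AdjoinRoot (minpoly F t ^ m))) h
        rw [aeval_cyc, mul_one, LinearMap.zero_apply, AdjoinRoot.mk_eq_zero] at h1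
        have h2 := (minpoly.dvd_iff).mp ((dvd_pow_self (minpoly F t) hk).trans h1)
        rw [map_sub, Polynomial.aeval_X, Polynomial.aeval_C, map_one, sub_eq_zero] at h2
        exact ht h2
    rw [this, pp_const]

lemma kapE_FK {E : Type} [Field E] [Algebra F E] [Fintype E] {ψ : AddChar F ℂ} (hψ : ∃ a, ψ a ≠ 1) :
    ∀ (k : ℕ) (χ : Fin k → MulChar F ℂ) (u : Eˣ), kapE (FK ψ k χ) (u : E) =
      (-1) ^ ((Module.finrank F E - 1) * (k + 1)) * Kl k (fun i => wE E ψ (χ i)) u := by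
  intro k
  induction k with
  | zero =>
    intro χ u
    rw [kapE_FK_zero]
    simp [Kl, Units.val_eq_one, eq_comm]
  | succ k ih =>
    intro χ u
    have hG := FK_isGL hψ k (fun i => χ i.succ)
    rw [FK, kapE_Mop _ (Phi_isGL hψ (Top_isGL _ hG)), kapE_Phi hψ (Top_isGL _ hG) (Top_supp _ _), sum_units, Kl_succ]
    · rw [Finset.mul_sum, Finset.mul_sum, Finset.mul_sum]
      refine Finset.sum_congr rfl fun s _ => ?_
      rw [kapE_Top _ hG, ← Units.val_inv_eq_inv_val, ih, wE, Units.val_mul, map_mul (Algebra.norm F), map_mul (χ 0)]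
      ring
    · intro r hr
      rw [isUnit_iff_ne_zero, not_not] at hr
      rw [kapE_Top _ hG, hr, Algebra.norm_zero, MulChar.map_zero, zero_mul, zero_mul]

noncomputable def wV (V : Type) [AddCommGroup V] [Module F V] (ψ : AddChar F ℂ) (χ : MulChar F ℂ) (u : (V →ₗ[F] V)ˣ) : ℂ :=
  χ (LinearMap.det (u : V →ₗ[F] V)) * ψ (LinearMap.trace F V u)

lemma FK_Kl (V : Type) [AddCommGroup V] [Module F V] [Finite V] (ψ : AddChar F ℂ) :
    ∀ (k : ℕ) (χ : Fin k → MulChar F ℂ) (x : (V →ₗ[F] V)ˣ),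
      (Nat.card F : ℂ) ^ ((Module.finrank F V).choose 2) * Kl k (fun i => wV V ψ (χ i)) x =
      ((Nat.card F : ℂ) ^ ((Module.finrank F V).choose 2)) ^ k * FK ψ k χ V x := by
  have hq : (Nat.card F : ℂ) ≠ 0 := by exact_mod_cast Nat.card_pos.ne'
  intro k
  induction k with
  | zero =>
    intro χ x
    have h1 : (Polynomial.aeval (x : V →ₗ[F] V) (Polynomial.X - Polynomial.C (1 : F)) = 0) ↔ 1 = x := by
      rw [map_sub, Polynomial.aeval_X, Polynomial.aeval_C, map_one, sub_eq_zero, Units.val_eq_one, eq_comm]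
    rw [FK, ssFam, Polynomial.natDegree_X_sub_C, if_congr h1 rfl rfl]
    simp [Kl]
  | succ k ih =>
    intro χ x
    rw [FK, Kl_succ, Mop, Phi, sum_units (R := V →ₗ[F] V), Finset.mul_sum, Finset.mul_sum, Finset.mul_sum, Finset.mul_sum]
    · refine Finset.sum_congr rfl fun h _ => ?_
      have h1 := ih (fun i => χ i.succ) h⁻¹
      rw [Top, Ring.inverse_unit, wV, Units.val_mul, map_mul LinearMap.det, map_mul (χ 0), LinearMap.trace_mul_comm, ← Module.End.mul_eq_comp]
      field_simp
      linear_combination ((Nat.card F : ℂ) ^ (Module.finrank F V).choose 2 * χ 0 (LinearMap.det (x : V →ₗ[F] V)) * χ 0 (LinearMap.det (h : V →ₗ[F] V)) * ψ (LinearMap.trace F V ((h : V →ₗ[F] V) * (x : V →ₗ[F] V)))) * h1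
    · intro r hr
      rw [isUnit_iff_det, not_not] at hr
      rw [Top, hr, MulChar.map_zero, zero_mul, zero_mul]

end

section
variable {F : Type} [Field F] [Fintype F]

lemma sum_inst {A : Type} {i₁ i₂ : Fintype A} (f g : A → ℂ) (h : ∀ x, f x = g x) :
    (@Finset.univ A i₁).sum f = (@Finset.univ A i₂).sum g := by
  rw [Subsingleton.elim i₁ i₂]
  exact Finset.sum_congr rfl fun x _ => h x

lemma ac_sum (ψ : AddChar F ℂ) {ι : Type} (s : Finset ι) (f : ι → F) : ψ (∑ i ∈ s, f i) = ∏ i ∈ s, ψ (f i) := by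
  induction s using Finset.induction_on with
  | empty => simp
  | insert i s hi ih => rw [Finset.sum_insert hi, Finset.prod_insert hi, AddChar.map_add_eq_mul, ih]

lemma field_bridge {k : ℕ} (α : Fin k → Fˣ →* ℂˣ) (ψ : AddChar F ℂ)
    (E : Type) [Field E] [Fintype E] [DecidableEq E] [Algebra F E] (u : Eˣ) :
    fieldKloosterman α ψ E (u : E) = Kl k (fun i => wE E ψ (MulChar.ofUnitHom (α i))) u := by
  unfold fieldKloosterman Kl
  refine sum_inst _ _ fun t => ?_
  by_cases h : (List.ofFn t).prod = u
  · rw [if_pos h, if_pos (by rw [← h, List.prod_ofFn]), map_sum, ac_sum, ← Finset.prod_mul_distrib]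
    refine Finset.prod_congr rfl fun i _ => ?_
    simp only [wE]
    rw [← MulChar.ofUnitHom_coe]
    rfl
  · rw [if_neg h, if_neg]
    intro h'
    apply h
    rw [List.prod_ofFn]
    exact Units.ext h'

lemma matrix_bridge [DecidableEq F] {ι : Type} [Fintype ι] [DecidableEq ι] {k : ℕ} (α : Fin k → Fˣ →* ℂˣ) (ψ : AddChar F ℂ)
    (x : (Matrix ι ι F)ˣ) :
    matrixKloosterman α ψ (x : Matrix ι ι F) = Kl k (fun i => wV (ι → F) ψ (MulChar.ofUnitHom (α i)))
      (Units.mapEquiv (Matrix.toLinAlgEquiv' (R := F) (n := ι)).toMulEquiv x) := by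
  rw [Kl_equiv (Units.mapEquiv (Matrix.toLinAlgEquiv' (R := F) (n := ι)).toMulEquiv) k
    (fun i g => MulChar.ofUnitHom (α i) (Matrix.det (g : Matrix ι ι F)) * ψ (Matrix.trace (g : Matrix ι ι F)))]
  · unfold matrixKloosterman Kl
    refine sum_inst _ _ fun t => ?_
    by_cases h : (List.ofFn t).prod = x
    · rw [if_pos h, if_pos (by rw [h]), Matrix.trace_sum, ac_sum, ← Finset.prod_mul_distrib]
      refine Finset.prod_congr rfl fun i _ => ?_
      rw [← MulChar.ofUnitHom_coe]
      rfl
    · rw [if_neg h, if_neg]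
      intro h'
      exact h (Units.ext h')
  · intro i g
    have h1 : ((Units.mapEquiv (Matrix.toLinAlgEquiv' (R := F) (n := ι)).toMulEquiv g : ((ι → F) →ₗ[F] (ι → F))ˣ) : (ι → F) →ₗ[F] (ι → F)) =
      Matrix.toLin' (g : Matrix ι ι F) := rfl
    simp only [wV]
    rw [h1, LinearMap.det_toLin', Matrix.trace_toLin'_eq]

/-- local identification with the chain families -/
lemma local_id {ψ : AddChar F ℂ} (hψ : ∃ a, ψ a ≠ 1) {k : ℕ} (hk : 1 ≤ k) (α : Fin k → Fˣ →* ℂˣ)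
    {P : Polynomial F} (hP : Irreducible P) (hm : P.Monic) (h0 : P.coeff 0 ≠ 0)
    (Em : ℕ → Type) [∀ m, Field (Em m)] [∀ m, Fintype (Em m)] [∀ m, DecidableEq (Em m)] [∀ m, Algebra F (Em m)]
    (hEm : ∀ m, 1 ≤ m → Module.finrank F (Em m) = P.natDegree * m) (t : ∀ m, Em m)
    (ht : ∀ m, 1 ≤ m → Polynomial.aeval (t m) P = 0) (ω : Fin k → ℂ)
    (hω : ∀ m, 1 ≤ m → ∑ i, ω i ^ m = (-1 : ℂ) ^ (k - 1) * fieldKloosterman α ψ (Em m) (t m))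
    (l : List ℂ) (hl : l.map (fun ρ => ρ ^ P.natDegree) = (List.ofFn fun i => (-1) ^ ((k - 1) * P.natDegree) * ω i).reverse)
    {V : Type} [AddCommGroup V] [Module F V] [Finite V] (g : V →ₗ[F] V) (hg : Nilp P g) :
    FK ψ k (fun i => MulChar.ofUnitHom (α i)) V g = RR F l V g := by
  have hd : 0 < P.natDegree := hP.natDegree_pos
  have hkap : ∀ m, 1 ≤ m → kap (FK ψ k (fun i => MulChar.ofUnitHom (α i))) P m = kap (RR F l) P m := by
    intro m hm1
    have hmin : minpoly F (t m) = P := (minpoly.eq_of_irreducible_of_monic hP (ht m hm1) hm).symm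
    have ht0 : t m ≠ 0 := by
      intro h
      have := ht m hm1
      rw [h, Polynomial.aeval_def, Polynomial.eval₂_at_zero, map_eq_zero] at this
      exact h0 this
    have h1 := kapE_FK hψ k (fun i => MulChar.ofUnitHom (α i)) (Units.mk0 (t m) ht0)
    rw [Units.val_mk0, kapE, hmin, hEm m hm1, Nat.mul_div_cancel_left _ hd, ← field_bridge, Units.val_mk0] at h1
    rw [h1, kap_RR l hP m hm1]
    have h2 : l.map (fun ρ => (ρ ^ P.natDegree) ^ m) = (l.map (fun ρ => ρ ^ P.natDegree)).map (fun x => x ^ m) := by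
      rw [List.map_map]; rfl
    rw [h2, hl, List.map_reverse, List.sum_reverse, List.map_ofFn, List.sum_ofFn]
    simp only [Function.comp_apply, mul_pow]
    rw [← Finset.mul_sum, hω m hm1, ← mul_assoc]
    congr 1
    rw [← pow_mul, ← pow_add]
    obtain ⟨k, rfl⟩ : ∃ k', k = k' + 1 := ⟨k - 1, by omega⟩
    obtain ⟨N, hN⟩ : ∃ N, P.natDegree * m = N + 1 := ⟨P.natDegree * m - 1, (Nat.succ_pred_eq_of_pos (Nat.mul_pos hd hm1)).symm⟩
    rw [mul_assoc, hN]
    simp only [Nat.add_sub_cancel]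
    have h3 : N * (k + 1 + 1) + 2 * k = k * (N + 1) + k + 2 * N := by ring
    have h4 : ∀ n : ℕ, (-1 : ℂ) ^ (2 * n) = 1 := fun n => by rw [pow_mul]; simp
    calc (-1 : ℂ) ^ (N * (k + 1 + 1)) = (-1) ^ (N * (k + 1 + 1)) * (-1) ^ (2 * k) := by rw [h4, mul_one]
      _ = (-1) ^ (k * (N + 1) + k) * (-1) ^ (2 * N) := by rw [← pow_add, h3, pow_add]
      _ = _ := by rw [h4, mul_one]
  have hG := FK_isGL hψ k (fun i => MulChar.ofUnitHom (α i))
  refine uniq hG (RR_isGL l) hP (Module.finrank F V) ?_ _ _ V g hg rfl le_rfl rfl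
  intro m _
  exact h_congr (hh_zero hG P) (hh_zero (RR_isGL l) P) m (fun m' h1 _ => hkap m' h1) m le_rfl
end

section
variable {F : Type} [Field F] [Finite F]

section
variable {E : Type} [Field E] [Algebra F E] [Finite E]

lemma RR_ext : ∀ (l : List ℂ) (V : Type) [AddCommGroup V] [Module F V] [Module E V] [IsScalarTower F E V] [Finite V]
    (T : V →ₗ[E] V) (hst : ∀ W : Submodule F V, (∀ x ∈ W, T x ∈ W) → ∀ (c : E), ∀ x ∈ W, c • x ∈ W),
    RR F l V (T.restrictScalars F) = RR E (l.map fun ρ => ρ ^ Module.finrank F E) V T := by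
  intro l
  induction l with
  | nil => intro V _ _ _ _ _ T _; rfl
  | cons ρ l ih =>
    intro V _ _ _ _ _ T hst
    rw [List.map_cons]
    unfold RR
    unfold conv
    symm
    refine Finset.sum_of_injOn (Submodule.restrictScalars F) (fun a _ b _ hab => Submodule.restrictScalars_injective F E V hab)
      (fun _ _ => Finset.mem_univ _) ?_ ?_
    · intro W _ hW
      rw [dif_neg]
      intro h
      apply hW
      refine ⟨{ W with smul_mem' := fun c x hx => hst W h c x hx }, by simp, ?_⟩
      ext x
      rfl
    · intro W _
      by_cases h : ∀ x ∈ W, T x ∈ W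
      · have h' : ∀ x ∈ W.restrictScalars F, T.restrictScalars F x ∈ W.restrictScalars F := h
        rw [dif_pos h, dif_pos h']
        have e1 : RR F l (W.restrictScalars F) ((T.restrictScalars F).restrict h') =
            RR F l W ((T.restrict h).restrictScalars F) :=
          ((RR_isGL l).conj' ((Submodule.restrictScalarsEquiv F E V W).restrictScalars F) ((T.restrictScalars F).restrict h')
            ((T.restrict h).restrictScalars F) fun x => rfl).symm
        rw [e1, ih W (T.restrict h)]
        · have e2 : Module.finrank F (V ⧸ W.restrictScalars F) = Module.finrank F E * Module.finrank E (V ⧸ W) := by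
            rw [Module.finrank_mul_finrank]
            rfl
          rw [e2, pow_mul]
        · intro U hU c x hx
          have h3 := hst (U.map (W.subtype.restrictScalars F)) (by
            rintro _ ⟨z, hz, rfl⟩
            exact ⟨_, hU z hz, rfl⟩) c x ⟨x, hx, rfl⟩
          obtain ⟨z, hz, hzx⟩ := h3
          have : z = c • x := Subtype.ext hzx
          rwa [← this]
      · rw [dif_neg h, dif_neg]
        exact h
end

section
variable {V : Type} [AddCommGroup V] [Module F V] [Finite V]

/-- chain sums inside a fixed space -/
noncomputable def CH (T : V →ₗ[F] V) : List ℂ → Submodule F V → ℂ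
  | [], W => if W = ⊥ then 1 else 0
  | ρ :: l, W => ∑ W' : Submodule F V, if W' ≤ W ∧ ∀ x ∈ W', T x ∈ W' then
      CH T l W' * ρ ^ (Module.finrank F W - Module.finrank F W') else 0

lemma RR_CH (T : V →ₗ[F] V) : ∀ (l : List ℂ) (W : Submodule F V) (h : ∀ x ∈ W, T x ∈ W),
    RR F l W (T.restrict h) = CH T l W := by
  intro l
  induction l with
  | nil =>
    intro W h
    simp only [RR, CH, Submodule.subsingleton_iff_eq_bot]
  | cons ρ l ih =>
    intro W h
    unfold RR CH
    unfold conv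
    refine Finset.sum_of_injOn (Submodule.map W.subtype)
      (fun a _ b _ hab => Submodule.map_injective_of_injective W.subtype_injective hab) (fun _ _ => Finset.mem_univ _) ?_ ?_
    · intro W' _ hW'
      rw [if_neg]
      rintro ⟨h1, h2⟩
      apply hW'
      refine ⟨W'.comap W.subtype, by simp, ?_⟩
      rw [Submodule.map_comap_subtype]
      exact inf_eq_right.mpr h1
    · intro U _
      have hle : U.map W.subtype ≤ W := Submodule.map_subtype_le W U
      by_cases hU : ∀ x ∈ U, T.restrict h x ∈ U
      · have hU' : ∀ x ∈ U.map W.subtype, T x ∈ U.map W.subtype := by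
          rintro _ ⟨z, hz, rfl⟩
          exact ⟨_, hU z hz, rfl⟩
        rw [dif_pos hU, if_pos ⟨hle, hU'⟩, ← ih _ hU', Submodule.finrank_quotient]
        have e1 := (RR_isGL (F := F) l).conj' (Submodule.equivSubtypeMap W U) ((T.restrict h).restrict hU) (T.restrict hU')
          fun x => rfl
        rw [e1, (Submodule.equivSubtypeMap W U).finrank_eq]
      · rw [dif_neg hU, if_neg]
        rintro ⟨_, h2⟩
        apply hU
        intro x hx
        obtain ⟨z, hz, hzx⟩ := h2 _ ⟨x, hx, rfl⟩
        have : z = T.restrict h x := Subtype.ext hzx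
        rwa [← this]

def Good (T : V →ₗ[F] V) {k : ℕ} (c : Fin (k + 1) → Submodule F V) (W : Submodule F V) : Prop :=
  c 0 = ⊥ ∧ (∀ i : Fin k, c i.castSucc ≤ c i.succ) ∧ (∀ j, ∀ x ∈ c j, T x ∈ c j) ∧ c (Fin.last k) = W

noncomputable def dd {k : ℕ} (c : Fin (k + 1) → Submodule F V) (i : Fin k) : ℕ :=
  Module.finrank F (c i.succ) - Module.finrank F (c i.castSucc)

lemma CH_chain (T : V →ₗ[F] V) : ∀ (k : ℕ) (ω : Fin k → ℂ) (W : Submodule F V) (h : ∀ x ∈ W, T x ∈ W),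
    CH T (List.ofFn ω).reverse W = ∑ c : Fin (k + 1) → Submodule F V, if Good T c W then ∏ i, ω i ^ dd c i else 0 := by
  intro k
  induction k with
  | zero =>
    intro ω W h
    rw [Finset.sum_eq_single (fun _ => W)]
    · simp only [List.ofFn_zero, List.reverse_nil, CH, Finset.univ_eq_empty, Finset.prod_empty]
      refine if_congr ?_ rfl rfl
      constructor
      · intro hW
        exact ⟨hW, fun i => i.elim0, fun _ => h, rfl⟩
      · intro hW
        exact hW.1
    · intro c _ hc
      rw [if_neg]
      intro hg
      apply hc
      funext j
      rw [← hg.2.2.2]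
      congr 1
      omega
    · intro hh
      exact absurd (Finset.mem_univ _) hh
  | succ k ih =>
    intro ω W h
    have h1 : (List.ofFn ω).reverse = ω (Fin.last k) :: (List.ofFn fun i : Fin k => ω i.castSucc).reverse := by
      rw [List.ofFn_succ', List.concat_eq_append, List.reverse_append]
      rfl
    rw [h1]
    unfold CH
    have hR : (∑ c : Fin (k + 1 + 1) → Submodule F V, if Good T c W then ∏ i, ω i ^ dd c i else 0) =
        ∑ c : Fin (k + 1) → Submodule F V, if Good T (Fin.snoc (α := fun _ => Submodule F V) c W) W then
          ∏ i, ω i ^ dd (Fin.snoc (α := fun _ => Submodule F V) c W) i else 0 := by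
      rw [← Equiv.sum_comp (Fin.snocEquiv fun _ => Submodule F V), Fintype.sum_prod_type, Finset.sum_eq_single W]
      · rfl
      · intro W' _ hW'
        refine Finset.sum_eq_zero fun c _ => if_neg ?_
        intro hg
        apply hW'
        rw [← hg.2.2.2]
        simp [Fin.snocEquiv]
      · intro hh
        exact absurd (Finset.mem_univ _) hh
    rw [hR]
    have h2 : ∀ W' : Submodule F V, (if W' ≤ W ∧ ∀ x ∈ W', T x ∈ W' then
        CH T (List.ofFn fun i : Fin k => ω i.castSucc).reverse W' *
          ω (Fin.last k) ^ (Module.finrank F W - Module.finrank F W') else 0) =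
        ∑ c : Fin (k + 1) → Submodule F V, if Good T c W' ∧ W' ≤ W then
          (∏ i : Fin k, ω i.castSucc ^ dd c i) * ω (Fin.last k) ^ (Module.finrank F W - Module.finrank F W') else 0 := by
      intro W'
      by_cases hW' : W' ≤ W ∧ ∀ x ∈ W', T x ∈ W'
      · rw [if_pos hW', ih _ W' hW'.2, Finset.sum_mul]
        refine Finset.sum_congr rfl fun c _ => ?_
        by_cases hc : Good T c W'
        · rw [if_pos hc, if_pos ⟨hc, hW'.1⟩]
        · rw [if_neg hc, if_neg (fun hh => hc hh.1), zero_mul]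
      · rw [if_neg hW']
        symm
        refine Finset.sum_eq_zero fun c _ => if_neg ?_
        rintro ⟨hc, hle⟩
        refine hW' ⟨hle, ?_⟩
        rw [← hc.2.2.2]
        exact hc.2.2.1 _
    simp only [h2]
    rw [Finset.sum_comm]
    refine Finset.sum_congr rfl fun c _ => ?_
    rw [Finset.sum_eq_single (c (Fin.last k))]
    · set C : Fin (k + 1 + 1) → Submodule F V := Fin.snoc (α := fun _ => Submodule F V) c W with hC
      have hC1 : ∀ j : Fin (k + 1), C j.castSucc = c j := fun j => Fin.snoc_castSucc (α := fun _ => Submodule F V) W c j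
      have hC2 : C (Fin.last _) = W := Fin.snoc_last (α := fun _ => Submodule F V) W c
      refine if_congr ?_ ?_ rfl
      · constructor
        · rintro ⟨⟨g1, g2, g3, g4⟩, g5⟩
          refine ⟨?_, ?_, ?_, hC2⟩
          · rw [← Fin.castSucc_zero, hC1, g1]
          · intro i
            rw [hC1]
            refine Fin.lastCases ?_ (fun i => ?_) i
            · rw [Fin.succ_last, hC2]
              exact g5
            · rw [Fin.succ_castSucc, hC1]
              exact g2 i
          · intro j
            refine Fin.lastCases ?_ (fun j => ?_) j
            · rw [hC2]
              exact h
            · rw [hC1]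
              exact g3 j
        · rintro ⟨g1, g2, g3, g4⟩
          refine ⟨⟨?_, ?_, ?_, rfl⟩, ?_⟩
          · rw [← hC1, Fin.castSucc_zero, g1]
          · intro i
            have := g2 i.castSucc
            rwa [Fin.succ_castSucc, hC1, hC1] at this
          · intro j
            have := g3 j.castSucc
            rwa [hC1] at this
          · have := g2 (Fin.last k)
            rwa [hC1, Fin.succ_last, hC2] at this
      · rw [Fin.prod_univ_castSucc]
        congr 2
        · funext i
          unfold dd
          rw [Fin.succ_castSucc, hC1, hC1]
        · unfold dd
          rw [Fin.succ_last, hC1, hC2]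
    · intro W' _ hW'
      rw [if_neg]
      rintro ⟨hg, _⟩
      exact hW' hg.2.2.2.symm
    · intro hh
      exact absurd (Finset.mem_univ _) hh
end
end

section

lemma iic_sum : ∀ {k : ℕ} (d : Fin k → ℕ) (f : Fin (k + 1) → ℕ) (h0 : f 0 = 0) (h : ∀ i : Fin k, f i.succ = f i.castSucc + d i)
    (j : Fin k), ∑ i ∈ Finset.Iic j, d i = f j.succ := by
  intro k d f h0 h j
  have h1 : ∀ n (hn : n < k + 1), ∑ i : Fin k, (if i.val < n then d i else 0) = f ⟨n, hn⟩ := by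
    intro n
    induction n with
    | zero => intro hn; simpa using h0.symm
    | succ n ih =>
      intro hn
      have h2 := h ⟨n, by omega⟩
      have h3 : f (Fin.castSucc ⟨n, by omega⟩) = f ⟨n, by omega⟩ := rfl
      rw [h3, ← ih] at h2
      have h4 : f (Fin.succ ⟨n, by omega⟩) = f ⟨n + 1, hn⟩ := rfl
      rw [← h4, h2]
      have h5 : d ⟨n, by omega⟩ = ∑ i : Fin k, if i = ⟨n, by omega⟩ then d i else 0 := by
        rw [Finset.sum_ite_eq' Finset.univ, if_pos (Finset.mem_univ _)]
      rw [h5, ← Finset.sum_add_distrib]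
      refine Finset.sum_congr rfl fun i _ => ?_
      simp only [Fin.ext_iff]
      split_ifs <;> omega
  rw [show f j.succ = f ⟨j.val + 1, by omega⟩ from rfl, ← h1, ← Finset.sum_filter]
  refine Finset.sum_congr ?_ fun _ _ => rfl
  ext i
  simp [Nat.lt_succ_iff]

variable {F : Type} [Field F] [Finite F]
variable {V : Type} [AddCommGroup V] [Module F V] [Finite V]

lemma sub_iff {k : ℕ} (d : Fin k → ℕ) (f : Fin (k + 1) → ℕ) (h0 : f 0 = 0) (hm : ∀ i : Fin k, f i.castSucc ≤ f i.succ) :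
    (∀ i, f i.succ - f i.castSucc = d i) ↔ ∀ j, f j.succ = ∑ i ∈ Finset.Iic j, d i := by
  constructor
  · intro h j
    refine (iic_sum d f h0 (fun i => ?_) j).symm
    have := h i
    have := hm i
    omega
  · intro h
    have h1 : ∀ j, f j = Fin.partialSum d j := by
      intro j
      refine Fin.cases ?_ (fun j => ?_) j
      · rw [h0, Fin.partialSum_zero]
      · rw [h j]
        exact iic_sum d _ (Fin.partialSum_zero d) (fun i => Fin.partialSum_succ d i) j
    intro i
    rw [h1, h1, Fin.partialSum_succ, Nat.add_sub_cancel_left]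

lemma flag_card (T : V →ₗ[F] V) {k : ℕ} (d : Fin (k + 1) → ℕ) :
    flagCount T d = (Finset.univ.filter fun c : Fin (k + 1 + 1) → Submodule F V => Good T c ⊤ ∧ dd c = d).card := by
  have hst : ∀ W : Submodule F V, Submodule.map T W ≤ W ↔ ∀ x ∈ W, T x ∈ W := fun W => Submodule.map_le_iff_le_comap
  rw [flagCount, Nat.card_eq_fintype_card, Fintype.card_subtype]
  symm
  have key : ∀ c : Fin (k + 1 + 1) → Submodule F V, c 0 = ⊥ → ((Good T c ⊤ ∧ dd c = d) ↔
      (Monotone (fun j : Fin (k + 1) => c j.succ) ∧ (∀ j : Fin (k + 1), Module.finrank F (c j.succ) = ∑ i ∈ Finset.Iic j, d i) ∧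
        (∀ j : Fin (k + 1), Submodule.map T (c j.succ) ≤ c j.succ) ∧ ∀ j : Fin (k + 1), (j : ℕ) + 1 = k + 1 → c j.succ = ⊤)) := by
    intro c h0
    have hf0 : Module.finrank F (c 0) = 0 := by rw [h0, finrank_bot]
    constructor
    · rintro ⟨⟨g1, g2, g3, g4⟩, hd⟩
      have hm := Fin.monotone_iff_le_succ.mpr g2
      refine ⟨fun i j hij => hm (Fin.succ_le_succ_iff.mpr hij), ?_, fun j => (hst _).mpr (g3 _), ?_⟩
      · exact (sub_iff d (fun j => Module.finrank F (c j)) hf0 (fun i => Submodule.finrank_mono (g2 i))).mp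
          (fun i => congrFun hd i)
      · intro j hj
        rw [← g4]
        congr 1
        apply Fin.ext
        simp [hj]
    · rintro ⟨g1, g2, g3, g4⟩
      have hm : ∀ i : Fin (k + 1), c i.castSucc ≤ c i.succ := by
        intro i
        refine Fin.cases ?_ (fun i => ?_) i
        · rw [Fin.castSucc_zero, h0]
          exact bot_le
        · rw [← Fin.succ_castSucc]
          exact g1 (Fin.castSucc_lt_succ).le
      refine ⟨⟨h0, hm, ?_, ?_⟩, ?_⟩
      · intro j
        refine Fin.cases ?_ (fun j => ?_) j
        · intro x hx
          rw [h0, Submodule.mem_bot] at hx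
          rw [hx, map_zero]
          exact Submodule.zero_mem _
        · exact (hst _).mp (g3 j)
      · exact g4 (Fin.last k) (by simp)
      · funext i
        exact (sub_iff d (fun j => Module.finrank F (c j)) hf0 (fun i => Submodule.finrank_mono (hm i))).mpr g2 i
  refine Finset.card_bij (fun c _ j => c j.succ) ?_ ?_ ?_
  · intro c hc
    rw [Finset.mem_filter] at hc ⊢
    exact ⟨Finset.mem_univ _, (key c hc.2.1.1).mp hc.2⟩
  · intro c hc c' hc' h
    rw [Finset.mem_filter] at hc hc'
    funext j
    refine Fin.cases ?_ (fun j => ?_) j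
    · rw [hc.2.1.1, hc'.2.1.1]
    · exact congrFun h j
  · intro W hW
    rw [Finset.mem_filter] at hW
    refine ⟨Fin.cons (α := fun _ => Submodule F V) ⊥ W, ?_, ?_⟩
    · rw [Finset.mem_filter]
      refine ⟨Finset.mem_univ _, (key _ rfl).mpr ?_⟩
      exact hW.2
    · rfl

lemma flag_sum (T : V →ₗ[F] V) {k : ℕ} (ω : Fin (k + 1) → ℂ) :
    RR F (List.ofFn ω).reverse V T =
      ∑ d ∈ Finset.Nat.antidiagonalTuple (k + 1) (Module.finrank F V), (flagCount T d : ℂ) * ∏ i, ω i ^ d i := by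
  have ht : ∀ x ∈ (⊤ : Submodule F V), T x ∈ (⊤ : Submodule F V) := fun _ _ => trivial
  rw [(RR_isGL _).conj' Submodule.topEquiv (T.restrict ht) T (fun x => rfl), RR_CH, CH_chain T _ _ _ ht]
  have h1 : ∀ d : Fin (k + 1) → ℕ, (flagCount T d : ℂ) * ∏ i, ω i ^ d i =
      ∑ c : Fin (k + 1 + 1) → Submodule F V, if Good T c ⊤ ∧ dd c = d then ∏ i, ω i ^ d i else 0 := by
    intro d
    rw [← Finset.sum_filter, Finset.sum_const, nsmul_eq_mul, flag_card]
  simp only [h1]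
  rw [Finset.sum_comm]
  refine Finset.sum_congr rfl fun c _ => ?_
  by_cases hc : Good T c ⊤
  · rw [if_pos hc, Finset.sum_eq_single (dd c)]
    · rw [if_pos ⟨hc, rfl⟩]
    · intro d _ hd
      rw [if_neg]
      exact fun h => hd h.2.symm
    · intro h
      exfalso
      apply h
      rw [Finset.Nat.mem_antidiagonalTuple]
      have h2 := (sub_iff (dd c) (fun j => Module.finrank F (c j)) (by rw [hc.1, finrank_bot])
        (fun i => Submodule.finrank_mono (hc.2.1 i))).mp (fun i => rfl) (Fin.last k)
      rw [Fin.succ_last, hc.2.2.2, finrank_top] at h2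
      rw [h2]
      refine Finset.sum_congr ?_ fun _ _ => rfl
      ext i
      simp [Fin.le_last]
  · rw [if_neg hc]
    symm
    refine Finset.sum_eq_zero fun d _ => if_neg fun h => hc h.1
end

section
variable {F : Type} [Field F] [Finite F]

lemma isUnit_of_nilp {V : Type} [AddCommGroup V] [Module F V] [Finite V] {P : Polynomial F} {g : V →ₗ[F] V}
    (hg : Nilp P g) (h0 : P.coeff 0 ≠ 0) : IsUnit g := by
  obtain ⟨N, hN⟩ := (nilp_iff_exists P g).mp hg
  have hinj : Function.Injective g := by
    rw [injective_iff_map_eq_zero]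
    intro x hx
    have h1 : ∀ Q : Polynomial F, (Polynomial.aeval g Q : V →ₗ[F] V) x = Q.coeff 0 • x := by
      intro Q
      have h2 := congrArg (fun R => (Polynomial.aeval g R : V →ₗ[F] V) x) (Polynomial.divX_mul_X_add Q)
      simp only [map_add, map_mul, Polynomial.aeval_X, Polynomial.aeval_C, LinearMap.add_apply, Module.End.mul_apply, hx,
        map_zero, zero_add, Module.algebraMap_end_apply] at h2
      exact h2.symm
    have h2 := hN x
    rw [h1, Polynomial.coeff_zero_eq_eval_zero, Polynomial.eval_pow, ← Polynomial.coeff_zero_eq_eval_zero] at h2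
    exact (smul_eq_zero.mp h2).resolve_left (pow_ne_zero _ h0)
  rw [Module.End.isUnit_iff]
  exact Finite.injective_iff_bijective.mp hinj

lemma pi_prod {f : Fam F} (hf : IsGL f) : ∀ (s : ℕ) (V : Fin s → Type) [∀ j, AddCommGroup (V j)] [∀ j, Module F (V j)]
    [∀ j, Finite (V j)] (g : ∀ j, V j →ₗ[F] V j) (P : Fin s → Polynomial F) (hP : ∀ i j, i ≠ j → IsCoprime (P i) (P j))
    (hg : ∀ j, Nilp (P j) (g j)),
    f (∀ j, V j) (LinearMap.pi fun j => g j ∘ₗ LinearMap.proj j) = ∏ j, f (V j) (g j) ∧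
      Nilp (∏ j, P j) (LinearMap.pi fun j => g j ∘ₗ LinearMap.proj j) := by
  intro s
  induction s with
  | zero =>
    intro V _ _ _ g P hP hg
    exact ⟨by rw [hf.one, Finset.univ_eq_empty, Finset.prod_empty], nilp_of_subsingleton _ _⟩
  | succ s ih =>
    intro V _ _ _ g P hP hg
    obtain ⟨h1, h2⟩ := ih (fun j => V j.succ) (fun j => g j.succ) (fun j => P j.succ)
      (fun i j hij => hP _ _ fun h => hij (Fin.succ_injective _ h)) (fun j => hg _)
    set D : (∀ j : Fin s, V j.succ) →ₗ[F] (∀ j : Fin s, V j.succ) := LinearMap.pi fun j => g j.succ ∘ₗ LinearMap.proj j with hD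
    have he : ∀ x, Fin.consLinearEquiv F V (blk (g 0) 0 D x) =
        (LinearMap.pi fun j => g j ∘ₗ LinearMap.proj j) (Fin.consLinearEquiv F V x) := by
      intro x
      funext j
      refine Fin.cases ?_ (fun j => ?_) j
      · simp [blk_apply, Fin.consLinearEquiv]
      · simp [blk_apply, Fin.consLinearEquiv, hD]
    have hc : IsCoprime (P 0) (∏ j : Fin s, P j.succ) :=
      IsCoprime.prod_right fun j _ => hP _ _ (Fin.succ_ne_zero j).symm
    constructor
    · rw [hf.conj' (Fin.consLinearEquiv F V) _ _ he, hf.prod_of_coprime _ _ _ hc (hg 0) h2, h1, Fin.prod_univ_succ]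
    · refine Nilp.conj (Fin.consLinearEquiv F V) he ?_
      rw [Fin.prod_univ_succ]
      obtain ⟨N₁, hN₁⟩ := (nilp_iff_exists _ _).mp ((hg 0).of_dvd (Dvd.intro (∏ j : Fin s, P j.succ) rfl))
      obtain ⟨N₂, hN₂⟩ := (nilp_iff_exists _ _).mp (h2.of_dvd (Dvd.intro_left (P 0) rfl))
      refine (nilp_iff_exists _ _).mpr ⟨N₁ + N₂, fun x => ?_⟩
      have e : x = LinearMap.inl F _ _ x.1 + LinearMap.inr F _ _ x.2 := by simp
      rw [e, map_add, aeval_apply_of_comm (D := g 0) (by intro z; simp [blk_apply]),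
        aeval_apply_of_comm (D := D) (by intro z; simp [blk_apply]), pow_add, map_mul, Module.End.mul_apply, map_mul,
        Module.End.mul_apply, hN₂, ← Module.End.mul_apply, ← map_mul, mul_comm, map_mul, Module.End.mul_apply, hN₁]
      simp

lemma blockDiagonal_pi {s : ℕ} {ι : Fin s → Type} [∀ j, Fintype (ι j)] [∀ j, DecidableEq (ι j)]
    (M : ∀ j, Matrix (ι j) (ι j) F) (x : (Σ j, ι j) → F) (j : Fin s) (i : ι j) :
    (Matrix.blockDiagonal' M).mulVec x ⟨j, i⟩ = (M j).mulVec (fun i => x ⟨j, i⟩) i := by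
  simp only [Matrix.mulVec, dotProduct]
  rw [Fintype.sum_sigma, Finset.sum_eq_single j]
  · simp [Matrix.blockDiagonal'_apply]
  · intro j' _ hj'
    refine Finset.sum_eq_zero fun i' _ => ?_
    rw [Matrix.blockDiagonal'_apply, dif_neg (fun h => hj' h.symm), zero_mul]
  · intro h
    exact absurd (Finset.mem_univ _) h

section
variable {E : Type} [Field E] [Algebra F E] [Fintype E]
variable {V : Type} [AddCommGroup V] [Module F V] [Module E V] [IsScalarTower F E V]

lemma stab {ξ : E} (h : (minpoly F ξ).natDegree = Module.finrank F E) (T : V →ₗ[E] V)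
    (hT : ∃ M, ∀ x, ((T - algebraMap E (Module.End E V) ξ) ^ M : Module.End E V) x = 0)
    (W : Submodule F V) (hW : ∀ x ∈ W, T x ∈ W) (c : E) (x : V) (hx : x ∈ W) : c • x ∈ W := by
  obtain ⟨M, hM⟩ := hT
  obtain ⟨p, hp⟩ := CharP.exists E
  obtain ⟨n, hpp, hn⟩ : ∃ n : ℕ, p.Prime ∧ Fintype.card E = p ^ n := by
    obtain ⟨n, h1, h2⟩ := FiniteField.card E p
    exact ⟨n, h1, h2⟩
  haveI : Fact p.Prime := ⟨hpp⟩
  have h1 : (Polynomial.X - Polynomial.C ξ) ^ p ^ (n * M) = (Polynomial.X : Polynomial E) ^ p ^ (n * M) - Polynomial.C ξ := by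
    rw [sub_pow_char_pow, ← Polynomial.C_pow]
    congr 2
    rw [pow_mul p, ← hn, FiniteField.pow_card_pow]
  have hle : M ≤ p ^ (n * M) := by
    rw [pow_mul, ← hn]
    exact (Nat.lt_pow_self Fintype.one_lt_card).le
  have h2 : ∀ z, (T ^ p ^ (n * M) : Module.End E V) z = ξ • z := by
    intro z
    have h3 := congrArg (fun Q => (Polynomial.aeval T Q : Module.End E V) z) h1
    simp only [map_pow, map_sub, Polynomial.aeval_X, Polynomial.aeval_C, LinearMap.sub_apply, Module.algebraMap_end_apply] at h3
    have h4 : (T - algebraMap E (Module.End E V) ξ) ^ p ^ (n * M) = 0 := by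
      rw [← Nat.add_sub_cancel' hle, pow_add]
      have : (T - algebraMap E (Module.End E V) ξ) ^ M = 0 := LinearMap.ext hM
      rw [this, zero_mul]
    rw [h4] at h3
    exact (sub_eq_zero.mp h3.symm)
  have h3 : ∀ m : ℕ, ∀ z ∈ W, (T ^ m : Module.End E V) z ∈ W := by
    intro m
    induction m with
    | zero => intro z hz; simpa using hz
    | succ m ih => intro z hz; rw [pow_succ]; exact ih _ (hW z hz)
  have h4 : ∀ z ∈ W, ξ • z ∈ W := fun z hz => by rw [← h2]; exact h3 _ z hz
  obtain ⟨Q, rfl⟩ := gen_aeval h c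
  clear h1 h2 h3 hle
  induction Q using Polynomial.induction_on' with
  | add P Q hP hQ =>
    rw [map_add, add_smul]
    exact W.add_mem hP hQ
  | monomial m a =>
    rw [Polynomial.aeval_monomial, mul_smul, algebraMap_smul]
    refine W.smul_mem a ?_
    induction m with
    | zero => rwa [pow_zero, one_smul]
    | succ m ih => rw [pow_succ', mul_smul]; exact h4 _ ih

lemma nilp_of_root {ξ : E} {P : Polynomial F} (h : Polynomial.aeval ξ P = 0) (T : V →ₗ[E] V)
    (hT : ∃ M, ∀ x, ((T - algebraMap E (Module.End E V) ξ) ^ M : Module.End E V) x = 0) :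
    Nilp P (T.restrictScalars F) := by
  obtain ⟨M, hM⟩ := hT
  have h1 : ∀ (Q : Polynomial F) (x : V), (Polynomial.aeval (T.restrictScalars F) Q : V →ₗ[F] V) x =
      (Polynomial.aeval T (Q.map (algebraMap F E)) : V →ₗ[E] V) x := by
    intro Q x
    induction Q using Polynomial.induction_on' with
    | add P Q hP hQ => simp only [map_add, Polynomial.map_add, LinearMap.add_apply, hP, hQ]
    | monomial m a =>
      have h2 : ∀ m : ℕ, ((T.restrictScalars F) ^ m : Module.End F V) x = (T ^ m : Module.End E V) x := by
        intro m
        induction m with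
        | zero => simp
        | succ m ih => rw [pow_succ', pow_succ', Module.End.mul_apply, ih]; rfl
      rw [Polynomial.map_monomial, Polynomial.aeval_monomial, Polynomial.aeval_monomial]
      simp only [Module.End.mul_apply, Module.algebraMap_end_apply, algebraMap_smul, h2]
  obtain ⟨Q, hQ⟩ : Polynomial.X - Polynomial.C ξ ∣ P.map (algebraMap F E) := by
    rw [Polynomial.dvd_iff_isRoot, Polynomial.IsRoot, Polynomial.eval_map_algebraMap, h]
  refine (nilp_iff_exists _ _).mpr ⟨M, fun x => ?_⟩
  rw [h1, Polynomial.map_pow, hQ, mul_pow, map_mul, Module.End.mul_apply, map_pow, map_sub, Polynomial.aeval_X,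
    Polynomial.aeval_C, hM]

end

lemma exists_e0 {E : Type} [Field E] [Algebra F E] [Fintype E] {P : Polynomial F} (hP : Irreducible P) (hm : P.Monic)
    {V : Type} [AddCommGroup V] [Module F V] [Finite V]
    (g : V →ₗ[F] V) (hg : (Polynomial.aeval g P : V →ₗ[F] V) = 0) (hV : Module.finrank F V = P.natDegree) {η : E}
    (hη : Polynomial.aeval η P = 0) (hE : Module.finrank F E = P.natDegree) :
    ∃ e : V ≃ₗ[F] E, ∀ x, e (g x) = η * e x := by
  have hmin : minpoly F η = P := (minpoly.eq_of_irreducible_of_monic hP hη hm).symm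
  have hgen : (minpoly F η).natDegree = Module.finrank F E := by rw [hmin, hE]
  haveI : Nontrivial V := Module.nontrivial_of_finrank_pos (R := F) (by rw [hV]; exact hP.natDegree_pos)
  obtain ⟨v, hv⟩ := exists_ne (0 : V)
  let ev : Polynomial F →ₗ[F] V :=
    { toFun := fun Q => (Polynomial.aeval g Q : V →ₗ[F] V) v
      map_add' := by simp
      map_smul' := by simp }
  have hk : ∀ Q : Polynomial F, (Polynomial.aeval g Q : V →ₗ[F] V) v = 0 ↔ P ∣ Q := by
    intro Q
    constructor
    · intro h
      by_contra hd
      obtain ⟨a, b, hab⟩ := (hP.coprime_iff_not_dvd).mpr hd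
      apply hv
      have h1 := congrArg (fun R => (Polynomial.aeval g R : V →ₗ[F] V) v) hab
      simp only [map_add, map_mul, hg, mul_zero, zero_add, Module.End.mul_apply, h, map_zero, map_one, Module.End.one_apply] at h1
      exact h1.symm
    · rintro ⟨R, rfl⟩
      rw [map_mul, hg, zero_mul, LinearMap.zero_apply]
  let ae : Polynomial F →ₗ[F] E := (Polynomial.aeval η).toLinearMap
  have hker : LinearMap.ker ae = LinearMap.ker ev := by
    ext Q
    rw [LinearMap.mem_ker, LinearMap.mem_ker]
    show Polynomial.aeval η Q = 0 ↔ _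
    rw [← minpoly.dvd_iff, hmin]
    exact (hk Q).symm
  have e1 := (ae.quotKerEquivOfSurjective (gen_aeval hgen)).symm.trans
    ((Submodule.quotEquivOfEq _ _ hker).trans ev.quotKerEquivRange)
  have hr : LinearMap.range ev = ⊤ := Submodule.eq_top_of_finrank_eq (by rw [← e1.finrank_eq, hE, hV])
  have hc : IsCyc P g := ⟨v, fun x => LinearMap.range_eq_top.mp hr x, hk⟩
  obtain ⟨e₂, h₂⟩ := isCyc_iff P g hc
  obtain ⟨e₃, h₃⟩ := isCyc_iff P _ (hmin ▸ gen_isCyc hgen)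
  refine ⟨e₂.symm.trans e₃, fun x => ?_⟩
  obtain ⟨z, rfl⟩ := e₂.surjective x
  rw [← h₂, LinearEquiv.trans_apply, LinearEquiv.trans_apply, LinearEquiv.symm_apply_apply, LinearEquiv.symm_apply_apply, h₃,
    LinearMap.mulLeft_apply]
end

section
variable {F : Type} [Field F] [Finite F]
variable {E : Type} [Field E] [Algebra F E] [Fintype E]

lemma scalar_apply {r : ℕ} (η : E) (μ : Fin r → ℕ) (w : (Σ j : Fin r, Fin (μ j)) → E) (j : Fin r) (p : Fin (μ j)) :
    Matrix.mulVecLin (jordanPartitionScalar η μ) w ⟨j, p⟩ =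
      η * w ⟨j, p⟩ + ∑ q : Fin (μ j), if (p : ℕ) + 1 = q then w ⟨j, q⟩ else 0 := by
  rw [Matrix.mulVecLin_apply, jordanPartitionScalar, blockDiagonal_pi]
  simp only [Matrix.mulVec, dotProduct, jordanBlockScalar]
  have h1 : η * w ⟨j, p⟩ = ∑ q : Fin (μ j), if q = p then η * w ⟨j, q⟩ else 0 := by
    rw [Finset.sum_ite_eq' Finset.univ, if_pos (Finset.mem_univ _)]
  rw [h1, ← Finset.sum_add_distrib]
  refine Finset.sum_congr rfl fun q _ => ?_
  by_cases h : p = q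
  · subst h
    simp
  · simp only [if_neg h, if_neg (fun h' : q = p => h h'.symm)]
    split_ifs <;> simp

lemma scalar_nilp {r : ℕ} (η : E) (μ : Fin r → ℕ) : ∃ M, ∀ x,
    ((Matrix.mulVecLin (jordanPartitionScalar η μ) - algebraMap E (Module.End E ((Σ j : Fin r, Fin (μ j)) → E)) η) ^ M :
      Module.End E ((Σ j : Fin r, Fin (μ j)) → E)) x = 0 := by
  refine ⟨∑ j, μ j, fun x => ?_⟩
  set N := (Matrix.mulVecLin (jordanPartitionScalar η μ) - algebraMap E (Module.End E ((Σ j : Fin r, Fin (μ j)) → E)) η) with hN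
  have h : ∀ m : ℕ, ∀ (j : Fin r) (p : Fin (μ j)), μ j ≤ p + m → (N ^ m : Module.End E _) x ⟨j, p⟩ = 0 := by
    intro m
    induction m with
    | zero => intro j p h; exact absurd p.2 (by omega)
    | succ m ih =>
      intro j p h
      rw [pow_succ', Module.End.mul_apply]
      generalize hz : (N ^ m : Module.End E _) x = z at ih ⊢
      have : N z ⟨j, p⟩ = Matrix.mulVecLin (jordanPartitionScalar η μ) z ⟨j, p⟩ - η * z ⟨j, p⟩ := rfl
      rw [this, scalar_apply, add_sub_cancel_left]
      refine Finset.sum_eq_zero fun q _ => ?_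
      split_ifs with hq
      · exact ih j q (by omega)
      · rfl
  funext ⟨j, p⟩
  refine h _ j p ?_
  have := Finset.single_le_sum (f := μ) (fun i _ => Nat.zero_le _) (Finset.mem_univ j)
  omega

lemma block_apply {a r : ℕ} (y : Matrix (Fin a) (Fin a) F) (μ : Fin r → ℕ) (v : (Σ j : Fin r, Fin (μ j) × Fin a) → F)
    (j : Fin r) (p : Fin (μ j)) : (fun i => Matrix.toLin' (jordanPartition y μ) v ⟨j, (p, i)⟩) =
      Matrix.toLin' y (fun i => v ⟨j, (p, i)⟩) + ∑ q : Fin (μ j), if (p : ℕ) + 1 = q then (fun i => v ⟨j, (q, i)⟩) else 0 := by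
  funext i
  rw [Matrix.toLin'_apply, jordanPartition, blockDiagonal_pi, Pi.add_apply, Matrix.toLin'_apply, Finset.sum_apply]
  simp only [Matrix.mulVec, dotProduct, jordanBlock]
  rw [Fintype.sum_prod_type]
  have h1 : ∑ i', y i i' * v ⟨j, (p, i')⟩ = ∑ q : Fin (μ j), if q = p then ∑ i', y i i' * v ⟨j, (q, i')⟩ else 0 := by
    rw [Finset.sum_ite_eq' Finset.univ, if_pos (Finset.mem_univ _)]
  rw [h1, ← Finset.sum_add_distrib]
  refine Finset.sum_congr rfl fun q _ => ?_
  by_cases h : p = q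
  · subst h
    simp
  · simp only [if_neg h, if_neg (fun h' : q = p => h h'.symm)]
    split_ifs <;> simp

lemma jordan_equiv {a r : ℕ} (y : Matrix (Fin a) (Fin a) F) (μ : Fin r → ℕ) (η : E)
    (e : (Fin a → F) ≃ₗ[F] E) (he : ∀ x, e (Matrix.toLin' y x) = η * e x) :
    ∃ Φ : ((Σ j : Fin r, Fin (μ j) × Fin a) → F) ≃ₗ[F] ((Σ j : Fin r, Fin (μ j)) → E),
      ∀ x, Φ (Matrix.toLin' (jordanPartition y μ) x) =
        (Matrix.mulVecLin (jordanPartitionScalar η μ)).restrictScalars F (Φ x) := by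
  let Φ : ((Σ j : Fin r, Fin (μ j) × Fin a) → F) ≃ₗ[F] ((Σ j : Fin r, Fin (μ j)) → E) :=
    { toFun := fun v jp => e fun i => v ⟨jp.1, (jp.2, i)⟩
      map_add' := fun v w => by funext jp; exact map_add e _ _
      map_smul' := fun c w => by funext jp; exact map_smul e c _
      invFun := fun w ji => e.symm (w ⟨ji.1, ji.2.1⟩) ji.2.2
      left_inv := fun v => by funext ji; simp
      right_inv := fun w => by funext jp; simp }
  refine ⟨Φ, fun x => ?_⟩
  funext ⟨j, p⟩
  rw [LinearMap.restrictScalars_apply, scalar_apply]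
  show e (fun i => Matrix.toLin' (jordanPartition y μ) x ⟨j, (p, i)⟩) = _
  rw [block_apply, map_add, he, map_sum]
  congr 1
  refine Finset.sum_congr rfl fun q _ => ?_
  split_ifs
  · rfl
  · exact map_zero e

/-- one primary block -/
lemma block_value {F : Type} [Field F] [Fintype F] {ψ : AddChar F ℂ} (hψ : ∃ a, ψ a ≠ 1) {k : ℕ} (hk : 1 ≤ k) (α : Fin k → Fˣ →* ℂˣ)
    {a r b : ℕ} (y : (Matrix (Fin a) (Fin a) F)ˣ) (hirr : Irreducible (y : Matrix (Fin a) (Fin a) F).charpoly)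
    (μ : Fin r → ℕ) (hμ : ∑ l, μ l = b)
    (E : Type) [Field E] [Fintype E] [Algebra F E] (hE : Module.finrank F E = a) (η : E)
    (hη : Polynomial.aeval η (y : Matrix (Fin a) (Fin a) F).charpoly = 0)
    (Em : ℕ → Type) [∀ m, Field (Em m)] [∀ m, Fintype (Em m)] [∀ m, DecidableEq (Em m)] [∀ m, Algebra F (Em m)]
    [∀ m, Algebra E (Em m)] [∀ m, IsScalarTower F E (Em m)]
    (hEm : ∀ m, 1 ≤ m → Module.finrank E (Em m) = m) (ω : Fin k → ℂ)
    (hω : ∀ m, 1 ≤ m → ∑ i, ω i ^ m = (-1 : ℂ) ^ (k - 1) * fieldKloosterman α ψ (Em m) (algebraMap E (Em m) η)) :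
    Nilp (y : Matrix (Fin a) (Fin a) F).charpoly (Matrix.toLin' (jordanPartition (y : Matrix (Fin a) (Fin a) F) μ)) ∧
    (y : Matrix (Fin a) (Fin a) F).charpoly.coeff 0 ≠ 0 ∧
    FK ψ k (fun i => MulChar.ofUnitHom (α i)) _ (Matrix.toLin' (jordanPartition (y : Matrix (Fin a) (Fin a) F) μ)) =
      (-1 : ℂ) ^ ((k - 1) * (a * b)) * ∑ d ∈ Finset.Nat.antidiagonalTuple k b,
        (flagCount (Matrix.mulVecLin (jordanPartitionScalar η μ)) d : ℂ) * ∏ i, ω i ^ d i := by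
  set P := (y : Matrix (Fin a) (Fin a) F).charpoly with hPdef
  have hdeg : P.natDegree = a := by rw [hPdef, Matrix.charpoly_natDegree_eq_dim, Fintype.card_fin]
  have hmon : P.Monic := Matrix.charpoly_monic _
  have ha : 0 < a := by rw [← hdeg]; exact hirr.natDegree_pos
  have h0 : P.coeff 0 ≠ 0 := by
    have h1 := Matrix.det_eq_sign_charpoly_coeff (y : Matrix (Fin a) (Fin a) F)
    intro h
    rw [← hPdef, h, mul_zero] at h1
    have h2 := (Matrix.isUnit_iff_isUnit_det _).mp y.isUnit
    rw [h1] at h2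
    exact not_isUnit_zero h2
  have hg : (Polynomial.aeval (Matrix.toLin' (y : Matrix (Fin a) (Fin a) F)) P : (Fin a → F) →ₗ[F] (Fin a → F)) = 0 := by
    have h1 := LinearMap.aeval_self_charpoly (Matrix.toLin' (y : Matrix (Fin a) (Fin a) F))
    rwa [Matrix.charpoly_toLin'] at h1
  obtain ⟨e, he⟩ := exists_e0 hirr hmon _ hg (by rw [hdeg]; simp) hη (by rw [hE, hdeg])
  obtain ⟨Φ, hΦ⟩ := jordan_equiv (y : Matrix (Fin a) (Fin a) F) μ η e he
  have hsn := scalar_nilp η μ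
  have hnil' : Nilp P ((Matrix.mulVecLin (jordanPartitionScalar η μ)).restrictScalars F) := nilp_of_root hη _ hsn
  have hnil : Nilp P (Matrix.toLin' (jordanPartition (y : Matrix (Fin a) (Fin a) F) μ)) := by
    refine Nilp.conj Φ.symm (fun x => ?_) hnil'
    rw [LinearEquiv.symm_apply_eq, hΦ, LinearEquiv.apply_symm_apply]
  refine ⟨hnil, h0, ?_⟩
  choose lam hlam using fun i => IsAlgClosed.exists_pow_nat_eq ((-1 : ℂ) ^ ((k - 1) * a) * ω i) ha
  have hl : (List.ofFn lam).reverse.map (fun ρ => ρ ^ a) = (List.ofFn fun i => (-1 : ℂ) ^ ((k - 1) * a) * ω i).reverse := by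
    rw [List.map_reverse, List.map_ofFn]
    congr 2
    funext i
    exact hlam i
  have hfin : ∀ m, 1 ≤ m → Module.finrank F (Em m) = P.natDegree * m := by
    intro m hm
    rw [hdeg, ← Module.finrank_mul_finrank F E (Em m), hE, hEm m hm]
  have hmin : minpoly F η = P := (minpoly.eq_of_irreducible_of_monic hirr hη hmon).symm
  have hG := FK_isGL hψ k (fun i => MulChar.ofUnitHom (α i))
  rw [← hG.conj' Φ _ _ hΦ, local_id hψ hk α hirr hmon h0 Em hfin (fun m => algebraMap E (Em m) η)
    (fun m _ => by rw [Polynomial.aeval_algebraMap_apply, hη, map_zero]) ω hω (List.ofFn lam).reverse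
    (by rw [hdeg]; exact hl) _ hnil',
    RR_ext _ _ _ (stab (by rw [hmin, hdeg, hE]) _ hsn), hE, hl]
  obtain ⟨k, rfl⟩ : ∃ k', k = k' + 1 := ⟨k - 1, by omega⟩
  have hb : Module.finrank E ((Σ j : Fin r, Fin (μ j)) → E) = b := by
    rw [Module.finrank_fintype_fun_eq_card, Fintype.card_sigma, ← hμ]
    simp
  rw [flag_sum, hb, Finset.mul_sum]
  refine Finset.sum_congr rfl fun d hd => ?_
  rw [Finset.Nat.mem_antidiagonalTuple] at hd
  simp only [mul_pow]
  rw [Finset.prod_mul_distrib, Finset.prod_pow_eq_pow_sum, hd, ← pow_mul, mul_assoc]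
  ring
end

end MK

namespace MK
section

lemma assemble {F : Type} [Field F] [Fintype F] [DecidableEq F]
    (ψ : AddChar F ℂ) (hψ : ∃ a : F, ψ a ≠ 1) {k : ℕ} (hk : 1 ≤ k) (α : Fin k → Fˣ →* ℂˣ)
    {s : ℕ} {ι : Fin s → Type} [∀ j, Fintype (ι j)] [∀ j, DecidableEq (ι j)] (M : ∀ j, Matrix (ι j) (ι j) F)
    (P : Fin s → Polynomial F) (hP : ∀ i j, i ≠ j → IsCoprime (P i) (P j))
    (hM : ∀ j, Nilp (P j) (Matrix.toLin' (M j))) (h0 : ∀ j, (P j).coeff 0 ≠ 0) (n : ℕ)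
    (hn : Module.finrank F ((Σ j, ι j) → F) = n) :
    matrixKloosterman α ψ (Matrix.blockDiagonal' M) = (Fintype.card F : ℂ) ^ ((k - 1) * (n * (n - 1) / 2)) *
      ∏ j, FK ψ k (fun i => MulChar.ofUnitHom (α i)) (ι j → F) (Matrix.toLin' (M j)) := by
  have hG := FK_isGL hψ k (fun i => MulChar.ofUnitHom (α i))
  obtain ⟨h1, h2⟩ := pi_prod hG s (fun j => ι j → F) (fun j => Matrix.toLin' (M j)) P hP hM
  have he : ∀ x, (LinearEquiv.piCurry F (fun (j : Fin s) (_ : ι j) => F)) (Matrix.toLin' (Matrix.blockDiagonal' M) x) =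
      (LinearMap.pi fun j => Matrix.toLin' (M j) ∘ₗ LinearMap.proj j)
        ((LinearEquiv.piCurry F (fun (j : Fin s) (_ : ι j) => F)) x) := by
    intro x
    funext j i
    rw [LinearMap.pi_apply, LinearMap.comp_apply, Matrix.toLin'_apply, Matrix.toLin'_apply]
    exact blockDiagonal_pi M x j i
  have hnil : Nilp (∏ j, P j) (Matrix.toLin' (Matrix.blockDiagonal' M)) := by
    refine Nilp.conj (LinearEquiv.piCurry F (fun (j : Fin s) (_ : ι j) => F)).symm (fun x => ?_) h2
    rw [LinearEquiv.symm_apply_eq, he, LinearEquiv.apply_symm_apply]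
  have h00 : (∏ j, P j).coeff 0 ≠ 0 := by
    rw [Polynomial.coeff_zero_prod]
    exact Finset.prod_ne_zero_iff.mpr fun j _ => h0 j
  have hu : IsUnit (Matrix.blockDiagonal' M) := by
    have h3 := isUnit_of_nilp hnil h00
    have h4 : Matrix.toLin' (Matrix.blockDiagonal' M) = Matrix.toLinAlgEquiv' (Matrix.blockDiagonal' M) := rfl
    rw [h4] at h3
    exact (MulEquiv.isUnit_map (Matrix.toLinAlgEquiv' (R := F) (n := Σ j, ι j))).mp h3
  obtain ⟨x, hx⟩ := hu
  rw [← hx, matrix_bridge]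
  have h5 := FK_Kl ((Σ j, ι j) → F) ψ k (fun i => MulChar.ofUnitHom (α i))
    (Units.mapEquiv (Matrix.toLinAlgEquiv' (R := F) (n := Σ j, ι j)).toMulEquiv x)
  have h6 : ((Units.mapEquiv (Matrix.toLinAlgEquiv' (R := F) (n := Σ j, ι j)).toMulEquiv x :
      (((Σ j, ι j) → F) →ₗ[F] ((Σ j, ι j) → F))ˣ) : ((Σ j, ι j) → F) →ₗ[F] ((Σ j, ι j) → F)) =
      Matrix.toLin' (Matrix.blockDiagonal' M) := by rw [← hx]; rfl
  rw [h6, ← hG.conj' _ _ _ he, h1, hn, Nat.card_eq_fintype_card] at h5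
  have hq : ((Fintype.card F : ℂ) ^ n.choose 2) ≠ 0 := pow_ne_zero _ (Nat.cast_ne_zero.mpr Fintype.card_ne_zero)
  refine mul_left_cancel₀ hq (h5.trans ?_)
  rw [← mul_assoc, ← Nat.choose_two_right, mul_comm (k - 1), pow_mul, ← pow_succ', Nat.sub_add_cancel hk]
end
end MK

/-- the general Hall--Littlewood formula. For pairwise coprime regular elliptic
blocks `y_j ∈ GL_{a_j}(F)`, partitions `μ_j ⊢ b_j`, roots `η_j ∈ E_j`, and roots
`ω_{j,1},…,ω_{j,k}` of the twisted Kloosterman sheaves at `η_j`, the twisted matrix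
Kloosterman sum of `y = diag(J_{μ₁}(y₁),…,J_{μ_s}(y_s))` equals
`(-1)^((k-1)n) q^((k-1)n(n-1)/2) ∏_j Σ_{d₁+⋯+d_k=b_j} N_d(J_{μ_j}(η_j)) ω_{j,1}^{d₁}⋯ω_{j,k}^{d_k}`. -/
theorem matrix_kloosterman_general_hall_littlewood
    {F : Type} [Field F] [Fintype F] [DecidableEq F]
    (ψ : AddChar F ℂ) (hψ : ∃ a : F, ψ a ≠ 1)
    {k : ℕ} (hk : 1 ≤ k) (α : Fin k → Fˣ →* ℂˣ)
    {s : ℕ} (a : Fin s → ℕ)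
    (y : ∀ j, (Matrix (Fin (a j)) (Fin (a j)) F)ˣ)
    (hirr : ∀ j, Irreducible (Matrix.charpoly (y j : Matrix (Fin (a j)) (Fin (a j)) F)))
    (hcop : ∀ j₁ j₂, j₁ ≠ j₂ →
      IsCoprime (Matrix.charpoly (y j₁ : Matrix (Fin (a j₁)) (Fin (a j₁)) F))
        (Matrix.charpoly (y j₂ : Matrix (Fin (a j₂)) (Fin (a j₂)) F)))
    (b : Fin s → ℕ) (r : Fin s → ℕ) (μ : ∀ j, Fin (r j) → ℕ)
    (hμpos : ∀ j l, 0 < μ j l) (hμanti : ∀ j, Antitone (μ j))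
    (hμsum : ∀ j, ∑ l, μ j l = b j)
    {n : ℕ} (hn : n = ∑ j, a j * b j)
    (E : Fin s → Type) [∀ j, Field (E j)] [∀ j, Fintype (E j)] [∀ j, DecidableEq (E j)]
    [∀ j, Algebra F (E j)] (hE : ∀ j, Module.finrank F (E j) = a j)
    (η : ∀ j, E j)
    (hη : ∀ j, Polynomial.aeval (η j)
      (Matrix.charpoly (y j : Matrix (Fin (a j)) (Fin (a j)) F)) = 0)
    (Em : Fin s → ℕ → Type) [∀ j m, Field (Em j m)] [∀ j m, Fintype (Em j m)]
    [∀ j m, DecidableEq (Em j m)] [∀ j m, Algebra F (Em j m)] [∀ j m, Algebra (E j) (Em j m)]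
    [∀ j m, IsScalarTower F (E j) (Em j m)]
    (hEm : ∀ j m, 1 ≤ m → Module.finrank (E j) (Em j m) = m)
    (ω : Fin s → Fin k → ℂ)
    (hω : ∀ j m, 1 ≤ m →
      (∑ i, ω j i ^ m) = (-1 : ℂ) ^ (k - 1) *
        fieldKloosterman α ψ (Em j m) (algebraMap (E j) (Em j m) (η j))) :
    matrixKloosterman α ψ
      (Matrix.blockDiagonal'
        (fun j => jordanPartition (y j : Matrix (Fin (a j)) (Fin (a j)) F) (μ j)))
    = (-1 : ℂ) ^ ((k - 1) * n) *
        (Fintype.card F : ℂ) ^ ((k - 1) * (n * (n - 1) / 2)) *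
        ∏ j, ∑ d ∈ Finset.Nat.antidiagonalTuple k (b j),
          (flagCount (Matrix.mulVecLin (jordanPartitionScalar (η j) (μ j))) d : ℂ) *
            ∏ i, ω j i ^ d i := by
  have hB := fun j => MK.block_value hψ hk α (y j) (hirr j) (μ j) (hμsum j) (E j) (hE j) (η j) (hη j) (Em j) (hEm j) (ω j) (hω j)
  have hfr : Module.finrank F ((Σ j, Σ l : Fin (r j), Fin (μ j l) × Fin (a j)) → F) = n := by
    rw [Module.finrank_fintype_fun_eq_card, Fintype.card_sigma, hn]
    refine Finset.sum_congr rfl fun j _ => ?_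
    rw [Fintype.card_sigma, ← hμsum j, Finset.mul_sum]
    refine Finset.sum_congr rfl fun l _ => ?_
    rw [Fintype.card_prod, Fintype.card_fin, Fintype.card_fin, mul_comm]
  rw [MK.assemble ψ hψ hk α _ (fun j => (y j : Matrix (Fin (a j)) (Fin (a j)) F).charpoly) hcop (fun j => (hB j).1)
    (fun j => (hB j).2.1) n hfr, Finset.prod_congr rfl (fun j _ => (hB j).2.2), Finset.prod_mul_distrib,
    Finset.prod_pow_eq_pow_sum, ← Finset.mul_sum, ← hn]
  ring
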